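/- Uniformly for 1 ≤ x ≤ T and T ≥ 3, one has 𝓕_{(0,T]}(x) = (T/(2π x²)) (log T)² · (1 + O(1/√(log T))) + (T/(2π)) log x + O(T √(log T)), where 𝓕_{(0,T]}(x) := Σ_{ρ,ρ' : 0<γ,γ'≤T} x^{ρ−ρ'} W(ρ−ρ') with W(u) = 4/(4 − u²), the sums running over pairs of nontrivial zeros ρ = β+iγ, ρ' = β'+iγ' of the Riemann zeta function counted with multiplicity. (This is unconditional; the Riemann Hypothesis is not assumed.) -/

import Mathlib

open Filter Topology MeasureTheory Set

/-- The multiplicity of `ρ` as a zero of the Riemann zeta function: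
the least `n` such that the `n`-th iterated derivative of `ζ` is nonzero at `ρ`. -/
noncomputable def zetaMult (ρ : ℂ) : ℕ :=
  sInf {n : ℕ | iteratedDeriv n riemannZeta ρ ≠ 0}

/-- `ρ` is a nontrivial zero of the Riemann zeta function. -/
def IsNontrivialZero (ρ : ℂ) : Prop :=
  riemannZeta ρ = 0 ∧ 0 < ρ.re ∧ ρ.re < 1

/-- The set of nontrivial zeros `ρ = β + iγ` with `T < γ ≤ 2T`. -/
def zeroBand (T : ℝ) : Set ℂ :=
  {ρ | IsNontrivialZero ρ ∧ T < ρ.im ∧ ρ.im ≤ 2 * T}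

/-- Number of nontrivial zeros with `T < γ ≤ 2T`, counted with multiplicity. -/
noncomputable def Ntot (T : ℝ) : ℝ :=
  ∑ᶠ ρ ∈ zeroBand T, (zetaMult ρ : ℝ)

/-- Number of simple nontrivial zeros with `T < γ ≤ 2T`. -/
noncomputable def Nsimple (T : ℝ) : ℝ :=
  ∑ᶠ ρ ∈ {ρ ∈ zeroBand T | zetaMult ρ = 1}, (1 : ℝ)

/-- Number of nontrivial zeros with `T < γ ≤ 2T` on the critical line, with multiplicity. -/
noncomputable def Nline (T : ℝ) : ℝ :=
  ∑ᶠ ρ ∈ {ρ ∈ zeroBand T | ρ.re = 1/2}, (zetaMult ρ : ℝ)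

/-- Number of simple critical-line nontrivial zeros with `T < γ ≤ 2T`. -/
noncomputable def NlineSimple (T : ℝ) : ℝ :=
  ∑ᶠ ρ ∈ {ρ ∈ zeroBand T | ρ.re = 1/2 ∧ zetaMult ρ = 1}, (1 : ℝ)

/-- The set of nontrivial zeros `ρ = β + iγ` with `0 < γ ≤ T`. -/
def zeroBand0 (T : ℝ) : Set ℂ :=
  {ρ | IsNontrivialZero ρ ∧ 0 < ρ.im ∧ ρ.im ≤ T}

/-- The weight `W(u) = 4/(4 - u²)`. -/
noncomputable def Wweight (u : ℂ) : ℂ := 4 / (4 - u ^ 2)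

/-- `𝓕_{(0,T]}(x) = Σ_{ρ,ρ' : 0<γ,γ'≤T} x^{ρ-ρ'} W(ρ-ρ')`, pairs of nontrivial zeros
counted with multiplicity. -/
noncomputable def FF0 (x T : ℝ) : ℂ :=
  ∑ᶠ ρ ∈ zeroBand0 T, ∑ᶠ ρ' ∈ zeroBand0 T,
    (zetaMult ρ : ℂ) * (zetaMult ρ' : ℂ) * (x : ℂ) ^ (ρ - ρ') * Wweight (ρ - ρ')

noncomputable section
open Real
open Complex hiding ext
open _root_.Finset hiding ext uIcc range Icc univ Ioi mem_Ici right_mem_Icc mem_univ mem_Ioi Ici Iic uIcc_of_le Ioc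
open intervalIntegral hiding norm_integral_le_of_norm_le integral_finsetSum integral_sub integral_mono integral_congr_ae abs_integral_le_integral_abs integral_neg integral_add integral_nonneg integral_const_mul integral_mul_const integral_indicator
local notation "pz" => (by positivity)
local notation "lz" => (by linarith)
local notation "nz" => (by norm_num)
local notation "lg" => Real.log
local notation "ex" => Real.exp
local notation "cex" => Complex.exp
local notation "Ci" => Complex.I
local notation "Fr" => Finset.range
local notation "vm" => ArithmeticFunction.vonMangoldt
local notation "csh" => Complex.sinh
local notation "cch" => Complex.cosh
local notation "sqr" => Real.sqrt
local notation "aord" => analyticOrderNatAt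
local notation "slz" => (by simp; linarith)
local notation "nnz" => (norm_nonneg _)
local notation "cj" => (starRingEnd ℂ)
local notation "sz" => (by simp)
local notation "fz" => (by fun_prop)
local notation "oz" => (by omega)
local notation "nlz" => (by nlinarith)
local notation "epz" => (exp_pos _)
local notation "rl1" => (1:ℝ)
local notation "rl0" => (0:ℝ)
local notation "rl2" => (2:ℝ)
local notation "q18" => (1/8:ℝ)
local notation "m78" => (-(7/8):ℝ)
local notation "q32" => (3/2:ℝ)
local notation "m74" => (-(7/4):ℝ)
local notation "q14" => (1/4:ℝ)
local notation "m34" => (-(3/4):ℝ)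
local notation "q25" => (2/5:ℝ)
local notation "q34" => (3/4:ℝ)
local notation "m12" => (-(1/2):ℝ)
local notation "q78" => (7/8:ℝ)
local notation "m54" => (-(5/4):ℝ)
local notation:max "eh" a:max => Real.exp (a/2)
local notation:max "lt2" a:max => Real.log (|a|+2)
local notation:max "ltp" a:max => Real.log (a+2)
local notation:max "ek" a:max b:max => Real.exp (-2*|a-Real.log b|)
local notation:max "dl" a:max b:max => |a-Real.log b|
local notation:max "abd" a:max b:max => (1+|a-b|)
local notation:max "rt" a:max b:max => (a-1-Complex.I*b)
local notation:max "cw" a:max b:max c:max => (a+(b+Complex.I*c))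
alias mlm := mul_le_mul_of_nonneg_left
alias lll := Real.log_le_log
alias non := Real.norm_of_nonneg
alias aop := abs_of_pos
alias ele := Real.exp_le_exp
alias rea := Real.exp_add
alias nsl := norm_sub_le
alias mmm := mul_le_mul
alias dli := div_le_iff₀
alias loe := le_of_eq
alias zlo := zero_le_one
alias mlo := mul_le_mul_of_nonneg_right
alias ncn := Nat.cast_nonneg
alias ala := add_le_add
alias cea := Complex.exp_add
alias nea := Real.norm_eq_abs
alias dld := div_le_div_iff₀
alias sls := Finset.sum_le_sum
alias aon := abs_of_nonneg
alias dem := div_eq_mul_inv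
alias tml := tsum_mul_left
alias den := dist_eq_norm
alias nal := norm_add_le
alias hhi := hasDerivAt_id
alias plp := pow_le_pow_left₀
alias rlm := Real.log_mul
alias icm := MeasureTheory.integral_const_mul
alias rlr := Real.rpow_le_rpow_of_exponent_le
alias sad := Finset.sum_add_distrib
alias rrn := Real.rpow_natCast
alias rel := Real.exp_log
alias cno := Complex.norm_ofNat
alias arl := Complex.abs_re_le_norm
alias snz := sub_ne_zero
alias slo := Finset.sum_le_sum_of_subset_of_nonneg
alias ccc := continuous_const
alias aol := Real.add_one_le_exp
alias olr := Real.one_le_rpow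
alias fmr := Finset.mem_range
alias ltl := Real.log_two_lt_d9
alias fmi := Finset.mem_Ico
alias iic := intervalIntegral.integral_const_mul
alias npi := norm_pos_iff
alias ddr := differentiable_riemannZeta₁
alias las := le_abs_self
alias son := Summable.of_nonneg_of_le
alias ton := tsum_of_norm_bounded
alias ren := Real.exp_nat_mul
alias rlo := Real.rpow_le_rpow_of_nonpos
alias mmi := measurableSet_Ioi
alias lmo := le_mul_of_one_le_right
alias nez := Nat.eq_zero_or_pos
alias ltg := Real.log_two_gt_d9
alias nla := Complex.norm_le_abs_re_add_abs_im
alias odl := one_div_le_one_div_of_le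
alias all := add_le_add_left
alias mii := measurableSet_Ioc
alias rei := riemannZeta_eq_inv_sub_mul
alias ieo := inv_eq_one_div
alias ail := Complex.abs_im_le_norm
alias lls := Real.log_le_sub_one_of_pos
alias fmp := Finset.mem_powerset
alias iia := intervalIntegral.integral_add
alias nca := Nat.cast_analyticOrderNatAt
alias dme := div_mul_eq_mul_div
alias sob := Summable.of_norm_bounded
alias avl := ArithmeticFunction.vonMangoldt_le_log
alias iii := intervalIntegrable_iff_integrableOn_Ioc_of_le
alias rnz := riemannZeta_ne_zero_of_one_le_re
alias hlo := harmonic_le_one_add_log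
alias lto := LSeries.term_of_ne_zero
alias lml := le_mul_of_one_le_left
alias npo := Nat.prime_of_mem_primesBelow
alias ies := intervalIntegral.integral_eq_sub_of_hasDerivAt
alias iif := intervalIntegral.integral_finsetSum
alias sgo := summable_geometric_of_lt_one
alias nce := Complex.norm_cpow_eq_rpow_re_of_pos
alias alv := ArithmeticFunction.LSeriesSummable_vonMangoldt
alias avn := ArithmeticFunction.vonMangoldt_nonneg
alias odn := one_div_neg_eq_neg_one_div
alias ini := intervalIntegral.norm_integral_le_of_norm_le_const

lemma fac1 {f:ℂ → ℂ} (hf : Differentiable ℂ f) {a:ℂ} (ha : analyticOrderAt f a ≠ ⊤) :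
    ∃ g:ℂ → ℂ, Differentiable ℂ g ∧ g a ≠0 ∧ (∀ s, f s=(s-a)^(aord f a)*g s) := by
  have hfa : AnalyticAt ℂ f a := hf.analyticAt a
  obtain ⟨g0, hg0, hg0a, hev⟩ := (hfa.analyticOrderAt_eq_natCast (n := aord f a)).1 (nca ha).symm
  set n := aord f a with hn
  refine ⟨fun s => if s=a then g0 a else f s/(s-a)^n, ?_, by simpa using hg0a, ?_⟩
  · intro s
    by_cases hs : s=a
    · subst hs
      refine hg0.differentiableAt.congr_of_eventuallyEq ?_
      filter_upwards [hev] with z hz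
      by_cases hzs : z=s
      · simp [hzs]
      · have : (z-s)^n ≠0 := pow_ne_zero _ (snz.2 hzs)
        simp only [hzs, if_false, hz, smul_eq_mul]
        field_simp
    · have : DifferentiableAt ℂ (fun s => f s/(s-a)^n) s :=
        (hf s).div fz (pow_ne_zero _ (snz.2 hs))
      refine this.congr_of_eventuallyEq ?_
      filter_upwards [isOpen_ne.mem_nhds hs] with z hz
      simp [hz]
  · intro s
    by_cases hs : s=a
    · subst hs
      have := hev.self_of_nhds
      simpa using this
    · have : (s-a)^n ≠0 := pow_ne_zero _ (snz.2 hs)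
      simp only [hs, if_false]
      field_simp

lemma fac1_log {f g:ℂ → ℂ} (hg : Differentiable ℂ g) {a:ℂ} {n:ℕ} (h : ∀ s, f s=(s-a)^n*g s) {z:ℂ} (hz : f z ≠0) (hza : z ≠ a) :
    logDeriv f z=n*(1/(z-a))+logDeriv g z := by
  have hf : f=fun s => (s-a)^n*g s := funext h
  have h0 := h z
  have hgz : g z ≠0 := by intro h1; rw [h1, mul_zero] at h0; exact hz h0
  have hza' : z-a ≠0 := snz.2 hza
  have hd : HasDerivAt f (n*(z-a)^(n-1)*1*g z+(z-a)^n*deriv g z) z := by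
    rw [hf]
    exact (((hhi z).sub_const a).pow n).mul (hg z).hasDerivAt
  rw [logDeriv_apply, logDeriv_apply, hd.deriv, h0]
  rcases n with _ | k
  · simp
  · simp only [Nat.add_sub_cancel]
    field_simp
    ring

lemma order_ne_top {f:ℂ → ℂ} (hf : Differentiable ℂ f) {c:ℂ} (hc : f c ≠0) (a:ℂ) :
    analyticOrderAt f a ≠ ⊤ := by
  have hA : AnalyticOnNhd ℂ f univ := fun z _ => hf.analyticAt z
  refine hA.analyticOrderAt_ne_top_of_isPreconnected isPreconnected_univ (mem_univ c) (mem_univ a) ?_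
  rw [(hf.analyticAt c).analyticOrderAt_eq_zero.2 hc]; simp

lemma fac {f:ℂ → ℂ} (hf : Differentiable ℂ f) {c:ℂ} (hc : f c ≠0) (F : Finset ℂ) :
    ∃ g:ℂ → ℂ, Differentiable ℂ g ∧ (∀ a ∈ F, g a ≠0) ∧ (∀ s, f s=(∏ a ∈ F, (s-a)^(aord f a))*g s) ∧ (∀ z, f z ≠0 → z ∉ F → logDeriv f z=∑ a ∈ F, (aord f a:ℂ)*(1/(z-a))+logDeriv g z) := by
  classical
  induction F using Finset.induction_on with
  | empty => exact ⟨f, hf, by simp, by simp, by simp⟩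
  | insert b F hb ih =>
    obtain ⟨g, hg, hgF, hfg, hlog⟩ := ih
    set P:ℂ → ℂ := fun s => ∏ a ∈ F, (s-a)^(aord f a) with hP
    have hPd : Differentiable ℂ P := by simp only [hP]; fun_prop
    have hPb : P b ≠0 := by
      simp only [hP]
      refine prod_ne_zero_iff.2 fun a ha => pow_ne_zero _ (snz.2 ?_)
      rintro rfl; exact hb ha
    have hord : analyticOrderAt f b=analyticOrderAt g b := by
      have : f=P*g := funext hfg
      rw [this, analyticOrderAt_mul (hPd.analyticAt b) (hg.analyticAt b), (hPd.analyticAt b).analyticOrderAt_eq_zero.2 hPb, zero_add]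
    have hN : aord f b=aord g b := by unfold analyticOrderNatAt; rw [hord]
    obtain ⟨g', hg', hg'b, hgg'⟩ := fac1 hg (a := b) (hord ▸ order_ne_top hf hc b)
    refine ⟨g', hg', ?_, ?_, ?_⟩
    · intro a ha
      rcases Finset.mem_insert.1 ha with rfl | ha
      · exact hg'b
      · intro h0; apply hgF a ha; rw [hgg', h0, mul_zero]
    · intro s
      rw [hfg s, Finset.prod_insert hb, hgg' s, hN]; ring
    · intro z hz hzF
      have hzb : z ≠ b := fun h => hzF (h ▸ mem_insert_self _ _)
      have hzF' : z ∉ F := fun h => hzF (Finset.mem_insert_of_mem h)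
      have hgz : g z ≠0 := by intro h0; apply hz; rw [hfg z, h0, mul_zero]
      rw [hlog z hz hzF', sum_insert hb, fac1_log hg' hgg' hgz hzb, hN]; ring

lemma landau_aux {f:ℂ → ℂ} (hf : Differentiable ℂ f) {c:ℂ} (hc : f c ≠0)
    {R M:ℝ} (hR :0<R) (F : Finset ℂ)
    (hF : ∀ z, z ∈ F ↔ f z =0 ∧ ‖z-c‖ ≤ R)
    (hM : ∀ s, ‖s-c‖ ≤4*R → ‖f s‖ ≤ ex M) :
    (∑ a ∈ F, (aord f a:ℝ)) ≤ M-lg ‖f c‖ ∧ ∀ z z', ‖z-c‖ < R/8 → ‖z'-c‖ < R/8 → f z ≠0 → f z' ≠0 → ‖(logDeriv f z-logDeriv f z')-∑ a ∈ F, (aord f a:ℂ)*(1/(z-a)-1/(z'-a))‖ ≤64*(M-lg ‖f c‖ +1)/R^2 * ‖z-z'‖ := by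
  obtain ⟨g, hg, hgF, hfg, hlog⟩ := fac hf hc F
  have hfc :0 < ‖f c‖ := npi.2 hc
  have hgc : g c ≠0 := by intro h0; apply hc; rw [hfg c, h0, mul_zero]
  set n := ∑ a ∈ F, aord f a with hn
  have hgb : ∀ s, ‖s-c‖ ≤4*R → ‖g s‖ ≤ ex M/(3*R)^n := by
    intro s hs
    have := norm_le_of_forall_mem_frontier_norm_le (f := g) (U := Metric.ball c (4*R)) (C := ex M/(3*R)^n) Metric.isBounded_ball
      hg.diffContOnCl (fun z hz => ?_) (z := s) (by rw [closure_ball _ pz]; simpa [den] using hs)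
    · exact this
    · rw [frontier_ball _ pz, mem_sphere_iff_norm] at hz
      rw [le_div_iff₀ pz]
      have h1 := hM z hz.le
      rw [hfg z, norm_mul] at h1
      refine le_trans ?_ h1
      rw [mul_comm]
      refine mlo ?_ nnz
      rw [norm_prod, hn, ← prod_pow_eq_pow_sum]
      refine Finset.prod_le_prod (fun a _ => pz) fun a ha => ?_
      rw [norm_pow]
      refine plp pz ?_ _
      have h2 := ((hF a).1 ha).2
      have h3 : ‖z-c‖ ≤ ‖z-a‖ + ‖a-c‖ := by have := nal (z-a) (a-c); simpa using this
      linarith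
  have hfcg : ‖f c‖ ≤ R^n * ‖g c‖ := by
    rw [hfg c, norm_mul]
    refine mlo ?_ nnz
    rw [norm_prod, hn, ← prod_pow_eq_pow_sum]
    refine Finset.prod_le_prod (fun a _ => pz) fun a ha => ?_
    rw [norm_pow]
    refine plp pz ?_ _
    rw [norm_sub_rev]; exact ((hF a).1 ha).2
  have hq : ∀ s, ‖s-c‖ ≤4*R → 3^n * ‖f c‖ * ‖g s‖ ≤ ex M * ‖g c‖ := by
    intro s hs
    have h1 := hgb s hs
    rw [le_div_iff₀ pz] at h1
    calc 3^n * ‖f c‖ * ‖g s‖ ≤3^n*(R^n * ‖g c‖) * ‖g s‖ := by gcongr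
      _=(‖g s‖ * (3*R)^n) * ‖g c‖ := by rw [mul_pow]; ring
      _ ≤ ex M * ‖g c‖ := by gcongr
  have hgcp :0 < ‖g c‖ := npi.2 hgc
  have hcount : (n:ℝ) ≤ M-lg ‖f c‖ := by
    have h1 := hq c (by simp; positivity)
    have h2 :3^n * ‖f c‖ ≤ ex M := le_of_mul_le_mul_right h1 hgcp
    have h3 := lll pz h2
    rw [Real.log_exp, rlm pz hfc.ne', log_pow] at h3
    have h4 : rl1 ≤ lg 3 := by
      rw [le_log_iff_exp_le nz]
      exact exp_one_lt_d9.le.trans nz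
    nlinarith [ncn (α := ℝ) n]
  refine ⟨by rw [hn] at hcount; exact_mod_cast hcount, ?_⟩
  set M' := M-lg ‖f c‖ +1 with hM'
  have hM'pos :0 < M' := by
    have : rl0 ≤ n := ncn n
    linarith
  have hgne : ∀ z ∈ Metric.ball c R, g z ≠0 := by
    intro z hz h0
    have hz' : ‖z-c‖ < R := by simpa [den] using hz
    exact hgF z ((hF z).2 ⟨by rw [hfg z, h0, mul_zero], hz'.le⟩) h0
  have hdl : DifferentiableOn ℂ (logDeriv g) (Metric.ball c R) := by
    intro z hz
    refine DifferentiableAt.differentiableWithinAt ?_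
    exact (hg.analyticAt z).deriv.differentiableAt.div (hg z) (hgne z hz)
  obtain ⟨h, hhc, hh⟩ := hdl.isExactOn_ball.with_val_at c 0
  have hexp : ∀ z ∈ Metric.ball c R, g z=g c*cex (h z) := by
    have hconst : ∀ z ∈ Metric.ball c R, HasDerivAt (fun z => g z*cex (-h z)) 0 z := by
      intro z hz
      have := (hg z).hasDerivAt.mul ((hh z hz).neg.cexp)
      refine this.congr_deriv ?_
      rw [logDeriv_apply]
      have := hgne z hz
      simp only [Pi.neg_apply]
      field_simp
      ring
    intro z hz
    have h1 := (convex_ball c R).is_const_of_fderivWithin_eq_zero (𝕜 := ℂ) (f := fun z => g z*cex (-h z)) (fun z hz => (hconst z hz).differentiableAt.differentiableWithinAt) (fun z hz => by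
        rw [fderivWithin_of_isOpen Metric.isOpen_ball hz, (hconst z hz).hasFDerivAt.fderiv]
        ext; simp) hz (Metric.mem_ball_self hR)
    simp only [hhc, neg_zero, Complex.exp_zero, mul_one] at h1
    rw [← h1, mul_assoc, ← cea]; simp
  have hre : ∀ z ∈ Metric.ball c R, (h z).re ≤ M' := by
    intro z hz
    have hz' : ‖z-c‖ < R := by simpa [den] using hz
    have h1 := hq z lz
    rw [hexp z hz, norm_mul, norm_exp] at h1
    have h2 : ‖f c‖ * ex (h z).re ≤ ex M := by
      have h3 : rl1 ≤3^n := one_le_pow₀ nz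
      have : (‖f c‖ * ex (h z).re) * ‖g c‖ ≤ ex M * ‖g c‖ := by
        calc _ =1*(‖f c‖ * (‖g c‖ * ex (h z).re)) := by ring
          _ ≤3^n*(‖f c‖ * (‖g c‖ * ex (h z).re)) := by gcongr
          _=_ := by ring
          _ ≤ _ := h1
      exact le_of_mul_le_mul_right this hgcp
    have h3 := lll pz h2
    rw [Real.log_exp, rlm hfc.ne' pz, Real.log_exp] at h3
    linarith
  have hBC : ∀ z, ‖z-c‖ ≤ R/2 → ‖h z‖ ≤2 * M' := by
    intro z hz
    have := borelCaratheodory_zero (f := fun w => h (w+c)) (M := M') (R := R) (z := z-c) hM'pos ?_ ?_ hR slz (by simpa using hhc)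
    · simp only [sub_add_cancel] at this
      refine this.trans ?_
      rw [dli lz]
      nlinarith
    · intro w hw
      have : HasDerivAt (fun w => h (w+c)) _ w :=
        (hh (w+c) (by simpa [den] using hw)).comp_add_const w c
      exact this.differentiableAt.differentiableWithinAt
    · intro w hw
      exact hre (w+c) (by simpa [den] using hw)
  have hhd : DifferentiableOn ℂ h (Metric.ball c R) :=
    fun w hw => (hh w hw).differentiableAt.differentiableWithinAt
  have hD1 : ∀ z, ‖z-c‖ ≤ R/4 → ‖logDeriv g z‖ ≤8 * M'/R := by
    intro z hz
    have hin : Metric.closedBall z (R/4) ⊆ Metric.ball c R := by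
      refine Metric.closedBall_subset_ball' ?_
      rw [den]; linarith
    have := norm_deriv_le_of_forall_mem_sphere_norm_le (f := h) (c := z) (R := R/4) (C :=2 * M') pz ((hhd.mono hin).diffContOnCl_ball (Subset.refl _)) (fun w hw => hBC w (by
        rw [mem_sphere_iff_norm] at hw
        have : ‖w-c‖ ≤ ‖w-z‖ + ‖z-c‖ := by simpa using nal (w-z) (z-c)
        linarith))
    rw [(hh z (hin (Metric.mem_closedBall_self pz))).deriv] at this
    refine this.trans (loe ?_)
    field_simp; norm_num
  have hD2 : ∀ z ∈ Metric.ball c (R/8), ‖deriv (logDeriv g) z‖ ≤64 * M'/R^2 := by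
    intro z hz
    have hz' : ‖z-c‖ < R/8 := by simpa [den] using hz
    have hin : Metric.closedBall z (R/8) ⊆ Metric.ball c R := by
      refine Metric.closedBall_subset_ball' ?_
      rw [den]; linarith
    have := norm_deriv_le_of_forall_mem_sphere_norm_le (f := logDeriv g) (c := z) (R := R/8) (C :=8 * M'/R) pz ((hdl.mono hin).diffContOnCl_ball (Subset.refl _)) (fun w hw => hD1 w (by
        rw [mem_sphere_iff_norm] at hw
        have : ‖w-c‖ ≤ ‖w-z‖ + ‖z-c‖ := by simpa using nal (w-z) (z-c)
        linarith))
    refine this.trans (loe ?_)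
    field_simp; norm_num
  intro z z' hz hz' hfz hfz'
  have hzF : z ∉ F := fun h => hfz ((hF z).1 h).1
  have hzF' : z' ∉ F := fun h => hfz' ((hF z').1 h).1
  rw [hlog z hfz hzF, hlog z' hfz' hzF']
  have e : (∑ a ∈ F, (aord f a:ℂ)*(1/(z-a))+logDeriv g z-(∑ a ∈ F, (aord f a:ℂ)*(1/(z'-a))+logDeriv g z'))-∑ a ∈ F, (aord f a:ℂ)*(1/(z-a)-1/(z'-a))=logDeriv g z-logDeriv g z' := by simp only [mul_sub, sum_sub_distrib]; ring
  rw [e]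
  refine (convex_ball c (R/8)).norm_image_sub_le_of_norm_deriv_le (𝕜 := ℂ) (fun w hw => ?_) hD2
    (by simpa [den] using hz') (by simpa [den] using hz)
  exact hdl.differentiableAt (Metric.isOpen_ball.mem_nhds (Metric.ball_subset_ball lz hw))

section landau
variable {f:ℂ → ℂ} (hf : Differentiable ℂ f) {c:ℂ} (hc : f c ≠0) {B:ℝ} (hB :0 ≤ B) (hgrow : ∀ s, ‖f s‖ ≤ ex (B*(1 + ‖s-c‖)^q32)) (hfin : ∀ R, ({z | f z =0} ∩ Metric.closedBall c R).Finite)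
include hf hc hB hgrow hfin

lemma landau_fin : ∃ C:ℝ,0<C ∧ ∀ R:ℝ,1 ≤ R → ∃ F : Finset ℂ, (∀ z, z ∈ F ↔ f z =0 ∧ ‖z-c‖ ≤ R) ∧ (∑ a ∈ F, (aord f a:ℝ)) ≤ C*R^q32 ∧ ∀ z z', ‖z-c‖ < R/8 → ‖z'-c‖ < R/8 → f z ≠0 → f z' ≠0 → ‖(logDeriv f z-logDeriv f z')-∑ a ∈ F, (aord f a:ℂ)*(1/(z-a)-1/(z'-a))‖ ≤ C*R^(- (1/2):ℝ) * ‖z-z'‖ := by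
  have h5 : rl0 <5^q32 := pz
  set C0:ℝ := B*5^q32 + |lg ‖f c‖| +1 with hC0
  have hC0p :0<C0 := pz
  refine ⟨64*C0, pz, fun R hR => ⟨(hfin R).toFinset, ?_, ?_⟩⟩
  · intro z; simp [den]
  have hRp :0<R := lz
  have hR1 : rl1 ≤ R^q32 := olr hR nz
  have hMb : B*(1+4*R)^q32-lg ‖f c‖ +1 ≤ C0*R^q32 := by
    have h1 : (1+4*R)^q32 ≤5^q32*R^q32 := by
      rw [← mul_rpow nz hRp.le]
      exact rpow_le_rpow pz lz nz
    have h2 := mlm h1 hB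
    have h3 : |lg ‖f c‖| ≤ |lg ‖f c‖| * R^q32 :=
      lmo (abs_nonneg _) hR1
    have h4 := neg_abs_le (lg ‖f c‖)
    rw [hC0]; linarith
  obtain ⟨h1, h2⟩ := landau_aux hf hc (R := R) (M := B*(1+4*R)^q32) hRp (hfin R).toFinset (by intro z; simp [den]) (fun s hs => (hgrow s).trans (by
      refine ele.2 (mlm ?_ hB)
      exact rpow_le_rpow pz lz nz))
  refine ⟨?_, fun z z' hz hz' hfz hfz' => (h2 z z' hz hz' hfz hfz').trans ?_⟩
  · have :0 ≤ C0*R^q32 := pz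
    linarith
  · refine mlo ?_ nnz
    rw [dli pz]
    have : R^q32=R^(- (1/2):ℝ)*R^2 := by rw [← rrn R 2, ← rpow_add hRp]; norm_num
    rw [mul_assoc (64*C0), ← this]
    linarith

lemma landau_summable :
    Summable (fun ρ => (aord f ρ:ℝ)*(1 + ‖ρ-c‖)^m74) := by
  classical
  obtain ⟨C, hC, hF⟩ := landau_fin hf hc hB hgrow hfin
  set q:ℝ :=2^(-(1/4):ℝ) with hq
  have hq0 :0<q := pz
  have hq1 : q <1 := rpow_lt_one_of_one_lt_of_neg nz nz
  have hm0 : ∀ ρ, f ρ ≠0 → aord f ρ =0 := by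
    intro ρ h
    by_contra h'
    exact h (apply_eq_zero_of_analyticOrderNatAt_ne_zero h')
  have h2k : ∀ k:ℕ, rl1 ≤2^(k+1) := fun k => one_le_pow₀ nz
  choose! F hF1 hF2 _ using hF
  refine summable_of_sum_le (c := C*2^q32*(1-q)⁻¹) (fun ρ => pz) ?_
  intro s
  obtain ⟨K, hK⟩ : ∃ K:ℕ, ∀ ρ ∈ s,1 + ‖ρ-c‖ <2^K := by
    obtain ⟨b, hb⟩ := (s.image (fun ρ => ‖ρ-c‖)).bddAbove
    obtain ⟨K, hK⟩ := pow_unbounded_of_one_lt (1+b) (nz : rl1 <2)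
    refine ⟨K, fun ρ hρ => lt_of_le_of_lt ?_ hK⟩
    have := hb (mem_coe.2 (Finset.mem_image_of_mem _ hρ))
    simpa using this
  have key : ∀ ρ ∈ s, (aord f ρ:ℝ)*(1 + ‖ρ-c‖)^m74 ≤ ∑ k ∈ Fr K, (rl2^k)^m74*(if ρ ∈ F (2^(k+1)) then (aord f ρ:ℝ) else 0) := by
    intro ρ hρ
    by_cases hz : f ρ =0
    swap
    · rw [hm0 ρ hz]; simp
    obtain ⟨k, hk⟩ := exists_nat_pow_near (y := rl2) (x :=1 + ‖ρ-c‖)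
      (by linarith [norm_nonneg (ρ-c)]) nz
    have hkK : k<K := by
      have := lt_of_le_of_lt hk.1 (hK ρ hρ)
      exact (pow_lt_pow_iff_right₀ nz).1 this
    refine le_trans ?_ (single_le_sum (f := fun k => (rl2^k)^m74*(if ρ ∈ F (2^(k+1)) then (aord f ρ:ℝ) else 0)) (fun j _ => ?_) (fmr.2 hkK))
    · have hmem : ρ ∈ F (2^(k+1)) := (hF1 _ (h2k k) ρ).2 ⟨hz, by linarith [hk.2]⟩
      simp only [hmem, if_true]
      rw [mul_comm]
      refine mlo ?_ (ncn _)
      exact rlo pz hk.1 nz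
    · split_ifs <;> positivity
  refine (sls key).trans ?_
  rw [sum_comm]
  have step : ∀ k ∈ Fr K, ∑ ρ ∈ s, (rl2^k)^m74*(if ρ ∈ F (2^(k+1)) then (aord f ρ:ℝ) else 0) ≤ (C*2^q32)*q^k := by
    intro k _
    rw [← mul_sum]
    have h1 : ∑ ρ ∈ s, (if ρ ∈ F (2^(k+1)) then (aord f ρ:ℝ) else 0) ≤ C*(rl2^(k+1))^q32 := by
      refine le_trans ?_ (hF2 _ (h2k k))
      rw [← sum_filter]
      refine slo ?_ (fun _ _ _ => ncn _)
      intro ρ hρ; exact (mem_filter.1 hρ).2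
    refine (mlm h1 pz).trans (loe ?_)
    have e1 : (rl2^(k+1))^q32 =2^q32*(rl2^k)^q32 := by rw [pow_succ, mul_rpow pz nz]; ring
    have e2 : q^k=(rl2^k)^m74*(rl2^k)^q32 := by
      rw [← rpow_add pz, hq, ← rrn, ← rrn, ← rpow_mul nz, ← rpow_mul nz]
      congr 1; ring
    rw [e1, e2]; ring
  refine (sls step).trans ?_
  rw [← mul_sum]
  refine mlm ?_ pz
  rw [← tsum_geometric_of_lt_one hq0.le hq1]
  exact (sgo hq0.le hq1).sum_le_tsum _ (fun _ _ => pz)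
end landau

section landau
variable {f:ℂ → ℂ} (hf : Differentiable ℂ f) {c:ℂ} (hc : f c ≠0) {B:ℝ} (hB :0 ≤ B) (hgrow : ∀ s, ‖f s‖ ≤ ex (B*(1 + ‖s-c‖)^q32)) (hfin : ∀ R, ({z | f z =0} ∩ Metric.closedBall c R).Finite)

lemma order_zero_of_ne {f:ℂ → ℂ} {ρ:ℂ} (h : f ρ ≠0) : aord f ρ =0 := by
  by_contra h'
  exact h (apply_eq_zero_of_analyticOrderNatAt_ne_zero h')

lemma pf_term_bound {z z' ρ c:ℂ} (h :2*(‖z-c‖ + ‖z'-c‖)+1 ≤ ‖ρ-c‖) :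
    ‖1/(z-ρ)-1/(z'-ρ)‖ ≤16 * ‖z-z'‖ * (1 + ‖ρ-c‖)^m74 := by
  have hz := norm_nonneg (z-c)
  have hz' := norm_nonneg (z'-c)
  have key : ∀ w:ℂ,2 * ‖w-c‖ +1 ≤ ‖ρ-c‖ → (1 + ‖ρ-c‖)/4 ≤ ‖w-ρ‖ := by
    intro w hw
    have : ‖ρ-c‖ ≤ ‖w-ρ‖ + ‖w-c‖ := by rw [norm_sub_rev w ρ]; simpa using nal (ρ-w) (w-c)
    linarith [norm_nonneg (w-c)]
  have h1 := key z lz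
  have h2 := key z' lz
  have hp :0<(1 + ‖ρ-c‖)/4 := pz
  have hz0 : z-ρ ≠0 := npi.1 lz
  have hz0' : z'-ρ ≠0 := npi.1 lz
  have e :1/(z-ρ)-1/(z'-ρ)=(z'-z)/((z-ρ)*(z'-ρ)) := by field_simp; ring
  rw [e, norm_div, norm_mul, norm_sub_rev z' z]
  have h3 : (1 + ‖ρ-c‖)^(-2:ℝ) ≤ (1 + ‖ρ-c‖)^m74 :=
    rlr (by linarith [norm_nonneg (ρ-c)]) nz
  have h4 : (1 + ‖ρ-c‖)^(-2:ℝ)=((1 + ‖ρ-c‖)^2)⁻¹ := by rw [rpow_neg pz]; norm_cast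
  calc ‖z-z'‖ / (‖z-ρ‖ * ‖z'-ρ‖) ≤ ‖z-z'‖ / ((1 + ‖ρ-c‖)/4*((1 + ‖ρ-c‖)/4)) := by gcongr
    _ =16 * ‖z-z'‖ * ((1 + ‖ρ-c‖)^2)⁻¹ := by field_simp; norm_num
    _ ≤ _ := by rw [← h4]; gcongr

include hf hc hB hgrow hfin in
lemma landau_hasSum {z z':ℂ} (hz : f z ≠0) (hz' : f z' ≠0) :
    HasSum (fun ρ => (aord f ρ:ℂ)*(1/(z-ρ)-1/(z'-ρ))) (logDeriv f z-logDeriv f z') := by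
  classical
  set t:ℂ → ℂ := fun ρ => (aord f ρ:ℂ)*(1/(z-ρ)-1/(z'-ρ)) with ht
  set D:ℝ :=2*(‖z-c‖ + ‖z'-c‖)+1 with hD
  have hS := landau_summable hf hc hB hgrow hfin
  have hsum : Summable t := by
    refine Summable.of_norm_bounded_eventually (hS.mul_left (16 * ‖z-z'‖)) ?_
    have : ({z | f z =0} ∩ Metric.closedBall c D)ᶜ ∈ (cofinite : Filter ℂ) :=
      (hfin D).compl_mem_cofinite
    filter_upwards [this] with ρ hρ
    by_cases h0 : f ρ =0
    · have hfar : D ≤ ‖ρ-c‖ := by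
        by_contra hlt
        exact hρ ⟨h0, by simpa [den] using (not_le.1 hlt).le⟩
      have := mlm (pf_term_bound hfar) (ncn (α := ℝ) (aord f ρ))
      rw [ht]; simp only [norm_mul, Complex.norm_natCast]
      linarith
    · simp [ht, order_zero_of_ne h0]
  obtain ⟨C, hC, hF⟩ := landau_fin hf hc hB hgrow hfin
  choose! F hF1 _ hF3 using hF
  have hlim1 : Tendsto (fun R:ℝ => ∑ a ∈ F R, t a) atTop (𝓝 (∑' ρ, t ρ)) := by
    have hdom := tendsto_tsum_of_dominated_convergence (𝓕 := (atTop : Filter ℝ)) (f := fun R ρ => if ρ ∈ F R then t ρ else 0) (g := t) (bound := fun ρ => ‖t ρ‖)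
      hsum.norm ?_ ?_
    · refine hdom.congr fun R => ?_
      rw [tsum_eq_sum (s := F R) (fun b hb => by simp [hb])]
      exact sum_congr rfl fun a ha => by simp [ha]
    · intro ρ
      by_cases h0 : f ρ =0
      · refine tendsto_const_nhds.congr' ?_
        filter_upwards [eventually_ge_atTop rl1, eventually_ge_atTop ‖ρ-c‖] with R h1 h2
        simp [(hF1 R h1 ρ).2 ⟨h0, h2⟩]
      · have : t ρ =0 := by simp [ht, order_zero_of_ne h0]
        simp [this]
    · refine Eventually.of_forall fun R ρ => ?_
      split_ifs <;> simp
  have hlim2 : Tendsto (fun R:ℝ => ∑ a ∈ F R, t a) atTop (𝓝 (logDeriv f z-logDeriv f z')) := by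
    rw [tendsto_iff_norm_sub_tendsto_zero]
    have h0 : Tendsto (fun R:ℝ => C*R^m12 * ‖z-z'‖) atTop (𝓝 0) := by
      have := ((tendsto_rpow_neg_atTop (y := (1/2:ℝ)) nz).const_mul C).mul_const
        ‖z-z'‖
      simpa using this
    refine squeeze_zero' (Eventually.of_forall fun R => norm_nonneg _) ?_ h0
    filter_upwards [eventually_ge_atTop rl1, eventually_gt_atTop (8 * ‖z-c‖), eventually_gt_atTop (8 * ‖z'-c‖)] with R h1 h2 h3
    rw [norm_sub_rev]
    exact hF3 R h1 z z' lz lz hz hz'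
  have := tendsto_nhds_unique hlim1 hlim2
  rw [← this]; exact hsum.hasSum
end landau

def frC (t:ℝ):ℂ := indicator (Ioi rl1) (fun t => ((Int.fract t:ℝ):ℂ)) t

lemma frC_norm_le (t:ℝ) : ‖frC t‖ ≤ indicator (Ioi rl1) (fun _ => rl1) t := by
  unfold frC
  by_cases h : t ∈ Ioi rl1
  · simp only [indicator_of_mem h, norm_real, nea, aon (Int.fract_nonneg t)]
    exact (Int.fract_lt_one t).le
  · simp [indicator_of_notMem h]

lemma frC_norm_le_one (t:ℝ) : ‖frC t‖ ≤1 :=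
  (frC_norm_le t).trans (indicator_le_self' (fun _ _ => zlo) t)

lemma measurable_frC : Measurable frC := by
  unfold frC
  exact (measurable_ofReal.comp measurable_fract).indicator mmi

lemma mellin_frC (s:ℂ) : mellin frC (-s)=∫ t in Ioi rl1, (t:ℂ)^(-(s+1))*((Int.fract t:ℝ):ℂ) := by
  rw [mellin, ← integral_indicator mmi, ← integral_indicator mmi]
  congr 1; ext t
  by_cases h1 : rl1<t
  · have h0 : rl0<t := lz
    simp only [indicator, mem_Ioi, h0, h1, if_true, frC, smul_eq_mul]
    congr 2; ring
  · simp [indicator, frC, h1]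

lemma mellin_frC_diff {s:ℂ} (hs :0<s.re) : DifferentiableAt ℂ (fun s => mellin frC (-s)) s := by
  have h1 : DifferentiableAt ℂ (mellin frC) (-s) := by
    refine mellin_differentiableAt_of_isBigO_rpow (a :=0) (b := -s.re-1) ?_ ?_ (by simpa) ?_
      sz
    · refine LocallyIntegrable.locallyIntegrableOn ?_ _
      refine (locallyIntegrable_const rl1).mono measurable_frC.aestronglyMeasurable ?_
      exact Eventually.of_forall fun t => by simpa using frC_norm_le_one t
    · refine Asymptotics.IsBigO.of_bound 1 (Eventually.of_forall fun t => ?_)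
      simpa using frC_norm_le_one t
    · refine Asymptotics.IsBigO.of_bound 1 ?_
      filter_upwards [mem_nhdsWithin_of_mem_nhds (Iio_mem_nhds (zero_lt_one))] with t ht
      have : ¬ rl1<t := not_lt.2 (le_of_lt ht)
      simp [frC, indicator, this]
  exact DifferentiableAt.fun_comp' s h1 differentiableAt_id.neg

lemma integrable_rpow_Ioi {σ:ℝ} (h :0<σ) : IntegrableOn (fun t:ℝ => t^(-(σ+1))) (Ioi 1) :=
  integrableOn_Ioi_rpow_of_lt lz one_pos

lemma mellin_frC_norm {s:ℂ} (hs :0<s.re) : ‖mellin frC (-s)‖ ≤1/s.re := by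
  rw [mellin_frC]
  have : ∫ t in Ioi rl1, t^(-(s.re+1)) =1/s.re := by
    rw [integral_Ioi_rpow_of_lt lz one_pos]
    simp only [one_rpow]
    rw [show -(s.re+1)+1 = -s.re by ring, neg_div_neg_eq]
  rw [← this]
  refine norm_integral_le_of_norm_le (integrable_rpow_Ioi hs) ?_
  refine (ae_restrict_iff' mmi).2 (Eventually.of_forall fun t ht => ?_)
  have h0 : rl0<t := lt_trans one_pos ht
  rw [norm_mul, nce h0]
  simp only [neg_re, add_re, one_re, norm_real, nea, aon (Int.fract_nonneg t)]
  exact mul_le_of_le_one_right pz (Int.fract_lt_one t).le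

lemma zeta1_eq {s:ℂ} (hs :0<s.re) :
    riemannZeta₁ s=s-s*(s-1) * mellin frC (-s) := by
  have hopen : IsOpen {s:ℂ | 0<s.re} := isOpen_lt ccc continuous_re
  have hpre : IsPreconnected {s:ℂ | 0<s.re} := (convex_halfSpace_re_gt 0).isPreconnected
  have hA : AnalyticOnNhd ℂ riemannZeta₁ {s:ℂ | 0<s.re} :=
    fun z _ => ddr.analyticAt z
  have hB : AnalyticOnNhd ℂ (fun s => s-s*(s-1) * mellin frC (-s)) {s:ℂ | 0<s.re} := by
    refine DifferentiableOn.analyticOnNhd (fun z hz => ?_) hopen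
    have := mellin_frC_diff hz
    refine DifferentiableAt.differentiableWithinAt ?_
    fun_prop
  refine hA.eqOn_of_preconnected_of_eventuallyEq hB hpre (z₀ :=2) sz ?_ hs
  have hev : ∀ᶠ z:ℂ in 𝓝 2,1<z.re :=
    (isOpen_lt ccc continuous_re).mem_nhds sz
  filter_upwards [hev] with z hz
  have hz1 : z ≠1 := by rintro rfl; simp at hz
  have hz1' : z-1 ≠0 := snz.2 hz1
  have hz0 :0<z.re := lz
  have h1 : riemannZeta z=z*∫ t in Ioi rl1, (∑ k ∈ Finset.Icc 1 ⌊t⌋₊, (rl1:ℂ))*(t:ℂ)^(-(z+1)) := by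
    have := LSeries_eq_mul_integral_of_nonneg (fun _ =>1) zlo hz ?_ (fun _ => zlo)
    · rw [← this, ← LSeries_one_eq_riemannZeta hz]
      refine LSeries_congr (fun {n} _ => by simp) _
    · refine Asymptotics.IsBigO.of_bound 1 (Eventually.of_forall fun n => ?_)
      simp
  have hint1 : IntegrableOn (fun t:ℝ => (t:ℂ)^(-z)) (Ioi 1) :=
    integrableOn_Ioi_cpow_of_lt (by simpa using hz) one_pos
  have hint2 : IntegrableOn (fun t:ℝ => (t:ℂ)^(-(z+1))*((Int.fract t:ℝ):ℂ)) (Ioi 1) := by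
    have hb : IntegrableOn (fun t:ℝ => (t:ℂ)^(-(z+1))) (Ioi 1) :=
      integrableOn_Ioi_cpow_of_lt (by simpa using hz0) one_pos
    refine hb.mul_bdd (c :=1) (measurable_ofReal.comp measurable_fract).aestronglyMeasurable (Eventually.of_forall fun t => ?_)
    simp only [norm_real, nea, aon (Int.fract_nonneg t)]
    exact (Int.fract_lt_one t).le
  have h2 : ∫ t in Ioi rl1, (∑ k ∈ Finset.Icc 1 ⌊t⌋₊, (rl1:ℂ))*(t:ℂ)^(-(z+1))=1/(z-1) - mellin frC (-z) := by
    have e1 : ∫ t in Ioi rl1, (t:ℂ)^(-z) =1/(z-1) := by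
      rw [integral_Ioi_cpow_of_lt (by simpa using hz) one_pos]
      simp only [ofReal_one, one_cpow]
      rw [show -z+1 = -(z-1) by ring, neg_div_neg_eq]
    rw [mellin_frC, ← e1, ← integral_sub hint1 hint2]
    refine setIntegral_congr_fun mmi fun t ht => ?_
    have h0 : rl0<t := lt_trans one_pos ht
    have hf : ((⌊t⌋₊:ℝ):ℂ)=t-((Int.fract t:ℝ):ℂ) := by
      rw [← ofReal_sub]; congr 1
      have h3 := Int.self_sub_floor t
      have h4 : (⌊t⌋₊:ℝ)=(⌊t⌋:ℝ) := natCast_floor_eq_intCast_floor h0.le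
      rw [h4]; linarith
    have hc : (t:ℂ)^(-z)=(t:ℂ)^(-(z+1))*t := by rw [show -z = -(z+1)+1 by ring, cpow_add _ _ (by exact_mod_cast h0.ne'), cpow_one]
    simp only [sum_const, Nat.card_Icc, Nat.add_sub_cancel, nsmul_eq_mul, ofReal_one, mul_one]
    have hf' : ((⌊t⌋₊:ℕ):ℂ)=t-((Int.fract t:ℝ):ℂ) := by rw [← hf]; simp
    rw [hc, hf']; ring
  rw [h2] at h1
  have h3 := rei hz1
  rw [h1] at h3
  have : riemannZeta₁ z=(z-1)*(1/(z-1)*riemannZeta₁ z) := by field_simp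
  rw [this, ← ieo, ← h3]
  field_simp

lemma zeta1_bound {s:ℂ} (hs :1/2 ≤ s.re) :
    ‖riemannZeta₁ s‖ ≤ ‖s‖ +2 * ‖s‖ * ‖s-1‖ := by
  rw [zeta1_eq lz]
  refine (nsl _ _).trans ?_
  rw [norm_mul, norm_mul]
  have h1 := mellin_frC_norm (s := s) lz
  have h2 :1/s.re ≤2 := by rw [dli lz]; linarith
  have : ‖s‖ * ‖s-1‖ * ‖mellin frC (-s)‖ ≤ ‖s‖ * ‖s-1‖ *2 := by gcongr; linarith
  linarith

lemma norm_Gamma_le {w:ℂ} (hw :0<w.re) : ‖Complex.Gamma w‖ ≤ Real.Gamma w.re := by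
  rw [Complex.Gamma_eq_integral hw, Real.Gamma_eq_integral hw, GammaIntegral]
  refine norm_integral_le_of_norm_le (Real.GammaIntegral_convergent hw) ?_
  refine (ae_restrict_iff' mmi).2 (Eventually.of_forall fun t ht => ?_)
  rw [norm_mul, nce ht]
  rw [norm_real, nea, aop epz]
  simp

lemma Gamma_growth {x:ℝ} (hx :1/2 ≤ x) :
    Real.Gamma x ≤2*ex (2*(x+4)^q32) := by
  have h1 : Real.Gamma (x+2)=(x+1)*(x*Real.Gamma x) := by rw [← Real.Gamma_add_one lz, ← Real.Gamma_add_one lz]; ring_nf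
  have hG :0<Real.Gamma x := Gamma_pos_of_pos lz
  have h2 : Real.Gamma x ≤2*Real.Gamma (x+2) := by rw [h1]; nlinarith [mul_pos (lz :0<x) hG]
  refine h2.trans (mlm ?_ nz)
  set n := ⌈x+2⌉₊ with hn
  have hn1 : x+2 ≤ n := Nat.le_ceil _
  have hn2 : (n:ℝ)<x+3 := by have := Nat.ceil_lt_add_one (a := x+2) lz; linarith
  have h3 : Real.Gamma (x+2) ≤ Real.Gamma (n+1) :=
    Gamma_strictMonoOn_Ici.monotoneOn slz slz lz
  have hnp : rl0<n := lz
  rw [Real.Gamma_nat_eq_factorial] at h3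
  have h4 : ((n.factorial:ℕ):ℝ) ≤ (n:ℝ)^n := by exact_mod_cast Nat.factorial_le_pow n
  refine h3.trans (h4.trans ?_)
  rw [← rel (pow_pos hnp n), log_pow]
  refine ele.2 ?_
  have h5 : lg n ≤2*(n:ℝ)^(1/2:ℝ) := by
    have := log_le_rpow_div hnp.le (ε :=1/2) nz
    linarith
  have h6 : (n:ℝ)*lg n ≤2*(n:ℝ)^q32 := by
    have : (n:ℝ)^q32=n*(n:ℝ)^(1/2:ℝ) := by rw [← rpow_one_add' hnp.le nz]; norm_num
    rw [this]; nlinarith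
  refine h6.trans (mlm ?_ nz)
  exact rpow_le_rpow hnp.le lz nz

lemma norm_ccos_le (z:ℂ) : ‖Complex.cos z‖ ≤ ex ‖z‖ := by
  rw [Complex.cos, norm_div]
  have h1 : ‖cex (z*Ci)‖ ≤ ex ‖z‖ :=
    (norm_exp_le_exp_norm _).trans sz
  have h2 : ‖cex (-z*Ci)‖ ≤ ex ‖z‖ :=
    (norm_exp_le_exp_norm _).trans sz
  have h3 := nal (cex (z*Ci)) (cex (-z*Ci))
  rw [cno, dli nz]
  linarith

lemma zeta1_one_sub {w:ℂ} (hw :0<w.re) (hw1 : w ≠1) :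
    riemannZeta₁ (1-w) = -w*(2*(2*π)^(-w)*Complex.Gamma w*Complex.cos (π*w/2)*riemannZeta w) := by
  have hw0 : w ≠0 := by rintro rfl; simp at hw
  have h1 : (1-w) ≠1 := by simpa using hw0
  have h := rei h1
  rw [riemannZeta_one_sub (fun n h => by rw [h] at hw; simp at hw; have := ncn (α := ℝ) n; linarith) hw1] at h
  rw [h, show (1-w-1) = -w by ring]
  field_simp

lemma zeta1_growth : ∃ B:ℝ,0 ≤ B ∧ ∀ s:ℂ, ‖riemannZeta₁ s‖ ≤ ex (B*(1 + ‖s-2‖)^q32) := by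
  obtain ⟨K, hK⟩ := (isCompact_closedBall (0:ℂ) (1/2)).exists_bound_of_continuousOn
    ddr.continuous.continuousOn
  refine ⟨|K| +1000, pz, fun s => ?_⟩
  set X :=1 + ‖s-2‖ with hX
  have hX1 :1 ≤ X := by linarith [norm_nonneg (s-2)]
  set Y := X^q32 with hY
  have hXY : X ≤ Y := by
    calc X=X^rl1 := (rpow_one X).symm
      _ ≤ Y := rlr hX1 nz
  have hs2 : ‖s‖ ≤ X+1 := by
    have := nal (s-2) 2
    simp at this; linarith
  have hs1 : ‖s-1‖ ≤ X := by
    have := nal (s-2) 1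
    rw [show s-2+1=s-1 by ring] at this
    simp at this; linarith
  have hXe : X ≤ ex X := by linarith [aol X]
  have hKY :0 ≤ |K| * Y := pz
  have aux : ∀ w:ℂ, ‖w‖ ≤4*X → ‖w-1‖ ≤4*X → 1/2 ≤ w.re → ‖riemannZeta₁ w‖ ≤ ex (10*X) := by
    intro w h1 h2 h3
    refine (zeta1_bound h3).trans ?_
    have e1 : ex (10*X)=ex X*ex X*ex (8*X) := by rw [← rea, ← rea]; ring_nf
    have e2 : (36:ℝ) ≤ ex (8*X) := by
      have : (36:ℝ) ≤ (2.7:ℝ)^8 := nz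
      refine this.trans ?_
      rw [mul_comm, exp_mul]
      have h8 : (2.7:ℝ) ≤ ex X :=
        (by linarith [exp_one_gt_d9] : (2.7:ℝ) ≤ ex 1).trans (ele.2 hX1)
      have := plp nz h8 8
      exact_mod_cast this
    have e3 : X*X ≤ ex X*ex X := by gcongr
    calc ‖w‖ +2 * ‖w‖ * ‖w-1‖ ≤4*X+2*(4*X)*(4*X) := by gcongr
      _ ≤ (X*X)*36 := by nlinarith
      _ ≤ _ := by rw [e1]; gcongr
  by_cases hre :1/2 ≤ s.re
  · refine (aux s lz lz hre).trans (ele.2 ?_)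
    nlinarith
  by_cases hsm : ‖s‖ ≤1/2
  · have h1 := hK s (by simpa using hsm)
    refine h1.trans ?_
    have h2 : |K| +1 ≤ ex |K| := aol _
    have h3 : ex |K| ≤ ex ((|K| +1000)*Y) := ele.2 (by nlinarith [abs_nonneg K])
    linarith [las K]
  push Not at hre hsm
  set w :=1-s with hw
  have hwre :1/2 ≤ w.re := by simp [hw]; linarith
  have hwn : ‖w‖ ≤ X := by rw [hw, norm_sub_rev]; exact hs1
  have hw1 : ‖w-1‖ ≤ X+1 := by rw [hw]; simpa using hs2
  have hw1' :1/2 < ‖w-1‖ := by rw [hw]; simpa using hsm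
  have hwne : w ≠1 := by intro h; rw [h] at hw1'; norm_num at hw1'
  have hsw : s =1-w := by rw [hw]; ring
  rw [hsw, zeta1_one_sub lz hwne, rei hwne]
  simp only [norm_mul, norm_neg, norm_inv, cno]
  have b1 : ‖((2*π:ℂ))^(-w)‖ ≤1 := by
    have : ((2*π:ℂ))=((2*π:ℝ):ℂ) := by push_cast; rfl
    rw [this, nce pz]
    refine rpow_le_one_of_one_le_of_nonpos (by linarith [pi_gt_three]) ?_
    simp; linarith
  have b2 : ‖Complex.Gamma w‖ ≤2*ex (250*Y) := by
    refine (norm_Gamma_le lz).trans ((Gamma_growth hwre).trans ?_)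
    refine mlm (ele.2 ?_) nz
    have hwX : w.re+4 ≤16*X := by have := re_le_norm w; linarith
    have h16 : (16:ℝ)^q32 =64 := by rw [show (16:ℝ) =4^rl2 by norm_num, ← rpow_mul nz]; norm_num
    have : (w.re+4)^q32 ≤64*Y := by
      rw [← h16, hY, ← mul_rpow nz lz]
      exact rpow_le_rpow lz hwX nz
    linarith
  have b3 : ‖Complex.cos (π*w/2)‖ ≤ ex (2*X) := by
    refine (norm_ccos_le _).trans (ele.2 ?_)
    rw [norm_div, norm_mul, norm_real, nea, aop pi_pos, cno]
    have := pi_lt_four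
    have : π * ‖w‖ ≤4*X := by gcongr
    linarith
  have b4 : ‖w-1‖⁻¹ ≤2 := by rw [inv_le_comm₀ lz nz]; linarith
  have b5 := aux w lz lz hwre
  calc ‖w‖ * (2 * ‖((2*π:ℂ))^(-w)‖ * ‖Complex.Gamma w‖ * ‖Complex.cos (π*w/2)‖ * (‖w-1‖⁻¹ * ‖riemannZeta₁ w‖)) ≤ ex X*(2*1*(2*ex (250*Y))*ex (2*X)*(2*ex (10*X))) := by gcongr; linarith
    _ =8*ex (250*Y+13*X) := by
        have :250*Y+13*X=X+(250*Y+(2*X+10*X)) := by ring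
        rw [this, rea X, rea (250*Y), rea (2*X)]; ring
    _ ≤ ex 8*ex (250*Y+13*X) := by gcongr; linarith [aol 8]
    _ ≤ _ := by
        rw [← rea]
        refine ele.2 ?_
        nlinarith

def mz (ρ:ℂ):ℝ := (aord riemannZeta₁ ρ:ℝ)
def mn (ρ:ℂ):ℝ := if 0<ρ.re ∧ ρ.re <1 then mz ρ else 0

lemma mz_nonneg (ρ:ℂ) :0 ≤ mz ρ := ncn _
lemma mn_nonneg (ρ:ℂ) :0 ≤ mn ρ := by unfold mn; split_ifs; exacts [mz_nonneg _, le_rfl]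

lemma zeta1_ne_zero_of_one_le {s:ℂ} (hs :1 ≤ s.re) : riemannZeta₁ s ≠0 := by
  by_cases h1 : s =1
  · rw [h1]; simp
  · have h := rei h1
    have h2 := rnz hs
    intro h0; rw [h0, mul_zero] at h; exact h2 h

lemma zeta1_eq_mul {s:ℂ} (hs : s ≠1) : riemannZeta₁ s=(s-1)*riemannZeta s := by
  rw [rei hs, mul_inv_cancel_left₀ (snz.2 hs)]

lemma zeta1_zero_iff {s:ℂ} (hs : s ≠1) : riemannZeta₁ s =0 ↔ riemannZeta s =0 := by
  rw [zeta1_eq_mul hs]; simp [snz.2 hs]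

lemma zeta1_fin (R:ℝ) : ({z | riemannZeta₁ z =0} ∩ Metric.closedBall 2 R).Finite := by
  refine ((isCompact_closedBall (2:ℂ) R).inter_riemannZetaZeros_finite).subset ?_
  rintro z ⟨h1, h2⟩
  have hz : z ≠1 := by rintro rfl; simp at h1
  exact ⟨h2, (zeta1_zero_iff hz).1 h1⟩

lemma zeta1_order_ne_top (a:ℂ) : analyticOrderAt riemannZeta₁ a ≠ ⊤ :=
  order_ne_top ddr (c :=2) (zeta1_ne_zero_of_one_le sz) a

lemma zetaMult_eq {ρ:ℂ} (hρ : ρ ≠1) : (zetaMult ρ:ℝ) = mz ρ := by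
  unfold mz; congr 1
  have hev : ∀ᶠ z in 𝓝 ρ, z ≠1 := isOpen_ne.mem_nhds hρ
  have hA : AnalyticAt ℂ riemannZeta ρ := by
    refine DifferentiableOn.analyticAt (s := {1}ᶜ) (fun z hz =>
      (differentiableAt_riemannZeta hz).differentiableWithinAt) (isOpen_ne.mem_nhds hρ)
  have hord : analyticOrderAt riemannZeta₁ ρ=analyticOrderAt riemannZeta ρ := by
    have h1 : riemannZeta₁ =ᶠ[𝓝 ρ] (fun z => z-1)*riemannZeta := by
      filter_upwards [hev] with z hz
      exact zeta1_eq_mul hz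
    have hl : AnalyticAt ℂ (fun z:ℂ => z-1) ρ := by fun_prop
    rw [analyticOrderAt_congr h1, analyticOrderAt_mul hl hA, hl.analyticOrderAt_eq_zero.2 (snz.2 hρ), zero_add]
  have h2 : analyticOrderAt riemannZeta ρ=(aord riemannZeta₁ ρ:ℕ) := by rw [← hord]; exact (nca (zeta1_order_ne_top ρ)).symm
  obtain ⟨h3, h4⟩ := (analyticOrderAt_eq_nat_iff_iteratedDeriv_eq_zero hA).1 h2
  refine le_antisymm (Nat.sInf_le h4) ?_
  refine le_csInf ⟨_, h4⟩ fun k hk => ?_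
  by_contra hlt
  exact hk (h3 k (not_le.1 hlt))

lemma zeta1_conj (s:ℂ) : riemannZeta₁ (starRingEnd ℂ s)=starRingEnd ℂ (riemannZeta₁ s) := by
  by_cases h : s =1
  · simp [h]
  · have h' : starRingEnd ℂ s ≠1 := by intro h0; apply h; rw [← conj_conj s, h0]; simp
    rw [zeta1_eq_mul h, zeta1_eq_mul h', riemannZeta_conj]; simp

lemma mz_conj (ρ:ℂ) : mz (starRingEnd ℂ ρ) = mz ρ := by
  unfold mz; congr 1
  obtain ⟨g, hg, hga, hfg⟩ := fac1 ddr (zeta1_order_ne_top ρ)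
  refine ((ddr.analyticAt _).analyticOrderNatAt_eq_iff (zeta1_order_ne_top _)).2 ⟨fun z => starRingEnd ℂ (g (starRingEnd ℂ z)), ?_, by simpa, ?_⟩
  · refine Differentiable.analyticAt (fun z => ?_) _
    exact differentiableAt_conj_conj_iff.2 (hg _)
  · refine Eventually.of_forall fun z => ?_
    have h1 := zeta1_conj (starRingEnd ℂ z)
    rw [conj_conj, hfg (starRingEnd ℂ z)] at h1
    rw [h1]; simp

def feA (w:ℂ):ℂ := -w*(2*(2*π)^(-w)*Complex.Gamma w)

lemma feA_analytic {w:ℂ} (hw :0<w.re) : AnalyticAt ℂ feA w := by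
  refine DifferentiableOn.analyticAt (s := {w:ℂ | 0<w.re}) (fun z hz => ?_) ((isOpen_lt ccc continuous_re).mem_nhds hw)
  have h2 : (2*π:ℂ) ≠0 := by norm_num [pi_ne_zero]
  have h1 : DifferentiableAt ℂ Complex.Gamma z := Complex.differentiableAt_Gamma z (fun n h => by simp [h] at hz; have := ncn (α := ℝ) n; linarith)
  have h3 : DifferentiableAt ℂ (fun w:ℂ => (2*π:ℂ)^(-w)) z :=
    differentiableAt_id.neg.const_cpow (Or.inl h2)
  unfold feA
  exact (differentiableAt_id.neg.mul (((differentiableAt_const _).mul h3).mul h1)).differentiableWithinAt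

lemma feA_ne_zero {w:ℂ} (hw :0<w.re) : feA w ≠0 := by
  have h2 : (2*π:ℂ) ≠0 := by norm_num [pi_ne_zero]
  have h0 : w ≠0 := by rintro rfl; simp at hw
  unfold feA
  have := Gamma_ne_zero_of_re_pos hw
  have h3 : (2*π:ℂ)^(-w) ≠0 := by simp [cpow_eq_zero_iff]
  simp [h0, this, h3]

lemma fe1 {w:ℂ} (hw :0<w.re) (h1 : w ≠1) :
    riemannZeta₁ (1-w)=feA w*Complex.cos (π*w/2)*riemannZeta w := by
  rw [zeta1_one_sub hw h1, feA]; ring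

lemma ccos_ne_zero {w:ℂ} (h : ∀ k : ℤ, w ≠2*k+1) : Complex.cos (π*w/2) ≠0 := by
  intro h0
  obtain ⟨k, hk⟩ := Complex.cos_eq_zero_iff.1 h0
  refine h k ?_
  have hpi : (π:ℂ) ≠0 := by exact_mod_cast pi_ne_zero
  field_simp at hk
  exact hk

lemma order_one_sub (ρ:ℂ) : analyticOrderAt (fun w => riemannZeta₁ (1-w)) (1-ρ)=analyticOrderAt riemannZeta₁ ρ := by
  have hg : AnalyticAt ℂ (fun w:ℂ =>1-w) (1-ρ) := by fun_prop
  have := analyticOrderAt_comp_of_deriv_ne_zero (f := riemannZeta₁) hg (by simp)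
  simp only [sub_sub_cancel] at this
  exact this

lemma mz_one_sub {ρ:ℂ} (h0 :0<ρ.re) (h1 : ρ.re <1) : mz (1-ρ) = mz ρ := by
  unfold mz; congr 1
  have hρ : ρ =1-(1-ρ) := by ring
  have e := order_one_sub (1-ρ)
  rw [← hρ] at e
  unfold analyticOrderNatAt
  rw [← e]
  congr 1
  have hne : ρ ≠1 := by rintro rfl; simp at h1
  have hcos : AnalyticAt ℂ (fun w:ℂ => Complex.cos (π*w/2)) ρ := by fun_prop
  have hinv : AnalyticAt ℂ (fun w:ℂ => (w-1)⁻¹) ρ :=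
    AnalyticAt.inv fz (snz.2 hne)
  have hA := feA_analytic h0
  have hev : (fun w => riemannZeta₁ (1-w)) =ᶠ[𝓝 ρ] (feA*(fun w:ℂ => Complex.cos (π*w/2))*(fun w:ℂ => (w-1)⁻¹))*riemannZeta₁ := by
    have h2 : ∀ᶠ z:ℂ in 𝓝 ρ,0<z.re :=
      (isOpen_lt ccc continuous_re).mem_nhds h0
    filter_upwards [h2, isOpen_ne.mem_nhds hne] with z hz hz1
    rw [fe1 hz hz1, rei hz1]
    simp only [Pi.mul_apply]; ring
  have hP : AnalyticAt ℂ (feA*(fun w:ℂ => Complex.cos (π*w/2))*(fun w:ℂ => (w-1)⁻¹)) ρ := (hA.mul hcos).mul hinv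
  rw [analyticOrderAt_congr hev, analyticOrderAt_mul hP (ddr.analyticAt ρ), hP.analyticOrderAt_eq_zero.2, zero_add]
  simp only [Pi.mul_apply]
  refine mul_ne_zero (mul_ne_zero (feA_ne_zero h0) (ccos_ne_zero ?_)) (inv_ne_zero (snz.2 hne))
  intro k hk
  rw [hk] at h0 h1
  simp at h0 h1
  have h3 : k <0 := by exact_mod_cast (lz : (k:ℝ) <0)
  have h4 : (k:ℝ) ≤ -1 := by exact_mod_cast (by omega : k ≤ -1)
  linarith

lemma mz_triv (k:ℕ) : mz (-2*(k+1)) =1 := by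
  unfold mz
  rw [Nat.cast_eq_one]
  set w0:ℂ :=2*k+3 with hw0
  have hre : w0.re =2*k+3 := by simp [hw0]
  have hw0re :0<w0.re := by rw [hre]; positivity
  have e := order_one_sub (-2*(k+1):ℂ)
  rw [show (1-(-2*((k:ℂ)+1)))=w0 by rw [hw0]; ring] at e
  unfold analyticOrderNatAt
  rw [← e]
  have hne : w0 ≠1 := by intro h; rw [h] at hre; simp at hre; have := ncn (α := ℝ) k; linarith
  have hcos : AnalyticAt ℂ (fun w:ℂ => Complex.cos (π*w/2)) w0 := by fun_prop
  have hZ : AnalyticAt ℂ riemannZeta w0 := DifferentiableOn.analyticAt (s := {1}ᶜ) (fun z hz =>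
      (differentiableAt_riemannZeta hz).differentiableWithinAt) (isOpen_ne.mem_nhds hne)
  have hA := feA_analytic hw0re
  have hev : (fun w => riemannZeta₁ (1-w)) =ᶠ[𝓝 w0] (feA*riemannZeta)*(fun w:ℂ => Complex.cos (π*w/2)) := by
    have h2 : ∀ᶠ z:ℂ in 𝓝 w0,0<z.re :=
      (isOpen_lt ccc continuous_re).mem_nhds hw0re
    filter_upwards [h2, isOpen_ne.mem_nhds hne] with z hz hz1
    rw [fe1 hz hz1]
    simp only [Pi.mul_apply]; ring
  have hzeta : riemannZeta w0 ≠0 := rnz (by rw [hre]; have := ncn (α := ℝ) k; linarith)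
  have hpi : (π:ℂ) ≠0 := by exact_mod_cast pi_ne_zero
  have hcos1 : analyticOrderAt (fun w:ℂ => Complex.cos (π*w/2)) w0 =1 := by
    have hc0 : Complex.cos (π*w0/2) =0 := by
      refine Complex.cos_eq_zero_iff.2 ⟨k+1, ?_⟩
      rw [hw0]; push_cast; ring
    refine hcos.analyticOrderAt_eq_one_of_zero_deriv_ne_zero hc0 ?_
    have hd : HasDerivAt (fun w:ℂ => Complex.cos (π*w/2)) (-Complex.sin (π*w0/2)*(π*1/2)) w0 :=
      (((hhi w0).const_mul (π:ℂ)).div_const 2).ccos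
    rw [hd.deriv]
    refine mul_ne_zero (neg_ne_zero.2 ?_) (by simp [hpi])
    intro hs
    have := Complex.sin_sq_add_cos_sq (π*w0/2)
    rw [hs, hc0] at this; norm_num at this
  rw [analyticOrderAt_congr hev, analyticOrderAt_mul (hA.mul hZ) hcos, hcos1, (hA.mul hZ).analyticOrderAt_eq_zero.2 (mul_ne_zero (feA_ne_zero hw0re) hzeta)]
  simp

lemma mz_cases {ρ:ℂ} (h : mz ρ ≠0) : (0<ρ.re ∧ ρ.re <1) ∨ ∃ k:ℕ, ρ = -2*(k+1) := by
  have hz : riemannZeta₁ ρ =0 := by by_contra h0; exact h (by unfold mz; rw [order_zero_of_ne h0]; simp)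
  have h1 : ρ.re <1 := by by_contra h1; exact zeta1_ne_zero_of_one_le (not_lt.1 h1) hz
  by_cases h0 :0<ρ.re
  · exact Or.inl ⟨h0, h1⟩
  right
  set w :=1-ρ with hw
  have hwre :1 ≤ w.re := by simp [hw]; linarith
  have hρ : ρ =1-w := by rw [hw]; ring
  have hw1 : w ≠1 := by
    intro hw1
    rw [hρ, hw1, sub_self, zeta1_eq_mul nz, riemannZeta_zero] at hz
    norm_num at hz
  rw [hρ, fe1 lz hw1] at hz
  have hzeta := rnz hwre
  have hA := feA_ne_zero (w := w) lz
  have hc : Complex.cos (π*w/2) =0 := by simpa [hzeta, hA] using hz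
  have : ∃ k : ℤ, w =2*k+1 := by by_contra hk; push Not at hk; exact ccos_ne_zero hk hc
  obtain ⟨k, hk⟩ := this
  have hk0 :0<k := by
    have h3 : rl0 ≤ k := by rw [hk] at hwre; simp at hwre; exact_mod_cast hwre
    have h4 : k ≠0 := by rintro rfl; apply hw1; rw [hk]; simp
    have :0 ≤ k := by exact_mod_cast h3
    omega
  refine ⟨(k-1).toNat, ?_⟩
  have : (((k-1).toNat : ℤ):ℂ)=k-1 := by rw [Int.toNat_of_nonneg oz]; push_cast; ring
  rw [hρ, hk]
  have h5 : (((k-1).toNat:ℕ):ℂ)=k-1 := by exact_mod_cast this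
  rw [h5]; ring

lemma pf_hasSum {z z':ℂ} (hz : riemannZeta₁ z ≠0) (hz' : riemannZeta₁ z' ≠0) :
    HasSum (fun ρ => (mz ρ:ℂ)*(1/(z-ρ)-1/(z'-ρ))) (logDeriv riemannZeta₁ z-logDeriv riemannZeta₁ z') := by
  obtain ⟨B, hB, hg⟩ := zeta1_growth
  have := landau_hasSum ddr (zeta1_ne_zero_of_one_le sz) hB hg
    zeta1_fin hz hz'
  simpa [mz] using this

lemma mz_summable : Summable (fun ρ => mz ρ*(1 + ‖ρ-2‖)^m74) := by
  obtain ⟨B, hB, hg⟩ := zeta1_growth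
  exact landau_summable ddr (zeta1_ne_zero_of_one_le sz) hB hg
    zeta1_fin

lemma mn_le_mz (ρ:ℂ) : mn ρ ≤ mz ρ := by
  unfold mn; split_ifs; exacts [le_rfl, mz_nonneg _]

lemma mn_strip {ρ:ℂ} (h : mn ρ ≠0) :0<ρ.re ∧ ρ.re <1 := by
  unfold mn at h; by_contra h0; simp [h0] at h

lemma mn_summable : Summable (fun ρ:ℂ => mn ρ*(1 + |ρ.im|)^m74) := by
  refine son (fun ρ => mul_nonneg (mn_nonneg ρ) pz) (fun ρ => ?_) (mz_summable.mul_left ((3:ℝ)^(7/4:ℝ)))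
  by_cases h : mn ρ =0
  · rw [h, zero_mul]; exact mul_nonneg pz (mul_nonneg (mz_nonneg ρ) pz)
  obtain ⟨h0, h1⟩ := mn_strip h
  have hb : ‖ρ-2‖ ≤2 + |ρ.im| := by
    refine (nla _).trans ?_
    have e1 : (ρ-2).re=ρ.re-2 := by simp
    have e2 : (ρ-2).im=ρ.im := by simp
    rw [e1, e2, abs_of_neg lz]; linarith
  have h3 : (1 + |ρ.im|)^m74 ≤ (3:ℝ)^(7/4:ℝ)*(1 + ‖ρ-2‖)^m74 := by
    have h4 : (3*(1 + |ρ.im|))^m74 ≤ (1 + ‖ρ-2‖)^m74 :=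
      rlo pz (by linarith [abs_nonneg ρ.im]) nz
    rw [mul_rpow nz pz] at h4
    have h5 : (3:ℝ)^(7/4:ℝ)*(3:ℝ)^m74 =1 := by rw [← rpow_add nz]; norm_num
    calc (1 + |ρ.im|)^m74 = (3:ℝ)^(7/4:ℝ)*((3:ℝ)^m74*(1 + |ρ.im|)^m74) := by rw [← mul_assoc, h5, one_mul]
      _ ≤ _ := by gcongr
  calc mn ρ*(1 + |ρ.im|)^m74 ≤ mz ρ*((3:ℝ)^(7/4:ℝ)*(1 + ‖ρ-2‖)^m74) :=
        mmm (mn_le_mz ρ) h3 pz (mz_nonneg ρ)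
    _=_ := by ring

lemma mz_split {φ:ℂ → ℂ} (h : Summable (fun ρ => (mz ρ:ℂ)*φ ρ)) :
    Summable (fun ρ => (mn ρ:ℂ)*φ ρ) ∧ Summable (fun k:ℕ => φ (-2*(k+1))) ∧ ∑' ρ, (mz ρ:ℂ)*φ ρ=∑' ρ, (mn ρ:ℂ)*φ ρ+∑' k:ℕ, φ (-2*(k+1)) := by
  set e:ℕ → ℂ := fun k => -2*(k+1) with he
  have hinj : Function.Injective e := by
    intro a b hab
    simp only [he] at hab
    have : (a:ℂ)=b := by linear_combination (-1/2:ℂ)*hab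
    exact_mod_cast this
  have h1 : Summable (fun ρ => (mn ρ:ℂ)*φ ρ) := by
    have hn := h.norm
    refine Summable.of_norm (son (fun _ => norm_nonneg _) (fun ρ => ?_) hn)
    rw [norm_mul, norm_mul, norm_real, norm_real, non (mn_nonneg ρ), non (mz_nonneg ρ)]
    exact mlo (mn_le_mz ρ) nnz
  have hd : Summable (fun ρ => ((mz ρ - mn ρ:ℝ):ℂ)*φ ρ) := by
    refine (h.sub h1).congr fun ρ => ?_
    push_cast; ring
  have h0 : ∀ ρ ∉ range e, ((mz ρ - mn ρ:ℝ):ℂ)*φ ρ =0 := by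
    intro ρ hρ
    by_cases hm : mz ρ =0
    · have : mn ρ =0 := le_antisymm (hm ▸ mn_le_mz ρ) (mn_nonneg ρ)
      simp [hm, this]
    · rcases mz_cases hm with hs | ⟨k, hk⟩
      · simp [mn, hs]
      · exact absurd ⟨k, hk.symm⟩ hρ
  have hcomp : (fun ρ => ((mz ρ - mn ρ:ℝ):ℂ)*φ ρ) ∘ e=fun k => φ (e k) := by
    ext k
    have hm : mz (e k) =1 := mz_triv k
    have hre : (e k).re ≤0 := by simp [he]; positivity
    have hn : mn (e k) =0 := by simp [mn, not_lt.2 hre]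
    simp [hm, hn]
  have hs := (hinj.hasSum_iff h0).2 hd.hasSum
  rw [hcomp] at hs
  refine ⟨h1, hs.summable, ?_⟩
  rw [hs.tsum_eq, ← h1.tsum_add hd]
  refine tsum_congr fun ρ => ?_
  push_cast; ring

def triv (s:ℂ):ℂ := ∑' k:ℕ, (1/(s - -2*(k+1))-1/(2 - -2*(k+1)))

lemma tele_sum {X:ℝ} (hX :1 ≤ X) (C:ℝ) (hC :0 ≤ C) :
    Summable (fun k:ℕ => C*X/((k+X)*(k+X+1))) ∧ ∑' k:ℕ, C*X/((k+X)*(k+X+1)) ≤ C := by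
  have hnn : ∀ k:ℕ,0 ≤ C*X/((k+X)*(k+X+1)) := fun k => pz
  have hp : ∀ n, ∑ k ∈ Fr n, C*X/((k+X)*(k+X+1)) ≤ C := by
    intro n
    have : ∀ k:ℕ, C*X/((k+X)*(k+X+1))=C*X/(k+X)-C*X/((k+1:ℕ)+X) := by
      intro k
      have h1 : (k:ℝ)+X ≠0 := pz
      have h2 : (k:ℝ)+X+1 ≠0 := pz
      have h3 : (k:ℝ)+1+X ≠0 := pz
      push_cast
      rw [show (k:ℝ)+1+X=k+X+1 by ring]
      field_simp; ring
    simp_rw [this]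
    rw [sum_range_sub' (fun k:ℕ => C*X/(k+X))]
    have :0 ≤ C*X/(n+X) := pz
    have h2 : C*X/((0:ℕ)+X)=C := by
      have : X ≠0 := pz
      simp; field_simp
    linarith
  exact ⟨summable_of_sum_range_le hnn hp, tsum_le_of_sum_range_le hnn hp⟩

lemma triv_den {s:ℂ} (hs : -1/2 ≤ s.re) (k:ℕ) : ((‖s‖ +2)+k)/2 ≤ ‖s - -2*(k+1)‖ := by
  have h0 := norm_nonneg s
  have hk : rl0 ≤ k := ncn k
  refine abs_le_of_sq_le_sq' ?_ nnz |>.2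
  have e1 : ‖s‖ ^2=s.re^2+s.im^2 := by rw [Complex.sq_norm, normSq_apply]; ring
  have e2 : ‖s - -2*(k+1)‖ ^2=(s.re+2*(k+1))^2+s.im^2 := by rw [Complex.sq_norm, normSq_apply]; simp; ring
  rw [e2]
  nlinarith [sq_nonneg (‖s‖ - (2*k+2))]

lemma triv_bound {s:ℂ} (hs : -1/2 ≤ s.re) :
    ‖triv s+(1/2:ℝ)*lg (‖s‖ +2)‖ ≤10 := by
  set X := ‖s‖ +2 with hX
  have hX2 :2 ≤ X := by linarith [norm_nonneg s]
  set N := ⌈X⌉₊ with hN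
  have hN1 : X ≤ N := Nat.le_ceil _
  have hN2 : (N:ℝ)<X+1 := Nat.ceil_lt_add_one lz
  set f:ℕ → ℂ := fun k =>1/(s - -2*(k+1))-1/(2 - -2*(k+1)) with hf
  set g:ℕ → ℂ := fun k => if k<N then 1/(2 - -2*(k+1)) else 0 with hg
  have hfg : ∀ k, ‖f k+g k‖ ≤6*X/((k+X)*(k+X+1)) := by
    intro k
    have hk : rl0 ≤ k := ncn k
    have hden := triv_den hs k
    rw [← hX] at hden
    have hdp :0 < ‖s - -2*(k+1)‖ := lz
    rw [le_div_iff₀ pz]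
    by_cases hkN : k<N
    · have hkX : (k:ℝ)<X := Nat.lt_ceil.1 hkN
      simp only [hf, hg, hkN, if_true, sub_add_cancel, norm_div, norm_one]
      rw [dme, dli hdp, one_mul]
      have : (k+X)*(k+X+1) ≤ (k+X)*(3*X) := by gcongr; linarith
      nlinarith
    · have hkX : X ≤ k := Nat.ceil_le.1 (not_lt.1 hkN)
      have hne1 : s - -2*((k:ℂ)+1) ≠0 := npi.1 hdp
      have hn2 : ‖(2 - -2*((k:ℂ)+1))‖ =2*k+4 := by rw [show (2 - -2*((k:ℂ)+1))=((2*k+4:ℝ):ℂ) by push_cast; ring, norm_real, non pz]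
      have hne2 : (2 - -2*((k:ℂ)+1)) ≠0 := npi.1 (by rw [hn2]; positivity)
      have e : f k+g k=(2-s)/((s - -2*(k+1))*(2 - -2*(k+1))) := by
        simp only [hf, hg, hkN, if_false, add_zero]
        rw [div_sub_div _ _ hne1 hne2]; ring
      have h2s : ‖2-s‖ ≤ X := by
        have := nsl (2:ℂ) s
        simp at this; linarith
      rw [e, norm_div, norm_mul, hn2, dme, dli pz]
      have : (k+X)*(k+X+1) ≤ (2 * ‖s - -2*((k:ℂ)+1)‖)*(2*k+4) := by gcongr <;> linarith
      calc ‖2-s‖ * ((k+X)*(k+X+1)) ≤ X*((2 * ‖s - -2*((k:ℂ)+1)‖)*(2*k+4)) := by gcongr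
        _ =2*X*(‖s - -2*((k:ℂ)+1)‖ * (2*k+4)) := by ring
        _ ≤ _ := by gcongr; norm_num
  obtain ⟨ht1, ht2⟩ := tele_sum (X := X) lz 6 nz
  have hsum : Summable (fun k => f k+g k) := sob ht1 hfg
  have hgs : Summable g := by
    refine summable_of_finite_support ((Fr N).finite_toSet.subset fun k hk => ?_)
    by_contra h
    exact hk (by simp [hg] at h ⊢; omega)
  have hgt : ∑' k, g k=((1/2*((harmonic (N+1) : ℚ)-1):ℝ):ℂ) := by
    rw [tsum_eq_sum (s := Fr N) (fun k hk => by simp [hg] at hk ⊢; omega)]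
    rw [harmonic, sum_range_succ']
    push_cast
    have : ∀ k ∈ Fr N, g k =1/2*(((k:ℂ)+1+1))⁻¹ := by
      intro k hk
      simp only [hg, fmr.1 hk, if_true]
      have : (k:ℂ)+1+1 ≠0 := by norm_cast
      rw [show (2 - -2*((k:ℂ)+1)) =2*(k+1+1) by ring]
      field_simp
    rw [sum_congr rfl this, ← mul_sum]
    simp
  have hfs : Summable f := by refine (hsum.sub hgs).congr fun k => by ring
  have htr : triv s=∑' k, (f k+g k)-∑' k, g k := by rw [hfs.tsum_add hgs, triv]; ring
  have hb : ‖∑' k, (f k+g k)‖ ≤6 := (ton ht1.hasSum hfg).trans ht2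
  have hh1 := log_add_one_le_harmonic (N+1)
  have hh2 := hlo (N+1)
  have hl1 : lg X ≤ lg ((N+1+1:ℕ):ℝ) :=
    lll lz (by push_cast; linarith)
  have hl2 : lg ((N+1:ℕ)) ≤ lg X+1 := by
    have : lg (N+1:ℕ) ≤ lg (2*X) :=
      lll pz (by push_cast; linarith)
    rw [rlm nz lz] at this
    linarith [ltl]
  rw [htr, hgt]
  have e : ∑' k, (f k+g k)-((1/2*((harmonic (N+1) : ℚ)-1):ℝ):ℂ)+((1/2:ℝ):ℂ)*(lg X:ℂ)=∑' k, (f k+g k)+((1/2*(lg X-(harmonic (N+1) : ℚ)+1):ℝ):ℂ) := by push_cast; ring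
  rw [e]
  refine (nal _ _).trans ?_
  rw [norm_real, nea]
  have : |1/2*(lg X-(harmonic (N+1) : ℚ)+1)| ≤1 := by rw [abs_le]; constructor <;> linarith
  linarith

lemma pf_split {s:ℂ} (hs : riemannZeta₁ s ≠0) :
    Summable (fun ρ => (mn ρ:ℂ)*(1/(s-ρ)-1/(2-ρ))) ∧ logDeriv riemannZeta₁ s-logDeriv riemannZeta₁ 2=∑' ρ, (mn ρ:ℂ)*(1/(s-ρ)-1/(2-ρ))+triv s := by
  have h := pf_hasSum hs (z' :=2) (zeta1_ne_zero_of_one_le sz)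
  obtain ⟨h1, _, h3⟩ := mz_split (φ := fun ρ =>1/(s-ρ)-1/(2-ρ)) h.summable
  refine ⟨h1, ?_⟩
  rw [← h.tsum_eq, h3]; rfl

def LL (s:ℂ):ℂ := logDeriv riemannZeta₁ s-1/(s-1)

lemma LL_eq {s:ℂ} (hs :1<s.re) :
    LL s = -LSeries (fun n => (vm n:ℂ)) s := by
  have h1 : s ≠1 := by rintro rfl; simp at hs
  have h2 := ArithmeticFunction.LSeries_vonMangoldt_eq_deriv_riemannZeta_div hs
  rw [h2, LL]
  have hz : riemannZeta s ≠0 := rnz hs.le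
  have hs1 : s-1 ≠0 := snz.2 h1
  have hev : riemannZeta₁ =ᶠ[𝓝 s] fun z => (z-1)*riemannZeta z := by
    filter_upwards [isOpen_ne.mem_nhds h1] with z hz
    exact zeta1_eq_mul hz
  have hd : HasDerivAt (fun z => (z-1)*riemannZeta z) (1*riemannZeta s+(s-1)*deriv riemannZeta s) s :=
    ((hhi s).sub_const 1).mul (differentiableAt_riemannZeta h1).hasDerivAt
  rw [logDeriv_apply, hev.deriv_eq, hd.deriv, zeta1_eq_mul h1]
  field_simp
  ring

lemma LL_norm_le {s:ℂ} (hs :1<s.re) : ‖LL s‖ ≤ (-LL (s.re:ℂ)).re := by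
  have h1 :1<((s.re:ℝ):ℂ).re := by simpa using hs
  rw [LL_eq hs, LL_eq h1, norm_neg, neg_neg, LSeries, LSeries]
  have hS := alv h1
  have hS' : Summable (fun n => LSeries.term (fun n => (vm n:ℂ)) ((s.re:ℝ):ℂ) n) := hS
  rw [re_tsum hS']
  have hS2 := (hasSum_re hS'.hasSum).summable
  refine ton hS2.hasSum fun n => ?_
  rcases nez n with rfl | hn
  · simp
  · rw [lto hn.ne', lto hn.ne', norm_div, norm_natCast_cpow_of_pos hn]
    have : ((n:ℂ)^((s.re:ℝ):ℂ))=(((n:ℝ)^s.re:ℝ):ℂ) := by rw [ofReal_cpow (ncn n)]; simp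
    rw [this, ← ofReal_div, ofReal_re, norm_real, non avn]

def pk (h t:ℝ) (ρ:ℂ):ℝ :=
  (h+(1-ρ.re))/((h+(1-ρ.re))^2+(ρ.im-t)^2)

lemma pk_eq (h t:ℝ) (ρ:ℂ) : pk h t ρ=(1/((⟨1+h, t⟩:ℂ)-ρ)).re := by
  rw [one_div, inv_re, normSq_apply, pk]
  simp only [sub_re, sub_im]
  congr 1 <;> ring

lemma mul_mn_le {ρ:ℂ} {a b:ℝ} (h :0<ρ.re → ρ.re <1 → a ≤ b) :
    mn ρ*a ≤ mn ρ*b := by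
  by_cases h0 : mn ρ =0
  · simp [h0]
  · exact mlm (h (mn_strip h0).1 (mn_strip h0).2) (mn_nonneg ρ)

lemma mn_mul_nonneg {ρ:ℂ} {a:ℝ} (h :0<ρ.re → ρ.re <1 → 0 ≤ a) :
    0 ≤ mn ρ*a := by
  have := mul_mn_le (ρ := ρ) (a :=0) (b := a) h
  simpa using this

lemma pk_nonneg {h t:ℝ} {ρ:ℂ} (hh :0 ≤ h) (h1 : ρ.re <1) :0 ≤ pk h t ρ := by
  unfold pk
  have :0 ≤ h+(1-ρ.re) := lz
  positivity

lemma rpow_74_le {a:ℝ} : (1+a^2)⁻¹ ≤2*(1 + |a|)^m74 := by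
  have h1 : rl1 ≤1 + |a| := by linarith [abs_nonneg a]
  have h2 : (1 + |a|)^(-rl2) ≤ (1 + |a|)^m74 :=
    rlr h1 nz
  have h3 : (1 + |a|)^(-rl2)=((1 + |a|)^2)⁻¹ := by rw [rpow_neg lz]; norm_num
  have h4 : (1+a^2)⁻¹ ≤2*((1 + |a|)^2)⁻¹ := by
    rw [← one_div, ← dem, dld pz pz]
    nlinarith [sq_nonneg (1 - |a|), sq_abs a]
  rw [h3] at h2
  linarith

lemma mn_summable2 : Summable (fun ρ => mn ρ*(1+ρ.im^2)⁻¹) := by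
  refine son (fun ρ => mul_nonneg (mn_nonneg _) pz) (fun ρ => ?_) (mn_summable.mul_left 2)
  have := mlm (rpow_74_le (a := ρ.im)) (mn_nonneg ρ)
  linarith

lemma zs_key : ∃ c:ℝ, ∀ h >0, ∀ t:ℝ, Summable (fun ρ => mn ρ*pk h t ρ) ∧ ∑' ρ, mn ρ*pk h t ρ=(LL ⟨1+h, t⟩).re+(1/((⟨1+h, t⟩:ℂ)-1)).re+c - (triv ⟨1+h, t⟩).re := by
  have hS1 : Summable (fun ρ => mn ρ*pk 1 0 ρ) := by
    refine son (fun ρ => mn_mul_nonneg fun _ h1 => pk_nonneg nz h1) (fun ρ => ?_) (mn_summable2.mul_left 2)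
    have : mn ρ*pk 1 0 ρ ≤ mn ρ*(2*(1+ρ.im^2)⁻¹) := mul_mn_le fun h0 h1 => by
      rw [pk, ← dem, sub_zero]
      exact div_le_div₀ nz lz pz nlz
    linarith
  set K := ∑' ρ, mn ρ*pk 1 0 ρ with hK
  set c := (logDeriv riemannZeta₁ 2).re with hc
  refine ⟨-c+K, ?_⟩
  · intro h hh t
    have hs : riemannZeta₁ ⟨1+h, t⟩ ≠0 := zeta1_ne_zero_of_one_le (by simp [hh.le])
    obtain ⟨h1, h2⟩ := pf_split hs
    have h3 := hasSum_re h1.hasSum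
    have h4 : (fun ρ => ((mn ρ:ℂ)*(1/((⟨1+h, t⟩:ℂ)-ρ)-1/(2-ρ))).re)=fun ρ => mn ρ*pk h t ρ - mn ρ*pk 1 0 ρ := by
      funext ρ
      have e2 : ((⟨1+1,0⟩:ℂ)) =2 := by apply Complex.ext <;> simp; norm_num
      rw [re_ofReal_mul, sub_re, pk_eq, pk_eq, e2]; ring
    rw [h4] at h3
    have h5 := h3.add hS1.hasSum
    simp only [sub_add_cancel] at h5
    refine ⟨h5.summable, ?_⟩
    rw [h5.tsum_eq]
    have := congrArg re h2
    rw [add_re, sub_re] at this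
    rw [LL, sub_re]
    linarith

lemma LL_real : ∃ c:ℝ, ∀ h >0, (-LL ((1+h:ℝ):ℂ)).re ≤1/h+(|c| +10+lg (h+3)) := by
  obtain ⟨c, key⟩ := zs_key
  refine ⟨c, ?_⟩
  · intro h hh
    obtain ⟨_, h2⟩ := key h hh 0
    have h0 :0 ≤ ∑' ρ, mn ρ*pk h 0 ρ :=
      tsum_nonneg fun ρ => mn_mul_nonneg fun _ h1 => pk_nonneg hh.le h1
    have e : (⟨1+h,0⟩:ℂ)=((1+h:ℝ):ℂ) := rfl
    rw [e] at h2
    have e2 : (1/(((1+h:ℝ):ℂ)-1)).re =1/h := by rw [show ((1+h:ℝ):ℂ)-1=(h:ℂ) by push_cast; ring, ← ofReal_one, ← ofReal_div, ofReal_re]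
    have h3 := triv_bound (s := ((1+h:ℝ):ℂ)) (by rw [ofReal_re]; linarith)
    have h4 := (arl _).trans h3
    rw [add_re, re_ofReal_mul, ofReal_re, norm_real, non lz] at h4
    have h5 :0 ≤ lg (h+3) := log_nonneg lz
    rw [show 1+h+2=h+3 by ring] at h4
    rw [e2] at h2
    rw [neg_re]
    have := abs_le.1 h4
    linarith [las c]

lemma zero_sum_bound : ∃ C >0, ∀ h >0, ∀ t:ℝ, Summable (fun ρ => mn ρ*pk h t ρ) ∧ ∑' ρ, mn ρ*pk h t ρ ≤ C*(1/h+lg (|t| + h+2)) := by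
  obtain ⟨c, key⟩ := zs_key
  obtain ⟨K, hLr⟩ := LL_real
  refine ⟨10*(2 * |c| +2 * |K| +30), pz, fun h hh t => ?_⟩
  obtain ⟨h1, h2⟩ := key h hh t
  refine ⟨h1, ?_⟩
  rw [h2]
  have hm : (LL ⟨1+h, t⟩).re ≤ _ :=
    (re_le_norm _).trans (LL_norm_le (s := ⟨1+h, t⟩) (by simpa using hh))
  have hr := hLr h hh
  have e1 : (1/((⟨1+h, t⟩:ℂ)-1)).re ≤1/h := by
    refine (re_le_norm _).trans ?_
    rw [norm_div, norm_one]
    refine odl hh ?_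
    refine le_trans ?_ (re_le_norm _)
    simp
  have h3 := triv_bound (s := ⟨1+h, t⟩) slz
  have h4 := (arl _).trans h3
  rw [add_re, re_ofReal_mul, ofReal_re] at h4
  have hn : ‖(⟨1+h, t⟩:ℂ)‖ ≤1+h + |t| := by
    refine (nla _).trans ?_
    simp [aop (show 0 <1+h by linarith)]
  set M := |t| + h+2 with hM
  have ht := abs_nonneg t
  have hM2 : (1/2:ℝ) ≤ lg M := by
    have : lg 2 ≤ lg M := lll nz lz
    linarith [ltg]
  have hl1 : lg (‖(⟨1+h, t⟩:ℂ)‖ +2) ≤ lg M+1 := by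
    have : lg (‖(⟨1+h, t⟩:ℂ)‖ +2) ≤ lg (2 * M) :=
      lll pz lz
    rw [rlm nz lz] at this
    linarith [ltl]
  have hl2 : lg (h+3) ≤ lg M+1 := by
    have : lg (h+3) ≤ lg (2 * M) :=
      lll pz lz
    rw [rlm nz lz] at this
    linarith [ltl]
  have hh' :0 <1/h := pz
  have := abs_le.1 h4
  have hA :0 ≤2 * |c| +2 * |K| := pz
  have hB :2 * |c| +2 * |K| ≤ (2 * |c| +2 * |K|)*(10*(1/h+lg M)) := by nlinarith
  calc _ ≤2/h+(2 * |c| +2 * |K| +22+2*lg M) := by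
        have :2/h =1/h+1/h := by ring
        linarith [las c, abs_nonneg c, abs_nonneg K]
    _ ≤ _ := by
        have :2/h =2*(1/h) := by ring
        nlinarith

lemma log_two_le {t:ℝ} (ht :2 ≤ t) : (1/2:ℝ) ≤ lg t := by
  have : lg 2 ≤ lg t := lll nz ht
  linarith [ltg]

lemma zs_H : ∃ C >0, ∀ H ≥ rl1, ∀ t:ℝ, Summable (fun ρ => mn ρ*(H^2+(ρ.im-t)^2)⁻¹) ∧ ∑' ρ, mn ρ*(H^2+(ρ.im-t)^2)⁻¹ ≤ C*lg (|t| + H+2)/H := by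
  obtain ⟨C, hC, h⟩ := zero_sum_bound
  refine ⟨12*C, pz, fun H hH t => ?_⟩
  obtain ⟨h1, h2⟩ := h H lz t
  have hb : ∀ ρ, mn ρ*(H^2+(ρ.im-t)^2)⁻¹ ≤4/H*(mn ρ*pk H t ρ) := by
    intro ρ
    rw [show 4/H*(mn ρ*pk H t ρ) = mn ρ*(4/H*pk H t ρ) by ring]
    refine mul_mn_le fun h0 h1 => ?_
    rw [pk, div_mul_div_comm, ← one_div, dld pz pz]
    have :0 ≤ (ρ.im-t)^2 := sq_nonneg _
    have hd :0 ≤ H*(H-(1-ρ.re)) := mul_nonneg lz lz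
    have he :0 ≤ H+(1-ρ.re) := lz
    nlinarith [mul_nonneg (lz :0 ≤1-ρ.re) this, mul_nonneg (lz :0 ≤ H) this, mul_nonneg he hd, mul_nonneg he (sq_nonneg H)]
  have hs := son (fun ρ => mul_nonneg (mn_nonneg _) pz) hb (h1.mul_left (4/H))
  refine ⟨hs, (hs.tsum_le_tsum hb (h1.mul_left _)).trans ?_⟩
  rw [tml]
  have hl := log_two_le (t := |t| + H+2) (by linarith [abs_nonneg t])
  have :1/H ≤1 := by rw [div_le_one lz]; exact hH
  calc _ ≤4/H*(C*(3*lg (|t| + H+2))) := by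
        gcongr
        refine h2.trans ?_
        gcongr; linarith
    _=_ := by ring

lemma mn_one_le {ρ:ℂ} (h : mn ρ ≠0) :1 ≤ mn ρ := by
  have := mn_strip h
  unfold mn mz at *
  rw [if_pos this] at *
  exact_mod_cast Nat.one_le_iff_ne_zero.2 (by exact_mod_cast h)

lemma mn_zero {ρ:ℂ} (h : mn ρ ≠0) : riemannZeta₁ ρ =0 := by
  by_contra h0
  have := order_zero_of_ne h0
  unfold mn mz at h
  simp [this] at h

lemma three_four_one {h t:ℝ} (hh :0<h) :
    3*(LL ((1+h:ℝ):ℂ)).re+4*(LL ⟨1+h, t⟩).re+(LL ⟨1+h,2*t⟩).re ≤0 := by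
  have hs : ∀ t:ℝ, LSeriesSummable (fun n => (vm n:ℂ)) ⟨1+h, t⟩ :=
    fun t => alv (by simpa using hh)
  have H : ∀ t:ℝ, HasSum (fun n => (LSeries.term (fun n => (vm n:ℂ)) ⟨1+h, t⟩ n).re) (-(LL ⟨1+h, t⟩).re) := by
    intro t
    rw [LL_eq (by simpa using hh), neg_re, neg_neg]
    exact hasSum_re (hs t).hasSum
  have e : ((1+h:ℝ):ℂ)=⟨1+h,0⟩ := rfl
  rw [e]
  have := (((H 0).mul_left 3).add ((H t).mul_left 4)).add (H (2*t))
  have h2 := this.nonneg (fun n => ?_)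
  · linarith
  rcases nez n with rfl | hn
  · simp
  have hn0 : (n:ℂ) ≠0 := by exact_mod_cast hn.ne'
  have ht : ∀ t:ℝ, LSeries.term (fun n => (vm n:ℂ)) ⟨1+h, t⟩ n=((vm n*(n:ℝ)^(-(1+h)):ℝ):ℂ)*(n:ℂ)^(-(t*Ci)) := by
    intro t
    rw [lto hn.ne', dem, ← cpow_neg]
    push_cast
    rw [ofReal_cpow (ncn n), mul_assoc, ofReal_natCast, ← cpow_add _ _ hn0]
    congr 2
    apply Complex.ext <;> simp
  simp only [ht, re_ofReal_mul]
  have hu : (n:ℂ)^(-(((2*t:ℝ):ℂ)*Ci))=((n:ℂ)^(-((t:ℂ)*Ci)))^2 := by rw [← cpow_nat_mul]; congr 1; push_cast; ring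
  rw [hu]
  have hv : ‖(n:ℂ)^(-((t:ℂ)*Ci))‖ =1 := by rw [norm_natCast_cpow_of_pos hn]; simp
  set u := (n:ℂ)^(-((t:ℂ)*Ci))
  have hu1 : u.re^2+u.im^2 =1 := by
    have := Complex.sq_norm u
    rw [hv, normSq_apply] at this; nlinarith
  have hu2 : (u^2).re=u.re^2-u.im^2 := by simp [pow_two]
  rw [hu2]
  simp only [ofReal_zero, zero_mul, neg_zero, cpow_zero, one_re]
  have hA :0 ≤ vm n*(n:ℝ)^(-(1+h)) :=
    mul_nonneg avn pz
  set A := vm n*(n:ℝ)^(-(1+h))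
  have :3*(A*1)+4*(A*u.re)+A*(u.re^2-u.im^2)=A*(2*(1+u.re)^2) := by
    linear_combination (-A)*hu1
  rw [this]; positivity

lemma zero_free : ∃ c >0, ∀ ρ, mn ρ ≠0 → c ≤ (1-ρ.re)*lg (|ρ.im| +2) := by
  obtain ⟨c1, hc1, h1⟩ : ∃ c >0, ∀ ρ, mn ρ ≠0 → |ρ.im| ≤1 → c ≤1-ρ.re := by
    set F := (zeta1_fin 4).toFinset
    rcases (F.filter (fun ρ => ρ.re <1)).eq_empty_or_nonempty with h0 | h0
    all_goals
      have hmem : ∀ ρ, mn ρ ≠0 → |ρ.im| ≤1 → ρ ∈ F.filter (fun ρ => ρ.re <1) := by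
        intro ρ hρ hi
        obtain ⟨a, b⟩ := mn_strip hρ
        refine mem_filter.2 ⟨(zeta1_fin 4).mem_toFinset.2 ⟨mn_zero hρ, ?_⟩, b⟩
        rw [Metric.mem_closedBall, den]
        refine (nla _).trans ?_
        simp only [sub_re, re_ofNat, sub_im, im_ofNat, sub_zero]
        have : |ρ.re-2| ≤2 := by rw [abs_le]; constructor <;> linarith
        linarith
    · refine ⟨1, one_pos, fun ρ h h' => ?_⟩
      have := hmem ρ h h'
      rw [h0] at this; simp at this
    · obtain ⟨r, hr, hm⟩ := Finset.exists_min_image _ (fun ρ:ℂ =>1-ρ.re) h0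
      refine ⟨1-r.re, by linarith [(mem_filter.1 hr).2], fun ρ h h' => hm ρ (hmem ρ h h')⟩
  obtain ⟨c, key⟩ := zs_key
  obtain ⟨K, hK⟩ := LL_real
  have hlow : ∀ h >0, h ≤6 → ∀ t:ℝ,1 ≤ |t| → ∑' ρ, mn ρ*pk h t ρ-(|c| +30)*(2*lt2 t) ≤ (LL ⟨1+h, t⟩).re := by
    intro h hh h6 t ht
    obtain ⟨_, h2⟩ := key h hh t
    have e1 : (1/((⟨1+h, t⟩:ℂ)-1)).re ≤1 := by
      refine (re_le_norm _).trans ?_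
      rw [norm_div, norm_one]
      rw [div_le_one (by
        rw [npi, snz]
        intro hh'; have := congrArg re hh'; simp at this; linarith)]
      refine ht.trans ((ail ((⟨1+h, t⟩:ℂ)-1)).trans' ?_)
      simp
    have h3 := triv_bound (s := ⟨1+h, t⟩) slz
    have h4 := abs_le.1 ((arl _).trans h3)
    rw [add_re, re_ofReal_mul, ofReal_re] at h4
    have hn : ‖(⟨1+h, t⟩:ℂ)‖ ≤1+h + |t| := by
      refine (nla _).trans ?_
      simp [aop (show 0 <1+h by linarith)]
    have hl := log_two_le (t := |t| +2) lz
    have hl1 : lg (‖(⟨1+h, t⟩:ℂ)‖ +2) ≤ lt2 t+3 := by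
      have : lg (‖(⟨1+h, t⟩:ℂ)‖ +2) ≤ lg (2^2*(|t| +2)) :=
        lll pz lz
      rw [rlm nz lz, log_pow] at this
      push_cast at this
      linarith [ltl]
    nlinarith [las c, abs_nonneg c]
  set M :=1000*(|c| + |K| +30) with hM
  have hMp :0 < M := pz
  refine ⟨min (c1/2) (1 / M), pz, fun ρ hρ => ?_⟩
  have hl := log_two_le (t := |ρ.im| +2) (by linarith [abs_nonneg ρ.im])
  by_cases hi : |ρ.im| ≤1
  · have := h1 ρ hρ hi
    refine (min_le_left _ _).trans ?_
    nlinarith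
  push Not at hi
  refine (min_le_right _ _).trans ?_
  obtain ⟨hb0, hb1⟩ := mn_strip hρ
  set δ :=1-ρ.re with hδ
  have hδ0 :0<δ := lz
  have hδ1 : δ <1 := lz
  have ht := three_four_one (h :=6*δ) (t := ρ.im) lz
  have hk := hK (6*δ) lz
  rw [neg_re] at hk
  have ha := hlow (6*δ) lz lz ρ.im hi.le
  have hb := hlow (6*δ) lz lz (2*ρ.im) (by rw [abs_mul, abs_two]; linarith)
  have h0 : ∀ t, ∀ ρ,0 ≤ mn ρ*pk (6*δ) t ρ := fun t ρ =>
    mn_mul_nonneg fun _ h => pk_nonneg lz h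
  have hb2 :0 ≤ ∑' ρ', mn ρ'*pk (6*δ) (2*ρ.im) ρ' := tsum_nonneg (h0 _)
  have ha2 :1/(7*δ) ≤ ∑' ρ', mn ρ'*pk (6*δ) ρ.im ρ' := by
    refine le_trans ?_ ((key (6*δ) lz ρ.im).1.le_tsum ρ fun j _ => h0 _ j)
    have : pk (6*δ) ρ.im ρ =1/(7*δ) := by rw [pk, sub_self, ← hδ]; field_simp; ring
    rw [this]
    have := mn_one_le hρ
    exact lml pz this
  have hl2 : lg (|2*ρ.im| +2) ≤ lg (|ρ.im| +2)+1 := by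
    have : lg (|2*ρ.im| +2) ≤ lg (2*(|ρ.im| +2)) :=
      lll pz (by rw [abs_mul, abs_two]; linarith)
    rw [rlm nz pz] at this
    linarith [ltl]
  have hl3 : lg (6*δ+3) ≤9 := by have := lls (show 0 <6*δ+3 by linarith); linarith
  set ℓ := lg (|ρ.im| +2) with hℓ
  set X :=1/δ with hX
  have e1 :1/(7*δ)=X/7 := by rw [hX]; field_simp
  have e2 :1/(6*δ)=X/6 := by rw [hX]; field_simp
  rw [e1] at ha2; rw [e2] at hk
  have hc0 := abs_nonneg c
  have hK0 := abs_nonneg K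
  have hfin : X ≤ M*ℓ := by
    have h1 : (|c| +30)*(2*lg (|2*ρ.im| +2)) ≤ (|c| +30)*(2*(ℓ+1)) := by gcongr
    nlinarith
  rw [dli hMp]
  rw [hX, dli hδ0] at hfin
  linarith

lemma mn_star (ρ:ℂ) : mn (1-cj ρ) = mn ρ := by
  unfold mn
  have e : (1-cj ρ).re =1-ρ.re := by simp
  rw [e]
  by_cases h :0<ρ.re ∧ ρ.re <1
  · rw [if_pos h, if_pos ⟨lz, lz⟩, mz_one_sub (by simpa using h.1) (by simpa using h.2), mz_conj]
  · rw [if_neg h, if_neg (fun h' => h ⟨lz, lz⟩)]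

def starE:ℂ ≃ ℂ where
  toFun ρ :=1-cj ρ
  invFun ρ :=1-cj ρ
  left_inv ρ := by simp
  right_inv ρ := by simp

lemma LL_left : ∃ C >0, ∀ t:ℝ, riemannZeta₁ ⟨-1/2, t⟩ ≠0 ∧ ‖LL ⟨-1/2, t⟩+(lt2 t:ℝ)‖ ≤ C := by
  have hS : Summable (fun ρ => (mn ρ:ℂ)*(1/(2-ρ)+1/(1+ρ))) := by
    refine sob (mn_summable2.mul_left 3) fun ρ => ?_
    rw [norm_mul, norm_real, non (mn_nonneg _), show 3*(mn ρ*(1+ρ.im^2)⁻¹) = mn ρ*(3*(1+ρ.im^2)⁻¹) by ring]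
    refine mul_mn_le fun h0 h1 => ?_
    have a1 : (2-ρ) ≠0 := fun h => by have := congrArg re h; simp at this; linarith
    have a2 : (1+ρ) ≠0 := fun h => by have := congrArg re h; simp at this; linarith
    have e :1/(2-ρ)+1/(1+ρ) =3/((2-ρ)*(1+ρ)) := by field_simp; ring
    rw [e, norm_div, norm_mul, dem]
    have hb : ∀ z:ℂ,1 ≤ z.re → z.im^2=ρ.im^2 → √(1+ρ.im^2) ≤ ‖z‖ := by
      intro z h h'
      rw [norm_eq_sqrt_sq_add_sq]
      apply sqrt_le_sqrt; nlinarith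
    have b1 := hb (2-ρ) slz sz
    have b2 := hb (1+ρ) slz sz
    have :1+ρ.im^2 ≤ ‖2-ρ‖ * ‖1+ρ‖ := by
      calc _=√(1+ρ.im^2)*√(1+ρ.im^2) := (mul_self_sqrt pz).symm
        _ ≤ _ := by gcongr
    simp only [cno]
    gcongr
  set K := ∑' ρ, (mn ρ:ℂ)*(1/(2-ρ)+1/(1+ρ)) with hK
  set c := logDeriv riemannZeta₁ 2 with hc
  set B := (-LL (q32:ℂ)).re with hB
  refine ⟨2 * ‖c‖ + ‖K‖ + |B| +60, pz, fun t => ?_⟩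
  have hz : riemannZeta₁ ⟨-1/2, t⟩ ≠0 := by
    intro h0
    have h1 : mz ⟨-1/2, t⟩ ≠0 := by
      have := zeta1_order_ne_top ⟨-1/2, t⟩
      intro h2
      unfold mz at h2
      have h3 : aord riemannZeta₁ ⟨-1/2, t⟩ =0 := by exact_mod_cast h2
      have h4 := (ddr.analyticAt ⟨-1/2, t⟩).analyticOrderAt_eq_zero.not_left.2 (by simpa using h0)
      apply h4
      rw [← nca this, h3]; rfl
    rcases mz_cases h1 with h | ⟨k, hk⟩
    · have := h.1; norm_num at this
    · have := congrArg re hk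
      simp at this
      have hk0 : rl0 ≤ k := ncn k
      linarith
  refine ⟨hz, ?_⟩
  set s:ℂ := ⟨-1/2, t⟩ with hs
  set s':ℂ := ⟨3/2, t⟩ with hs'
  have hz' : riemannZeta₁ s' ≠0 := zeta1_ne_zero_of_one_le (by rw [hs']; norm_num)
  obtain ⟨hA, hA2⟩ := pf_split hz
  obtain ⟨hB1, hB2⟩ := pf_split hz'
  have hre : ∑' ρ, (mn ρ:ℂ)*(1/(s-ρ)-1/(2-ρ)) = -cj (∑' ρ, (mn ρ:ℂ)*(1/(s'-ρ)-1/(2-ρ))+K) := by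
    rw [← starE.tsum_eq, hK, ← hB1.tsum_add hS, conj_tsum, ← tsum_neg]
    refine tsum_congr fun ρ => ?_
    have e1 : s-(1-cj ρ) = -cj (s'-ρ) := by apply Complex.ext <;> simp [hs, hs'] <;> ring
    have e2 :2-(1-cj ρ)=cj (1+ρ) := by simp; ring
    change (mn (1-cj ρ):ℂ)*(1/(s-(1-cj ρ))-1/(2-(1-cj ρ)))=_
    rw [mn_star, e1, e2, ← mul_add, map_mul, conj_ofReal, odn, ← mul_neg]
    congr 1
    have e3 : (1/(s'-ρ)-1/(2-ρ)+(1/(2-ρ)+1/(1+ρ)):ℂ)=1/(s'-ρ)+1/(1+ρ) := by ring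
    rw [e3]
    simp only [map_add, map_sub, map_div₀, map_one]
    ring
  have hl : ∀ z:ℂ, z.im=t → |z.re| ≤2 → |lg (‖z‖ +2)-lt2 t| ≤2 := by
    intro z h1 h2
    have h3 : ‖z‖ ≤2 + |t| := (nla z).trans (by rw [h1]; linarith)
    have h4 : |t| ≤ ‖z‖ := h1 ▸ ail z
    have ht := abs_nonneg t
    have h5 : lg (‖z‖ +2) ≤ lg (2*(|t| +2)) :=
      lll pz lz
    have h6 : lt2 t ≤ lg (‖z‖ +2) :=
      lll pz lz
    rw [rlm nz pz] at h5
    rw [abs_le]; constructor <;> linarith [ltl]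
  have hl1 := hl s rfl (by rw [hs]; norm_num [abs_le])
  have hl2 := hl s' rfl (by rw [hs']; norm_num [abs_le])
  have t1 := triv_bound (s := s) (by rw [hs])
  have t2 := triv_bound (s := s') (by rw [hs']; norm_num)
  have L1 : ‖LL s'‖ ≤ |B| := (LL_norm_le (s := s') (by rw [hs']; norm_num)).trans (las _)
  have n1 : ‖1/(s'-1)‖ ≤2 := by
    rw [norm_div, norm_one, dli (npi.2 ?_)]
    · have := arl (s'-1)
      have e : (s'-1).re =1/2 := by simp [hs']; norm_num
      rw [e, aop nz] at this; linarith
    · intro h; have := congrArg re h; simp [hs'] at this; norm_num at this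
  have n2 : ‖1/(s-1)‖ ≤2 := by
    rw [norm_div, norm_one, dli (npi.2 ?_)]
    · have := arl (s-1)
      have e : (s-1).re = -(3/2) := by simp [hs]; norm_num
      rw [e, abs_neg, aop nz] at this; linarith
    · intro h; have := congrArg re h; simp [hs] at this; norm_num at this
  have hS' : ∑' ρ, (mn ρ:ℂ)*(1/(s'-ρ)-1/(2-ρ))=LL s'+1/(s'-1)-c-triv s' := by rw [LL]; linear_combination -hB2
  have fin : LL s+(lt2 t:ℝ)=(triv s+(1/2:ℝ)*lg (‖s‖ +2))+cj (triv s'+(1/2:ℝ)*lg (‖s'‖ +2))-cj (LL s')-cj (1/(s'-1))+cj c-cj K+c-1/(s-1)-((1/2*(lg (‖s‖ +2)-lt2 t)+1/2*(lg (‖s'‖ +2)-lt2 t):ℝ):ℂ) := by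
    rw [hre, hS'] at hA2
    simp only [map_add, map_sub, map_mul, conj_ofReal] at hA2 ⊢
    rw [LL]
    push_cast
    linear_combination hA2
  rw [fin]
  have n3 : |1/2*(lg (‖s‖ +2)-lt2 t)+1/2*(lg (‖s'‖ +2)-lt2 t)| ≤2 := by rw [abs_le] at *; constructor <;> linarith
  refine (nsl _ _).trans ?_
  rw [norm_real, nea]
  have nc : ∀ z, ‖cj z‖ = ‖z‖ := norm_conj
  refine (all ((nsl _ _).trans (all ((nal _ _).trans (all ((nsl _ _).trans (all ((nal _ _).trans (all ((nsl _ _).trans (all ((nsl _ _).trans (all (nal _ _) _)) _)) _)) _)) _)) _)) _).trans ?_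
  simp only [nc]
  linarith

lemma two_exp {a b:ℂ} (ha : a.re <0) (hb :0<b.re) :
    Integrable (fun v:ℝ => if 0<v then cex (a*v) else cex (b*v)) ∧ ∫ v:ℝ, (if 0<v then cex (a*v) else cex (b*v)) =1/b-1/a := by
  set g:ℝ → ℂ := fun v:ℝ => if 0<v then cex (a*v) else cex (b*v) with hg
  have e1 : EqOn g (fun v:ℝ => cex (a*v)) (Ioi 0) := fun v hv => if_pos hv
  have e2 : EqOn g (fun v:ℝ => cex (b*v)) (Iic 0) := fun v hv => if_neg (not_lt.2 hv)
  have i1 : IntegrableOn g (Ioi 0) :=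
    (integrableOn_exp_mul_complex_Ioi ha 0).congr_fun e1.symm mmi
  have i2 : IntegrableOn g (Iic 0) :=
    (integrableOn_exp_mul_complex_Iic hb 0).congr_fun e2.symm measurableSet_Iic
  refine ⟨?_, ?_⟩
  · rw [← integrableOn_univ, ← Iic_union_Ioi (a := rl0)]; exact i2.union i1
  · rw [← setIntegral_univ, ← Iic_union_Ioi (a := rl0), setIntegral_union (Iic_disjoint_Ioi le_rfl) mmi i2 i1, setIntegral_congr_fun measurableSet_Iic e2, setIntegral_congr_fun mmi e1, integral_exp_mul_complex_Ioi ha, integral_exp_mul_complex_Iic hb]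
    simp; ring

lemma xyz_bound {X Y Z:ℝ} (hX :1 ≤ X) (hY :1 ≤ Y) (hZ :1 ≤ Z) (h : Z ≤ X+Y) : (X*Y)⁻¹ ≤2*Z^m34*(X^m54+Y^m54) := by
  wlog hXY : X ≤ Y generalizing X Y
  · rw [mul_comm X, add_comm (X^_)]; exact this hY hX lz lz
  have h1 : Z^q34 ≤2*Y^q34 := by
    calc Z^q34 ≤ (2*Y)^q34 :=
          rpow_le_rpow lz lz nz
      _ =2^q34*Y^q34 := mul_rpow nz lz
      _ ≤ _ := by
        gcongr
        calc rl2^q34 ≤2^rl1 :=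
              rlr nz nz
          _ =2 := nz
  have h2 : Y^(-(1/4):ℝ) ≤ X^(-(1/4):ℝ) :=
    rlo lz hXY nz
  have hZp :0<Z^q34 := rpow_pos_of_pos lz _
  have hYp :0<Y^q34 := rpow_pos_of_pos lz _
  have h3 : (Y^q34)⁻¹ ≤2*Z^m34 := by
    rw [rpow_neg lz, ← dem, ieo, dld hYp hZp]
    linarith
  have h4 : (X*Y)⁻¹=(X⁻¹*Y^(-(1/4):ℝ))*(Y^q34)⁻¹ := by
    rw [mul_inv, mul_assoc]; congr 1
    rw [← rpow_neg lz, ← rpow_add lz, ← rpow_neg_one]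
    norm_num
  have h5 : X^m54=X⁻¹*X^(-(1/4):ℝ) := by rw [← rpow_neg_one, ← rpow_add lz]; norm_num
  have hYq :0 ≤ Y^m54 := rpow_nonneg lz _
  have hZq :0 ≤ Z^m34 := rpow_nonneg lz _
  have hXi :0 ≤ X⁻¹ := inv_nonneg.2 lz
  have hX4 :0 ≤ X^(-(1/4):ℝ) := rpow_nonneg lz _
  rw [h4]
  calc X⁻¹*Y^(-(1/4):ℝ)*(Y^q34)⁻¹ ≤ (X⁻¹*X^(-(1/4):ℝ))*(2*Z^m34) :=
        mmm (mlm h2 hXi) h3 (inv_nonneg.2 hYp.le) (mul_nonneg hXi hX4)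
    _ ≤ _ := by rw [← h5]; nlinarith [mul_nonneg hZq hYq]

def PK (a b:ℂ) (v τ:ℝ):ℂ :=
  cex (Ci*τ*v)*(1/((Ci*τ-a)*(b-Ci*τ)))

lemma PK_ne {a b:ℂ} (ha : a.re <0) (hb :0<b.re) (τ:ℝ) :
    Ci*τ-a ≠0 ∧ b-Ci*τ ≠0 := by
  constructor <;> intro h <;> have := congrArg re h <;> simp at this <;> linarith

def J54:ℝ := ∫ τ:ℝ, (1 + |τ|)^m54

lemma J54_int (a:ℝ) : Integrable (fun τ:ℝ => abd τ a^m54) := by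
  have : Integrable (fun τ:ℝ => (1 + ‖τ‖)^m54) :=
    integrable_one_add_norm (by simp; norm_num)
  exact this.comp_sub_right a

lemma PK_bound {a b:ℂ} {d:ℝ} (hd :0<d) (ha : a.re ≤ -d) (hb : d ≤ b.re) (v τ:ℝ) :
    ‖PK a b v τ‖ ≤ ((1+d)/d)^2*(2*(1 + ‖b-a‖)^m34*((1 + |τ-a.im|)^m54+(1 + |τ-b.im|)^m54)) := by
  set p := Ci*τ-a with hp
  set q := b-Ci*τ with hq
  have p1 : d ≤ ‖p‖ := by
    have := arl p
    simp [hp] at this; exact le_trans (by rw [le_abs]; right; linarith) this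
  have q1 : d ≤ ‖q‖ := by
    have := arl q
    simp [hq] at this; exact le_trans (by rw [le_abs]; left; linarith) this
  have p2 : |τ-a.im| ≤ ‖p‖ := by simpa [hp] using ail p
  have q2 : |τ-b.im| ≤ ‖q‖ := by rw [abs_sub_comm]; simpa [hq] using ail q
  have h1 : ‖PK a b v τ‖ = (‖p‖ * ‖q‖)⁻¹ := by rw [PK, norm_mul, show Ci*τ*v=((τ*v:ℝ):ℂ)*Ci by push_cast; ring, norm_exp_ofReal_mul_I, one_mul, one_div, norm_inv, norm_mul]
  have hb' : ∀ r:ℝ, d ≤ r → r⁻¹ ≤ (1+d)/d*(1+r)⁻¹ := fun r hr => by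
    rw [← dem, ieo, dld lz lz, one_mul, dme, le_div_iff₀ hd]
    nlinarith
  rw [h1]
  calc (‖p‖ * ‖q‖)⁻¹ = ‖p‖⁻¹ * ‖q‖⁻¹ := mul_inv _ _
    _ ≤ ((1+d)/d*(1 + ‖p‖)⁻¹)*((1+d)/d*(1 + ‖q‖)⁻¹) := by gcongr <;> [exact hb' _ p1; exact hb' _ q1]
    _=((1+d)/d)^2*((1 + ‖p‖)*(1 + ‖q‖))⁻¹ := by rw [mul_inv]; ring
    _ ≤ _ := by
      refine mlm ((xyz_bound (Z :=1 + ‖b-a‖) lz lz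
        (by linarith [norm_nonneg (b-a)]) ?_).trans ?_) pz
      · have : b-a=p+q := by rw [hp, hq]; ring
        have := nal p q; rw [← ‹b-a=p+q›] at this; linarith
      · refine mlm (ala ?_ ?_) (mul_nonneg nz (rpow_nonneg pz _))
        · exact rlo pz lz nz
        · exact rlo pz lz nz

lemma PK_int {a b:ℂ} (ha : a.re <0) (hb :0<b.re) (v:ℝ) : Integrable (PK a b v) := by
  set d := min (-a.re) b.re
  have hd :0<d := lt_min lz hb
  refine (((J54_int a.im).add (J54_int b.im)).const_mul (((1+d)/d)^2*(2*(1 + ‖b-a‖)^m34))).mono' ?_ (Eventually.of_forall fun τ => ?_)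
  · refine Continuous.aestronglyMeasurable ?_
    unfold PK
    refine Continuous.mul fz (ccc.div fz fun τ => ?_)
    exact mul_ne_zero (PK_ne ha hb τ).1 (PK_ne ha hb τ).2
  · refine (PK_bound hd (by linarith [min_le_left (-a.re) b.re]) (min_le_right _ _) v τ).trans (loe ?_)
    simp only [Pi.add_apply]; ring

lemma PK_norm_int {a b:ℂ} {d:ℝ} (hd :0<d) (ha : a.re ≤ -d) (hb : d ≤ b.re) (v:ℝ) :
    ∫ τ, ‖PK a b v τ‖ ≤ ((1+d)/d)^2*4*J54*(1 + ‖b-a‖)^m34 := by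
  have h := integral_mono (PK_int lz lz v).norm (((J54_int a.im).add (J54_int b.im)).const_mul (((1+d)/d)^2*(2*(1 + ‖b-a‖)^m34))) (fun τ => (PK_bound hd ha hb v τ).trans (loe (by simp only [Pi.add_apply]; ring)))
  refine h.trans (loe ?_)
  have e : ∀ x:ℝ, ∫ τ, abd τ x^m54=J54 := fun x =>
    integral_sub_right_eq_self (fun τ:ℝ => (1 + |τ|)^m54) x
  rw [icm, integral_add' (J54_int _) (J54_int _), e, e]
  ring

lemma PK_integral {a b:ℂ} (ha : a.re <0) (hb :0<b.re) (v:ℝ) :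
    ∫ τ, PK a b v τ =2*π/(b-a)*(if 0<v then cex (a*v) else cex (b*v)) := by
  set g:ℝ → ℂ := fun v:ℝ => if 0<v then cex (a*v) else cex (b*v) with hg
  have hba : b-a ≠0 := by intro h; have := congrArg re h; simp at this; linarith
  have hgc : Continuous g := by
    have c1 : Continuous fun v:ℝ => cex (b*v) := by fun_prop
    have c2 : Continuous fun v:ℝ => cex (a*v) := by fun_prop
    refine (Continuous.if_le c1 c2 continuous_id (ccc (y := rl0)) (fun v hv => ?_)).congr
      fun v => ?_
    · simp [show v =0 from hv]
    · simp only [hg, id]; by_cases h :0<v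
      · rw [if_pos h, if_neg (not_le.2 h)]
      · rw [if_neg h, if_pos (not_lt.1 h)]
  have hF : FourierTransform.fourier g=fun ξ:ℝ => (b-a)*PK a b 0 (2*π*ξ) := by
    ext ξ
    rw [fourier_real_eq_integral_exp_smul]
    have e : ∀ z:ℂ, ((z-Ci*(2*π*ξ:ℝ)).re)=z.re := fun z => by simp
    have h2 := (two_exp (a := a-Ci*(2*π*ξ:ℝ)) (b := b-Ci*(2*π*ξ:ℝ)) (by rwa [e]) (by rwa [e])).2
    have n := PK_ne ha hb (2*π*ξ)
    have n1 : a-Ci*(2*π*ξ:ℝ) ≠0 := fun h => n.1 (by rw [← neg_sub, h, neg_zero])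
    have h3 : (∫ v:ℝ, cex (↑(-2*π*v*ξ)*Ci) • g v)=1/(b-Ci*(2*π*ξ:ℝ))-1/(a-Ci*(2*π*ξ:ℝ)) := by
      rw [← h2]
      refine integral_congr_ae (Eventually.of_forall fun v => ?_)
      simp only [hg, smul_eq_mul]
      split_ifs <;> rw [← cea] <;> congr 1 <;> push_cast <;> ring
    rw [h3, PK, div_sub_div _ _ n.2 n1]
    simp only [ofReal_zero, mul_zero, Complex.exp_zero, one_mul, mul_one]
    rw [mul_one_div, div_eq_div_iff (mul_ne_zero n.2 n1) (mul_ne_zero n.1 n.2)]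
    ring
  have hint : Integrable (fun ξ:ℝ => (b-a)*PK a b 0 (2*π*ξ)) :=
    ((PK_int ha hb 0).comp_mul_left' pz).const_mul _
  have h := congrFun (hgc.fourierInv_fourier_eq (two_exp ha hb).1 (by rw [hF]; exact hint)) v
  rw [hF, fourierInv_eq'] at h
  change _=_*g v
  rw [← h]
  have h4 := Measure.integral_comp_mul_left (fun τ => PK a b v τ) (2*π)
  rw [aop pz] at h4
  have h5 : (∫ ξ:ℝ, cex (((2*π*inner ℝ ξ v:ℝ):ℂ)*Ci) • ((b-a)*PK a b 0 (2*π*ξ)))=(b-a)*∫ ξ:ℝ, PK a b v (2*π*ξ) := by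
    rw [← icm]
    refine integral_congr_ae (Eventually.of_forall fun ξ => ?_)
    simp only [PK, smul_eq_mul, ofReal_zero, mul_zero, Complex.exp_zero, one_mul]
    have : (((2*π*inner ℝ ξ v:ℝ):ℂ)*Ci)=Ci*((2*π*ξ:ℝ):ℂ)*v := by simp; ring
    rw [this]; ring
  rw [h5, h4]
  have hpi : (π:ℂ) ≠0 := by simp
  simp only [real_smul]
  push_cast
  field_simp

lemma mz_sum2 (z:ℂ) :
    Summable (fun ρ => mz ρ*(‖z-ρ‖⁻¹*(1 + ‖z-ρ‖)^m34)) := by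
  set M :=2 + ‖z-2‖ with hM
  have hM1 :1 ≤ M := by rw [hM]; linarith [norm_nonneg (z-2)]
  refine Summable.of_norm_bounded_eventually (mz_summable.mul_left (2 * M^(7/4:ℝ))) ?_
  have hfin := (zeta1_fin (1 + ‖z-2‖))
  refine hfin.subset fun ρ hρ => ?_
  by_contra hcon
  apply hρ
  change ‖mz ρ*(‖z-ρ‖⁻¹*(1 + ‖z-ρ‖)^m34)‖ ≤ _
  by_cases h0 : riemannZeta₁ ρ =0
  swap
  · simp [mz, order_zero_of_ne h0]
  have h1 :1 ≤ ‖z-ρ‖ := by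
    by_contra h
    refine hcon ⟨h0, ?_⟩
    rw [Metric.mem_closedBall, den]
    calc ‖ρ-2‖ = ‖(z-2)-(z-ρ)‖ := by ring_nf
      _ ≤ ‖z-2‖ + ‖z-ρ‖ := nsl _ _
      _ ≤ _ := lz
  have hp :0 ≤ ‖z-ρ‖⁻¹*(1 + ‖z-ρ‖)^m34 :=
    mul_nonneg pz (rpow_nonneg pz _)
  rw [norm_mul, non (mz_nonneg _), non hp, mul_left_comm (2 * M^(7/4:ℝ))]
  refine mlm ?_ (mz_nonneg _)
  have h2 : ‖z-ρ‖⁻¹ ≤2*(1 + ‖z-ρ‖)^(-1:ℝ) := by rw [rpow_neg_one, ← dem, ieo, dld lz lz]; linarith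
  have h3 : (1 + ‖z-ρ‖)^(-1:ℝ)*(1 + ‖z-ρ‖)^m34=(1 + ‖z-ρ‖)^m74 := by rw [← rpow_add pz]; norm_num
  have h4 :1 + ‖ρ-2‖ ≤ M*(1 + ‖z-ρ‖) := by
    have : ‖ρ-2‖ ≤ ‖z-2‖ + ‖z-ρ‖ := by
      calc ‖ρ-2‖ = ‖(z-2)-(z-ρ)‖ := by ring_nf
        _ ≤ _ := nsl _ _
    rw [hM]; nlinarith [norm_nonneg (z-2)]
  have h5 : (1 + ‖z-ρ‖)^m74 ≤ M^(7/4:ℝ)*(1 + ‖ρ-2‖)^m74 := by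
    have := rlo (z := -(7/4)) pz h4 nz
    rw [mul_rpow lz pz, rpow_neg (x := M) lz] at this
    have hMp :0 < M^(7/4:ℝ) := rpow_pos_of_pos lz _
    rwa [inv_mul_le_iff₀ hMp] at this
  calc _ ≤2*(1 + ‖z-ρ‖)^(-1:ℝ)*(1 + ‖z-ρ‖)^m34 :=
        mlo h2 (rpow_nonneg pz _)
    _ =2*(1 + ‖z-ρ‖)^m74 := by rw [mul_assoc, h3]
    _ ≤ _ := lz

lemma hasSum_int {μ : Measure ℝ} {F:ℂ → ℝ → ℂ} {b:ℂ → ℝ} (hF : ∀ ρ, Integrable (F ρ) μ) (hb : Summable b) (h : ∀ ρ, ∫ τ, ‖F ρ τ‖ ∂μ ≤ b ρ) (h0 : ∀ ρ, mz ρ =0 → ∀ τ, F ρ τ =0) :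
    HasSum (fun ρ => ∫ τ, F ρ τ ∂μ) (∫ τ, ∑' ρ, F ρ τ ∂μ) := by
  have hc : (Function.support mz).Countable := by
    refine mz_summable.countable_support.mono fun ρ hρ => ?_
    exact mul_ne_zero hρ (rpow_pos_of_pos pz _).ne'
  have : Countable (Function.support mz) := hc
  have hs : ∀ {g:ℂ → ℂ}, (∀ ρ, mz ρ =0 → g ρ =0) → Function.support g ⊆ Function.support mz :=
    fun hg ρ hρ h => hρ (hg ρ h)
  have h1 := hasSum_integral_of_summable_integral_norm (μ := μ) (F := fun i : Function.support mz => F i) (fun i => hF i) (son (fun i => integral_nonneg fun _ => norm_nonneg _) (fun i => h i) (hb.subtype _))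
  have h2 : ∀ τ, ∑' i : Function.support mz, F i τ=∑' ρ, F ρ τ := fun τ =>
    tsum_subtype_eq_of_support_subset (f := fun ρ => F ρ τ) (hs fun ρ h => h0 ρ h τ)
  simp only [h2] at h1
  exact (hasSum_subtype_iff_of_support_subset (f := fun ρ => ∫ τ, F ρ τ ∂μ) (hs fun ρ h => by simp [h0 ρ h])).1 h1

lemma EF {y κ c:ℝ} {w:ℂ} (hy :0 ≤ y) (hc0 : -κ<c) (hc : c<κ) (h1 :1<w.re+c) (hz : riemannZeta₁ (w-κ) ≠0) (hw : w-κ ≠1) :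
    HasSum (fun ρ => (mz ρ:ℂ)*(cex ((ρ-w)*y)*(2*κ/(κ^2-(ρ-w)^2)))) (cex ((1-w)*y)*(2*κ/(κ^2-(1-w)^2))-cex (-κ*y)*LL (w-κ)-∑' n:ℕ, (vm n:ℂ)*((n:ℂ)^(-w)*cex (-κ * dl y n))) := by
  set Λ := fun n:ℕ => (vm n:ℂ)
  have hκ :0<κ := lz
  set d := min (w.re+c-1) (κ-c) with hd
  have hd0 :0<d := lt_min lz lz
  have hpi : (π:ℂ) ≠0 := by simp
  have hif : ∀ {a b:ℂ}, (if 0<y then cex (a*y) else cex (b*y))=cex (a*y) := by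
    intro a b
    rcases hy.eq_or_lt with rfl | h
    · simp
    · rw [if_pos h]
  have hb : d ≤ ((κ-c:ℝ):ℂ).re := by simp [hd]
  have hP : ∀ u:ℂ, u.re<c → κ+u ≠0 → ∫ τ, cex (c*y)*(2*κ/(κ+u))*PK (u-c) ((κ-c:ℝ):ℂ) y τ=2*π*(cex (u*y)*(2*κ/(κ^2-u^2))) := by
    intro u hu hu2
    rw [icm, PK_integral (by simpa using hu) (by simpa using hc), hif]
    have e : (((κ-c:ℝ):ℂ)-(u-c))=κ-u := by push_cast; ring
    have e2 : (κ:ℂ)-u ≠0 := by intro h; have := congrArg re h; simp at this; linarith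
    rw [e, show (κ:ℂ)^2-u^2=(κ+u)*(κ-u) by ring, show u*y=c*y+(u-c)*y by ring, cea]
    field_simp
  have hS1 : ∀ τ:ℝ,1<(w+(c+Ci*τ)).re := fun τ => by simpa using lz
  set Q:ℝ → ℂ := fun τ => cex (c*y)*(2*κ)*PK ((-κ-c:ℝ):ℂ) ((κ-c:ℝ):ℂ) y τ with hQ
  have ha' : ((-κ-c:ℝ):ℂ).re <0 := by simp; linarith
  have hb' :0<((κ-c:ℝ):ℂ).re := by simp; linarith
  have hsummable : Summable fun n:ℕ => ‖LSeries.term Λ (w.re+c:ℝ) n‖ :=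
    (alv (s := ((w.re+c:ℝ):ℂ)) (by simpa using h1)).norm
  have hterm : ∀ (n:ℕ) (s:ℂ), LSeries.term Λ s n=Λ n*(n:ℂ)^(-s) := by
    intro n s
    rcases eq_or_ne n 0 with rfl | hn
    · simp [Λ]
    · rw [lto hn, cpow_neg, dem]
  have hF : ∀ (n:ℕ) (τ:ℝ), LSeries.term Λ cw w c τ n*Q τ=(Λ n*(n:ℂ)^(-w)*(cex (c*(y-lg n))*(2*κ)))*PK ((-κ-c:ℝ):ℂ) ((κ-c:ℝ):ℂ) (y-lg n) τ := by
    intro n τ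
    rcases eq_or_ne n 0 with rfl | hn
    · simp [Λ]
    have hn' : (n:ℂ) ≠0 := by exact_mod_cast hn
    rw [hterm, hQ, neg_add, cpow_add _ _ hn', cpow_def_of_ne_zero hn' (-(c+Ci*τ)), ← natCast_log]
    simp only [PK]
    have e1 : cex (c*y)*cex (Ci*τ*y)*cex (lg n*(-(c+Ci*τ)))=cex (c*(y-lg n))*cex (Ci*τ*((y-lg n:ℝ):ℂ)) := by rw [← cea, ← cea, ← cea]; congr 1; push_cast; ring
    linear_combination (Λ n*(n:ℂ)^(-w)*(2*κ)*(1/((Ci*τ-((-κ-c:ℝ):ℂ))*(((κ-c:ℝ):ℂ)-Ci*τ))))*e1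
  have hQi : Integrable Q := (PK_int ha' hb' y).const_mul _
  have hnorm : ∀ (n:ℕ) (τ:ℝ), ‖LSeries.term Λ cw w c τ n*Q τ‖ = ‖LSeries.term Λ (w.re+c:ℝ) n‖ * ‖Q τ‖ := by
    intro n τ
    rw [norm_mul]; congr 1
    rw [LSeries.norm_term_eq, LSeries.norm_term_eq]; simp
  have hN : HasSum (fun n:ℕ => ∫ τ:ℝ, LSeries.term Λ cw w c τ n*Q τ) (∫ τ:ℝ, ∑' n:ℕ, LSeries.term Λ cw w c τ n*Q τ) := by
    refine hasSum_integral_of_summable_integral_norm (fun n => ?_) ?_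
    · simp only [hF]; exact (PK_int ha' hb' _).const_mul _
    · simp only [hnorm, icm]
      exact hsummable.mul_right _
  have hNv : ∀ n:ℕ, ∫ τ:ℝ, LSeries.term Λ cw w c τ n*Q τ=2*π*(Λ n*((n:ℂ)^(-w)*cex (-κ * dl y n))) := by
    intro n
    simp only [hF]
    rw [icm, PK_integral ha' hb']
    have e : (((κ-c:ℝ):ℂ)-((-κ-c:ℝ):ℂ)) =2*κ := by push_cast; ring
    have hκ' : (κ:ℂ) ≠0 := by exact_mod_cast hκ.ne'
    have e2 : cex (c*(y-lg n))*(if 0<y-lg n then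
        cex (((-κ-c:ℝ):ℂ)*((y-lg n:ℝ):ℂ)) else
        cex (((κ-c:ℝ):ℂ)*((y-lg n:ℝ):ℂ)))=cex (-κ * dl y n) := by
      split_ifs with h
      · rw [aop h, ← cea]; congr 1; push_cast; ring
      · rw [abs_of_nonpos (not_lt.1 h), ← cea]; congr 1; push_cast; ring
    rw [e, ← e2]
    field_simp
  set F:ℂ → ℝ → ℂ := fun ρ τ => (mz ρ:ℂ)*(cex (c*y)*(2*κ/(κ+(ρ-w)))*PK (ρ-w-c) ((κ-c:ℝ):ℂ) y τ) with hFdef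
  have hmz : ∀ ρ, mz ρ ≠0 → ρ.re <1 ∧ κ+(ρ-w) ≠0 := by
    intro ρ h
    have h0 : riemannZeta₁ ρ =0 := by by_contra h'; exact h (by simp [mz, order_zero_of_ne h'])
    refine ⟨?_, ?_⟩
    · by_contra h'; exact zeta1_ne_zero_of_one_le (not_lt.1 h') h0
    · intro h'; exact hz (by rw [← h0]; congr 1; linear_combination -h')
  have hFint : ∀ ρ, Integrable (F ρ) := by
    intro ρ
    by_cases h : mz ρ =0
    · simp [hFdef, h]
    · exact ((PK_int (by simp; linarith [(hmz ρ h).1]) hb' y).const_mul _).const_mul _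
  have hFb : ∀ ρ, ∫ τ, ‖F ρ τ‖ ≤ (ex (c*y)*(2*κ)*(((1+d)/d)^2*4*J54))*(mz ρ*(‖w-κ-ρ‖⁻¹*(1 + ‖w+κ-ρ‖)^m34)) := by
    intro ρ
    by_cases h : mz ρ =0
    · simp [hFdef, h]
    have hre := (hmz ρ h).1
    have hp := PK_norm_int (a := ρ-w-c) hd0 (by have := min_le_left (w.re+c-1) (κ-c); simp; linarith) hb y
    simp only [hFdef, norm_mul, icm]
    rw [norm_real, non (mz_nonneg _), ← ofReal_mul, norm_exp_ofReal, norm_div, norm_mul, norm_real, non hκ.le, cno, ← norm_neg (κ+(ρ-w):ℂ), show -(κ+(ρ-w))=w-κ-ρ by ring]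
    rw [show (((κ-c:ℝ):ℂ)-(ρ-w-c))=w+κ-ρ by push_cast; ring] at hp
    calc _ ≤ mz ρ*(ex (c*y)*(2*κ / ‖w-κ-ρ‖)*_) :=
          mlm (mlm hp pz) (mz_nonneg _)
      _=_ := by rw [dem]; ring
  have hbsum : Summable (fun ρ => mz ρ*(‖w-κ-ρ‖⁻¹*(1 + ‖w+κ-ρ‖)^m34)) := by
    refine son (fun ρ => mul_nonneg (mz_nonneg _) (mul_nonneg pz (rpow_nonneg pz _))) (fun ρ => ?_) ((mz_sum2 (w-κ)).mul_left ((1+2*κ)^q34))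
    have hK : rl0<(1+2*κ)^q34 := rpow_pos_of_pos lz _
    have : (1 + ‖w+κ-ρ‖)^m34 ≤ (1+2*κ)^q34*(1 + ‖w-κ-ρ‖)^m34 := by
      have h4 :1 + ‖w-κ-ρ‖ ≤ (1+2*κ)*(1 + ‖w+κ-ρ‖) := by
        have : ‖w-κ-ρ‖ ≤ ‖w+κ-ρ‖ +2*κ := by
          calc ‖w-κ-ρ‖ = ‖(w+κ-ρ)-((2*κ:ℝ):ℂ)‖ := by push_cast; ring_nf
            _ ≤ _ := nsl _ _
            _=_ := by rw [norm_real, non lz]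
        nlinarith [norm_nonneg (w+κ-ρ)]
      have h5 := rlo (z := -(3/4)) pz h4 nz
      rw [mul_rpow lz pz, rpow_neg (x :=1+2*κ) lz]
        at h5
      rwa [inv_mul_le_iff₀ hK] at h5
    calc _ ≤ mz ρ*(‖w-κ-ρ‖⁻¹*((1+2*κ)^q34*(1 + ‖w-κ-ρ‖)^m34)) :=
        mlm (mlm this pz) (mz_nonneg _)
      _=_ := by ring
  have hZ := hasSum_int hFint (hbsum.mul_left _) hFb (fun ρ h τ => by simp [hFdef, h])
  have hker : ∀ (u:ℂ) (τ:ℝ), u.re<c → κ+u ≠0 → (1/((c+Ci*τ)-u)+1/(κ+u))*Q τ=cex (c*y)*(2*κ/(κ+u))*PK (u-c) ((κ-c:ℝ):ℂ) y τ := by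
    intro u τ hu hu2
    have n1 := (PK_ne (a := u-c) (by simpa using hu) hb' τ).1
    have n2 := PK_ne ha' hb' τ
    have n3 : (c:ℂ)+Ci*τ-u ≠0 := by convert n1 using 1; ring
    simp only [hQ, PK]
    rw [show Ci*τ-(u-c)=(c:ℂ)+Ci*τ-u by ring]
    have e : Ci*τ-((-κ-c:ℝ):ℂ)=((c+Ci*τ)-u)+(κ+u) := by push_cast; ring
    have n4 := n2.1
    rw [e] at n4 ⊢
    have n5 := n2.2
    rw [div_add_div _ _ n3 hu2, one_mul, mul_one, add_comm ((κ:ℂ)+u)]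
    field_simp
  have hLL : ∀ τ:ℝ, ∑' ρ, F ρ τ = -(∑' n:ℕ, LSeries.term Λ cw w c τ n*Q τ)-LL (w-κ)*Q τ+cex (c*y)*(2*κ/(κ+(1-w)))*PK (1-w-c) ((κ-c:ℝ):ℂ) y τ := by
    intro τ
    have hz1 := zeta1_ne_zero_of_one_le (hS1 τ).le
    have h2 := (pf_hasSum hz1 hz).mul_right (Q τ)
    have h3 : ∀ ρ, (mz ρ:ℂ)*(1/(w+(c+Ci*τ)-ρ)-1/(w-κ-ρ))*Q τ=F ρ τ := by
      intro ρ
      by_cases h : mz ρ =0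
      · simp [hFdef, h]
      have := hker (ρ-w) τ (by simp; linarith [(hmz ρ h).1]) (hmz ρ h).2
      simp only [hFdef]
      rw [← this, show (w-κ-ρ:ℂ) = -(κ+(ρ-w)) by ring, odn, show (w+(c+Ci*τ)-ρ:ℂ)=(c+Ci*τ)-(ρ-w) by ring]
      ring
    simp only [h3] at h2
    rw [h2.tsum_eq, tsum_mul_right]
    have h4 := LL_eq (hS1 τ)
    rw [← hker (1-w) τ slz (fun h => hw (by linear_combination -h))]
    have h5 : LSeries Λ cw w c τ=∑' n:ℕ, LSeries.term Λ cw w c τ n := rfl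
    rw [← h5]
    have h6 : LSeries Λ cw w c τ = -LL cw w c τ := by rw [h4, neg_neg]
    rw [h6, LL, LL, show (w-κ-1:ℂ) = -(κ+(1-w)) by ring, odn, show (w+(c+Ci*τ)-1:ℂ)=(c+Ci*τ)-(1-w) by ring]
    ring
  have hQv : ∫ τ, Q τ =2*π*cex (-κ*y) := by
    simp only [hQ]
    rw [icm, PK_integral ha' hb', hif]
    have e : (((κ-c:ℝ):ℂ)-((-κ-c:ℝ):ℂ)) =2*κ := by push_cast; ring
    have hκ' : (κ:ℂ) ≠0 := by exact_mod_cast hκ.ne'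
    rw [e, show (-κ*y:ℂ)=c*y+((-κ-c:ℝ):ℂ)*y by push_cast; ring, cea]
    field_simp
  have hNint : Integrable (fun τ:ℝ => ∑' n:ℕ, LSeries.term Λ cw w c τ n*Q τ) := by
    have hm : ∀ n:ℕ, Measurable fun τ:ℝ => LSeries.term Λ cw w c τ n*Q τ := by
      intro n
      simp only [hF]
      unfold PK
      fun_prop
    refine Integrable.mono' (hQi.norm.const_mul (∑' n, ‖LSeries.term Λ (w.re+c:ℝ) n‖)) (Measurable.aestronglyMeasurable ?_) (Eventually.of_forall fun τ => ?_)
    · have hs : ∀ τ:ℝ, Summable fun n:ℕ => LSeries.term Λ cw w c τ n*Q τ :=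
        fun τ => Summable.of_norm (by simp only [hnorm]; exact hsummable.mul_right _)
      exact measurable_of_tendsto_metrizable (fun N => measurable_sum (Fr N)
        fun n _ => hm n) (tendsto_pi_nhds.2 fun τ => by simpa using (hs τ).hasSum.tendsto_sum_nat)
    · rw [← tsum_mul_right]
      exact ton (hsummable.mul_right _).hasSum (fun n => (hnorm n τ).le)
  simp only [hLL] at hZ
  have hPi : Integrable fun τ => cex (c*y)*(2*κ/(κ+(1-w)))*PK (1-w-c) ((κ-c:ℝ):ℂ) y τ :=
    (PK_int slz hb' y).const_mul _
  have i1 : Integrable fun τ:ℝ => -∑' n:ℕ, LSeries.term Λ cw w c τ n*Q τ :=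
    hNint.neg
  have i2 : Integrable fun τ:ℝ => LL (w-κ)*Q τ := hQi.const_mul _
  have i3 : Integrable fun τ:ℝ => -(∑' n:ℕ, LSeries.term Λ cw w c τ n*Q τ)-LL (w-κ)*Q τ := i1.sub i2
  rw [integral_add i3 hPi, integral_sub i1 i2, integral_neg, ← hN.tsum_eq, icm, hQv, hP (1-w) slz (fun h => hw (by linear_combination -h))] at hZ
  simp only [hNv, tml] at hZ
  have h7 := hZ.mul_left (1/(2*π:ℂ))
  have h8 : (fun ρ => (mz ρ:ℂ)*(cex ((ρ-w)*y)*(2*κ/(κ^2-(ρ-w)^2))))=fun ρ =>1/(2*π:ℂ)*∫ τ, F ρ τ := by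
    funext ρ
    simp only [hFdef]
    by_cases h : mz ρ =0
    · simp [h]
    rw [icm, hP _ (by simp; linarith [(hmz ρ h).1]) (hmz ρ h).2]
    field_simp
  rw [h8]
  have h9 : ∀ A B D:ℂ,1/(2*π:ℂ)*(-(2*π*A)-B*(2*π*D)
      +2*π*(cex ((1-w)*y)*(2*κ/(κ^2-(1-w)^2))))=cex ((1-w)*y)*(2*κ/(κ^2-(1-w)^2))-D*B-A := by
    intro A B D; generalize (cex ((1-w)*y)*(2*κ/(κ^2-(1-w)^2)))=E
    field_simp; ring
  rwa [h9] at h7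

noncomputable abbrev vM (n:ℕ):ℝ := vm n

lemma vM_nn (n:ℕ) :0 ≤ vM n := avn
lemma vM_zero : vM 0 =0 := by simp [vM]

lemma dyad {c f B g:ℕ → ℝ} (hc : ∀ n,0 ≤ c n) (hc0 : c 0 =0) (hf : ∀ n,0 ≤ f n) (hfg : ∀ n, n ≠0 → f n ≤ g (Nat.log 2 n)) (hB : ∀ k, ∑ n ∈ Finset.Ico (2^k) (2^(k+1)), c n ≤ B k) (hs : Summable fun k => B k*g k) :
    Summable (fun n => c n*f n) ∧ ∑' n, c n*f n ≤ ∑' k, B k*g k := by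
  have hB0 : ∀ k,0 ≤ B k := fun k => (sum_nonneg fun n _ => hc n).trans (hB k)
  have hg0 : ∀ k,0 ≤ g k := fun k => by
    have := hfg (2^k) pz
    rw [Nat.log_pow nz] at this
    exact (hf _).trans this
  have h1 : ∀ N, ∑ n ∈ Fr (2^N), c n*f n ≤ ∑ k ∈ Fr N, B k*g k := by
    intro N
    induction N with
    | zero => simp [hc0]
    | succ N ih =>
      rw [sum_range_succ, ← sum_range_add_sum_Ico _ (Nat.pow_le_pow_right nz (Nat.le_succ N) :2^N ≤2^(N+1))]
      refine ala ih ?_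
      refine le_trans ?_ (mlo (hB N) (hg0 N))
      rw [sum_mul]
      refine sls fun n hn => mlm ?_ (hc n)
      rw [fmi] at hn
      have := hfg n (by have := Nat.pos_of_neZero (2^N); omega)
      rwa [(Nat.log_eq_iff (Or.inr ⟨nz, by have := Nat.pos_of_neZero (2^N); omega⟩)).2 hn]
        at this
  have h2 : ∀ N, ∑ n ∈ Fr N, c n*f n ≤ ∑' k, B k*g k := fun N =>
    (slo (range_mono Nat.lt_two_pow_self.le)
      fun n _ _ => mul_nonneg (hc n) (hf n)).trans ((h1 N).trans (hs.sum_le_tsum _ fun k _ => mul_nonneg (hB0 k) (hg0 k)))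
  exact ⟨summable_of_sum_range_le (fun n => mul_nonneg (hc n) (hf n)) h2, tsum_le_of_sum_range_le (fun n => mul_nonneg (hc n) (hf n)) h2⟩

lemma K1 : ∃ C >0, ∀ y:ℝ, Summable (fun k:ℕ => ex (-|y-k*lg 2| /4)) ∧ ∑' k:ℕ, ex (-|y-k*lg 2| /4) ≤ C := by
  have hl := log_pos (nz : rl1 <2)
  have s0 : Summable fun n:ℕ => ex (-lg 2/4)^n :=
    sgo (exp_pos _).le (by rw [exp_lt_one_iff]; linarith)
  set q : ℤ → ℝ := fun j => ex ((-|(j:ℝ)| +1)*lg 2/4)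
  have hq : ∀ n:ℕ, ex ((-(n:ℝ)+1)*lg 2/4)=ex (lg 2/4)*ex (-lg 2/4)^n := by intro n; rw [← ren, ← rea]; ring_nf
  have hs : Summable q := by
    refine Summable.of_nat_of_neg ?_ ?_
    · simpa [q, hq] using s0.mul_left (ex (lg 2/4))
    · simpa [q, hq] using s0.mul_left (ex (lg 2/4))
  have hqp : ∀ j,0 ≤ q j := fun j => (exp_pos _).le
  refine ⟨∑' j, q j+1, by have :0 ≤ ∑' j, q j := tsum_nonneg hqp; linarith, fun y => ?_⟩
  set m := ⌊y/lg 2⌋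
  have hi : Function.Injective fun k:ℕ => (k : ℤ) - m := fun a b h => by simpa using h
  have hle : ∀ k:ℕ, ex (-|y-k*lg 2| /4) ≤ q ((k : ℤ) - m) := by
    intro k
    have h1 := Int.floor_le (y/lg 2)
    have h2 := Int.lt_floor_add_one (y/lg 2)
    rw [le_div_iff₀ hl] at h1
    rw [div_lt_iff₀ hl] at h2
    refine ele.2 ?_
    have h3 : (|(((k : ℤ) - m : ℤ):ℝ)| -1)*lg 2 ≤ |y-k*lg 2| := by
      push_cast
      rcases abs_cases ((k:ℝ) - m) with h | h <;> rcases abs_cases (y-k*lg 2) with h' | h' <;>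
        rw [h.1, h'.1] <;> nlinarith
    linarith
  have hs2 := hs.comp_injective hi
  have hs3 : Summable (fun k:ℕ => ex (-|y-k*lg 2| /4)) :=
    son (fun k => (exp_pos _).le) hle hs2
  refine ⟨hs3, (hs3.tsum_le_tsum hle hs2).trans ?_⟩
  have := tsum_comp_le_tsum_of_inj hs hqp hi
  simp only [Function.comp_def] at this
  linarith

lemma KW {y s:ℝ} (hy :0 ≤ y) (hs :0 ≤ s) (hs1 : s ≤1) (k:ℕ) : ((k:ℝ)+1)^s*ex (-|y-k*lg 2| /2) ≤12*(1+y)^s*ex (-|y-k*lg 2| /4) := by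
  set u := |y-k*lg 2|
  have hu :0 ≤ u := abs_nonneg _
  have h1 : (k:ℝ)+1 ≤12*(1+y)*ex (u/4) := by
    have h2 := aol (u/4)
    have h3 : (k:ℝ)*lg 2 ≤ y+u := by have := neg_abs_le (y-k*lg 2); linarith
    have h4 := ltg
    have h5 : (k:ℝ) ≤2*(y+u) := by nlinarith [ncn (α := ℝ) k]
    nlinarith [mul_nonneg hy hu]
  have h6 : ((k:ℝ)+1)^s ≤12*(1+y)^s*ex (u/4) := by
    refine (rpow_le_rpow pz h1 hs).trans ?_
    rw [mul_rpow pz (exp_pos _).le, mul_rpow nz pz]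
    have a1 : (12:ℝ)^s ≤12 := by simpa using rlr (nz : rl1 ≤12) hs1
    have a2 : ex (u/4)^s ≤ ex (u/4) := by simpa using rlr (one_le_exp pz) hs1
    gcongr
  calc _ ≤12*(1+y)^s*ex (u/4)*ex (-u/2) := by gcongr
    _=_ := by rw [mul_assoc, ← rea]; ring_nf

lemma dy : ∃ C >0, ∀ {y s θ κ A M:ℝ} {c f:ℕ → ℝ},0 ≤ y → 0 ≤ s → s ≤1 → 0 ≤ θ → θ ≤2 → θ+1/2 ≤ κ → κ ≤2 → 0 ≤ A → 0 ≤ M → (∀ n,0 ≤ c n) → c 0 =0 → (∀ n,0 ≤ f n) → (∀ n:ℕ, n ≠0 → f n ≤ M*((n:ℝ)^(θ-1)*ex (-κ * dl y n))) → (∀ k:ℕ, ∑ n ∈ Finset.Ico (2^k) (2^(k+1)), c n ≤ A*(2^k*((k:ℝ)+1)^s)) → Summable (fun n => c n*f n) ∧ ∑' n, c n*f n ≤ C*(A * M*(ex (θ*y)*(1+y)^s)) := by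
  obtain ⟨C, hC, hK⟩ := K1
  refine ⟨96*C, pz, fun {y s θ κ A M c f} hy hs hs1 hθ hθ2 hκ hκ2 hA hM hc hc0 hf hfg hB => ?_⟩
  have hl := log_pos (nz : rl1 <2)
  set g:ℕ → ℝ := fun k =>8 * M*(ex ((θ-1)*(k*lg 2))*ex (-κ * |y-k*lg 2|)) with hgdef
  have hg : ∀ n, n ≠0 → f n ≤ g (Nat.log 2 n) := by
    intro n hn
    refine (hfg n hn).trans ?_
    have hn' : rl0<n := pz
    set k := Nat.log 2 n
    have b1 : (k:ℝ)*lg 2 ≤ lg n := by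
      rw [← log_pow]
      exact lll pz (by exact_mod_cast Nat.pow_log_le_self 2 hn)
    have b2 : lg n ≤ (k:ℝ)*lg 2+lg 2 := by
      have : lg n ≤ lg (rl2^(k+1)) :=
        lll hn' (by exact_mod_cast (Nat.lt_pow_succ_log_self nz n).le)
      rw [log_pow] at this; push_cast at this; linarith
    have b3 : |y-k*lg 2| ≤ dl y n + lg 2 := by
      have := abs_sub_abs_le_abs_sub (y-k*lg 2) (y-lg n)
      rw [show y-k*lg 2-(y-lg n)=lg n-k*lg 2 by ring, aon (sub_nonneg.2 b1)] at this
      linarith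
    have b4 : (8:ℝ)=ex (3*lg 2) := by rw [mul_comm, exp_mul, rel nz]; norm_num
    rw [rpow_def_of_pos hn', ← rea, hgdef]
    simp only
    rw [mul_comm (8:ℝ) M, mul_assoc, ← rea, b4, ← rea]
    refine mlm (ele.2 ?_) hM
    nlinarith [abs_nonneg (y-lg n)]
  have hle : ∀ k:ℕ, A*(2^k*((k:ℝ)+1)^s)*g k ≤96*(A * M*(ex (θ*y)*(1+y)^s))*ex (-|y-k*lg 2| /4) := by
    intro k
    have h1 := KW hy hs hs1 k
    set u := |y-k*lg 2| with hu
    have h2 : rl2^k*(ex ((θ-1)*(k*lg 2))*ex (-κ*u)) ≤ ex (θ*y)*ex (-u/2) := by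
      have e : rl2^k=ex (k*lg 2) := by rw [mul_comm, exp_mul, rel nz, rrn]
      rw [e, ← rea, ← rea, ← rea]
      refine ele.2 ?_
      have := neg_abs_le (y-k*lg 2)
      rw [← hu] at this
      nlinarith [abs_nonneg (y-k*lg 2)]
    calc _=A*(8 * M)*((rl2^k*(ex ((θ-1)*(k*lg 2))*ex (-κ*u)))*((k:ℝ)+1)^s) := by simp only [hgdef]; ring
      _ ≤ A*(8 * M)*((ex (θ*y)*ex (-u/2))*((k:ℝ)+1)^s) := by gcongr
      _=A*(8 * M)*ex (θ*y)*(((k:ℝ)+1)^s*ex (-u/2)) := by ring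
      _ ≤ A*(8 * M)*ex (θ*y)*(12*(1+y)^s*ex (-u/4)) := by gcongr
      _=_ := by ring
  have hs' := son (fun k => pz) hle ((hK y).1.mul_left _)
  obtain ⟨r1, r2⟩ := dyad hc hc0 hf hg hB hs'
  refine ⟨r1, r2.trans ((hs'.tsum_le_tsum hle ((hK y).1.mul_left _)).trans ?_)⟩
  rw [tml]
  calc _ ≤96*(A * M*(ex (θ*y)*(1+y)^s))*C :=
        mlm (hK y).2 pz
    _=_ := by ring

lemma vM_dyad (k:ℕ) : ∑ n ∈ Finset.Ico (2^k) (2^(k+1)), vM n ≤12*2^k := by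
  have h := Chebyshev.psi_le_const_mul_self (x := ((2^(k+1):ℕ):ℝ)) pz
  rw [Chebyshev.psi_eq_sum_Icc, Nat.floor_natCast] at h
  have h2 : lg 4 ≤2 := by rw [show (4:ℝ) =2^2 by norm_num, log_pow]; have := ltl; push_cast; linarith
  have h3 : ∑ n ∈ Finset.Ico (2^k) (2^(k+1)), vM n ≤ ∑ n ∈ Finset.Icc 0 (2^(k+1)), vM n :=
    slo (fun n hn => by rw [fmi] at hn; exact Finset.mem_Icc.2 ⟨Nat.zero_le _, hn.2.le⟩) fun n _ _ => vM_nn n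
  refine h3.trans (h.trans ?_)
  push_cast
  rw [pow_succ]
  nlinarith [pow_pos (two_pos : rl0 <2) k]

def aa (y:ℝ) (n:ℕ):ℝ := vM n*((n:ℝ)^m12*ex (-dl y n))

lemma aa_nn (y:ℝ) (n:ℕ) :0 ≤ aa y n := mul_nonneg (vM_nn n) pz

lemma G1 : ∃ C >0, ∀ y:ℝ,0 ≤ y → Summable (aa y) ∧ ∑' n, aa y n ≤ C*eh y := by
  obtain ⟨C, hC, h⟩ := dy
  refine ⟨12*C, pz, fun y hy => ?_⟩
  obtain ⟨h1, h2⟩ := h (s :=0) (θ :=1/2) (κ :=1) (A :=12) (M :=1) (f := fun n => (n:ℝ)^m12*ex (-dl y n)) hy le_rfl nz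
    nz nz nz nz nz nz vM_nn vM_zero
    (fun n => pz) (fun n _ => loe nz) (fun k => by simpa using vM_dyad k)
  refine ⟨h1, h2.trans (loe ?_)⟩
  rw [rpow_zero]; ring_nf

lemma P1 : ∃ C >0, ∀ y:ℝ,0 ≤ y → Summable (fun n => vM n*((n:ℝ)⁻¹*ex (-dl y n))) ∧ ∑' n:ℕ, vM n*((n:ℝ)⁻¹*ex (-dl y n)) ≤ C := by
  obtain ⟨C, hC, h⟩ := dy
  refine ⟨12*C, pz, fun y hy => ?_⟩
  obtain ⟨h1, h2⟩ := h (s :=0) (θ :=0) (κ :=1) (A :=12) (M :=1) (f := fun n => (n:ℝ)⁻¹*ex (-dl y n)) hy le_rfl nz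
    nz nz nz nz nz nz vM_nn vM_zero
    (fun n => pz) (fun n _ => loe (by rw [zero_sub, rpow_neg_one]; simp))
    (fun k => by simpa using vM_dyad k)
  refine ⟨h1, h2.trans (loe ?_)⟩
  rw [rpow_zero]; simp; ring

lemma P2 : Summable fun n:ℕ => vM n*(lg n-vM n)*(n:ℝ)⁻¹ := by
  obtain ⟨C, hC, h⟩ := dy
  obtain ⟨D, hD⟩ := Chebyshev.psi_sub_theta_le_mul_sqrt
  set c:ℕ → ℝ := fun n => (if n.Prime then 0 else vM n)*(lg n*√n)
  have hc : ∀ n,0 ≤ c n := fun n => mul_nonneg (by split_ifs; exacts [le_rfl, vM_nn n]) (mul_nonneg (log_natCast_nonneg n) (sqrt_nonneg _))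
  have hl := log_pos (nz : rl1 <2)
  have hl1 : lg 2 <1 := ltl.trans nz
  obtain ⟨h1, -⟩ := h (y :=0) (s :=1) (θ :=1/2) (κ :=1) (A :=2 * |D|) (M :=1) (c := c) (f := fun n => (√n)⁻¹*(n:ℝ)⁻¹) le_rfl nz nz
    nz nz nz nz pz nz hc (by simp [c])
    (fun n => pz) (fun n hn => loe (by
      have hn' : rl0<n := pz
      rw [sqrt_eq_rpow, ← rpow_neg hn'.le, zero_sub, abs_neg, aon (log_natCast_nonneg n), neg_one_mul, Real.exp_neg, rel hn']
      norm_num)) (fun k => by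
      have e := Chebyshev.psi_sub_theta_eq_sum_not_prime ((2^(k+1):ℕ):ℝ)
      have e2 := hD ((2^(k+1):ℕ):ℝ)
      rw [e, Nat.floor_natCast, sum_filter] at e2
      set q := √((2^(k+1):ℕ):ℝ)
      have q0 :0 ≤ q := sqrt_nonneg _
      have hq : q*q =2*2^k := by rw [mul_self_sqrt pz]; push_cast; ring
      have e3 : ∑ n ∈ Finset.Ico (2^k) (2^(k+1)), (if n.Prime then 0 else vM n) ≤ |D| * q := by
        refine le_trans ?_ (e2.trans (mlo (las D) q0))
        simp only [ite_not]
        refine slo (fun n hn => ?_)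
          fun n _ _ => by split_ifs; exacts [le_rfl, vM_nn n]
        rw [fmi] at hn
        exact Finset.mem_Ioc.2 ⟨by have := Nat.pos_of_neZero (2^k); omega, hn.2.le⟩
      calc _ ≤ ∑ n ∈ Finset.Ico (2^k) (2^(k+1)), (if n.Prime then 0 else vM n)*(((k:ℝ)+1)*q) := by
            refine sls fun n hn => mlm ?_
              (by split_ifs; exacts [le_rfl, vM_nn n])
            rw [fmi] at hn
            have hn0 :0<n := by have := Nat.pos_of_neZero (2^k); omega
            have : lg n ≤ lg (rl2^(k+1)) :=
              lll (by exact_mod_cast hn0) (by exact_mod_cast hn.2.le)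
            rw [log_pow] at this
            push_cast at this
            refine mmm (by nlinarith [ncn (α := ℝ) k]) (sqrt_le_sqrt (by exact_mod_cast hn.2.le)) (sqrt_nonneg _) pz
        _ ≤ |D| * q*(((k:ℝ)+1)*q) := by rw [← sum_mul]; exact mlo e3 pz
        _ = |D| * (k+1)*(q*q) := by ring
        _=_ := by rw [hq, rpow_one]; ring)
  refine son (fun n => mul_nonneg (mul_nonneg (vM_nn n) (sub_nonneg.2 avl)) pz) (fun n => ?_) h1
  rcases eq_or_ne n 0 with rfl | hn
  · simp
  have hs : √(n:ℝ) ≠0 := (sqrt_pos.2 pz).ne'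
  by_cases hp : n.Prime
  · simp [c, hp, vM, ArithmeticFunction.vonMangoldt_apply_prime hp]
  · simp only [c, hp, if_false]
    rw [show vM n*(lg n*√n)*((√n)⁻¹*(n:ℝ)⁻¹)=vM n*lg n*(n:ℝ)⁻¹*(√n*(√n)⁻¹) by ring, mul_inv_cancel₀ hs, mul_one]
    have := vM_nn n
    gcongr
    linarith

lemma Jsum : ∃ C >0, ∀ y:ℝ,0<y → |∑' n:ℕ, vM n*((n:ℝ)⁻¹*ek y n)-1| ≤ C/y := by
  obtain ⟨c, hc, hzf⟩ := zero_free
  set Z := ∑' ρ:ℂ, mz ρ*(1 + ‖ρ-2‖)^m74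
  have hZ :0 ≤ Z := tsum_nonneg fun ρ => mul_nonneg (mz_nonneg ρ) pz
  set D :=8*(1/c+1)*40
  refine ⟨‖LL (-1)‖ + D*Z+1, pz, fun y hy => ?_⟩
  have hz1 : riemannZeta₁ (((1:ℂ))-(rl2:ℂ)) ≠0 := by
    intro h
    have h1 : mz (-1) ≠0 := by
      intro h0
      rw [mz, Nat.cast_eq_zero] at h0
      have h2 := (zeta1_order_ne_top (-1)).lt_top
      norm_num at h
      have h3 := (ddr.analyticAt (-1)).analyticOrderAt_ne_zero.2 h
      rw [← nca h2.ne, h0] at h3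
      simp at h3
    rcases mz_cases h1 with h2 | ⟨k, hk⟩
    · norm_num at h2
    · have := congrArg re hk
      simp at this
      have : rl2*(k+1) =1 := lz
      have :2*(k+1) =1 := by exact_mod_cast this
      omega
  have h := EF (y := y) (κ :=2) (c :=1) (w :=1) hy.le nz nz sz hz1
    nz
  have hb : ∀ ρ:ℂ, ‖(mz ρ:ℂ)*(cex ((ρ-1)*y)*(2*(rl2:ℂ)/((rl2:ℂ)^2-(ρ-1)^2)))‖ ≤ mz ρ*(1 + ‖ρ-2‖)^m74*(D/y) := by
    intro ρ
    by_cases h0 : mz ρ =0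
    · simp [h0]
    set X :=1 + ‖ρ-2‖
    have hX :1 ≤ X := by simp [X]
    have hX4 :1 ≤ X^q14 := olr hX nz
    have key : ρ.re <1 ∧ 1 ≤ ‖1+ρ‖ ∧ 1 ≤8*(1/c+1)*X^q14*(1-ρ.re) := by
      rcases mz_cases h0 with hs | ⟨k, hk⟩
      · refine ⟨hs.2, ?_, ?_⟩
        · have := arl (1+ρ)
          simp at this
          rw [aop lz] at this; linarith
        · have h1 := hzf ρ (by rw [mn, if_pos hs]; exact h0)
          have h2 := ail (ρ-2)
          simp at h2
          have h3 := log_le_rpow_div (x := |ρ.im| +2) pz (nz : rl0 <1/4)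
          have h4 : (|ρ.im| +2)^q14 ≤2*X^q14 := by
            calc _ ≤ (2*X)^q14 := rpow_le_rpow pz (by simp only [X]; linarith [norm_nonneg (ρ-2)]) nz
              _ =2^q14*X^q14 := mul_rpow nz lz
              _ ≤ _ := by
                have : rl2^q14 ≤2 := by simpa using rlr (nz : rl1 ≤2) (nz : q14 ≤1)
                gcongr
          have h5 : c ≤ (1-ρ.re)*(8*X^q14) :=
            h1.trans (mlm lz (by linarith [hs.2]))
          have h6 :0 ≤ (1-ρ.re)*(8*X^q14) := hc.le.trans h5
          calc rl1 =1/c*c := by field_simp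
            _ ≤1/c*((1-ρ.re)*(8*X^q14)) := by gcongr
            _ ≤ _ := lz
      · have hre : ρ.re = -2*(k+1) := by rw [hk]; simp
        have hk0 := ncn (α := ℝ) k
        refine ⟨lz, ?_, ?_⟩
        · have := arl (1+ρ)
          simp only [add_re, one_re, hre] at this
          rw [abs_of_nonpos lz] at this; linarith
        · have :0 <1/c := pz
          calc rl1 ≤8*(0+1)*1*(1-0) := nz
            _ ≤ _ := by gcongr; linarith
    obtain ⟨k1, k2, k3⟩ := key
    have hd :0 <1-ρ.re := lz
    have n1 : X ≤2 * ‖3-ρ‖ := by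
      have := arl (3-ρ)
      simp at this
      rw [aop lz] at this
      have h2 := nsl (3-ρ) 1
      rw [show (3-ρ-1:ℂ) = -(ρ-2) by ring, norm_neg, norm_one] at h2
      simp only [X]; linarith
    have n2 : X ≤5 * ‖1+ρ‖ := by
      have h2 := nsl (1+ρ) 3
      rw [show (1+ρ-3:ℂ)=ρ-2 by ring] at h2
      norm_num at h2
      simp only [X]; linarith
    have hE : ‖cex ((ρ-1)*y)‖ ≤8*(1/c+1)*X^q14/y := by
      rw [norm_exp]
      simp only [mul_re, sub_re, one_re, ofReal_re, ofReal_im, mul_zero, sub_zero]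
      have h1 : ex ((ρ.re-1)*y) ≤1/((1-ρ.re)*y) := by
        rw [show (ρ.re-1)*y = -((1-ρ.re)*y) by ring, Real.exp_neg, ← one_div]
        exact odl pz (by linarith [aol ((1-ρ.re)*y)])
      refine h1.trans ?_
      rw [dld pz hy]
      calc _ =1*y := rfl
        _ ≤ (8*(1/c+1)*X^q14*(1-ρ.re))*y := by gcongr
        _=_ := by ring
    have hW : ‖(2*(rl2:ℂ)/((rl2:ℂ)^2-(ρ-1)^2))‖ ≤40*X^(-2:ℝ) := by
      rw [show ((rl2:ℂ)^2-(ρ-1)^2)=(3-ρ)*(1+ρ) by push_cast; ring, norm_div, norm_mul, norm_mul]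
      rw [rpow_neg lz, rpow_two, ← dem]
      norm_num
      have :0 < ‖3-ρ‖ := lz
      rw [dld pz pz]
      nlinarith [mmm n1 n2 lz pz]
    rw [norm_mul, norm_mul, norm_real, non (mz_nonneg ρ)]
    calc _ ≤ mz ρ*(8*(1/c+1)*X^q14/y*(40*X^(-2:ℝ))) :=
          mlm (mmm hE hW nnz pz) (mz_nonneg ρ)
      _ = mz ρ*(X^q14*X^(-2:ℝ))*(D/y) := by simp only [D]; ring
      _=_ := by rw [← rpow_add lz]; norm_num
  have hnorm := ton (mz_summable.hasSum.mul_right (D/y)) hb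
  rw [h.tsum_eq] at hnorm
  have hT : (∑' n:ℕ, (vm n:ℂ)*((n:ℂ)^(-1:ℂ)*cex (-(rl2:ℂ) * dl y n)))=((∑' n:ℕ, vM n*((n:ℝ)⁻¹*ek y n):ℝ):ℂ) := by
    rw [ofReal_tsum]
    refine tsum_congr fun n => ?_
    push_cast
    rw [cpow_neg_one]
  rw [hT] at hnorm
  set J := ∑' n:ℕ, vM n*((n:ℝ)⁻¹*ek y n)
  have e1 : ((J-1:ℝ):ℂ) = -(cex ((1-1)*y)*(2*(rl2:ℂ)/((rl2:ℂ)^2-(1-1)^2))-cex (-(rl2:ℂ)*y)*LL (1-(rl2:ℂ))-J)-cex (-(rl2:ℂ)*y)*LL (1-(rl2:ℂ)) := by push_cast; simp; norm_num; ring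
  have e2 : ‖cex (-(rl2:ℂ)*y)‖ ≤1/y := by
    rw [norm_exp, show (-(rl2:ℂ)*y)=((-(2*y):ℝ):ℂ) by push_cast; ring, ofReal_re, Real.exp_neg, ← one_div]
    exact odl hy (by linarith [aol (2*y)])
  rw [← nea, ← norm_real, e1]
  refine (nsl _ _).trans ?_
  rw [norm_neg, norm_mul, show (1-(rl2:ℂ)) = -1 by norm_num] at *
  calc _ ≤ Z*(D/y)+1/y * ‖LL (-1)‖ := ala hnorm (mlo e2 nnz)
    _ ≤ Z*(D/y)+1/y * ‖LL (-1)‖ +1/y := by have :0 <1/y := pz; linarith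
    _=_ := by ring

lemma G2 : ∃ C >0, ∀ y:ℝ,0 ≤ y → Summable (fun n => aa y n^2) ∧ |∑' n, aa y n^2-y| ≤ C := by
  obtain ⟨C1, hC1, hJ⟩ := Jsum
  obtain ⟨C2, hC2, hP⟩ := P1
  have hP2 := P2
  have hp2 : ∀ n:ℕ,0 ≤ vM n*(lg n-vM n)*(n:ℝ)⁻¹ := fun n => mul_nonneg (mul_nonneg (vM_nn n) (sub_nonneg.2 avl)) pz
  set Z := ∑' n:ℕ, vM n*(lg n-vM n)*(n:ℝ)⁻¹
  have hZ :0 ≤ Z := tsum_nonneg hp2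
  refine ⟨C1+C2+Z, pz, fun y hy => ?_⟩
  obtain ⟨s1, b1⟩ := hP y hy
  set j:ℕ → ℝ := fun n => vM n*((n:ℝ)⁻¹*ek y n) with hj
  have sj : Summable j := son (fun n => mul_nonneg (vM_nn n) pz) (fun n => by
    refine mlm (mlm (ele.2 ?_) pz) (vM_nn n)
    linarith [abs_nonneg (y-lg n)]) s1
  have hd : ∀ n, ‖aa y n^2-y*j n‖ ≤ vM n*((n:ℝ)⁻¹*ex (-dl y n))+vM n*(lg n-vM n)*(n:ℝ)⁻¹ := by
    intro n
    rcases eq_or_ne n 0 with rfl | hn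
    · simp [aa, hj]
    have hn' : rl0<n := pz
    set u := dl y n with hu
    have e1 : aa y n^2=vM n^2*((n:ℝ)⁻¹*ex (-2*u)) := by
      rw [aa, mul_pow, mul_pow, ← rrn ((n:ℝ)^_), ← rpow_mul hn'.le, ← ren]
      norm_num [rpow_neg_one, ← hu]
    have e2 : aa y n^2-y*j n=vM n*(n:ℝ)⁻¹*((lg n-y)*ex (-2*u))-vM n*(lg n-vM n)*(n:ℝ)⁻¹*ex (-2*u) := by rw [e1, hj]; ring
    have e3 : u*ex (-2*u) ≤ ex (-u) := by
      rw [show-2*u = -u + -u by ring, rea]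
      have : u*ex (-u) ≤1 := by
        rw [Real.exp_neg, ← dem, div_le_one epz]
        linarith [aol u]
      nlinarith [exp_pos (-u)]
    rw [e2]
    refine (nsl _ _).trans (ala ?_ ?_)
    · rw [norm_mul, norm_mul, norm_mul, non (vM_nn n), non (pz :0 ≤ (n:ℝ)⁻¹), non (exp_pos _).le, nea, abs_sub_comm, ← mul_assoc (vM n)]
      exact mlm e3 (mul_nonneg (vM_nn n) pz)
    · rw [norm_mul, non (hp2 n), non (exp_pos _).le]
      refine mul_le_of_le_one_right (hp2 n) ?_
      rw [exp_le_one_iff]; linarith [abs_nonneg (y-lg n)]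
  have sd := sob (s1.add hP2) hd
  have hb := ton (s1.add hP2).hasSum hd
  have sa : Summable fun n => aa y n^2 := by simpa using sd.add (sj.mul_left y)
  refine ⟨sa, ?_⟩
  rw [sa.tsum_sub (sj.mul_left y), tml, s1.tsum_add hP2, nea] at hb
  have h3 : |y*∑' n, j n-y| ≤ C1 := by
    rcases hy.eq_or_lt with rfl | hy'
    · simpa using hC1.le
    · have := hJ y hy'
      rw [le_div_iff₀ hy'] at this
      rw [show y*∑' n, j n-y=(∑' n, j n-1)*y by ring, abs_mul, aop hy']
      exact this
  have := abs_add_le (∑' n, aa y n^2-y*∑' n, j n) (y*∑' n, j n-y)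
  rw [sub_add_sub_cancel] at this
  linarith

lemma bonf (S : Finset ℕ) (m:ℕ) : (if S=∅ then rl1 else 0) ≤ ∑ D ∈ S.powerset, if D.card ≤2 * m then (-1:ℝ)^D.card else 0 := by
  have h := sum_powerset_apply_card (fun j => if j ≤2 * m then (-1:ℝ)^j else 0) (x := S)
  rw [h]
  rcases S.eq_empty_or_nonempty with rfl | hS
  · simp
  rw [if_neg hS.ne_empty]
  obtain ⟨n, hn⟩ := Nat.exists_eq_succ_of_ne_zero hS.card_pos.ne'
  rw [hn]
  have e : ∑ j ∈ Fr (n+1+1), (n+1).choose j • (if j ≤2 * m then (-1:ℝ)^j else 0)=∑ j ∈ Fr (2 * m+1), (-1:ℝ)^j*(n+1).choose j := by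
    have e1 : ∀ j, (n+1).choose j • (if j ≤2 * m then (-1:ℝ)^j else 0)=if j ∈ Fr (2 * m+1) then (-1:ℝ)^j*(n+1).choose j else 0 := by intro j; simp only [fmr, Nat.lt_succ_iff]; split_ifs <;> simp [mul_comm]
    simp only [e1]
    rw [sum_ite_mem, Finset.inter_comm, ← sum_ite_mem]
    refine sum_congr rfl fun j _ => ?_
    split_ifs with hj
    · rfl
    · rw [Nat.choose_eq_zero_of_lt (by simp at hj; omega)]; simp
  have h2 := Int.alternating_sum_range_choose_eq_choose (n := n) (m :=2 * m)
  rw [Nat.succ_eq_add_one, e]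
  have h3 : (∑ j ∈ Fr (2 * m+1), (-1:ℝ)^j*(n+1).choose j)=n.choose (2 * m) := by
    have := congrArg (fun z : ℤ => (z:ℝ)) h2
    push_cast at this
    simpa using this
  rw [h3]; positivity

lemma crt_count {d e r N:ℕ} (h : d.Coprime e) (hd :0<d) (he :0<e) :
    |(((Fr N).filter fun n => d ∣ n ∧ e ∣ n+r).card:ℝ)-N/(d*e)| ≤1 := by
  obtain ⟨v, hv1, hv2⟩ := Nat.chineseRemainder h 0 ((e-1)*r)
  have hiff : ∀ n, (d ∣ n ∧ e ∣ n+r) ↔ n ≡ v [MOD d*e] := by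
    intro n
    rw [← Nat.modEq_and_modEq_iff_modEq_mul h, ← Nat.modEq_zero_iff_dvd, ← Nat.modEq_zero_iff_dvd]
    have h0 : (e-1)*r+r ≡ 0 [MOD e] := by
      rw [Nat.modEq_zero_iff_dvd]
      exact ⟨r, by obtain ⟨e', rfl⟩ := Nat.exists_eq_add_of_le' he; simp; ring⟩
    constructor
    · rintro ⟨a, b⟩
      exact ⟨a.trans hv1.symm, (Nat.ModEq.add_right_cancel' r (b.trans h0.symm)).trans hv2.symm⟩
    · rintro ⟨a, b⟩
      exact ⟨a.trans hv1, ((b.trans hv2).add_right r).trans h0⟩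
  have hde :0<d*e := Nat.mul_pos hd he
  have hc := Nat.count_modEq_card (b := N) hde v
  rw [Nat.count_eq_card_filter_range] at hc
  simp only [hiff]
  rw [hc]
  have hN : (N:ℝ)=(d*e)*(N/(d*e):ℕ)+(N % (d*e):ℕ) := by exact_mod_cast (Nat.div_add_mod N (d*e)).symm
  have hlt : ((N % (d*e):ℕ):ℝ)<d*e := by exact_mod_cast Nat.mod_lt N hde
  have hp : rl0<d*e := by exact_mod_cast hde
  have h1 : (N:ℝ)/(d*e)=(N/(d*e):ℕ)+(N % (d*e):ℕ)/(d*e:ℝ) := by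
    nth_rewrite 1 [hN]; field_simp
  have h2 : ((N % (d*e):ℕ):ℝ)/(d*e:ℝ) ≤1 := by rw [div_le_one hp]; exact hlt.le
  have h3 :0 ≤ ((N % (d*e):ℕ):ℝ)/(d*e:ℝ) := pz
  rw [h1, abs_le]
  push_cast at h2 h3 ⊢
  split_ifs <;> constructor <;> push_cast <;> linarith

lemma prod_ind (D : Finset ℕ) (hD : ∀ p ∈ D, p.Prime) (n:ℕ) : (∏ p ∈ D, if p ∣ n then rl1 else 0)=if (∏ p ∈ D, p) ∣ n then 1 else 0 := by
  by_cases h : ∀ p ∈ D, p ∣ n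
  · rw [if_pos (prod_primes_dvd n (fun p hp => (hD p hp).prime) h), prod_congr rfl (fun p hp => if_pos (h p hp)), prod_const_one]
  · push Not at h
    obtain ⟨p, hp, hpn⟩ := h
    rw [prod_eq_zero hp (if_neg hpn), if_neg fun h => hpn ((dvd_prod_of_mem _ hp).trans h)]

lemma sieve_D {D : Finset ℕ} (hD : ∀ p ∈ D, p.Prime) (r N:ℕ) :
    |∑ n ∈ Fr N, ∏ p ∈ D, ((if p ∣ n then rl1 else 0)+if p ∣ n+r then 1 else 0) - N*∏ p ∈ D, (2/p:ℝ)| ≤2^D.card := by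
  have e1 : ∑ n ∈ Fr N, ∏ p ∈ D, ((if p ∣ n then rl1 else 0)+if p ∣ n+r then 1 else 0) = ∑ t ∈ D.powerset, (((Fr N).filter fun n => (∏ p ∈ t, p) ∣ n ∧ (∏ p ∈ D \ t, p) ∣ n+r).card:ℝ) := by
    simp only [prod_add]
    rw [sum_comm]
    refine sum_congr rfl fun t ht => ?_
    rw [card_filter, Nat.cast_sum]
    refine sum_congr rfl fun n _ => ?_
    rw [fmp] at ht
    rw [prod_ind t (fun p hp => hD p (ht hp)), prod_ind (D \ t) fun p hp => hD p (Finset.sdiff_subset hp)]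
    by_cases h1 : (∏ p ∈ t, p) ∣ n <;> by_cases h2 : (∏ p ∈ D \ t, p) ∣ n+r <;> simp [h1, h2]
  have e2 : (N:ℝ)*∏ p ∈ D, (2/p:ℝ)=∑ t ∈ D.powerset, (N:ℝ)/((∏ p ∈ t, (p:ℝ))*∏ p ∈ D \ t, (p:ℝ)) := by
    rw [sum_congr rfl (g := fun _ => (N:ℝ)/∏ p ∈ D, (p:ℝ)) fun t ht => by rw [mul_comm, prod_sdiff (fmp.1 ht)], sum_const, card_powerset, prod_div_distrib, prod_const, nsmul_eq_mul]
    push_cast; ring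
  rw [e1, e2, ← sum_sub_distrib]
  refine (abs_sum_le_sum_abs _ _).trans ?_
  calc _ ≤ ∑ t ∈ D.powerset, rl1 := sls fun t ht => by
        rw [fmp] at ht
        have h := crt_count (d := ∏ p ∈ t, p) (e := ∏ p ∈ D \ t, p) (r := r) (N := N) (Nat.Coprime.prod_left fun p hp => Nat.Coprime.prod_right fun q hq => by
            rw [Finset.mem_sdiff] at hq
            exact (Nat.coprime_primes (hD p (ht hp)) (hD q hq.1)).2 fun h => hq.2 (h ▸ hp))
          (prod_pos fun p hp => (hD p (ht hp)).pos)
          (prod_pos fun p hp => (hD p (Finset.sdiff_subset hp)).pos)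
        push_cast at h
        exact h
    _=_ := by simp

lemma sieve_count {P : Finset ℕ} (hP : ∀ p ∈ P, p.Prime) {r:ℕ} (hr : ∀ p ∈ P, ¬ p ∣ r) {Z:ℝ} (hZ :1 ≤ Z) (hPZ : (P.card:ℝ) ≤ Z) (N m:ℕ) : (((Fr N).filter fun n => ∀ p ∈ P, ¬ p ∣ n ∧ ¬ p ∣ n+r).card:ℝ) ≤ N*(ex (-2*∑ p ∈ P, (1/p:ℝ))+(1/4) ^ m*ex (4*∑ p ∈ P, (1/p:ℝ)))+(2*Z)^(2 * m)*ex 1 := by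
  classical
  set g:ℕ → ℕ → ℝ := fun p n => (if p ∣ n then rl1 else 0)+if p ∣ n+r then 1 else 0 with hg
  set μ : Finset ℕ → ℝ := fun D => if D.card ≤2 * m then (-1:ℝ)^D.card else 0 with hμ
  have s1 : ∀ n, (if ∀ p ∈ P, ¬ p ∣ n ∧ ¬ p ∣ n+r then rl1 else 0) ≤ ∑ D ∈ P.powerset, μ D*∏ p ∈ D, g p n := by
    intro n
    set S := P.filter fun p => p ∣ n ∨ p ∣ n+r
    have hS : S=∅ ↔ ∀ p ∈ P, ¬ p ∣ n ∧ ¬ p ∣ n+r := by rw [filter_eq_empty_iff]; simp only [not_or]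
    have h1 := bonf S m
    simp only [hS] at h1
    refine h1.trans (loe ?_)
    rw [← sum_subset (Finset.powerset_mono.2 (filter_subset _ _ : S ⊆ P))]
    · refine sum_congr rfl fun D hD => ?_
      rw [prod_eq_one, mul_one]
      intro p hp
      have hpS := mem_filter.1 (fmp.1 hD hp)
      simp only [hg]
      by_cases h2 : p ∣ n
      · rw [if_pos h2, if_neg fun h => hr p hpS.1 ((Nat.dvd_add_right h2).1 h), add_zero]
      · rw [if_neg h2, if_pos (hpS.2.resolve_left h2), zero_add]
    · intro D hD hDS
      rw [fmp] at hD hDS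
      obtain ⟨p, hp, hpS⟩ := Finset.not_subset.1 hDS
      have : ¬ (p ∣ n ∨ p ∣ n+r) := fun h => hpS (mem_filter.2 ⟨hD hp, h⟩)
      rw [not_or] at this
      rw [prod_eq_zero hp (by simp [hg, this]), mul_zero]
  have hμ1 : ∀ D, |μ D| ≤1 := fun D => by simp only [hμ]; split_ifs <;> simp
  have s2 : (((Fr N).filter fun n => ∀ p ∈ P, ¬ p ∣ n ∧ ¬ p ∣ n+r).card:ℝ) ≤ ∑ D ∈ P.powerset, (μ D*(N*∏ p ∈ D, (2/p:ℝ)) + |μ D| *2^D.card) := by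
    rw [card_filter, Nat.cast_sum]
    simp only [Nat.cast_ite, Nat.cast_one, Nat.cast_zero]
    refine (sls fun n _ => s1 n).trans ?_
    rw [sum_comm]
    refine sls fun D hD => ?_
    rw [← mul_sum]
    have h := sieve_D (fun p hp => hP p (fmp.1 hD hp)) r N
    have h2 := mlm h (abs_nonneg (μ D))
    rw [← abs_mul] at h2
    have := las (μ D*(∑ n ∈ Fr N, ∏ p ∈ D, g p n-N*∏ p ∈ D, (2/p:ℝ)))
    simp only [hg] at this ⊢
    linarith
  refine s2.trans ?_
  rw [sad]
  have hm4 : (rl1/4) ^ m=(1/2)^(2 * m) := by rw [pow_mul]; norm_num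
  refine ala ?_ ?_
  · have t1 : ∀ D ∈ P.powerset, μ D*(N*∏ p ∈ D, (2/p:ℝ)) ≤ N*(∏ p ∈ D, (-(2/p):ℝ)+(1/4) ^ m*∏ p ∈ D, (4/p:ℝ)) := by
      intro D hD
      have a1 : ∏ p ∈ D, (-(2/p):ℝ)=(-1)^D.card*∏ p ∈ D, (2/p:ℝ) := by rw [prod_neg]
      have a2 : ∏ p ∈ D, (4/p:ℝ) =2^D.card*∏ p ∈ D, (2/p:ℝ) := by
        rw [← prod_const, ← prod_mul_distrib]
        exact prod_congr rfl fun p _ => by ring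
      have a3 :0 ≤ ∏ p ∈ D, (2/p:ℝ) := prod_nonneg fun p _ => pz
      rw [a1, a2]
      set Q := ∏ p ∈ D, (2/p:ℝ)
      have a4 : μ D ≤ (-1)^D.card+(1/4) ^ m*2^D.card := by
        simp only [hμ]
        split_ifs with h
        · have : rl0 ≤ (1/4) ^ m*2^D.card := pz
          linarith
        · have b1 : rl1 ≤ (1/4) ^ m*2^D.card := by
            rw [hm4]
            calc rl1=(1/2)^(2 * m)*2^(2 * m) := by rw [← mul_pow]; norm_num
              _ ≤ _ := by gcongr; · norm_num
                          · omega
          have b2 := neg_abs_le ((-1:ℝ)^D.card)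
          simp at b2
          linarith
      have := mlo a4 (mul_nonneg (ncn (α := ℝ) N) a3)
      linarith
    refine (sls t1).trans ?_
    rw [← mul_sum, sad, ← mul_sum, ← prod_one_add, ← prod_one_add]
    gcongr
    · rw [mul_sum, Real.exp_sum]
      refine Finset.prod_le_prod (fun p hp => ?_) fun p hp => ?_
      · have : rl2 ≤ p := by exact_mod_cast (hP p hp).two_le
        have : rl2/p ≤1 := by rw [div_le_one lz]; exact this
        linarith
      · have := aol (-2*(1/p:ℝ))
        calc _ = -2*(1/p:ℝ)+1 := by ring
          _ ≤ _ := this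
    · refine (prod_one_add_le_exp_sum P fun p => pz).trans (loe ?_)
      rw [mul_sum]; congr 1
      exact sum_congr rfl fun p _ => by ring
  · have t2 : ∀ D ∈ P.powerset, |μ D| *2^D.card ≤ (2*Z)^(2 * m)*∏ p ∈ D, (1/Z) := by
      intro D _
      rw [prod_const]
      simp only [hμ]
      split_ifs with h
      · rw [abs_pow, abs_neg, abs_one, one_pow, one_mul]
        calc rl2^D.card=(2*Z)^D.card*(1/Z)^D.card := by rw [← mul_pow]; congr 1; field_simp
          _ ≤ _ := by gcongr; linarith
      · simp; positivity
    refine (sls t2).trans ?_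
    rw [← mul_sum, ← prod_one_add]
    gcongr
    refine (prod_one_add_le_exp_sum P fun p => pz).trans (ele.2 ?_)
    rw [sum_const, nsmul_eq_mul, mul_one_div, div_le_one lz]
    exact hPZ

lemma poly_exp (n:ℕ) : ∃ C:ℝ,0<C ∧ ∀ u:ℝ,0 ≤ u → u^n ≤ C*ex u :=
  ⟨n.factorial, by exact_mod_cast n.factorial_pos, fun u hu => by
    have h := pow_div_factorial_le_exp u hu n
    have h1 : rl0<n.factorial := by exact_mod_cast n.factorial_pos
    rw [dli h1] at h; linarith⟩

lemma mert_lower {N:ℕ} (hN :2 ≤ N) : lg N ≤ ex (∑ p ∈ N.primesBelow, (1/p:ℝ)+1) := by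
  let f:ℕ →* ℝ := { toFun := fun n => (n:ℝ)⁻¹, map_one' := by simp, map_mul' := fun a b => by push_cast; rw [mul_inv] }
  have hf : ∀ n, f n=(n:ℝ)⁻¹ := fun _ => rfl
  obtain ⟨h1, h2⟩ := EulerProduct.summable_and_hasSum_smoothNumbers_prod_primesBelow_geometric (f := f) (fun {p} hp => by
      rw [hf, norm_inv, RCLike.norm_natCast]
      exact inv_lt_one_of_one_lt₀ (by exact_mod_cast hp.one_lt)) N
  have h3 : lg N ≤ ∏ p ∈ N.primesBelow, (1-f p)⁻¹ := by
    have a1 := log_add_one_le_harmonic (N-1)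
    rw [Nat.sub_add_cancel oz, harmonic_eq_sum_Icc] at a1
    push_cast at a1
    refine a1.trans ?_
    have hm : ∀ n ∈ Finset.Icc 1 (N-1), n ∈ N.smoothNumbers := fun n hn => by
      rw [Finset.mem_Icc] at hn
      exact Nat.mem_smoothNumbers_of_lt oz oz
    have a2 := sum_le_hasSum ((Finset.Icc 1 (N-1)).subtype (· ∈ N.smoothNumbers)) (fun i _ => by rw [hf]; positivity) h2
    refine le_trans (loe ?_) a2
    rw [sum_subtype_of_mem (fun n => f n) hm]
    rfl
  refine h3.trans ?_
  have h4 : ∀ p ∈ N.primesBelow, (1-f p)⁻¹ ≤ ex (1/p+(1/((p:ℝ)-1)-1/p)) := fun p hp => by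
    have hp2 : rl2 ≤ p := by exact_mod_cast (npo hp).two_le
    have : (1-f p)⁻¹ =1/((p:ℝ)-1)+1 := by
      rw [hf]; have : (p:ℝ)-1 ≠0 := by linarith
      field_simp; ring
    rw [this]
    refine (aol _).trans (loe (by ring_nf))
  refine (Finset.prod_le_prod (fun p hp => ?_) h4).trans ?_
  · have hp2 : rl2 ≤ p := by exact_mod_cast (npo hp).two_le
    rw [hf, inv_nonneg, sub_nonneg]; exact inv_le_one_of_one_le₀ lz
  · rw [← Real.exp_sum, sad]
    refine ele.2 (add_le_add_right ?_ _)
    have hsub : N.primesBelow ⊆ Finset.Ico 2 N := fun p hp => by rw [Nat.mem_primesBelow] at hp; rw [fmi]; exact ⟨hp.2.two_le, hp.1⟩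
    refine (slo hsub fun n hn _ => ?_).trans ?_
    · rw [fmi] at hn
      have : rl2 ≤ n := by exact_mod_cast hn.1
      rw [sub_nonneg]; exact odl lz lz
    · have : ∀ M:ℕ,2 ≤ M → ∑ n ∈ Finset.Ico 2 M, (1/((n:ℝ)-1)-1/n) =1-1/((M:ℝ)-1) := fun M hM => by
        induction M, hM using Nat.le_induction with
        | base => norm_num
        | succ k hk ih => rw [sum_Ico_succ_top hk, ih]; push_cast; ring
      rw [this N hN]
      have : rl2 ≤ N := by exact_mod_cast hN
      linarith [show 0 ≤1/((N:ℝ)-1) from div_nonneg zlo lz]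

lemma mert_upper (Y:ℕ) (hY :1 ≤ Y) : ∑ p ∈ Nat.primesBelow (2^Y), (1/(p:ℝ)) ≤36*(1+lg Y) := by
  have key : ∀ Y:ℕ,1 ≤ Y → ∑ p ∈ Nat.primesBelow (2^Y), (1/(p:ℝ)) ≤36*∑ k ∈ Finset.Icc 1 Y, (k:ℝ)⁻¹ := fun Y hY => by
    induction Y, hY using Nat.le_induction with
    | base =>
      rw [show Nat.primesBelow (2^1)=∅ by decide]; simp
    | succ k hk ih =>
      have hs : Nat.primesBelow (2^(k+1)) ⊆ Nat.primesBelow (2^k) ∪ ((Finset.Ico (2^k) (2^(k+1))).filter Nat.Prime) := fun p hp => by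
        rw [Nat.mem_primesBelow] at hp
        rw [Finset.mem_union, Nat.mem_primesBelow, mem_filter, fmi]
        rcases lt_or_ge p (2^k) with h | h
        · exact Or.inl ⟨h, hp.2⟩
        · exact Or.inr ⟨⟨h, hp.1⟩, hp.2⟩
      have hnn : ∀ p ∈ Nat.primesBelow (2^k) ∪ ((Finset.Ico (2^k) (2^(k+1))).filter Nat.Prime), p ∉ Nat.primesBelow (2^(k+1)) → rl0 ≤1/p :=
        fun p _ _ => pz
      refine (slo hs hnn).trans ?_
      have hu := sum_union_inter (s₁ := Nat.primesBelow (2^k)) (s₂ := (Finset.Ico (2^k) (2^(k+1))).filter Nat.Prime) (f := fun p:ℕ => (1/p:ℝ))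
      have hi : rl0 ≤ ∑ p ∈ Nat.primesBelow (2^k) ∩ ((Finset.Ico (2^k) (2^(k+1))).filter Nat.Prime), (1/p:ℝ) :=
        sum_nonneg fun p _ => pz
      rw [sum_Icc_succ_top oz]
      have hk0 : rl1 ≤ k := by exact_mod_cast hk
      have h2k : rl0 <2^k := pz
      have hb : ∑ p ∈ (Finset.Ico (2^k) (2^(k+1))).filter Nat.Prime, (1/p:ℝ) ≤36*((k+1:ℕ):ℝ)⁻¹ := by
        have hl2 : (0.69:ℝ)<lg 2 := by linarith [ltg]
        have a1 : ∀ p ∈ (Finset.Ico (2^k) (2^(k+1))).filter Nat.Prime, (1/p:ℝ) ≤ vM p*(1/(2^k*(k*lg 2))) := fun p hp => by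
          rw [mem_filter, fmi] at hp
          have hp1 : rl2^k ≤ p := by exact_mod_cast hp.1.1
          have : k*lg 2 ≤ lg p := by rw [← log_pow]; exact lll h2k hp1
          rw [show vM p=lg p from ArithmeticFunction.vonMangoldt_apply_prime hp.2, mul_one_div, dld lz pz, one_mul, mul_comm (lg p)]
          exact mmm hp1 this pz lz
        refine (sls a1).trans ?_
        rw [← sum_mul]
        have a2 := (slo (filter_subset Nat.Prime (Finset.Ico (2^k) (2^(k+1))))
          fun n _ _ => vM_nn n).trans (vM_dyad k)
        refine (mlo a2 pz).trans ?_
        push_cast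
        rw [mul_one_div, ← dem, dld pz pz]
        have :12*(k+1:ℝ) ≤36*(k*lg 2) := by nlinarith
        nlinarith
      linarith
  have h := hlo Y
  rw [harmonic_eq_sum_Icc] at h
  push_cast at h
  linarith [key Y hY]

lemma omega_sum {r:ℕ} (hr :1 ≤ r) : ∑ p ∈ r.primeFactors, (1/p:ℝ) ≤ lg (1+lg r)+3 := by
  have hr1 : rl1 ≤ r := by exact_mod_cast hr
  have hl := log_nonneg hr1
  set M := ⌊1+lg r⌋₊ with hM
  have hM1 :1 ≤ M := Nat.le_floor (by push_cast; linarith)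
  have hMl : (M:ℝ) ≤1+lg r := Nat.floor_le lz
  have hb : ∀ p ∈ r.primeFactors, (1/p:ℝ) ≤ (if p ∈ Finset.Icc 1 M then (p:ℝ)⁻¹ else 0)+1/(1+lg r) := fun p hp => by
    have h0 :0 ≤1/(1+lg r) := pz
    split_ifs with h
    · rw [one_div]; linarith
    · rw [Finset.mem_Icc, not_and_or] at h
      have hp1 := (Nat.prime_of_mem_primeFactors hp).one_lt
      have : M<p := by omega
      have :1+lg r<p := (Nat.floor_lt lz).1 this
      rw [zero_add]; exact odl lz this.le
  refine (sls hb).trans ?_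
  rw [sad, sum_const, ← sum_filter, nsmul_eq_mul]
  have a1 : ∑ p ∈ r.primeFactors.filter (· ∈ Finset.Icc 1 M), (p:ℝ)⁻¹ ≤1+lg (1+lg r) := by
    have h := hlo M
    rw [harmonic_eq_sum_Icc] at h
    push_cast at h
    refine (slo (t := Finset.Icc 1 M) (fun p hp => (mem_filter.1 hp).2) fun n _ _ => pz).trans (h.trans ?_)
    have := lll (by exact_mod_cast hM1) hMl
    linarith
  have a2 : (r.primeFactors.card:ℝ)*lg 2 ≤ lg r := by
    rw [← log_pow]
    refine lll pz ?_
    have h1 :2^r.primeFactors.card ≤ ∏ p ∈ r.primeFactors, p :=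
      pow_card_le_prod _ _ _ fun p hp => (Nat.prime_of_mem_primeFactors hp).two_le
    exact_mod_cast h1.trans (Nat.le_of_dvd oz (Nat.prod_primeFactors_dvd r))
  have a3 : (r.primeFactors.card:ℝ)*(1/(1+lg r)) ≤2 := by
    rw [mul_one_div, dli lz]
    have : (0.69:ℝ)<lg 2 := by linarith [ltg]
    have h0 : rl0 ≤ r.primeFactors.card := pz
    nlinarith
  linarith

lemma sieve_pt {K Y r:ℕ} (hK :1 ≤ K) (hr : r <2^K) {S : Finset ℕ} {P : Finset ℕ} (hP : P=(Nat.primesBelow (2^Y)).filter fun p => ¬ p ∣ r) (hS : S=(Fr (2^K)).filter fun n => ∀ p ∈ P, ¬ p ∣ n ∧ ¬ p ∣ n+r) :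
    ∑ n ∈ Fr (2^K), vM n*vM (n+r) ≤2*(K:ℝ)^2*(S.card+2*(2^Y*(K+2))) := by
  classical
  have hK1 : rl1 ≤ K := by exact_mod_cast hK
  set Q : Finset ℕ := (Fr (2^Y) ×ˢ Fr (K+2)).image fun z => z.1^z.2 with hQ
  have hQc : Q.card ≤2^Y*(K+2) := card_image_le.trans sz
  have hQm : ∀ p n, p ∈ P → p ∣ n → vM n ≠0 → n <2^(K+1) → n ∈ Q := fun p n hp hpn hn hlt => by
    rw [hP, mem_filter, Nat.mem_primesBelow] at hp
    have h1 : IsPrimePow n := ArithmeticFunction.vonMangoldt_ne_zero_iff.1 hn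
    obtain ⟨q, a, hq, ha, rfl⟩ := (isPrimePow_nat_iff n).1 h1
    have : p=q := (Nat.prime_dvd_prime_iff_eq hp.1.2 hq).1 (hp.1.2.dvd_of_dvd_pow hpn)
    subst this
    refine Finset.mem_image.2 ⟨(p, a), ?_, rfl⟩
    rw [mem_product, fmr, fmr]
    refine ⟨hp.1.1, ?_⟩
    have :2^a <2^(K+1) := lt_of_le_of_lt (Nat.pow_le_pow_left hq.two_le a) hlt
    have := (Nat.pow_lt_pow_iff_right (nz :1 <2)).1 this
    show a<K+2
    omega
  have hvM : ∀ n:ℕ, n <2^(K+1) → vM n ≤ K+1 := fun n hn => by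
    rcases nez n with rfl | h0
    · rw [show vM 0 =0 by simp]; positivity
    refine avl.trans ?_
    have h1 : lg n ≤ lg (2^(K+1)) := lll (by exact_mod_cast h0) (by exact_mod_cast hn.le)
    rw [log_pow] at h1; push_cast at h1
    have : lg 2 ≤1 := by linarith [ltl]
    nlinarith
  have hvM2 : ∀ n:ℕ, n <2^K → vM n ≤ K := fun n hn => by
    have := hvM
    rcases nez n with rfl | h0
    · rw [show vM 0 =0 by simp]; positivity
    refine avl.trans ?_
    have h1 : lg n ≤ lg (2^K) := lll (by exact_mod_cast h0) (by exact_mod_cast hn.le)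
    rw [log_pow] at h1
    have : lg 2 ≤1 := by linarith [ltl]
    nlinarith
  have pt : ∀ n ∈ Fr (2^K), vM n*vM (n+r) ≤2*(K:ℝ)^2*((if n ∈ S then 1 else 0)+((if n ∈ Q then 1 else 0)+if n+r ∈ Q then 1 else 0)) := fun n hn => by
    rw [fmr] at hn
    have hnr : n+r <2^(K+1) := by rw [pow_succ]; omega
    have hn' : n <2^(K+1) := by omega
    by_cases h0 : vM n*vM (n+r) =0
    · rw [h0]; positivity
    have h1 : vM n ≠0 := left_ne_zero_of_mul h0
    have h2 : vM (n+r) ≠0 := right_ne_zero_of_mul h0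
    have hb : vM n*vM (n+r) ≤2*(K:ℝ)^2*1 := by
      have := mmm (hvM2 n hn) (hvM _ hnr) (vM_nn _) pz
      nlinarith
    refine hb.trans (mlm ?_ pz)
    by_cases hq : n ∈ Q
    · rw [if_pos hq]
      have : rl0 ≤ if n ∈ S then 1 else 0 := pz
      have : rl0 ≤ if n+r ∈ Q then 1 else 0 := pz
      linarith
    by_cases hq2 : n+r ∈ Q
    · rw [if_pos hq2]
      have : rl0 ≤ if n ∈ S then 1 else 0 := pz
      have : rl0 ≤ if n ∈ Q then 1 else 0 := pz
      linarith
    have hs : n ∈ S := by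
      rw [hS, mem_filter, fmr]
      exact ⟨hn, fun p hp => ⟨fun h => hq (hQm p n hp h h1 hn'), fun h => hq2 (hQm p _ hp h h2 hnr)⟩⟩
    rw [if_pos hs, if_neg hq, if_neg hq2]; norm_num
  refine (sls pt).trans ?_
  rw [← mul_sum]
  refine mlm ?_ pz
  rw [sad, sad, two_mul]
  have hQr : (Q.card:ℝ) ≤2^Y*(K+2) := by exact_mod_cast hQc
  refine ala ?_ (ala ?_ ?_)
  · rw [← sum_filter, sum_const, nsmul_eq_mul, mul_one]
    exact_mod_cast Finset.card_le_card fun n hn => (mem_filter.1 hn).2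
  · rw [← sum_filter, sum_const, nsmul_eq_mul, mul_one]
    refine le_trans ?_ hQr
    exact_mod_cast Finset.card_le_card fun n hn => (mem_filter.1 hn).2
  · rw [← sum_filter, sum_const, nsmul_eq_mul, mul_one]
    refine le_trans ?_ hQr
    exact_mod_cast card_le_card_of_injOn (fun n => n+r) (fun n hn => (mem_filter.1 hn).2)
      fun a _ b _ h => by simpa using h

lemma poly_exp8 (n:ℕ) : ∃ C:ℝ,0<C ∧ ∀ u:ℝ,0 ≤ u → u^n ≤ C*ex (u/8) := by
  obtain ⟨C, hC, h⟩ := poly_exp n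
  refine ⟨8^n*C, pz, fun u hu => ?_⟩
  have e : u^n =8^n*(u/8)^n := by rw [← mul_pow]; congr 1; ring
  rw [e, mul_assoc]; exact mlm (h _ pz) pz

lemma sieve_B : ∃ C:ℝ,0<C ∧ ∀ (v σ:ℝ) (m:ℕ),1 ≤ v → v/8 ≤ m+1 → σ ≤36*(1+lg (v^5)) → q14 ^ m*ex (4*σ)*(v^5)^2 ≤ C := by
  obtain ⟨C1, hC1, h1⟩ := poly_exp8 (5*146)
  refine ⟨4*ex 144*C1, pz, fun v σ m hv1 hm2 hs2 => ?_⟩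
  generalize hk : v^5=k at *
  have hk1 :1 ≤ k := hk ▸ one_le_pow₀ hv1
  have e1 : ex (4*σ) ≤ ex 144*k^144 := by
    have : ex 144*k^144=ex (144+144*lg k) := by
      rw [rea]; congr 1
      rw [show (144:ℝ)*lg k=(144:ℕ)*lg k by norm_num, ren, rel lz]
    rw [this]; exact ele.2 lz
  have e2 : q14 ^ m ≤4*ex (-(v/8)) := by
    have : q14 ^ m =4*(1/4)^(m+1) := by rw [pow_succ]; ring
    rw [this]
    refine mlm ?_ nz
    have h14 : q14 ≤ ex (-1) := by rw [Real.exp_neg, one_div]; exact inv_anti₀ (exp_pos 1) (by linarith [exp_one_lt_d9])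
    refine (plp nz h14 _).trans ?_
    rw [← ren]; refine ele.2 ?_
    push_cast; linarith
  have e3 : k^146 ≤ C1*ex (v/8) := by rw [← hk, ← pow_mul]; exact h1 v lz
  calc _ ≤4*ex (-(v/8))*(ex 144*k^144)*k^2 := by gcongr
    _ =4*ex 144*(ex (-(v/8))*k^146) := by rw [show 146 =144+2 from rfl, pow_add k 144 2]; ring
    _ ≤4*ex 144*(ex (-(v/8))*(C1*ex (v/8))) := by gcongr
    _ =4*ex 144*C1*(ex (-(v/8))*ex (v/8)) := by ring
    _=_ := by rw [← rea]; simp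

lemma hhalf (K:ℕ) (q:ℝ) (hq : q ≤ K/2) : rl2^q*(K:ℝ)^3 ≤384*2^K := by
    have hl2 : (0.69:ℝ)<lg 2 := by linarith [ltg]
    have hK0 : rl0 ≤ K := pz
    have a1 : rl2^q ≤ rl2^((K:ℝ)/2) := rlr nz hq
    have a2 : (K:ℝ)^3 ≤384*rl2^((K:ℝ)/2) := by
      have := pow_div_factorial_le_exp ((K:ℝ)/4) pz 3
      rw [dli pz] at this
      have h6 : ((Nat.factorial 3:ℕ):ℝ) =6 := by norm_num [Nat.factorial]
      rw [h6] at this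
      have : ex ((K:ℝ)/4) ≤ rl2^((K:ℝ)/2) := by rw [rpow_def_of_pos nz]; exact ele.2 nlz
      have : ((K:ℝ)/4)^3=(K:ℝ)^3/64 := by ring
      nlinarith
    calc _ ≤ rl2^((K:ℝ)/2)*(384*rl2^((K:ℝ)/2)) := by gcongr
      _ =384*(rl2^((K:ℝ)/2)*rl2^((K:ℝ)/2)) := by ring
      _=_ := by rw [← rpow_add nz, add_halves, rrn]

set_option maxHeartbeats 800000 in
lemma sieve_pairs : ∃ C >0, ∀ K r:ℕ,1 ≤ K → 1 ≤ r → r <2^K → ∑ n ∈ Fr (2^K), vM n*vM (n+r) ≤ C*((1+lg r)^2*(2^K*(K:ℝ)^q25)) := by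
  obtain ⟨C1, hC1, h1⟩ := sieve_B
  refine ⟨2*(16*ex 8+C1+384*ex 1+6*(2^16*384)), pz, fun K r hK hr hrK => ?_⟩
  have hK1 : rl1 ≤ K := by exact_mod_cast hK
  have hr1 : rl1 ≤ r := by exact_mod_cast hr
  have hlr := log_nonneg hr1
  set R :=1+lg r with hR
  have hR1 :1 ≤ R := by linarith only [hR, hlr]
  set Y := ⌊(K:ℝ)^(4/5:ℝ)⌋₊ with hY
  have hK45 :1 ≤ (K:ℝ)^(4/5:ℝ) := olr hK1 nz
  have hY1 :1 ≤ Y := Nat.le_floor (by simpa using hK45)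
  have hYr : rl1 ≤ Y := by exact_mod_cast hY1
  have hYK : (Y:ℝ) ≤ (K:ℝ)^(4/5:ℝ) := Nat.floor_le pz
  have hYK2 : (K:ℝ)^(4/5:ℝ) ≤2*Y := by linarith only [hY, hK45, hYr, Nat.lt_floor_add_one ((K:ℝ)^(4/5:ℝ))]
  have hYK3 : (Y:ℝ) ≤ K := hYK.trans (by
    conv_rhs => rw [← rpow_one (K:ℝ)]
    exact rlr hK1 nz)
  set v := (K:ℝ)^(1/5:ℝ) with hv
  have hv1 :1 ≤ v := olr hK1 nz
  have hvK : v^5=K := by rw [hv, ← rrn, ← rpow_mul (by linarith only [hK1, hK1])]; norm_num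
  have hv4 : (K:ℝ)^(4/5:ℝ)=v^4 := by rw [hv, ← rrn, ← rpow_mul (by linarith only [hK1, hK1])]; norm_num
  have hv2 : (K:ℝ)^q25=v^2 := by rw [hv, ← rrn, ← rpow_mul (by linarith only [hK1, hK1])]; norm_num
  set m := ⌊v/8⌋₊ with hm
  have hm1 : (m:ℝ) ≤ v/8 := Nat.floor_le pz
  have hm2 : v/8 ≤ m+1 := (Nat.lt_floor_add_one _).le
  set P := (Nat.primesBelow (2^Y)).filter fun p => ¬ p ∣ r with hP
  set S := (Fr (2^K)).filter fun n => ∀ p ∈ P, ¬ p ∣ n ∧ ¬ p ∣ n+r with hS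
  have hPp : ∀ p ∈ P, p.Prime := fun p hp => npo (mem_filter.1 hp).1
  have hpt := sieve_pt hK hrK hP hS
  have hcard : (P.card:ℝ) ≤2^Y := by
    have : P.card ≤ (Fr (2^Y)).card := Finset.card_le_card fun p hp => by rw [fmr]; exact (Nat.mem_primesBelow.1 (mem_filter.1 hp).1).1
    rw [card_range] at this; exact_mod_cast this
  have hsc := sieve_count hPp (fun p hp => (mem_filter.1 hp).2) (r := r) (one_le_pow₀ (nz : rl1 ≤2)) hcard (2^K) m
  rw [← hS] at hsc
  set σ := ∑ p ∈ P, (1/p:ℝ) with hσ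
  set σ0 := ∑ p ∈ Nat.primesBelow (2^Y), (1/(p:ℝ)) with hσ0
  have hs1 : σ0 ≤ σ+(lg R+3) := by
    refine le_trans ?_ (add_le_add_right (omega_sum hr) σ)
    rw [hσ0, ← sum_filter_not_add_sum_filter _ (fun p => p ∣ r)]
    refine add_le_add_right (slo (fun p hp => ?_) fun p _ _ => pz) _
    rw [mem_filter] at hp
    exact Nat.mem_primeFactors.2 ⟨npo hp.1, hp.2, by omega⟩
  have hs2 : σ ≤36*(1+lg K) := by
    have a : σ ≤ σ0 := slo (filter_subset _ _) fun p _ _ => pz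
    have := lll (by linarith only [hYr]) hYK3
    linarith only [a, this, mert_upper Y hY1]
  have hlow : Y*lg 2 ≤ ex (σ0+1) := by
    have := mert_lower (N :=2^Y) (le_trans nz (Nat.pow_le_pow_right nz hY1))
    rw [Nat.cast_pow, log_pow] at this; exact_mod_cast this
  have hl2 : (0.69:ℝ)<lg 2 := by linarith [ltg]
  have hA : ex (-2*σ)*v^8 ≤16*ex 8*R^2 := by
    have e1 : ex (σ0+1) ≤ ex σ*(R*ex 4) := by
      have : R*ex 4=ex (lg R+4) := by rw [rea, rel (by linarith only [hR1])]
      rw [this, ← rea]; exact ele.2 (by linarith only [hs1])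
    have e2 : v^4 ≤4*(ex σ*(R*ex 4)) := by
      have := mlm hl2.le (show rl0 ≤ Y by positivity)
      linarith only [this, e1, hlow, hYK2, hv4]
    have e3 : v^8 ≤16*ex 8*R^2*ex (2*σ) := by
      have e8 : ex 8=ex 4^2 := by rw [← ren]; norm_num
      have e9 : ex (2*σ)=ex σ^2 := by rw [← ren]; norm_num
      rw [e8, e9, show v^8=(v^4)^2 by ring]
      refine (plp pz e2 2).trans (loe (by ring))
    calc _ ≤ ex (-2*σ)*(16*ex 8*R^2*ex (2*σ)) := mlm e3 (exp_pos _).le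
      _ =16*ex 8*R^2*(ex (-2*σ)*ex (2*σ)) := by ring
      _=_ := by rw [← rea]; simp
  have hB := h1 v σ m hv1 hm2 (by rw [hvK]; exact hs2)
  have hC' : (2*2^Y:ℝ)^(2 * m)*(K:ℝ)^3 ≤384*2^K := by
    have e : (2*2^Y:ℝ)^(2 * m)=rl2^(((Y+1)*(2 * m):ℕ):ℝ) := by rw [rrn, pow_mul 2 (Y+1), pow_succ' 2 Y]
    rw [e]
    refine hhalf K _ ?_
    push_cast
    have : ((Y:ℝ)+1)*(2 * m) ≤ (2*v^4)*(2*(v/8)) := by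
      rw [hv4] at hYK
      exact mmm (by linarith only [hYK, hYr]) (by linarith only [hm1]) pz pz
    refine this.trans (loe ?_)
    rw [← hvK]; ring
  have hD : rl2^Y*(K:ℝ)^3 ≤2^16*(384*2^K) := by
    have a : (Y:ℝ)-16 ≤ K/2 := by
      rw [hv4] at hYK
      rw [← hvK]
      by_cases h : v ≤2
      · have : v^4 ≤2^4 := plp pz h 4
        have h5 :0 ≤ v^5 := pz
        linarith only [this, h5, hYK]
      · have e5 : v^5=v*v^4 := by ring
        have := mlo (not_le.1 h).le (show 0 ≤ v^4 by positivity)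
        linarith only [this, e5, hYK]
    have := hhalf K _ a
    rw [rpow_sub nz, rrn, show rl2^(16:ℝ) =2^16 by norm_num, dme, dli nz] at this
    linarith only [this]
  have hG :1 ≤ R^2*v^2 := one_le_mul_of_one_le_of_one_le (one_le_pow₀ hR1) (one_le_pow₀ hv1)
  have h2K : rl0 <2^K := pz
  have hK3 : (K:ℝ)^2 ≤ (K:ℝ)^3 := pow_le_pow_right₀ hK1 nz
  have t1 : ex (-2*σ)*(K:ℝ)^2 ≤16*ex 8*(R^2*v^2) := by
    rw [← hvK]
    calc _=ex (-2*σ)*v^8*v^2 := by ring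
      _ ≤16*ex 8*R^2*v^2 := by gcongr
      _=_ := by ring
  rw [hvK] at hB
  have t3 : (2*2^Y:ℝ)^(2 * m)*(K:ℝ)^2 ≤384*2^K := le_trans (by gcongr) hC'
  have t4 : rl2^Y*(K+2)*(K:ℝ)^2 ≤3*(2^16*(384*2^K)) := by
    calc _ ≤ rl2^Y*(3*K)*(K:ℝ)^2 := by gcongr; linarith only [hK1]
      _ =3*(rl2^Y*(K:ℝ)^3) := by ring
      _ ≤ _ := by gcongr
  rw [Nat.cast_pow, Nat.cast_ofNat] at hsc
  rw [hv2]
  refine hpt.trans ?_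
  calc 2*(K:ℝ)^2*(S.card+2*(2^Y*(K+2)))
      ≤2*(K:ℝ)^2*((2^K*(ex (-2*σ)+(1/4) ^ m*ex (4*σ))+(2*2^Y)^(2 * m)*ex 1)
        +2*(2^Y*(K+2))) := by gcongr
    _ =2*(2^K*(ex (-2*σ)*(K:ℝ)^2)+2^K*((1/4) ^ m*ex (4*σ)*(K:ℝ)^2) + ((2*2^Y:ℝ)^(2 * m)*(K:ℝ)^2)*ex 1+2*(rl2^Y*(K+2)*(K:ℝ)^2)) := by ring
    _ ≤2*(2^K*(16*ex 8*(R^2*v^2))+2^K*C1+(384*2^K)*ex 1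
        +2*(3*(2^16*(384*2^K)))) := by gcongr
    _ =2*2^K*(16*ex 8)*(R^2*v^2)+2*2^K*(C1+384*ex 1+6*(2^16*384))*1 := by ring
    _ ≤2*2^K*(16*ex 8)*(R^2*v^2)+2*2^K*(C1+384*ex 1+6*(2^16*384))*(R^2*v^2) := by gcongr
    _=_ := by ring

lemma ker_bound {v T η ε:ℝ} (hv : v ≠0) (hη :0<η) (hε : ε =1 ∨ ε = -1) :
    |∫ s in 0..η, (Real.sin (v*(T+ε*s))+Real.sin (v*(ε*s)))/v| ≤ η * min (2 / |v|) (4/(η*v^2)) := by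
  have hεa : |ε| =1 := by rcases hε with rfl | rfl <;> simp
  have hε0 : ε ≠0 := by rcases hε with rfl | rfl <;> norm_num
  have hv2 :0<v^2 := pz
  rw [mul_min_of_nonneg _ _ hη.le, le_min_iff]
  constructor
  · have := ini (a :=0) (b := η) (C :=2 / |v|) (f := fun s => (Real.sin (v*(T+ε*s))+Real.sin (v*(ε*s)))/v) fun s _ => by
        rw [nea, abs_div]
        refine div_le_div_of_nonneg_right ?_ (abs_nonneg v)
        have := abs_add_le (Real.sin (v*(T+ε*s))) (Real.sin (v*(ε*s)))
        linarith [abs_sin_le_one (v*(T+ε*s)), abs_sin_le_one (v*(ε*s))]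
    rw [nea, sub_zero, aop hη] at this
    linarith
  · have hd : ∀ s ∈ Set.uIcc 0 η, HasDerivAt (fun s => -(Real.cos (v*(T+ε*s))+Real.cos (v*(ε*s)))/(ε*v^2)) ((Real.sin (v*(T+ε*s))+Real.sin (v*(ε*s)))/v) s := fun s _ => by
      have h1 : HasDerivAt (fun s => v*(T+ε*s)) (v*ε) s := by simpa using (((hhi s).const_mul ε).const_add T).const_mul v
      have h2 : HasDerivAt (fun s => v*(ε*s)) (v*ε) s := by simpa using ((hhi s).const_mul ε).const_mul v
      refine ((h1.cos.add h2.cos).neg.div_const _).congr_deriv ?_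
      field_simp; ring
    rw [ies hd (by apply Continuous.intervalIntegrable; fun_prop)]
    rw [← sub_div, abs_div, abs_mul, hεa, one_mul, aop hv2, mul_div_assoc', mul_div_mul_left _ _ hη.ne']
    refine div_le_div_of_nonneg_right ?_ hv2.le
    have b := fun z => abs_cos_le_one z
    rw [abs_le]
    constructor <;> linarith [abs_le.1 (b (v*(T+ε*η))), abs_le.1 (b (v*(ε*η))), abs_le.1 (b (v*(T+ε*0))), abs_le.1 (b (v*(ε*0))), (abs_le.1 (b (v*(T+ε*η)))).1, (abs_le.1 (b (v*(T+ε*η)))).2, (abs_le.1 (b (v*(ε*η)))).1, (abs_le.1 (b (v*(ε*η)))).2, (abs_le.1 (b (v*(T+ε*0)))).1, (abs_le.1 (b (v*(T+ε*0)))).2, (abs_le.1 (b (v*(ε*0)))).1, (abs_le.1 (b (v*(ε*0)))).2]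

def DP (a:ℕ → ℝ) (M:ℕ) (t:ℝ):ℂ := ∑ n ∈ Fr M, (a n:ℂ)*cex (-Ci*t*lg n)

lemma DP_cont (a:ℕ → ℝ) (M:ℕ) : Continuous (DP a M) := by unfold DP; fun_prop

lemma DP_sq (a:ℕ → ℝ) (M:ℕ) (t:ℝ) : ‖DP a M t‖ ^2=∑ m ∈ Fr M, ∑ n ∈ Fr M, a m*a n*Real.cos ((lg m-lg n)*t) := by
  have h : ∀ n:ℕ, cex (-Ci*t*lg n)=((Real.cos (lg n*t):ℝ):ℂ)+((-Real.sin (lg n*t):ℝ):ℂ)*Ci := fun n => by rw [show -Ci*t*lg n=((-(lg n*t):ℝ):ℂ)*Ci by push_cast; ring, exp_mul_I, ← ofReal_cos, ← ofReal_sin, Real.cos_neg, Real.sin_neg]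
  have hD : DP a M t=((∑ n ∈ Fr M, a n*Real.cos (lg n*t):ℝ):ℂ)+((∑ n ∈ Fr M, a n * -Real.sin (lg n*t):ℝ):ℂ)*Ci := by
    rw [DP, ofReal_sum, ofReal_sum, sum_mul, ← sad]
    refine sum_congr rfl fun n _ => ?_
    rw [h n]; push_cast; ring
  rw [hD, Complex.sq_norm, normSq_add_mul_I, sq, sq, sum_mul_sum, sum_mul_sum, ← sad]
  refine sum_congr rfl fun m _ => ?_
  rw [← sad]
  refine sum_congr rfl fun n _ => ?_
  rw [sub_mul, Real.cos_sub]; ring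

lemma DP_int (a:ℕ → ℝ) (M:ℕ) (p q:ℝ) : ∫ t in p..q, ‖DP a M t‖ ^2=∑ m ∈ Fr M, ∑ n ∈ Fr M, a m*a n*∫ t in p..q, Real.cos ((lg m-lg n)*t) := by
  simp only [DP_sq]
  rw [iif fun m _ => by apply Continuous.intervalIntegrable; fun_prop]
  refine sum_congr rfl fun m _ => ?_
  rw [iif fun m _ => by apply Continuous.intervalIntegrable; fun_prop]
  refine sum_congr rfl fun n _ => ?_
  rw [iic]

lemma cos_int {v:ℝ} (hv : v ≠0) (T ε s:ℝ) : ∫ t in (-(ε*s))..(T+ε*s), Real.cos (v*t)=(Real.sin (v*(T+ε*s))+Real.sin (v*(ε*s)))/v := by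
  rw [integral_comp_mul_left (fun t => Real.cos t) hv, integral_cos, smul_eq_mul, mul_neg, Real.sin_neg]
  field_simp; ring

def offd (a:ℕ → ℝ) (η:ℝ) (M:ℕ):ℝ := ∑ m ∈ Fr M, ∑ n ∈ Fr M, if m=n then 0 else a m*a n * min (2 / |lg m-lg n|) (4/(η*(lg m-lg n)^2))

lemma DP_avg {a:ℕ → ℝ} (ha : ∀ n,0 ≤ a n) (ha0 : a 0 =0) {M:ℕ} {T η ε:ℝ} (hη :0<η) (hε : ε =1 ∨ ε = -1) :
    |(∫ s in 0..η, ∫ t in (-(ε*s))..(T+ε*s), ‖DP a M t‖ ^2)-(∑ n ∈ Fr M, a n^2)*(η*T+ε*η^2)| ≤ η*offd a η M := by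
  have hc : ∀ v:ℝ, Continuous fun s:ℝ => ∫ t in (-(ε*s))..(T+ε*s), Real.cos (v*t) := fun v => by
    by_cases hv : v =0
    · subst hv; simp only [zero_mul, Real.cos_zero, intervalIntegral.integral_const]; fun_prop
    · simp only [cos_int hv]; fun_prop
  have e1 : (∫ s in 0..η, ∫ t in (-(ε*s))..(T+ε*s), ‖DP a M t‖ ^2)=∑ m ∈ Fr M, ∑ n ∈ Fr M, a m*a n*∫ s in 0..η, ∫ t in (-(ε*s))..(T+ε*s), Real.cos ((lg m-lg n)*t) := by
    simp only [DP_int]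
    rw [iif fun m _ => by
      apply Continuous.intervalIntegrable
      exact continuous_finsetSum _ fun n _ => (hc _).const_mul _]
    refine sum_congr rfl fun m _ => ?_
    rw [iif fun n _ => by apply Continuous.intervalIntegrable; exact (hc _).const_mul _]
    refine sum_congr rfl fun n _ => ?_
    rw [iic]
  have e2 : (∑ n ∈ Fr M, a n^2)*(η*T+ε*η^2)=∑ m ∈ Fr M, ∑ n ∈ Fr M, if m=n then a m*a n*(η*T+ε*η^2) else 0 := by
    rw [sum_mul]
    refine sum_congr rfl fun m hm => ?_
    rw [sum_ite_eq, if_pos hm, sq]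
  rw [e1, e2, ← sum_sub_distrib, offd, mul_sum]
  refine (abs_sum_le_sum_abs _ _).trans (sls fun m _ => ?_)
  rw [← sum_sub_distrib, mul_sum]
  refine (abs_sum_le_sum_abs _ _).trans (sls fun n _ => ?_)
  by_cases hmn : m=n
  · subst hmn
    rw [if_pos rfl, if_pos rfl, mul_zero]
    have : (∫ s in 0..η, ∫ t in (-(ε*s))..(T+ε*s), Real.cos ((lg m-lg m)*t))=η*T+ε*η^2 := by
      simp only [sub_self, zero_mul, Real.cos_zero, intervalIntegral.integral_const, smul_eq_mul, mul_one]
      have : (fun s:ℝ => T+ε*s - -(ε*s))=fun s => T+(2*ε)*s := by funext s; ring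
      rw [this, iia sz (by apply Continuous.intervalIntegrable; fun_prop), iic]
      simp; ring
    rw [this, sub_self, abs_zero]
  · rw [if_neg hmn, if_neg hmn, sub_zero]
    by_cases h0 : a m*a n =0
    · rw [h0]; simp
    have hm0 : m ≠0 := fun h => h0 (by rw [h, ha0, zero_mul])
    have hn0 : n ≠0 := fun h => h0 (by rw [h, ha0, mul_zero])
    have hv : lg m-lg n ≠0 := fun h => hmn (by
      have := log_injOn_pos (show (m:ℝ) ∈ Set.Ioi 0 by simpa using Nat.pos_of_ne_zero hm0) (show (n:ℝ) ∈ Set.Ioi 0 by simpa using Nat.pos_of_ne_zero hn0) (sub_eq_zero.1 h)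
      exact_mod_cast this)
    have := ker_bound (T := T) hv hη hε
    simp only [cos_int hv]
    rw [abs_mul, aon (mul_nonneg (ha m) (ha n))]
    calc _ ≤ a m*a n*(η * min (2 / |lg m-lg n|) (4/(η*(lg m-lg n)^2))) :=
          mlm this (mul_nonneg (ha m) (ha n))
      _=_ := by ring

lemma DP_mean {a:ℕ → ℝ} (ha : ∀ n,0 ≤ a n) (ha0 : a 0 =0) {M:ℕ} {T η:ℝ} (hη :0<η) (hηT :2*η ≤ T) :
    |(∫ t in 0..T, ‖DP a M t‖ ^2)-T*∑ n ∈ Fr M, a n^2| ≤ offd a η M+η*∑ n ∈ Fr M, a n^2 := by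
  have hc : Continuous fun t => ‖DP a M t‖ ^2 := (DP_cont a M).norm.pow 2
  have hI : ∀ p q:ℝ, IntervalIntegrable (fun t => ‖DP a M t‖ ^2) volume p q := fun p q => hc.intervalIntegrable p q
  have hcF : ∀ ε:ℝ, Continuous fun s:ℝ => ∫ t in (-(ε*s))..(T+ε*s), ‖DP a M t‖ ^2 := fun ε => by
    have h : Continuous fun x:ℝ => ∫ t in 0..x, ‖DP a M t‖ ^2 := continuous_primitive hI 0
    have e : (fun s:ℝ => ∫ t in (-(ε*s))..(T+ε*s), ‖DP a M t‖ ^2)=fun s => (∫ t in 0..(T+ε*s), ‖DP a M t‖ ^2)-∫ t in 0..(-(ε*s)), ‖DP a M t‖ ^2 := by funext s; rw [integral_interval_sub_left (hI _ _) (hI _ _)]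
    rw [e]; exact (h.comp fz).sub (h.comp fz)
  set D := ∑ n ∈ Fr M, a n^2
  set J := ∫ t in 0..T, ‖DP a M t‖ ^2
  have up := abs_le.1 (DP_avg ha ha0 (M := M) (T := T) hη (Or.inl rfl))
  have lo := abs_le.1 (DP_avg ha ha0 (M := M) (T := T) hη (Or.inr rfl))
  have m1 : η*J ≤ ∫ s in 0..η, ∫ t in (-(1*s))..(T+1*s), ‖DP a M t‖ ^2 := by
    have := integral_mono_on (a :=0) (b := η) (μ := volume) hη.le (f := fun _ => J) (ccc.intervalIntegrable 0 η) ((hcF 1).intervalIntegrable 0 η) fun s hs => by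
        refine integral_mono_interval ?_ ?_ ?_ ?_ (hI _ _)
        · linarith [hs.1]
        · linarith
        · linarith [hs.1]
        · exact Eventually.of_forall fun t => pz
    simpa using this
  have m2 : (∫ s in 0..η, ∫ t in (-((-1)*s))..(T+(-1)*s), ‖DP a M t‖ ^2) ≤ η*J := by
    have := integral_mono_on (a :=0) (b := η) (μ := volume) hη.le (g := fun _ => J) ((hcF (-1)).intervalIntegrable 0 η) (ccc.intervalIntegrable 0 η) fun s hs => by
        refine integral_mono_interval ?_ ?_ ?_ ?_ (hI _ _)
        · linarith [hs.1]
        · linarith [hs.2]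
        · linarith [hs.1]
        · exact Eventually.of_forall fun t => pz
    simpa using this
  rw [abs_le]
  constructor
  · refine le_of_mul_le_mul_left ?_ hη
    nlinarith [lo.1]
  · refine le_of_mul_le_mul_left ?_ hη
    nlinarith [up.2]

lemma log_gap {n r:ℕ} (hn :1 ≤ n) (hr : r ≤ n) : (r:ℝ)/(2*n) ≤ lg ((n+r:ℕ))-lg n := by
  have hn0 : rl0<n := by exact_mod_cast hn
  have hr0 : rl0 ≤ r := pz
  have hrn : (r:ℝ) ≤ n := by exact_mod_cast hr
  push_cast
  rw [← log_div pz hn0.ne']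
  refine le_trans ?_ (one_sub_inv_le_log_of_pos pz)
  rw [inv_div, one_sub_div pz, add_sub_cancel_left]
  exact div_le_div_of_nonneg_left hr0 pz lz

def bmin (η v:ℝ):ℝ := min (2 / |v|) (4/(η*v^2))

lemma bmin_nn {η:ℝ} (hη :0<η) (v:ℝ) :0 ≤ bmin η v := le_min pz pz

lemma pair_near {y η:ℝ} (hη :0<η) {n r:ℕ} (hr :1 ≤ r) (hrn : r<n) :
    aa y n*aa y (n+r)*bmin η (lg ((n+r:ℕ))-lg n) ≤8/r*(vM n*vM (n+r)*ek y n) ∧ aa y n*aa y (n+r)*bmin η (lg ((n+r:ℕ))-lg n) ≤16/sqr η*(1/(r*sqr r))*(vM n*vM (n+r)*(sqr n*ek y n)) := by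
  have hn0 : rl0<n := by exact_mod_cast (by omega :0<n)
  have hr0 : rl0<r := by exact_mod_cast hr
  have hgap := log_gap (n := n) (r := r) oz hrn.le
  set v := lg ((n+r:ℕ))-lg n with hv
  have hv0 :0<v := lt_of_lt_of_le pz hgap
  have ha : aa y n*aa y (n+r) ≤2/n*(vM n*vM (n+r)*ek y n) := by
    have h1 : ((n+r:ℕ):ℝ)^m12 ≤ (n:ℝ)^m12 :=
      rlo hn0 (by push_cast; linarith) nz
    have h2 : ex (-|y-lg ((n+r:ℕ))|) ≤2*ex (-dl y n) := by
      have hl : v ≤ lg 2 := by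
        rw [hv, ← log_div pz hn0.ne']
        refine lll pz ?_
        rw [dli hn0]; push_cast
        have : (r:ℝ) ≤ n := by exact_mod_cast hrn.le
        linarith
      rw [show rl2*ex (-dl y n)=ex (lg 2 + -dl y n) by rw [rea, rel nz]]
      refine ele.2 ?_
      have := abs_add_le (y-lg ((n+r:ℕ))) v
      rw [show y-lg ((n+r:ℕ))+v=y-lg n by rw [hv]; ring, aop hv0] at this
      linarith
    have h3 : (n:ℝ)^m12*(n:ℝ)^m12 =1/n := by rw [← rpow_add hn0, show (-(1/2) + -(1/2):ℝ) = -1 by norm_num, rpow_neg_one, one_div]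
    have h4 : ek y n=ex (-dl y n)*ex (-dl y n) := by rw [← rea]; ring_nf
    unfold aa
    calc _ ≤ vM n*((n:ℝ)^m12*ex (-dl y n))*(vM (n+r)*((n:ℝ)^m12*(2*ex (-dl y n)))) := by gcongr
      _ =2*((n:ℝ)^m12*(n:ℝ)^m12)*(vM n*vM (n+r)*(ex (-dl y n)*ex (-dl y n))) := by ring
      _=_ := by rw [h3, ← h4]; ring
  have hE :0 ≤ vM n*vM (n+r)*ek y n := mul_nonneg (mul_nonneg (vM_nn _) (vM_nn _)) (exp_pos _).le
  have b1 : bmin η v ≤4*n/r := by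
    refine (min_le_left _ _).trans ?_
    rw [aop hv0, dld hv0 hr0]
    rw [dli pz] at hgap
    linarith
  have b2 : bmin η v ≤16*n^2/(η*r^2) := by
    refine (min_le_right _ _).trans ?_
    rw [dld pz pz]
    rw [dli pz] at hgap
    have := plp hr0.le hgap 2
    nlinarith
  have hb := bmin_nn hη v
  constructor
  · calc _ ≤2/n*(vM n*vM (n+r)*ek y n)*(4*n/r) := by gcongr
      _=_ := by field_simp; ring
  · have b3 : bmin η v ≤8*(n*sqr n)/(sqr η*(r*sqr r)) := by
      refine (pow_le_pow_iff_left₀ hb pz two_ne_zero).1 ?_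
      calc bmin η v^2=bmin η v*bmin η v := sq _
        _ ≤ (4*n/r)*(16*n^2/(η*r^2)) := mmm b1 b2 hb pz
        _=_ := by
          rw [div_pow, mul_pow, mul_pow, mul_pow, mul_pow, sq_sqrt hn0.le, sq_sqrt hr0.le, sq_sqrt hη.le]
          field_simp; ring
    calc _ ≤2/n*(vM n*vM (n+r)*ek y n)*(8*(n*sqr n)/(sqr η*(r*sqr r))) := by gcongr
      _=_ := by field_simp; ring

lemma pair_far {η:ℝ} (hη :0<η) {n m:ℕ} (hn :1 ≤ n) (h :2*n ≤ m) : bmin η (lg m-lg n) ≤10/η := by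
  have hn0 : rl0<n := by exact_mod_cast hn
  have hm : rl2*n ≤ m := by exact_mod_cast h
  have h1 : (0.69:ℝ) ≤ lg m-lg n := by
    have := lll pz hm
    rw [rlm nz hn0.ne'] at this
    linarith [ltg]
  refine (min_le_right _ _).trans ?_
  rw [dld (mul_pos hη nlz) hη]
  nlinarith [mul_pos hη hη, mmm h1 h1 nz lz]

lemma near1 : ∃ C >0, ∀ (y:ℝ) (r M:ℕ),0 ≤ y → 1 ≤ r → ∑ n ∈ Fr M, (if r<n then vM n*vM (n+r) else 0)*ek y n ≤ C*((1+lg r)^2*(ex y*(1+y)^q25)) := by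
  obtain ⟨C, hC, hdy⟩ := dy
  obtain ⟨C2, hC2, hs⟩ := sieve_pairs
  refine ⟨C*(2*C2), pz, fun y r M hy hr => ?_⟩
  have hc : ∀ n,0 ≤ (if r<n then vM n*vM (n+r) else 0) := fun n => by split_ifs; exacts [mul_nonneg (vM_nn _) (vM_nn _), le_rfl]
  obtain ⟨h1, h2⟩ := hdy (y := y) (s :=2/5) (θ :=1) (κ :=2) (A :=2*C2*(1+lg r)^2) (M :=1) (c := fun n => if r<n then vM n*vM (n+r) else 0) (f := fun n => ek y n) hy nz nz nz nz
    nz nz pz nz hc sz (fun n => (exp_pos _).le)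
    (fun n _ => by rw [sub_self, rpow_zero, one_mul, one_mul]) fun k => by
      by_cases hk : r <2^(k+1)
      · calc _ ≤ ∑ n ∈ Finset.Ico (2^k) (2^(k+1)), vM n*vM (n+r) := sls fun n _ => by split_ifs; exacts [le_rfl, mul_nonneg (vM_nn _) (vM_nn _)]
          _ ≤ ∑ n ∈ Fr (2^(k+1)), vM n*vM (n+r) :=
            slo (fun n hn => fmr.2 (fmi.1 hn).2) fun n _ _ => mul_nonneg (vM_nn _) (vM_nn _)
          _ ≤ _ := hs (k+1) r oz hr hk
          _=_ := by push_cast; rw [pow_succ]; ring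
      · rw [sum_eq_zero fun n hn => if_neg (by rw [fmi] at hn; omega)]
        positivity
  have := h1.sum_le_tsum (Fr M) fun n _ => mul_nonneg (hc n) (exp_pos _).le
  refine this.trans (h2.trans (loe ?_))
  rw [one_mul]; ring

lemma near2 : ∃ C >0, ∀ (y:ℝ) (M:ℕ),0 ≤ y → ∑ n ∈ Fr M, vM n*lg (2*n)*(sqr n*ek y n) ≤ C*(ex (3/2*y)*(1+y)) := by
  obtain ⟨C, hC, hdy⟩ := dy
  have hc : ∀ n:ℕ,0 ≤ vM n*lg (2*n) := fun n => by
    rcases nez n with rfl | h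
    · simp
    · have : rl1 ≤ n := by exact_mod_cast h
      exact mul_nonneg (vM_nn _) (log_nonneg lz)
  refine ⟨C*24, pz, fun y M hy => ?_⟩
  obtain ⟨h1, h2⟩ := hdy (y := y) (s :=1) (θ :=3/2) (κ :=2) (A :=24) (M :=1) (c := fun n => vM n*lg (2*n)) (f := fun n => sqr n*ek y n) hy nz nz nz nz
    nz nz pz nz hc sz (fun n => pz)
    (fun n _ => by rw [one_mul, sqrt_eq_rpow]; norm_num) fun k => by
      have hb : ∀ n ∈ Finset.Ico (2^k) (2^(k+1)), vM n*lg (2*n) ≤ vM n*(2*(k+1)) := fun n hn => by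
        rw [fmi] at hn
        refine mlm ?_ (vM_nn n)
        have hn0 : rl0<n := by exact_mod_cast lt_of_lt_of_le pz hn.1
        have : rl2*n ≤2^(k+2) := by
          have :2*n ≤2^(k+2) := by rw [pow_succ]; omega
          exact_mod_cast this
        have := lll pz this
        rw [log_pow] at this; push_cast at this
        have h2 : lg 2 ≤0.7 := by linarith [ltl]
        have hk : rl0 ≤ k := pz
        nlinarith
      refine (sls hb).trans ?_
      rw [← sum_mul, rpow_one]
      have := mlo (vM_dyad k) (show rl0 ≤2*(k+1) by positivity)
      linarith
  have := h1.sum_le_tsum (Fr M) fun n _ => mul_nonneg (hc n) pz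
  refine this.trans (h2.trans (loe ?_))
  rw [rpow_one]; ring

lemma sum32 {R M:ℕ} (hR :1 ≤ R) : ∑ r ∈ Finset.Ico (R+1) M, (1/(r*sqr r):ℝ) ≤2/sqr R := by
  have hR0 : rl0<R := by exact_mod_cast hR
  rcases lt_or_ge M (R+1) with h | h
  · rw [Finset.Ico_eq_empty oz, sum_empty]; positivity
  · have key : ∑ r ∈ Finset.Ico (R+1) M, (1/(r*sqr r):ℝ) ≤2/sqr R-2/sqr ((M:ℝ)-1) := by
      induction M, h using Nat.le_induction with
      | base => simp
      | succ k hk ih =>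
        rw [sum_Ico_succ_top hk]
        have hk1 : rl1<k := by exact_mod_cast (by omega :1<k)
        have e :1/(k*sqr k) ≤2/sqr ((k:ℝ)-1)-2/sqr k := by
          set p := sqr ((k:ℝ)-1)
          set q := sqr k
          have hp :0<p := sqrt_pos.2 lz
          have hpq : p ≤ q := sqrt_le_sqrt lz
          have hp2 : p^2=k-1 := sq_sqrt lz
          have hq2 : q^2=k := sq_sqrt lz
          have hq :0<q := lz
          have hd : (q-p)*(q+p) =1 := by nlinarith
          rw [← hq2, div_sub_div _ _ hp.ne' hq.ne', dld pz pz]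
          have : (q-p)*(2*q) ≥ 1 := by nlinarith
          nlinarith [mlm this (show 0 ≤ q^2 by positivity), mul_pos hq hq, mlo hpq hq.le]
        push_cast; rw [add_sub_cancel_right]
        linarith
    exact key.trans (sub_le_self _ pz)

lemma sum_shift {h:ℕ → ℝ} (hh : ∀ r,0 ≤ h r) (M n:ℕ) :
    ∑ m ∈ Fr M, (if n < m then h (m-n) else 0) ≤ ∑ r ∈ Fr M, h r := by
  rw [← sum_filter, ← sum_image (f := h) (g := fun m => m-n) fun a ha b hb hab => by have := (mem_filter.1 ha).2; have := (mem_filter.1 hb).2; simp only at hab; omega]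
  refine slo (fun r hr => ?_) fun r _ _ => hh r
  obtain ⟨m, hm, rfl⟩ := Finset.mem_image.1 hr
  have := fmr.1 (mem_filter.1 hm).1
  rw [fmr]; omega

lemma offd_bound : ∃ C >0, ∀ (y η:ℝ) (R M:ℕ),0 ≤ y → 0<η → 1 ≤ R → offd (aa y) η M ≤ C*(ex y/η+ex y*(1+y)^q25*(1+lg R)^3+ex (3/2*y)*(1+y)/(sqr η*sqr R)) := by
  obtain ⟨C1, hC1, hG1⟩ := G1
  obtain ⟨C2, hC2, hN1⟩ := near1
  obtain ⟨C3, hC3, hN2⟩ := near2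
  refine ⟨2*(10*C1^2+8*C2+32*C3), pz, fun y η R M hy hη hR => ?_⟩
  have hR0 : rl1 ≤ R := by exact_mod_cast hR
  have hlR := log_nonneg hR0
  set b:ℕ → ℕ → ℝ := fun m n => aa y n*aa y m*bmin η (lg m-lg n) with hb
  have hbn : ∀ m n,0 ≤ b m n := fun m n => mul_nonneg (mul_nonneg (aa_nn _ _) (aa_nn _ _)) (bmin_nn hη _)
  have s1 : offd (aa y) η M ≤2*∑ n ∈ Fr M, ∑ m ∈ Fr M, (if n < m then b m n else 0) := by
    rw [two_mul]
    nth_rw 1 [sum_comm]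
    rw [offd, ← sad]
    refine sls fun m _ => ?_
    rw [← sad]
    refine sls fun n _ => ?_
    rcases lt_trichotomy m n with h | h | h
    · rw [if_neg h.ne, if_neg h.not_gt, if_pos h, zero_add]
      refine loe ?_
      simp only [hb, bmin]
      rw [abs_sub_comm, ← neg_sub (lg m), neg_sq, neg_sub]
    · rw [if_pos h, if_neg oz, if_neg oz, add_zero]
    · rw [if_neg h.ne', if_pos h, if_neg h.not_gt, add_zero]
      refine loe ?_
      simp only [hb, bmin]; ring
  set e:ℕ → ℝ := fun n => ek y n with he
  set g1:ℕ → ℕ → ℝ := fun n r => if 1 ≤ r ∧ r ≤ R then 8/r*((if r<n then vM n*vM (n+r) else 0)*e n) else 0 with hg1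
  set g2:ℕ → ℕ → ℝ := fun n r => if R<r then 16/sqr η*(1/(r*sqr r))*(vM n*lg (2*n)*(sqr n*e n)) else 0 with hg2
  have hlog : ∀ n:ℕ,0 ≤ vM n*lg (2*n) := fun n => by
    rcases nez n with rfl | h
    · simp
    · have : rl1 ≤ n := by exact_mod_cast h
      exact mul_nonneg (vM_nn _) (log_nonneg lz)
  have hen : ∀ n,0 ≤ e n := fun n => (exp_pos _).le
  have hg1n : ∀ n r,0 ≤ g1 n r := fun n r => by
    simp only [hg1]; split_ifs
    · exact mul_nonneg pz (mul_nonneg (mul_nonneg (vM_nn _) (vM_nn _)) (hen n))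
    · simp
    · exact le_rfl
  have hg2n : ∀ n r,0 ≤ g2 n r := fun n r => by
    simp only [hg2]; split_ifs
    · exact mul_nonneg pz (mul_nonneg (hlog n) (mul_nonneg pz (hen n)))
    · exact le_rfl
  have pt : ∀ n m, (if n < m then b m n else 0) ≤10/η*(aa y n*aa y m)+(if n < m then g1 n (m-n)+g2 n (m-n) else 0) := fun n m => by
    have hA :0 ≤10/η*(aa y n*aa y m) := mul_nonneg pz (mul_nonneg (aa_nn _ _) (aa_nn _ _))
    by_cases h : n < m
    swap
    · rw [if_neg h, if_neg h, add_zero]; exact hA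
    rw [if_pos h, if_pos h]
    have hg := add_nonneg (hg1n n (m-n)) (hg2n n (m-n))
    rcases nez n with rfl | hn
    · have : b m 0 =0 := by simp [hb, aa]
      rw [this]; linarith
    by_cases h2 :2*n ≤ m
    · have := mlm (pair_far hη hn h2) (mul_nonneg (aa_nn y n) (aa_nn y m))
      have hh : b m n ≤ aa y n*aa y m*(10/η) := this
      linarith
    · obtain ⟨r, rfl⟩ := Nat.exists_eq_add_of_lt h
      have hr1 : n+r+1-n=r+1 := by omega
      rw [hr1]
      obtain ⟨p1, p2⟩ := pair_near (y := y) hη (n := n) (r := r+1) oz oz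
      have hbb : b (n+r+1) n=aa y n*aa y (n+(r+1))*bmin η (lg ((n+(r+1):ℕ))-lg n) := rfl
      rw [hbb]
      by_cases hrR : r+1 ≤ R
      · have : g1 n (r+1) =8/((r+1:ℕ):ℝ)*(vM n*vM (n+(r+1))*ek y n) := by simp only [hg1]; rw [if_pos ⟨by omega, hrR⟩, if_pos oz]
        linarith [hg2n n (r+1)]
      · have e2 : g2 n (r+1) =16/sqr η*(1/(((r+1:ℕ):ℝ)*sqr ((r+1:ℕ):ℝ)))*(vM n*lg (2*n)*(sqr n*e n)) := by simp only [hg2]; rw [if_pos oz]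
        have hn1 : rl1 ≤ n := by exact_mod_cast hn
        have hL : vM (n+(r+1)) ≤ lg (2*n) := by
          refine avl.trans (lll pz ?_)
          exact_mod_cast (by omega : n+(r+1) ≤2*n)
        have :16/sqr η*(1/(((r+1:ℕ):ℝ)*sqr ((r+1:ℕ):ℝ)))*(vM n*vM (n+(r+1))*(sqr n*ek y n)) ≤ g2 n (r+1) := by
          rw [e2]
          refine mlm ?_ pz
          exact mlo (mlm hL (vM_nn n)) (mul_nonneg pz (hen n))
        linarith [hg1n n (r+1)]
  have s2 : ∑ n ∈ Fr M, ∑ m ∈ Fr M, (if n < m then b m n else 0) ≤10/η*((∑ n ∈ Fr M, aa y n)*∑ m ∈ Fr M, aa y m)+(∑ n ∈ Fr M, ∑ r ∈ Fr M, g1 n r+∑ n ∈ Fr M, ∑ r ∈ Fr M, g2 n r) := by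
    rw [sum_mul_sum, mul_sum, ← sad, ← sad]
    refine sls fun n _ => (sls fun m _ => pt n m).trans ?_
    rw [sad, ← mul_sum, ← sad]
    exact add_le_add_right (sum_shift (h := fun r => g1 n r+g2 n r) (fun r => add_nonneg (hg1n n r) (hg2n n r)) M n) _
  have t1 : ∑ n ∈ Fr M, aa y n ≤ C1*eh y :=
    ((hG1 y hy).1.sum_le_tsum _ fun n _ => aa_nn y n).trans (hG1 y hy).2
  have t1' : (∑ n ∈ Fr M, aa y n)*∑ m ∈ Fr M, aa y m ≤ C1^2*ex y := by
    have h0 :0 ≤ ∑ n ∈ Fr M, aa y n := sum_nonneg fun n _ => aa_nn y n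
    refine (mmm t1 t1 h0 pz).trans (loe ?_)
    rw [show y=y/2+y/2 by ring, rea]; ring_nf
  have t2 : ∑ n ∈ Fr M, ∑ r ∈ Fr M, g1 n r ≤8*C2*(ex y*(1+y)^q25*(1+lg R)^3) := by
    rw [sum_comm]
    have : ∀ r ∈ Fr M, ∑ n ∈ Fr M, g1 n r ≤ if r ∈ Finset.Icc 1 R then (r:ℝ)⁻¹*(8*C2*((1+lg R)^2*(ex y*(1+y)^q25))) else 0 := fun r _ => by
      simp only [hg1, Finset.mem_Icc]
      by_cases hr :1 ≤ r ∧ r ≤ R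
      · simp only [if_pos hr]
        rw [← mul_sum]
        have hr1 : rl1 ≤ r := by exact_mod_cast hr.1
        have h1 := hN1 y r M hy hr.1
        have h2 : lg r ≤ lg R := lll lz (by exact_mod_cast hr.2)
        have h3 := log_nonneg hr1
        calc _ ≤8/(r:ℝ)*(C2*((1+lg r)^2*(ex y*(1+y)^q25))) := mlm h1 pz
          _ ≤8/(r:ℝ)*(C2*((1+lg R)^2*(ex y*(1+y)^q25))) := by gcongr
          _=_ := by ring
      · simp [if_neg hr]
    refine (sls this).trans ?_
    rw [← sum_filter]
    have hs : ∑ r ∈ (Fr M).filter (· ∈ Finset.Icc 1 R), (r:ℝ)⁻¹ ≤1+lg R := by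
      have h := hlo R
      rw [harmonic_eq_sum_Icc] at h
      push_cast at h
      exact (slo (fun p hp => (mem_filter.1 hp).2) fun n _ _ => pz).trans h
    rw [← sum_mul]
    refine (mlo hs pz).trans (loe (by ring))
  have t3 : ∑ n ∈ Fr M, ∑ r ∈ Fr M, g2 n r ≤32*C3*(ex (3/2*y)*(1+y)/(sqr η*sqr R)) := by
    have h2 := hN2 y M hy
    have h1 := sum32 (R := R) (M := M) hR
    have : ∀ n ∈ Fr M, ∑ r ∈ Fr M, g2 n r =16/sqr η*(∑ r ∈ Finset.Ico (R+1) M, (1/(r*sqr r):ℝ))*(vM n*lg (2*n)*(sqr n*e n)) := fun n _ => by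
      simp only [hg2]
      rw [← sum_filter, ← sum_mul, ← mul_sum]
      congr 3
      ext r; rw [mem_filter, fmr, fmi]; omega
    rw [sum_congr rfl this, ← mul_sum]
    calc _ ≤16/sqr η*(2/sqr R)*(C3*(ex (3/2*y)*(1+y))) := by
          refine mmm (mlm h1 pz) h2 ?_ pz
          exact sum_nonneg fun n _ => mul_nonneg (hlog n) (mul_nonneg pz (hen n))
      _=_ := by field_simp; ring
  have t1'' := mlm t1' (show 0 ≤10/η by positivity)
  have q1 :0 ≤ ex y/η := pz
  have q2 :0 ≤ ex y*(1+y)^q25*(1+lg R)^3 := pz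
  have q3 :0 ≤ ex (3/2*y)*(1+y)/(sqr η*sqr R) := pz
  have e1 :10/η*(C1^2*ex y) =10*C1^2*(ex y/η) := by ring
  refine (s1.trans (mlm (s2.trans (ala t1'' (ala t2 t3))) zero_le_two)).trans ?_
  rw [e1]
  generalize ex y/η=u1 at *
  generalize ex y*(1+y)^q25*(1+lg R)^3=u2 at *
  generalize ex (3/2*y)*(1+y)/(sqr η*sqr R)=u3 at *
  have w1 :0 ≤ C1^2*u2 := pz
  have w2 :0 ≤ C1^2*u3 := pz
  have w3 :0 ≤ C2*u1 := pz
  have w4 :0 ≤ C2*u3 := pz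
  have w5 :0 ≤ C3*u1 := pz
  have w6 :0 ≤ C3*u2 := pz
  linarith only [w1, w2, w3, w4, w5, w6]

def AA (y t:ℝ):ℂ := ∑' n:ℕ, (aa y n:ℂ)*cex (-Ci*t*lg n)

lemma AA_term (y t:ℝ) (n:ℕ) : ‖(aa y n:ℂ)*cex (-Ci*t*lg n)‖ = aa y n := by
  rw [norm_mul, show -Ci*t*lg n=((-(t*lg n):ℝ):ℂ)*Ci by push_cast; ring, norm_exp_ofReal_mul_I, mul_one, norm_real, non (aa_nn y n)]

lemma AA_sum {y:ℝ} (hy :0 ≤ y) (t:ℝ) : Summable fun n:ℕ => (aa y n:ℂ)*cex (-Ci*t*lg n) := by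
  obtain ⟨C, hC, h⟩ := G1
  exact Summable.of_norm (by simpa only [AA_term] using (h y hy).1)

lemma AA_norm : ∃ C >0, ∀ y:ℝ,0 ≤ y → ∀ t, ‖AA y t‖ ≤ C*eh y := by
  obtain ⟨C, hC, h⟩ := G1
  refine ⟨C, hC, fun y hy t => ?_⟩
  refine le_trans ?_ (h y hy).2
  refine (norm_tsum_le_tsum_norm (by simpa only [AA_term] using (h y hy).1)).trans (loe ?_)
  simp only [AA_term]

lemma AA_cont {y:ℝ} (hy :0 ≤ y) : Continuous (AA y) := by
  obtain ⟨C, hC, h⟩ := G1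
  exact continuous_tsum (fun n => by fun_prop) (h y hy).1 fun n t => (AA_term y t n).le

lemma mean_AA0 {y T η B:ℝ} (hy :0 ≤ y) (hη :0<η) (hηT :2*η ≤ T) (hB : ∀ M, offd (aa y) η M ≤ B) :
    |(∫ t in 0..T, ‖AA y t‖ ^2)-T*∑' n, aa y n^2| ≤ B+η*∑' n, aa y n^2 := by
  obtain ⟨C, hC, h⟩ := G1
  obtain ⟨C2, hC2, h2⟩ := G2
  obtain ⟨hs, hb⟩ := h y hy
  have hs2 := (h2 y hy).1
  have hDP : ∀ M t, ‖DP (aa y) M t‖ ≤ C*eh y := fun M t => by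
    refine (norm_sum_le _ _).trans (le_trans ?_ hb)
    simp only [AA_term]
    exact hs.sum_le_tsum _ fun n _ => aa_nn y n
  have l1 : Tendsto (fun M => ∫ t in 0..T, ‖DP (aa y) M t‖ ^2) atTop (𝓝 (∫ t in 0..T, ‖AA y t‖ ^2)) := by
    refine intervalIntegral.tendsto_integral_filter_of_dominated_convergence (fun _ => (C*eh y)^2) ?_ ?_ ?_ ?_
    · exact Eventually.of_forall fun M => ((DP_cont (aa y) M).norm.pow 2).aestronglyMeasurable
    · refine Eventually.of_forall fun M => Eventually.of_forall fun t _ => ?_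
      rw [non pz]
      exact plp nnz (hDP M t) 2
    · exact ccc.intervalIntegrable 0 T
    · exact Eventually.of_forall fun t _ => ((AA_sum hy t).hasSum.tendsto_sum_nat.norm).pow 2
  have l2 := hs2.hasSum.tendsto_sum_nat
  refine le_of_tendsto (l1.sub (l2.const_mul T)).abs (Eventually.of_forall fun M => ?_)
  refine (DP_mean (aa_nn y) (by simp [aa]) hη hηT).trans (ala (hB M) (mlm ?_ hη.le))
  exact hs2.sum_le_tsum _ fun n _ => pz

lemma log_three : rl1 ≤ lg 3 := by
  rw [le_log_iff_exp_le nz]; linarith [exp_one_lt_d9]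

lemma mean_AA : ∃ C >0, ∀ x T:ℝ,3 ≤ T → 1 ≤ x → x ≤ T → |(∫ t in 0..T, ‖AA (lg x) t‖ ^2)-T*lg x| ≤ C*(T*sqr (lg T)) := by
  obtain ⟨C, hC, ho⟩ := offd_bound
  obtain ⟨C2, hC2, h2⟩ := G2
  refine ⟨C*(2+2*62^3+4)+(1+C2)+C2, pz, fun x T hT hx hxT => ?_⟩
  set y := lg x with hy
  set l := lg T with hl
  have hy0 :0 ≤ y := log_nonneg hx
  have hyl : y ≤ l := lll lz hxT
  have hl1 :1 ≤ l := log_three.trans (lll nz hT)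
  set q := sqr l with hq
  have hq1 :1 ≤ q := one_le_sqrt.2 hl1
  have hq2 : q^2=l := sq_sqrt lz
  have hT0 :0<T := lz
  set η := T/(2*q) with hη
  have hη0 :0<η := pz
  have hηT :2*η ≤ T := by rw [hη, mul_div_assoc', dli lz]; nlinarith
  set R := ⌈l^2⌉₊ with hR
  have hRl : l^2 ≤ R := Nat.le_ceil _
  have hRu : (R:ℝ) ≤2*l^2 := by
    have := Nat.ceil_lt_add_one (show 0 ≤ l^2 by positivity)
    have h1 :1 ≤ l^2 := one_le_pow₀ hl1
    linarith
  have hR1 :1 ≤ R := Nat.one_le_ceil_iff.2 pz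
  have hR1' : rl1 ≤ R := by exact_mod_cast hR1
  have hex : ex y=x := rel lz
  have b1 : ex y/η ≤2*(T*q) := by
    rw [hex, hη, div_div_eq_mul_div, dli hT0]
    nlinarith [mul_nonneg hT0.le (show 0 ≤ q by linarith)]
  have b2 : ex y*(1+y)^q25*(1+lg R)^3 ≤2*62^3*(T*q) := by
    set z := l^(1/30:ℝ) with hz
    have hz1 :1 ≤ z := olr hl1 nz
    have c1 : (1+y)^q25 ≤2*z^12 := by
      calc (1+y)^q25 ≤ (2*l)^q25 := rpow_le_rpow lz lz nz
        _ =2^q25*l^q25 := mul_rpow nz lz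
        _ ≤2*z^12 := by
          have e1 : rl2^q25 ≤2 := by
            conv_rhs => rw [← rpow_one 2]
            exact rlr nz nz
          have e2 : l^q25=z^12 := by rw [hz, ← rrn, ← rpow_mul lz]; norm_num
          rw [e2]; gcongr
    have c2 :1+lg R ≤62*z := by
      have e1 : lg R ≤ lg 2+2*lg l := by
        have := lll lz hRu
        rwa [rlm nz pz, log_pow] at this
      have e2 : lg l ≤ z/(1/30) := log_le_rpow_div lz nz
      linarith [ltl]
    have c3 : (1+lg R)^3 ≤ (62*z)^3 :=
      plp (by linarith [log_nonneg hR1']) c2 3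
    have c4 : z^15=q := by rw [hz, hq, sqrt_eq_rpow, ← rrn, ← rpow_mul lz]; norm_num
    rw [hex]
    calc _ ≤ T*(2*z^12)*(62*z)^3 := by
          have := log_nonneg hR1'
          gcongr
      _ =2*62^3*(T*z^15) := by ring
      _=_ := by rw [c4]
  have b3 : ex (3/2*y)*(1+y)/(sqr η*sqr R) ≤4*(T*q) := by
    rw [dli pz, ← sqrt_mul hη0.le]
    refine (pow_le_pow_iff_left₀ pz pz two_ne_zero).1 ?_
    rw [mul_pow, mul_pow _ (sqr _), sq_sqrt pz, ← ren, show ((2:ℕ):ℝ)*(3/2*y)=(3:ℕ)*y by push_cast; ring, ren, hex]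
    calc x^3*(1+y)^2 ≤ T^3*(2*l)^2 := by gcongr; linarith
      _ =4*T^3*l^2 := by ring
      _ ≤8*T^3*q*l^2 := by nlinarith [show 0 ≤ T^3*l^2 by positivity]
      _=(4*(T*q))^2*(η*l^2) := by rw [hη]; field_simp; ring
      _ ≤ _ := by gcongr
  have hoff : ∀ M, offd (aa y) η M ≤ C*(2+2*62^3+4)*(T*q) := fun M => by
    refine (ho y η R M hy0 hη0 hR1).trans ?_
    rw [mul_assoc C (2+2*62^3+4)]
    refine mlm ?_ hC.le
    linarith
  obtain ⟨hs2, hb2⟩ := h2 y hy0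
  have hm := mean_AA0 hy0 hη0 hηT hoff
  rw [abs_le] at hb2
  set D := ∑' n, aa y n^2
  have d1 : η*D ≤ (1+C2)*(T*q) := by
    calc η*D ≤ η*((1+C2)*l) := by
          refine mlm ?_ hη0.le
          nlinarith [hb2.2]
      _=(1+C2)*(T*q)/2 := by rw [hη, ← hq2]; field_simp
      _ ≤ _ := by linarith [show 0 ≤ (1+C2)*(T*q) by positivity]
  have d2 : |T*D-T*y| ≤ C2*(T*q) := by
    rw [← mul_sub, abs_mul, aop hT0]
    calc T * |D-y| ≤ T*C2 := mlm (abs_le.2 hb2) hT0.le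
      _ ≤ C2*(T*q) := by nlinarith [mul_pos hC2 hT0]
  calc _ ≤ |(∫ t in 0..T, ‖AA y t‖ ^2)-T*D| + |T*D-T*y| := abs_sub_le _ _ _
    _ ≤ _ := lz

def kp (z:ℂ):ℂ :=2/(1-z^2)
def ww (t:ℝ):ℂ :=1/2+Ci*t
def tt (y t:ℝ) (ρ:ℂ):ℂ := (mn ρ:ℂ)*(cex ((ρ-ww t)*y)*kp (ρ-ww t))
def S1 (y T t:ℝ):ℂ := ∑' ρ:ℂ, if 0<ρ.im ∧ ρ.im ≤ T then tt y t ρ else 0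

lemma kp_PK (a:ℂ) (t:ℝ) : kp (a-Ci*t) =2*PK (a-1) (a+1) 0 t := by
  unfold kp PK
  rw [show 1-(a-Ci*t)^2=(Ci*t-(a-1))*(a+1-Ci*t) by ring]
  simp [dem]

lemma kp_int {a:ℂ} (h : |a.re| <1/2) : Integrable fun t:ℝ => kp (a-Ci*t) := by
  simp only [kp_PK]
  rw [abs_lt] at h
  exact (PK_int slz slz 0).const_mul 2

lemma kp_FT {a:ℂ} (h : |a.re| <1/2) (u:ℝ) :
    ∫ t:ℝ, kp (a-Ci*t)*cex (-Ci*t*u)=2*π*cex (-a*u - |u|) := by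
  rw [abs_lt] at h
  have := PK_integral (a := a-1) (b := a+1) slz slz (-u)
  have e : (fun t:ℝ => kp (a-Ci*t)*cex (-Ci*t*u))=fun t =>2*PK (a-1) (a+1) (-u) t := by
    funext t; rw [kp_PK]; unfold PK; push_cast
    rw [show Ci*(t:ℂ) * -u = -Ci*t*u by ring]; simp; ring
  rw [e, icm, this]
  split_ifs with h1
  · rw [abs_of_neg lz]; push_cast; ring_nf
  · rw [aon lz]; push_cast; ring_nf

lemma exp_abs {c:ℂ} {m:ℝ} (hc : |c.re| < m) : Integrable (fun u:ℝ => cex (c*u - m * |u|)) ∧ ∫ u:ℝ, cex (c*u - m * |u|) =2 * m/(m^2-c^2) := by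
  rw [abs_lt] at hc
  have := two_exp (a := c - m) (b := c + m) slz slz
  have e : (fun v:ℝ => if 0<v then cex ((c - m)*v) else cex ((c + m)*v))=fun u:ℝ => cex (c*u - m * |u|) := by
    funext u
    split_ifs with h1
    · rw [aop h1]; ring_nf
    · rw [abs_of_nonpos lz]; push_cast; ring_nf
  rw [e] at this
  refine ⟨this.1, this.2.trans ?_⟩
  have h1 : c - m ≠0 := fun h => by have := congrArg re h; simp at this; linarith
  have h2 : c + m ≠0 := fun h => by have := congrArg re h; simp at this; linarith
  rw [show (m:ℂ)^2-c^2 = -((c - m)*(c + m)) by ring]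
  field_simp; ring

lemma kp_conv {a b:ℂ} (ha : |a.re| <1/2) (hb : |b.re| <1/2) :
    ∫ t:ℝ, kp (a-Ci*t)*kp (b-Ci*t) =2*π*Wweight (a-b) := by
  have hE : Integrable fun u:ℝ => cex (b*u-rl1 * |u|) := (exp_abs lz).1
  have hb2 : ∀ t:ℝ, kp (b-Ci*t)=∫ u:ℝ, cex (b*u-rl1 * |u|)*cex (-Ci*t*u) := by
    intro t
    have h3 := (exp_abs (c := b-Ci*t) (m :=1) slz).2
    unfold kp
    simp only [← cea]
    refine Eq.trans ?_ (h3.symm.trans ?_)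
    · simp
    · refine integral_congr_ae (Eventually.of_forall fun u => ?_)
      simp only; ring_nf
  simp only [hb2, ← icm]
  rw [integral_integral_swap]
  · have e : ∀ u:ℝ, ∫ t:ℝ, kp (a-Ci*t)*(cex (b*u-rl1 * |u|)*cex (-Ci*t*u))=2*π*cex ((b-a)*u-rl2 * |u|) := by
      intro u
      rw [show cex ((b-a)*u-rl2 * |u|)=cex (-a*u - |u|)*cex (b*u-rl1 * |u|) by rw [← cea]; push_cast; ring_nf, ← mul_assoc, ← kp_FT ha, ← integral_mul_const]
      exact integral_congr_ae (Eventually.of_forall fun t => by simp only; ring)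
    simp only [e]
    rw [icm, (exp_abs (c := b-a) (m :=2) _).2]
    · unfold Wweight; push_cast; ring_nf
    · rw [abs_lt] at ha hb ⊢; simp; constructor <;> linarith
  · have := (kp_int ha).mul_prod hE
    refine this.mono ?_ (Eventually.of_forall fun p => ?_)
    · have e : (Function.uncurry fun (t u:ℝ) => kp (a-Ci*t)*(cex (b*u-rl1 * |u|)*cex (-Ci*t*u))) = fun p:ℝ × ℝ => (kp (a-Ci*p.1)*cex (b*p.2-rl1 * |p.2|))*cex (-Ci*p.1*p.2) := by funext p; simp [Function.uncurry]; ring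
      rw [e]
      exact this.aestronglyMeasurable.mul fz
    · simp [Function.uncurry, norm_exp]

lemma kp_bound {z:ℂ} (h : |z.re| ≤1/2) : ‖kp z‖ ≤8/(1+z.im^2) := by
  have h1 : (1+z.im^2)/4 ≤ ‖1-z^2‖ := by
    refine (pow_le_pow_iff_left₀ pz nnz two_ne_zero).1 ?_
    rw [← normSq_eq_norm_sq, show 1-z^2=(1-z)*(1+z) by ring, map_mul]
    simp only [normSq_apply, sub_re, sub_im, add_re, add_im, one_re, one_im]
    rw [abs_le] at h
    have a1 : (1+z.im^2)/4 ≤ (1-z.re)*(1-z.re)+(0-z.im)*(0-z.im) := by nlinarith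
    have a2 : (1+z.im^2)/4 ≤ (1+z.re)*(1+z.re)+(0+z.im)*(0+z.im) := by nlinarith
    calc _=(1+z.im^2)/4*((1+z.im^2)/4) := by ring
      _ ≤ _ := mmm a1 a2 pz (le_trans pz a1)
  unfold kp
  rw [norm_div, cno, dld (by nlinarith [sq_nonneg z.im]) pz]
  linarith

lemma kp_conj (z:ℂ) : cj (kp z)=kp (cj z) := by
  unfold kp; rw [map_div₀, map_sub, map_pow, map_one, conj_ofNat]
lemma kp_neg (z:ℂ) : kp (-z)=kp z := by simp [kp]

lemma zb_fin (T:ℝ) : (zeroBand0 T).Finite := by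
  refine (zeta1_fin (T+4)).subset fun ρ hρ => ?_
  obtain ⟨⟨h1, h2, h3⟩, h4, h5⟩ := hρ
  have hne : ρ ≠1 := by rintro rfl; simp at h3
  refine ⟨(zeta1_zero_iff hne).2 h1, ?_⟩
  rw [mem_closedBall_iff_norm]
  refine (nla _).trans ?_
  simp only [sub_re, sub_im, re_ofNat, im_ofNat, sub_zero]
  rw [abs_of_neg lz, aop h4]; linarith

lemma S1_eq (y T t:ℝ) : S1 y T t=∑ ρ ∈ (zb_fin T).toFinset, tt y t ρ := by
  unfold S1
  rw [tsum_eq_sum (s := (zb_fin T).toFinset)]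
  · refine sum_congr rfl fun ρ hρ => ?_
    simp only [Finite.mem_toFinset] at hρ
    rw [if_pos hρ.2]
  · intro ρ hρ
    split_ifs with h
    · have : mn ρ =0 := by
        by_contra h0
        obtain ⟨a, b⟩ := mn_strip h0
        exact hρ ((zb_fin T).mem_toFinset.2 ⟨⟨(zeta1_zero_iff (by rintro rfl; simp at b)).1 (mn_zero h0), a, b⟩, h⟩)
      simp [tt, this]
    · rfl

lemma zb_star {T:ℝ} {ρ:ℂ} (h : ρ ∈ (zb_fin T).toFinset) :1-cj ρ ∈ (zb_fin T).toFinset := by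
  rw [Finite.mem_toFinset] at h ⊢
  obtain ⟨⟨h1, h2, h3⟩, h4⟩ := h
  have hne : ρ ≠1 := by rintro rfl; simp at h3
  have h5 : mn ρ ≠0 := fun h => by
    have h6 : mz ρ =0 := by simpa [mn, h2, h3] using h
    have h0 := (zeta1_zero_iff hne).2 h1
    have h7 := nca (zeta1_order_ne_top ρ)
    rw [show aord riemannZeta₁ ρ =0 by unfold mz at h6; exact_mod_cast h6] at h7
    exact ((ddr.analyticAt _).analyticOrderAt_eq_zero.1 h7.symm) h0
  have h6 : mn (1-cj ρ) ≠0 := by rwa [mn_star]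
  obtain ⟨a, b⟩ := mn_strip h6
  exact ⟨⟨(zeta1_zero_iff (by intro h; rw [h] at b; simp at b)).1 (mn_zero h6), a, b⟩, by simpa using h4⟩

lemma tt_conj (y t:ℝ) (ρ:ℂ) : cj (tt y t ρ)=(mn (1-cj ρ):ℂ)*(cex (-(1-cj ρ-ww t)*y)*kp (1-cj ρ-ww t)) := by
  unfold tt
  rw [mn_star, map_mul, map_mul, kp_conj, ← exp_conj, ← kp_neg]
  have : -(1-cj ρ-ww t)=cj (ρ-ww t) := by simp [ww, conj_ofNat]; ring
  rw [← kp_neg (1-_-_), this, kp_neg]; simp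

lemma FF0_eq {x T:ℝ} (hx :1 ≤ x) : Integrable (fun t => ‖S1 (lg x) T t‖ ^2) ∧ FF0 x T=((1/(2*π)*∫ t, ‖S1 (lg x) T t‖ ^2:ℝ):ℂ) := by
  set y := lg x with hy
  set Z := (zb_fin T).toFinset with hZ
  have hre : ∀ ρ ∈ Z, |(ρ-1/2).re| <1/2 := fun ρ h => by
    rw [hZ, Finite.mem_toFinset] at h
    rw [abs_lt]; simp; constructor <;> linarith [h.1.2.1, h.1.2.2]
  have hsq : ∀ t, ((‖S1 y T t‖ ^2:ℝ):ℂ)=∑ ρ ∈ Z, ∑ ρ' ∈ Z, (mn ρ * mn ρ'*cex ((ρ-ρ')*y))*(kp (ρ-1/2-Ci*t)*kp (ρ'-1/2-Ci*t)) := by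
    intro t
    have : cj (S1 y T t)=∑ ρ ∈ Z, (mn ρ:ℂ)*(cex (-(ρ-ww t)*y)*kp (ρ-ww t)) := by
      rw [S1_eq, map_sum]
      simp only [tt_conj]
      refine sum_nbij' (fun ρ =>1-cj ρ) (fun ρ =>1-cj ρ) (fun ρ h => zb_star h) (fun ρ h => zb_star h) ?_ ?_ ?_ <;> intros <;> simp
    push_cast
    rw [← mul_conj', this, S1_eq, sum_mul_sum]
    refine sum_congr rfl fun ρ _ => sum_congr rfl fun ρ' _ => ?_
    unfold tt ww
    rw [show (ρ-ρ')*(y:ℂ)=(ρ-(1/2+Ci*t))*y + -(ρ'-(1/2+Ci*t))*y by ring, cea, ← sub_sub, ← sub_sub]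
    ring
  have hint : ∀ ρ ∈ Z, ∀ ρ' ∈ Z, Integrable fun t:ℝ => (mn ρ * mn ρ'*cex ((ρ-ρ')*y))*(kp (ρ-1/2-Ci*t)*kp (ρ'-1/2-Ci*t)) := by
    intro ρ h ρ' h'
    refine Integrable.const_mul ((kp_int (hre ρ h)).mul_bdd (c :=8) (kp_int (hre ρ' h')).aestronglyMeasurable (Eventually.of_forall fun t => (kp_bound ?_).trans ((dli pz).2 ?_))) _
    · simpa using (hre ρ' h').le
    · nlinarith [sq_nonneg (ρ'-1/2-Ci*t).im]
  have hI : Integrable fun t => ((‖S1 y T t‖ ^2:ℝ):ℂ) := by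
    simp only [hsq]
    exact integrable_finsetSum _ fun ρ h => integrable_finsetSum _ fun ρ' h' => hint ρ h ρ' h'
  refine ⟨by exact_mod_cast hI.re, ?_⟩
  push_cast
  rw [← integral_complex_ofReal]
  simp only [hsq]
  rw [integral_finsetSum _ fun ρ h => integrable_finsetSum _ fun ρ' h' => hint ρ h ρ' h', mul_sum]
  unfold FF0
  rw [finsum_mem_eq_finite_toFinset_sum _ (zb_fin T)]
  refine sum_congr rfl fun ρ h => ?_
  rw [finsum_mem_eq_finite_toFinset_sum _ (zb_fin T), integral_finsetSum _ fun ρ' h' => hint ρ h ρ' h', mul_sum]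
  refine sum_congr rfl fun ρ' h' => ?_
  rw [icm, kp_conv (hre ρ h) (hre ρ' h')]
  have hm : ∀ ρ ∈ Z, (zetaMult ρ:ℂ) = mn ρ := fun ρ h => by
    rw [hZ, Finite.mem_toFinset] at h
    have := zetaMult_eq (ρ := ρ) (by rintro rfl; simpa using h.1.2.2)
    rw [mn, if_pos h.1.2, ← this]; simp
  rw [hm ρ h, hm ρ' h', cpow_def_of_ne_zero (by exact_mod_cast (lz : x ≠0)), ← ofReal_log lz, sub_sub_sub_cancel_right, mul_comm (y:ℂ)]
  have : (π:ℂ) ≠0 := by exact_mod_cast pi_ne_zero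
  field_simp

def SS (y t:ℝ):ℂ := ∑' ρ:ℂ, tt y t ρ
def cT (t:ℝ) (k:ℕ):ℂ := -2*(k+1)-ww t
def TR (y t:ℝ):ℂ := ∑' k:ℕ, cex (cT t k*y)*kp (cT t k)

lemma SS_eq {y:ℝ} (hy :0 ≤ y) (t:ℝ) : Summable (tt y t) ∧ Summable (fun k:ℕ => cex (cT t k*y)*kp (cT t k)) ∧ SS y t=cex ((1-ww t)*y)*kp (1-ww t)-cex (-y)*LL ⟨-1/2, t⟩-AA y t-TR y t := by
  obtain ⟨C, hC, h⟩ := LL_left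
  have hw : ww t-rl1=⟨-1/2, t⟩ := by apply Complex.ext <;> simp [ww]; norm_num
  have h1 := EF (y := y) (κ :=1) (c :=3/4) (w := ww t) hy nz nz (by simp [ww]; norm_num)
    (by rw [hw]; exact (h t).1) (by rw [hw]; intro h; have := congrArg re h; norm_num at this)
  rw [hw] at h1
  obtain ⟨a1, a2, a3⟩ := mz_split h1.summable
  have e : ∀ z:ℂ, (2*(rl1:ℂ)/((rl1:ℂ)^2-z^2))=kp z := fun z => by simp [kp]
  simp only [e] at a1 a2 a3 h1
  refine ⟨a1, a2, ?_⟩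
  rw [h1.tsum_eq] at a3
  have hA : (∑' n:ℕ, (vm n:ℂ)*((n:ℂ)^(-ww t)*cex (-(rl1:ℂ) * dl y n)))=AA y t := by
    unfold AA
    refine tsum_congr fun n => ?_
    rcases nez n with rfl | hn
    · simp [aa]
    have hn' : (n:ℂ) ≠0 := by exact_mod_cast hn.ne'
    unfold aa
    rw [ofReal_mul, ofReal_mul, ofReal_cpow pz, ofReal_natCast, cpow_def_of_ne_zero hn', cpow_def_of_ne_zero hn', ← ofReal_natCast, ← ofReal_log pz, ofReal_exp, mul_assoc, ← cea, ← cea, ← cea]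
    congr 2; unfold ww; simp; ring
  rw [hA] at a3
  unfold SS TR
  refine eq_sub_of_add_eq (a3.symm.trans ?_)
  simp

lemma cT_re (t:ℝ) (k:ℕ) : (cT t k).re = -2*(k+1)-1/2 := by simp [cT, ww]

lemma kp_triv (t:ℝ) (k:ℕ) : ‖kp (cT t k)‖ ≤2/((k:ℝ)+1)^2 ∧ ‖cT t k-1/2‖ * ‖kp (cT t k)‖ ≤2 := by
  set c := cT t k with hc
  have hr := cT_re t k
  rw [← hc] at hr
  have hk : rl0 ≤ k := ncn k
  have h1 : (k:ℝ)+1 ≤ ‖1+c‖ := by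
    refine le_trans ?_ (arl _)
    rw [abs_of_neg] <;> simp [hr] <;> linarith
  have h2 : (k:ℝ)+1 ≤ ‖1-c‖ := by
    refine le_trans ?_ (arl _)
    rw [aop] <;> simp [hr] <;> linarith
  have h3 : ‖c-1/2‖ ≤ ‖1-c‖ := by
    refine (pow_le_pow_iff_left₀ nnz nnz two_ne_zero).1 ?_
    rw [← normSq_eq_norm_sq, ← normSq_eq_norm_sq, normSq_apply, normSq_apply]
    simp [hr]; nlinarith
  have e : ‖kp c‖ =2/(‖1-c‖ * ‖1+c‖) := by unfold kp; rw [norm_div, ← norm_mul, show 1-c^2=(1-c)*(1+c) by ring]; simp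
  rw [e]
  constructor
  · rw [sq]; gcongr
  · rw [← mul_div_assoc, dli nlz]
    nlinarith [norm_nonneg (c-1/2), norm_nonneg (1-c), mmm h3 h1 pz pz]

lemma TR_bound : ∃ C >0, ∀ y:ℝ,0 ≤ y → ∀ t, ‖TR y t‖ ≤ C*ex (-y) := by
  have hs : Summable fun k:ℕ =>2/((k:ℝ)+1)^2 := by
    have := ((summable_nat_add_iff 1).2 (summable_one_div_nat_pow.2 one_lt_two)).mul_left 2
    simpa [dem] using this
  refine ⟨∑' k:ℕ,2/((k:ℝ)+1)^2, hs.tsum_pos (fun k => pz) 0 nz, fun y hy t => ?_⟩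
  rw [← tsum_mul_right]
  refine ton (hs.mul_right _).hasSum fun k => ?_
  rw [norm_mul, mul_comm]
  refine mmm (kp_triv t k).1 ?_ pz pz
  rw [norm_exp]
  refine ele.2 ?_
  simp [cT_re]; nlinarith [mul_nonneg hy (ncn (α := ℝ) k)]

lemma kp_one (t:ℝ) : ‖kp (1-ww t)‖ ≤8/(1+t^2) := by
  have : |(1-ww t).re| ≤1/2 := by simp [ww]; norm_num [abs_le]
  simpa [ww] using kp_bound this

lemma SS_main : ∃ C >0, ∀ y:ℝ,0 ≤ y → ∀ t, ‖SS y t-(ex (-y)*lt2 t:ℝ)+AA y t‖ ≤ C*(ex (-y)+eh y/(1+t^2)) := by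
  obtain ⟨C1, h1, hL⟩ := LL_left
  obtain ⟨C2, h2, hT⟩ := TR_bound
  refine ⟨C1+C2+8, pz, fun y hy t => ?_⟩
  rw [(SS_eq hy t).2.2]
  have e1 : cex (-y)=(ex (-y):ℝ) := by push_cast; rfl
  rw [e1, ofReal_mul]
  rw [show ∀ P E L A R l:ℂ, P-E*L-A-R-E*l+A=P-E*(L+l)-R from fun _ _ _ _ _ _ => by ring]
  refine (nsl _ _).trans ((ala (nsl _ _) (hT y hy t)).trans ?_)
  have a1 : ‖cex ((1-ww t)*y)*kp (1-ww t)‖ ≤ eh y*(8/(1+t^2)) := by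
    rw [norm_mul]
    refine mmm (loe ?_) (kp_one t) nnz pz
    rw [norm_exp]; congr 1; simp [ww]; ring
  have a2 : ‖(ex (-y):ℂ)*(LL ⟨-1/2, t⟩+(lt2 t:ℝ))‖ ≤ ex (-y)*C1 := by
    rw [norm_mul, norm_real, non pz]
    exact mlm (hL t).2 pz
  have e3 : eh y*(8/(1+t^2)) =8*(eh y/(1+t^2)) := by ring
  have p1 :0 ≤ eh y/(1+t^2) := pz
  have p2 := exp_pos (-y)
  nlinarith

lemma SS_bound : ∃ C >0, ∀ y:ℝ,0 ≤ y → ∀ t, ‖SS y t‖ ≤ C*(eh y+ex (-y)*lt2 t) := by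
  obtain ⟨C, h1, h⟩ := SS_main
  obtain ⟨C2, h2, hT⟩ := AA_norm
  refine ⟨2*C+C2+1, pz, fun y hy t => ?_⟩
  have h3 := h y hy t
  have h4 := hT y hy t
  set L := ex (-y)*lt2 t
  have hL :0 ≤ L := mul_nonneg pz (log_nonneg (by linarith [abs_nonneg t]))
  have e1 : ex (-y) ≤ eh y := ele.2 lz
  have e2 : eh y/(1+t^2) ≤ eh y := div_le_self pz (by nlinarith [sq_nonneg t])
  have : ‖SS y t‖ ≤ ‖SS y t-(L:ℝ)+AA y t‖ + ‖(L:ℂ)‖ + ‖AA y t‖ := by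
    calc _ = ‖(SS y t-(L:ℝ)+AA y t)+L-AA y t‖ := by ring_nf
      _ ≤ _ := (nsl _ _).trans (by gcongr; exact nal _ _)
  rw [norm_real, non hL] at this
  nlinarith [exp_pos (y/2)]

lemma exp_lip (a b:ℂ) : ‖cex a-cex b‖ ≤ ‖a-b‖ * (‖cex a‖ + ‖cex b‖) := by
  rw [mul_comm]
  refine (convex_halfSpace_re_le (max a.re b.re)).norm_image_sub_le_of_norm_deriv_le (fun z _ => Complex.differentiableAt_exp) (fun z hz => ?_) sz sz
  rw [Complex.deriv_exp]
  simp only [norm_exp]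
  rcases le_max_iff.1 (show z.re ≤ max a.re b.re from hz) with h | h
  · linarith [ele.2 h, exp_pos b.re]
  · linarith [ele.2 h, exp_pos a.re]

def bb (Y t:ℝ):ℂ := ex (-Y/2)*SS Y t

lemma bb_eq {Y:ℝ} (hY :0 ≤ Y) (t:ℝ) : bb Y t=cex (-(Ci*t)*Y)*kp (1-ww t)-cex (-(3/2)*Y)*LL ⟨-1/2, t⟩-ex (-Y/2)*AA Y t-ex (-Y/2)*TR Y t := by
  unfold bb
  rw [(SS_eq hY t).2.2, mul_sub, mul_sub, mul_sub, ← mul_assoc, ← mul_assoc, ofReal_exp, ← cea, ← cea]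
  unfold ww; push_cast; ring_nf

lemma A_lip : ∃ C >0, ∀ Y Y' t:ℝ,0 ≤ Y → 0 ≤ Y' → ‖ex (-Y/2)*AA Y t-ex (-Y'/2)*AA Y' t‖ ≤ C * |Y-Y'| := by
  obtain ⟨C, hC, h⟩ := G1
  refine ⟨3*C, pz, fun Y Y' t hY hY' => ?_⟩
  obtain ⟨s1, b1⟩ := h Y hY
  obtain ⟨s2, b2⟩ := h Y' hY'
  unfold AA
  rw [← tml, ← tml, ← Summable.tsum_sub ((AA_sum hY t).mul_left _) ((AA_sum hY' t).mul_left _)]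
  have hs := ((s1.mul_left (ex (-Y/2))).add (s2.mul_left (ex (-Y'/2)))).mul_left (3/2 * |Y-Y'|)
  refine (ton hs.hasSum fun n => ?_).trans ?_
  · rw [← mul_assoc, ← mul_assoc, ← sub_mul, norm_mul]
    have e : ‖cex (-Ci*t*lg n)‖ =1 := by rw [show -Ci*t*lg n=((-(t*lg n):ℝ):ℂ)*Ci by push_cast; ring, norm_exp_ofReal_mul_I]
    rw [e, mul_one]
    unfold aa
    set v := vM n*(n:ℝ)^m12 with hv
    have hv0 :0 ≤ v := mul_nonneg (vM_nn n) pz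
    have e2 : ∀ Y:ℝ, ex (-Y/2)*(vM n*((n:ℝ)^m12*ex (-dl Y n)))=v*ex (-Y/2 - dl Y n) := fun Y => by rw [sub_eq_add_neg (-Y/2), rea, hv]; ring
    have e3 := exp_lip ((-Y/2 - dl Y n:ℝ)) ((-Y'/2 - dl Y' n:ℝ))
    rw [← ofReal_mul, ← ofReal_mul, ← ofReal_sub, e2, e2, ← mul_sub, norm_real, nea, abs_mul, aon hv0, ← mul_add, ← mul_assoc (3/2*_), mul_comm _ v, mul_assoc v]
    refine mlm ?_ hv0
    rw [← ofReal_exp, ← ofReal_exp, ← ofReal_sub, ← ofReal_sub] at e3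
    simp only [norm_real, nea, abs_exp] at e3
    refine e3.trans (mlo ?_ pz)
    have := abs_abs_sub_abs_le_abs_sub (Y-lg n) (Y'-lg n)
    rw [sub_sub_sub_cancel_right] at this
    calc _ = |-(Y-Y')/2 + -(dl Y n - dl Y' n)| := by ring_nf
      _ ≤ |-(Y-Y')/2| + |-(dl Y n - dl Y' n)| := abs_add_le _ _
      _ ≤ _ := by rw [abs_neg, abs_div, abs_neg, abs_two]; linarith
  · rw [tml, Summable.tsum_add (s1.mul_left _) (s2.mul_left _), tml, tml]
    have e : ∀ Y S:ℝ, S ≤ C*eh Y → ex (-Y/2)*S ≤ C := fun Y S h => by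
      calc _ ≤ ex (-Y/2)*(C*eh Y) := by gcongr
        _=C*ex (-Y/2+Y/2) := by rw [rea]; ring
        _=C := by rw [show -Y/2+Y/2 =0 by ring]; simp
    nlinarith [e Y _ b1, e Y' _ b2, abs_nonneg (Y-Y')]

lemma T_lip : ∃ C >0, ∀ Y Y' t:ℝ,1/2 ≤ Y → 1/2 ≤ Y' → ‖ex (-Y/2)*TR Y t-ex (-Y'/2)*TR Y' t‖ ≤ C * |Y-Y'| := by
  have hg : Summable fun k:ℕ => ex (-1)^k := sgo pz sz
  refine ⟨4*∑' k:ℕ, ex (-1)^k, mul_pos nz (hg.tsum_pos (fun k => pz) 0 nz), fun Y Y' t hY hY' => ?_⟩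
  unfold TR
  rw [← tml, ← tml, ← Summable.tsum_sub ((SS_eq lz t).2.1.mul_left _) ((SS_eq lz t).2.1.mul_left _), ← tml, ← tsum_mul_right]
  refine ton ((hg.mul_left _).mul_right _).hasSum fun k => ?_
  set c := cT t k with hc
  have e : ∀ Y:ℝ, ((ex (-Y/2):ℝ):ℂ)*(cex (c*Y)*kp c)=cex ((c-1/2)*Y)*kp c := fun Y => by rw [← mul_assoc, ofReal_exp, ← cea]; push_cast; ring_nf
  have e2 : ∀ Y:ℝ,1/2 ≤ Y → ‖cex ((c-1/2)*Y)‖ ≤ ex (-1)^k := fun Y hY => by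
    rw [norm_exp, ← ren]
    refine ele.2 ?_
    simp [hc, cT_re]; nlinarith [ncn (α := ℝ) k]
  rw [e, e, ← sub_mul, norm_mul]
  have h1 := exp_lip ((c-1/2)*Y) ((c-1/2)*Y')
  rw [← mul_sub, norm_mul, ← ofReal_sub, norm_real, nea] at h1
  calc _ ≤ (‖c-1/2‖ * |Y-Y'| * (ex (-1)^k+ex (-1)^k)) * ‖kp c‖ := by
        refine mlo (h1.trans ?_) nnz
        gcongr
        exacts [e2 Y hY, e2 Y' hY']
    _=(‖c-1/2‖ * ‖kp c‖)*(2*(ex (-1)^k * |Y-Y'|)) := by ring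
    _ ≤2*(2*(ex (-1)^k * |Y-Y'|)) := mlo (kp_triv t k).2 pz
    _=_ := by ring

lemma bb_lip : ∃ C >0, ∀ Y Y' t:ℝ,1/2 ≤ Y → 1/2 ≤ Y' → lt2 t ≤ ex Y → lt2 t ≤ ex Y' → ‖bb Y t‖ ≤ C ∧ ‖bb Y t-bb Y' t‖ ≤ C * |Y-Y'| := by
  obtain ⟨C1, h1, hA⟩ := A_lip
  obtain ⟨C2, h2, hT⟩ := T_lip
  obtain ⟨C3, h3, hL⟩ := LL_left
  obtain ⟨C4, h4, hS⟩ := SS_bound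
  refine ⟨C1+C2+4*(C3+1)+2*C4+16, pz, fun Y Y' t hY hY' hl hl' => ⟨?_, ?_⟩⟩
  · unfold bb
    rw [norm_mul, norm_real, non pz]
    have p1 : ex (-Y/2)*eh Y =1 := by rw [← rea]; ring_nf; simp
    have p2 : ex (-Y/2)*(ex (-Y)*ex Y) ≤1 := by rw [← rea (-Y)]; simp; linarith
    have p3 : ex (-Y/2)*(ex (-Y)*lt2 t) ≤1 := le_trans (by gcongr) p2
    calc _ ≤ ex (-Y/2)*(C4*(eh Y+ex (-Y)*lt2 t)) := by gcongr; exact hS Y lz t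
      _=C4*(ex (-Y/2)*eh Y+ex (-Y/2)*(ex (-Y)*lt2 t)) := by ring
      _ ≤ C4*(1+1) := by rw [p1]; gcongr
      _ ≤ _ := lz
  · rw [bb_eq lz, bb_eq lz]
    have a1 := hA Y Y' t lz lz
    have a2 := hT Y Y' t hY hY'
    have a3 : ‖cex (-(Ci*t)*Y)*kp (1-ww t)-cex (-(Ci*t)*Y')*kp (1-ww t)‖ ≤16 * |Y-Y'| := by
      rw [← sub_mul, norm_mul]
      have h1 := exp_lip (-(Ci*t)*Y) (-(Ci*t)*Y')
      have e : ∀ Y:ℝ, ‖cex (-(Ci*t)*Y)‖ =1 := fun Y => by rw [norm_exp]; simp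
      rw [e, e, ← mul_sub, norm_mul, ← ofReal_sub, norm_real, nea, norm_neg, norm_mul, norm_I, norm_real, nea] at h1
      calc _ ≤ (1 * |t| * |Y-Y'| * (1+1))*(8/(1+t^2)) := mmm h1 (kp_one t) nnz pz
        _ =16 * |Y-Y'| * (|t| / (1+t^2)) := by ring
        _ ≤16 * |Y-Y'| *1 := by
          gcongr
          rw [div_le_one pz, ← sq_abs]; nlinarith [sq_nonneg (|t| -1), sq_nonneg |t|]
        _=_ := mul_one _
    have a4 : ‖cex (-(3/2)*Y)*LL ⟨-1/2, t⟩-cex (-(3/2)*Y')*LL ⟨-1/2, t⟩‖ ≤4*(C3+1) * |Y-Y'| := by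
      rw [← sub_mul, norm_mul]
      have h1 := exp_lip (-(3/2)*Y) (-(3/2)*Y')
      rw [← mul_sub, norm_mul, ← ofReal_sub, norm_real, nea] at h1
      have hlog :0 ≤ lt2 t := log_nonneg (by linarith [abs_nonneg t])
      have e1 : ‖LL ⟨-1/2, t⟩‖ ≤ C3+lt2 t := by
        have := nsl (LL ⟨-1/2, t⟩+(lt2 t:ℝ)) (lt2 t:ℝ)
        rw [add_sub_cancel_right, norm_real, non hlog] at this
        linarith [(hL t).2]
      have e2 : ∀ Y:ℝ,1/2 ≤ Y → lt2 t ≤ ex Y → ‖cex (-(3/2)*Y)‖ * (C3+lt2 t) ≤ C3+1 := by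
        intro Y hY hl
        rw [norm_exp]
        have e : (-(3/2)*(Y:ℂ)).re = -Y + -Y/2 := by rw [show (-(3/2)*(Y:ℂ))=((-(3/2)*Y:ℝ):ℂ) by push_cast; ring, ofReal_re]; ring
        rw [e]
        have q1 : ex (-Y + -Y/2) ≤1 := exp_le_one_iff.2 lz
        have q2 : ex (-Y + -Y/2)*ex Y ≤1 := by rw [← rea]; exact exp_le_one_iff.2 lz
        have q3 := exp_pos (-Y + -Y/2)
        nlinarith [mlm hl q3.le]
      calc _ ≤ (‖(-(3/2):ℂ)‖ * |Y-Y'| * (‖cex (-(3/2)*Y)‖ + ‖cex (-(3/2)*Y')‖))*(C3+lt2 t) :=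
            mmm h1 e1 nnz pz
        _ =3/2 * |Y-Y'| * (‖cex (-(3/2)*Y)‖ * (C3+lt2 t) + ‖cex (-(3/2)*Y')‖ * (C3+lt2 t)) := by rw [norm_neg]; norm_num; ring
        _ ≤3/2 * |Y-Y'| * ((C3+1)+(C3+1)) := by gcongr; exacts [e2 Y hY hl, e2 Y' hY' hl']
        _ ≤ _ := by nlinarith [abs_nonneg (Y-Y')]
    rw [show ∀ a b c d a' b' c' d':ℂ, a-b-c-d-(a'-b'-c'-d')=(a-a')-(b-b')-(c-c')-(d-d') from
      fun _ _ _ _ _ _ _ _ => by ring]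
    refine ((nsl _ _).trans (ala ((nsl _ _).trans (ala ((nsl _ _).trans (ala a3 a4)) a1)) a2)).trans ?_
    nlinarith [abs_nonneg (Y-Y')]

def lam (u:ℝ):ℝ := (1-u)^3*(1+3*u)
def Ph (z:ℂ):ℂ := ∫ u in 0..1, (lam u:ℂ)*(csh (z*u)/u)
def Dh (z:ℂ):ℂ := ∫ u in 0..1, (lam u:ℂ)*cch (z*u)

lemma ch_le (w:ℂ) : ‖cch w‖ ≤ ex |w.re| ∧ ‖csh w‖ ≤ ex |w.re| ∧ ‖csh w‖ ≤2 * ‖w‖ * ex |w.re| := by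
  have h1 : ‖cex w‖ ≤ ex |w.re| := by rw [norm_exp]; exact ele.2 (las _)
  have h2 : ‖cex (-w)‖ ≤ ex |w.re| := by rw [norm_exp]; exact ele.2 (by simpa using neg_le_abs _)
  have h3 := exp_lip w (-w)
  rw [sub_neg_eq_add, ← two_mul, norm_mul, cno] at h3
  rw [Complex.sinh, Complex.cosh, norm_div, norm_div, cno]
  refine ⟨?_, ?_, ?_⟩
  · linarith [nal (cex w) (cex (-w))]
  · linarith [nsl (cex w) (cex (-w))]
  · nlinarith [mlm (ala h1 h2) (norm_nonneg w)]

lemma lam_bd {u:ℝ} (h0 :0 ≤ u) (h1 : u ≤1) :0 ≤ lam u ∧ lam u ≤1 := by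
  unfold lam
  have h2 :0 ≤1-u := lz
  refine ⟨pz, ?_⟩
  nlinarith [mul_nonneg h0 h2, mul_nonneg (mul_nonneg h0 h2) h0, mul_nonneg (mul_nonneg h0 h2) (mul_nonneg h0 h2), sq_nonneg u]

lemma lam_cont : Continuous lam := by unfold lam; fun_prop

lemma Ph_term (z:ℂ) {u:ℝ} (h0 :0<u) (h1 : u ≤1) :
    ‖(lam u:ℂ)*(csh (z*u)/u)‖ ≤2 * ‖z‖ * ex |z.re| := by
  have hl := lam_bd h0.le h1
  rw [norm_mul, norm_real, non hl.1, norm_div, norm_real, non h0.le]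
  have h2 := (ch_le (z*u)).2.2
  rw [norm_mul, norm_real, non h0.le, re_mul_ofReal, abs_mul, aop h0] at h2
  have h3 : ex (|z.re| * u) ≤ ex |z.re| := ele.2 (by nlinarith [abs_nonneg z.re])
  calc _ ≤1*(2*(‖z‖ * u)*ex (|z.re|)/u) := by
        gcongr
        · exact hl.2
        · exact h2.trans (by gcongr)
    _=_ := by field_simp

lemma Ph_int (z:ℂ) : IntervalIntegrable (fun u:ℝ => (lam u:ℂ)*(csh (z*u)/u)) volume 0 1 := by
  rw [iii zlo]
  refine Measure.integrableOn_of_bounded (M :=2 * ‖z‖ * ex |z.re|) sz ?_ ?_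
  · have := lam_cont.measurable
    exact Measurable.aestronglyMeasurable fz
  · exact (ae_restrict_iff' mii).2 (Eventually.of_forall fun u hu => Ph_term z hu.1 hu.2)

lemma Ph_deriv (z:ℂ) : HasDerivAt Ph (Dh z) z := by
  have hm := lam_cont.measurable
  refine (intervalIntegral.hasDerivAt_integral_of_dominated_loc_of_deriv_le (s := Metric.ball z 1) (bound := fun _ => ex (‖z‖ +1)) (F := fun (z:ℂ) (u:ℝ) => (lam u:ℂ)*(csh (z*u)/u)) (F' := fun (z:ℂ) (u:ℝ) => (lam u:ℂ)*cch (z*u)) (Metric.ball_mem_nhds z one_pos) (Eventually.of_forall fun z => ?_) (Ph_int z) ?_ ?_ sz ?_).2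
  · exact Measurable.aestronglyMeasurable fz
  · exact Measurable.aestronglyMeasurable fz
  · refine Eventually.of_forall fun u hu x hx => ?_
    rw [uIoc_of_le zlo] at hu
    have hl := lam_bd hu.1.le hu.2
    rw [norm_mul, norm_real, non hl.1]
    refine (mmm hl.2 (ch_le _).1 nnz zlo).trans ?_
    rw [one_mul, re_mul_ofReal, abs_mul, aop hu.1]
    refine ele.2 ?_
    have h1 := arl x
    have h2 : ‖x‖ ≤ ‖z‖ +1 := by
      have := mem_ball_iff_norm.1 hx
      linarith [norm_sub_norm_le x z]
    nlinarith [hu.1, hu.2, abs_nonneg x.re]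
  · refine Eventually.of_forall fun u hu x hx => ?_
    rw [uIoc_of_le zlo] at hu
    have : (u:ℂ) ≠0 := by exact_mod_cast hu.1.ne'
    have h := ((((hhi x).mul_const (u:ℂ)).csinh).div_const (u:ℂ)).const_mul (lam u:ℂ)
    refine h.congr_deriv ?_
    rw [one_mul, mul_div_cancel_right₀ _ this]; rfl

lemma Dh_eq {z:ℂ} (hz : z ≠0) : Dh z =24*(2+cch z-3*(csh z/z))/z^4 := by
  unfold Dh
  have : ∀ u:ℝ, HasDerivAt (fun u:ℝ => (1-(u:ℂ))^3*(1+3*u)*csh (z*u)/z-(-12*u*(1-u)^2)*cch (z*u)/z^2 + (-12*(1-u)*(1-3*u))*csh (z*u)/z^3-(48-72*u)*cch (z*u)/z^4+(-72)*csh (z*u)/z^5) ((lam u:ℂ)*cch (z*u)) u := by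
    intro u
    have h1 : HasDerivAt (fun u:ℂ => (1-u)^3*(1+3*u)*csh (z*u)/z-(-12*u*(1-u)^2)*cch (z*u)/z^2 + (-12*(1-u)*(1-3*u))*csh (z*u)/z^3-(48-72*u)*cch (z*u)/z^4+(-72)*csh (z*u)/z^5) ((1-(u:ℂ))^3*(1+3*u)*cch (z*u)) (u:ℂ) := by
      have hs : HasDerivAt (fun u:ℂ => csh (z*u)) (cch (z*u)*(z*1)) (u:ℂ) := ((hhi _).const_mul z).csinh
      have hc : HasDerivAt (fun u:ℂ => cch (z*u)) (csh (z*u)*(z*1)) (u:ℂ) := ((hhi _).const_mul z).ccosh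
      have i := hhi (u:ℂ)
      have i1 := i.const_sub 1
      have i3 := (i.const_mul 3)
      refine ((((((i1.pow 3).mul (i3.const_add 1)).mul hs).div_const z).sub ((((i.const_mul (-12)).mul (i1.pow 2)).mul hc).div_const (z^2))).add ((((i1.const_mul (-12)).mul (i3.const_sub 1)).mul hs).div_const (z^3)) |>.sub ((((i.const_mul 72).const_sub 48).mul hc).div_const (z^4)) |>.add ((hs.const_mul (-72)).div_const (z^5))).congr_deriv ?_
      simp; field_simp; ring
    have := h1.comp_ofReal
    refine this.congr_deriv ?_
    unfold lam; push_cast; ring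
  rw [ies (fun u _ => this u) ((by have := lam_cont; fun_prop : Continuous _).intervalIntegrable _ _)]
  simp; field_simp; ring

lemma Dh_bd (z:ℂ) : ‖Dh z‖ ≤2304*ex |z.re| / (1 + |z.im|)^3 := by
  have ha := abs_nonneg z.im
  rw [le_div_iff₀ pz]
  rcases le_or_gt 1 |z.im| with h | h
  · have hz : |z.im| ≤ ‖z‖ := ail z
    have hz1 :1 ≤ ‖z‖ := h.trans hz
    have h3 : ‖2+cch z-3*(csh z/z)‖ ≤6*ex |z.re| := by
      have e1 := one_le_exp (abs_nonneg z.re)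
      have e2 : ‖csh z/z‖ ≤ ex |z.re| := by rw [norm_div]; exact (div_le_self nnz hz1).trans (ch_le z).2.1
      have e3 := nsl (2+cch z) (3*(csh z/z))
      have e4 := nal 2 (cch z)
      rw [norm_mul, cno] at e3
      rw [cno] at e4
      linarith [(ch_le z).1]
    rw [Dh_eq (npi.1 lz), norm_div, norm_mul, norm_pow, cno]
    have h4 : (1 + |z.im|)^3 ≤8 * ‖z‖ ^4 := by
      calc _ ≤ (2 * ‖z‖)^3 := plp pz lz 3
        _ =8 * ‖z‖ ^3*1 := by ring
        _ ≤8 * ‖z‖ ^3 * ‖z‖ := by gcongr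
        _=_ := by ring
    calc _ ≤24*(6*ex |z.re|) / ‖z‖ ^4*(8 * ‖z‖ ^4) := by gcongr
      _ =1152*ex |z.re| := by field_simp; ring
      _ ≤ _ := by linarith [exp_pos |z.re|]
  · have h1 : ‖Dh z‖ ≤ ex |z.re| * |1-0| := by
      refine ini fun u hu => ?_
      rw [uIoc_of_le zlo] at hu
      have hl := lam_bd hu.1.le hu.2
      rw [norm_mul, norm_real, non hl.1]
      refine (mmm hl.2 (ch_le _).1 nnz zlo).trans ?_
      rw [one_mul, re_mul_ofReal, abs_mul, aop hu.1]
      exact ele.2 (by nlinarith [hu.2, abs_nonneg z.re])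
    have h2 : (1 + |z.im|)^3 ≤2^3 := plp pz lz 3
    calc _ ≤ (ex |z.re| * |1-0|)*2^3 := by gcongr
      _ ≤ _ := by norm_num; linarith [exp_pos |z.re|]

lemma Ph_I (τ:ℝ) : HasDerivAt (fun τ:ℝ => Ph (Ci*τ)) (Ci*Dh (Ci*τ)) τ := by
  have := (Ph_deriv (Ci*τ)).comp (τ:ℂ) ((hhi _).const_mul Ci)
  simpa [mul_comm] using this.comp_ofReal

lemma Ph_diff {a b:ℝ} (ha :0 ≤ a) (hab : a ≤ b) : ‖Ph (Ci*b)-Ph (Ci*a)‖ ≤1152/(1+a)^2 := by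
  have h := image_norm_le_of_norm_deriv_right_le_deriv_boundary' (f := fun τ:ℝ => Ph (Ci*τ)-Ph (Ci*a)) (a := a) (b := b) (f' := fun τ => Ci*Dh (Ci*τ)) (B := fun τ =>1152/(1+a)^2-1152/(1+τ)^2) (B' := fun τ =>2304/(1+τ)^3) (fun τ _ => ((Ph_I τ).sub_const _).continuousAt.continuousWithinAt) (fun τ _ => ((Ph_I τ).sub_const _).hasDerivWithinAt) sz
    ?_ ?_ ?_ (right_mem_Icc.2 hab)
  · exact h.trans (by simp; positivity)
  · intro τ hτ
    have :0 <1+τ := by linarith [hτ.1]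
    exact ContinuousAt.continuousWithinAt (by fun_prop (disch := positivity))
  · intro τ hτ
    have h0 :0 <1+τ := by linarith [hτ.1]
    have := ((((hhi τ).const_add 1).pow 2).inv (by simp; positivity)).const_mul 1152 |>.const_sub (1152/(1+a)^2)
    refine HasDerivAt.hasDerivWithinAt (this.congr_deriv ?_)
    simp; field_simp; norm_num
  · intro τ hτ
    have := Dh_bd (Ci*τ)
    rw [norm_mul, norm_I, one_mul]
    simpa [aon (ha.trans hτ.1)] using this

lemma Ph_lim : ∃ L:ℂ, L ≠0 ∧ ∀ a:ℝ,0 ≤ a → ‖Ph (Ci*a)-L‖ ≤1152/(1+a)^2 := by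
  have ht : Tendsto (fun a:ℝ =>1152/(1+a)^2) atTop (𝓝 0) :=
    Tendsto.const_div_atTop (tendsto_pow_atTop two_ne_zero |>.comp (tendsto_atTop_add_const_left _ _ tendsto_id)) _
  have hc : CauchySeq fun n:ℕ => Ph (Ci*(n:ℝ)) := by
    refine cauchySeq_of_le_tendsto_0' (fun n:ℕ =>1152/(1+(n:ℝ))^2) (fun n m hnm => ?_) (ht.comp tendsto_natCast_atTop_atTop)
    rw [dist_comm, den]; exact Ph_diff (ncn _) (by exact_mod_cast hnm)
  obtain ⟨L, hL⟩ := cauchySeq_tendsto_of_complete hc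
  refine ⟨L, ?_, fun a ha => ?_⟩
  · have him : ∀ τ:ℝ, (Ph (Ci*τ)).im=∫ u in 0..1, lam u*(Real.sin (τ*u)/u) := by
      intro τ
      have : Ph (Ci*τ)=(∫ u in 0..1, lam u*(Real.sin (τ*u)/u):ℝ)*Ci := by
        rw [← intervalIntegral.integral_ofReal, ← intervalIntegral.integral_mul_const]
        refine integral_congr fun u _ => ?_
        rw [show Ci*τ*u=((τ*u:ℝ):ℂ)*Ci by push_cast; ring, sinh_mul_I]; push_cast; ring
      rw [this]; simp
    have h3 :0<(Ph (Ci*(3:ℝ))).im := by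
      rw [him]
      refine intervalIntegral_pos_of_pos_on ?_ (fun u hu => ?_) zero_lt_one
      · have := (Ph_int (Ci*(3:ℝ)))
        have h := (intervalIntegrable_iff.1 this).im
        refine (intervalIntegrable_iff.2 (show IntegrableOn _ _ _ from h)).congr fun u hu => ?_
        rw [show Ci*(3:ℝ)*u=((3*u:ℝ):ℂ)*Ci by push_cast; ring, sinh_mul_I, ← ofReal_sin]
        simp only [RCLike.im_to_complex, im_ofReal_mul, div_ofReal_im]; simp
      · have :0 <1-u := by linarith [hu.2]
        have h0 := hu.1
        have := sin_pos_of_pos_of_lt_pi (x :=3*u) lz (by linarith [pi_gt_three, hu.2])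
        unfold lam; positivity
    have hmono : MonotoneOn (fun τ:ℝ => (Ph (Ci*τ)).im) (Ici 3) := by
      have hd : ∀ τ:ℝ, HasDerivAt (fun τ:ℝ => (Ph (Ci*τ)).im) (Ci*Dh (Ci*τ)).im τ :=
        fun τ => (imCLM.hasFDerivAt.comp_hasDerivAt τ (Ph_I τ))
      refine monotoneOn_of_deriv_nonneg (convex_Ici 3) (fun τ _ => (hd τ).continuousAt.continuousWithinAt) (fun τ _ => (hd τ).differentiableAt.differentiableWithinAt) fun τ hτ => ?_
      rw [interior_Ici, mem_Ioi] at hτ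
      rw [(hd τ).deriv, Dh_eq slz]
      have e :24*(2+cch (Ci*τ)-3*(csh (Ci*τ)/(Ci*τ)))/(Ci*τ)^4=((24*(2+Real.cos τ-3*(Real.sin τ/τ))/τ^4:ℝ):ℂ) := by
        rw [mul_comm Ci, cosh_mul_I, sinh_mul_I, mul_pow, I_pow_four, mul_div_mul_right _ _ I_ne_zero]
        push_cast; ring
      rw [e, I_mul_im, ofReal_re]
      have : Real.sin τ/τ ≤1/3 := by rw [dld lz nz]; linarith [sin_le_one τ]
      have := neg_one_le_cos τ
      exact div_nonneg lz pz
    have hL2 : Tendsto (fun n:ℕ => (Ph (Ci*(n:ℝ))).im) atTop (𝓝 L.im) := (continuous_im.tendsto L).comp hL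
    have : (Ph (Ci*(3:ℝ))).im ≤ L.im := ge_of_tendsto hL2 (eventually_atTop.2 ⟨3, fun n hn => hmono (mem_Ici.2 le_rfl) (by simpa using hn) (by exact_mod_cast hn)⟩)
    rintro rfl
    rw [zero_im] at this; linarith
  · rw [norm_sub_rev]
    refine le_of_tendsto (hL.sub_const _).norm ?_
    filter_upwards [tendsto_natCast_atTop_atTop.eventually_ge_atTop a] with n hn
    exact Ph_diff ha hn

lemma Ph_neg (z:ℂ) : Ph (-z) = -Ph z := by
  unfold Ph; rw [← intervalIntegral.integral_neg]; refine integral_congr fun u _ => ?_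
  simp only [neg_mul, Complex.sinh_neg]; ring

lemma Ph_main : ∃ L:ℂ, L ≠0 ∧ ∃ C >0, ∀ z:ℂ, (0 ≤ z.im → ‖Ph z-L‖ ≤ C*(ex (2 * |z.re|)/(1+z.im^2))) ∧ (z.im ≤0 → ‖Ph z+L‖ ≤ C*(ex (2 * |z.re|)/(1+z.im^2))) := by
  obtain ⟨L, h0, hL⟩ := Ph_lim
  have key : ∀ z:ℂ,0 ≤ z.im → ‖Ph z-L‖ ≤3456*(ex (2 * |z.re|)/(1+z.im^2)) := by
    intro z hz
    have h1 := hL z.im hz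
    have h2 : ‖Ph z-Ph (Ci*z.im)‖ ≤ (2304*ex |z.re| / (1+z.im)^3) * ‖z-Ci*z.im‖ := by
      have hcv : Convex ℝ (({w:ℂ | w.im ≤ z.im} ∩ {w:ℂ | z.im ≤ w.im}) ∩ ({w:ℂ | w.re ≤ |z.re|} ∩ {w:ℂ | -|z.re| ≤ w.re})) :=
        ((convex_halfSpace_im_le z.im).inter (convex_halfSpace_im_ge z.im) |>.inter ((convex_halfSpace_re_le _).inter (convex_halfSpace_re_ge _)))
      refine hcv.norm_image_sub_le_of_norm_hasDerivWithin_le (fun w _ => (Ph_deriv w).hasDerivWithinAt) (fun w hw => ?_) ?_ ?_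
      · refine (Dh_bd w).trans ?_
        obtain ⟨⟨a, a'⟩, b, c⟩ := hw
        simp only [mem_ofPred_eq] at a b c a'
        rw [le_antisymm a a', aon hz]
        have := ele.2 (abs_le.2 ⟨c, b⟩)
        gcongr
      · simp
      · simp [las, neg_abs_le]
    have e : z-Ci*z.im=z.re := by apply Complex.ext <;> simp
    rw [e, norm_real, nea] at h2
    have h3 : ‖Ph z-L‖ ≤ ‖Ph z-Ph (Ci*z.im)‖ + ‖Ph (Ci*z.im)-L‖ := norm_sub_le_norm_sub_add_norm_sub _ _ _
    have e2 :1+z.im^2 ≤ (1+z.im)^2 := by nlinarith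
    have e3 :1+z.im^2 ≤ (1+z.im)^3 := by nlinarith [sq_nonneg z.im, mul_nonneg hz (sq_nonneg z.im)]
    have e4 : ex |z.re| * |z.re| ≤ ex (2 * |z.re|) := by rw [two_mul, rea]; gcongr; linarith [aol |z.re|]
    have e5 :1 ≤ ex (2 * |z.re|) := one_le_exp pz
    calc _ ≤2304*(ex |z.re| * |z.re|)/(1+z.im)^3+1152*1/(1+z.im)^2 := by refine h3.trans (ala (h2.trans (loe ?_)) (by simpa using h1)); ring
      _ ≤2304*ex (2 * |z.re|)/(1+z.im^2)+1152*ex (2 * |z.re|)/(1+z.im^2) := by gcongr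
      _=_ := by ring
  refine ⟨L, h0,3456, nz, fun z => ⟨key z, fun hz => ?_⟩⟩
  have := key (-z) (by simpa using hz)
  rw [Ph_neg, ← neg_add', norm_neg] at this
  simpa using this

def EE (y A t:ℝ):ℂ := (∑' ρ:ℂ, if ρ.im ≤ A then tt y t ρ else 0)-if t ≤ A then SS y t else 0

lemma sub_ww (t:ℝ) (ρ:ℂ) : (ρ-ww t).re=ρ.re-1/2 ∧ (ρ-ww t).im=ρ.im-t := by simp [ww]

lemma tt_norm (y t:ℝ) (ρ:ℂ) : ‖tt y t ρ‖ ≤ mn ρ*(ex ((ρ.re-1/2)*y)*(8/(1+(ρ.im-t)^2))) := by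
  by_cases h : mn ρ =0
  · simp [tt, h]
  have hs := mn_strip h
  obtain ⟨h1, h2⟩ := sub_ww t ρ
  have hk := kp_bound (z := ρ-ww t) (by rw [h1, abs_le]; constructor <;> linarith)
  unfold tt
  rw [norm_mul, norm_mul, norm_real, non (mn_nonneg _), norm_exp, re_mul_ofReal, h1]
  rw [h2] at hk
  have := mn_nonneg ρ
  gcongr

lemma tt_norm' {y:ℝ} (hy :0 ≤ y) (t:ℝ) (ρ:ℂ) : ‖tt y t ρ‖ ≤ mn ρ*(eh y*(8/(1+(ρ.im-t)^2))) := by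
  refine (tt_norm y t ρ).trans ?_
  by_cases h : mn ρ =0
  · simp [h]
  have hs := mn_strip h
  have : ex ((ρ.re-1/2)*y) ≤ eh y := ele.2 nlz
  have := mn_nonneg ρ
  gcongr

lemma SS_cont {y:ℝ} (hy :0 ≤ y) : Continuous (SS y) := by
  refine continuous_iff_continuousAt.2 fun t₀ => ?_
  set N := |t₀| +1
  refine ContinuousOn.continuousAt (s := Icc (-N) N) ?_ (Icc_mem_nhds (by linarith [neg_abs_le t₀]) (by linarith [las t₀]))
  refine continuousOn_tsum (u := fun ρ =>16*eh y*(1+N^2)*(mn ρ*(1+ρ.im^2)⁻¹)) (fun ρ => ?_) (mn_summable2.mul_left _) (fun ρ t ht => ?_)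
  · by_cases h : mn ρ =0
    · simp only [tt, h]; simpa using continuousOn_const
    have hs := mn_strip h
    refine Continuous.continuousOn ?_
    have : ∀ t,1-(ρ-ww t)^2 ≠0 := by
      intro t h0
      have h1 := (sub_ww t ρ).1
      have : (ρ-ww t-1)*(ρ-ww t+1) =0 := by linear_combination -h0
      rcases mul_eq_zero.1 this with h | h <;> have := congrArg re h <;> simp [ww] at this <;> linarith
    unfold tt kp
    have hw : Continuous ww := by unfold ww; fun_prop
    fun_prop (disch := exact this _)
  · refine (tt_norm' hy t ρ).trans ?_
    have := mn_nonneg ρ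
    have hd : (1+(ρ.im-t)^2)⁻¹ ≤2*(1+N^2)*(1+ρ.im^2)⁻¹ := by
      rw [← dem, ieo, dld pz pz]
      have : t^2 ≤ N^2 := sq_le_sq' ht.1 ht.2
      nlinarith [sq_nonneg (ρ.im-2*t), mul_nonneg (sq_nonneg N) (sq_nonneg (ρ.im-t)), sq_nonneg t]
    calc _ = mn ρ*(8*eh y)*(1+(ρ.im-t)^2)⁻¹ := by ring
      _ ≤ mn ρ*(8*eh y)*(2*(1+N^2)*(1+ρ.im^2)⁻¹) := by gcongr
      _=_ := by ring

lemma tt_ind {y:ℝ} (hy :0 ≤ y) (t:ℝ) (p:ℂ → Prop) [DecidablePred p] : Summable fun ρ => if p ρ then tt y t ρ else 0 :=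
  sob ((SS_eq hy t).1.norm) fun ρ => by split_ifs <;> simp

lemma S1_split {y T:ℝ} (hy :0 ≤ y) (hT :0 ≤ T) (t:ℝ) :
    S1 y T t=(if 0<t ∧ t ≤ T then SS y t else 0)+(EE y T t-EE y 0 t) := by
  have h1 : S1 y T t=(∑' ρ:ℂ, if ρ.im ≤ T then tt y t ρ else 0)-∑' ρ:ℂ, if ρ.im ≤0 then tt y t ρ else 0 := by
    rw [← (tt_ind hy t _).tsum_sub (tt_ind hy t _)]
    refine tsum_congr fun ρ => ?_
    split_ifs <;> simp <;> grind
  rw [h1]; unfold EE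
  split_ifs <;> first | (ring; done) | (exfalso; simp_all; linarith) | (exfalso; simp_all)

lemma EE_triv : ∃ C >0, ∀ y:ℝ,0 ≤ y → ∀ A t, ‖EE y A t‖ ≤ C*(eh y*(lg (|t| + |t-A| +3)/abd t A)) := by
  obtain ⟨C, hC, h⟩ := zs_H
  refine ⟨24*C, pz, fun y hy A t => ?_⟩
  obtain ⟨h1, h2⟩ := h abd t A (by linarith [abs_nonneg (t-A)]) t
  have e : EE y A t=∑' ρ:ℂ, ((if ρ.im ≤ A then tt y t ρ else 0)-if t ≤ A then tt y t ρ else 0) := by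
    rw [(tt_ind hy t _).tsum_sub (tt_ind hy t fun _ => t ≤ A)]
    unfold EE SS; split_ifs <;> simp
  rw [e]
  refine (ton (h1.mul_left (24*eh y)).hasSum fun ρ => ?_).trans ?_
  · have hm := mn_nonneg ρ
    have key : |t-A| ≤ |ρ.im-t| → ‖tt y t ρ‖ ≤24*eh y*(mn ρ*(abd t A^2+(ρ.im-t)^2)⁻¹) := by
      intro hd
      refine (tt_norm' hy t ρ).trans ?_
      have hd2 : |t-A| ^2 ≤ (ρ.im-t)^2 := by rw [← sq_abs (ρ.im-t)]; gcongr
      have : (1+(ρ.im-t)^2)⁻¹ ≤3*(abd t A^2+(ρ.im-t)^2)⁻¹ := by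
        rw [← dem, ieo, dld pz pz]
        nlinarith [sq_nonneg (|t-A| -1)]
      calc _ = mn ρ*(8*eh y)*(1+(ρ.im-t)^2)⁻¹ := by ring
        _ ≤ mn ρ*(8*eh y)*(3*(abd t A^2+(ρ.im-t)^2)⁻¹) := by gcongr
        _=_ := by ring
    have hp :0 ≤24*eh y*(mn ρ*(abd t A^2+(ρ.im-t)^2)⁻¹) := pz
    split_ifs with h1 h2 h2
    · simpa using hp
    · rw [sub_zero]; refine key ?_; rw [aon lz, abs_of_nonpos lz]; linarith
    · rw [zero_sub, norm_neg]; refine key ?_; rw [abs_of_nonpos lz, aon lz]; linarith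
    · simpa using hp
  · rw [tml]
    calc _ ≤24*eh y*(C*lg (|t| + abd t A+2)/abd t A) := by gcongr
      _=_ := by rw [show |t| + abd t A+2 = |t| + |t-A| +3 by ring]; ring

lemma mpt {X M r θ:ℝ} (h0 :0 ≤ θ) (h1 : θ ≤1) (hr :0<r) (hM :0 ≤ M) (ha : X ≤ M) (hb : X ≤ M*r) : X ≤ M*r^θ := by
  rcases le_total 1 r with h | h
  · exact ha.trans (lmo hM (olr h h0))
  · refine hb.trans (mlm ?_ hM)
    simpa using rpow_le_rpow_of_exponent_ge hr h h1

lemma mp78 {X M r:ℝ} (hr :0<r) (hM :0 ≤ M) (h1 : X ≤ M) (h2 : X ≤ M*r) : X ≤ M*r^q78 :=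
  mpt nz nz hr hM h1 h2

lemma int78 {F:ℝ → ℂ} {M:ℝ} (h : ∀ u,0<u → u ≤1 → ‖F u‖ ≤ M*u^m78) : ‖∫ u in 0..1, F u‖ ≤8 * M := by
  have hi := (intervalIntegrable_rpow' (a :=0) (b :=1) (show (-1:ℝ) < -(7/8) by norm_num)).const_mul M
  refine (intervalIntegral.norm_integral_le_of_norm_le zlo (Eventually.of_forall fun u hu => h u hu.1 hu.2) hi).trans ?_
  rw [iic, integral_rpow (Or.inl nz)]
  norm_num; linarith

lemma lam_lip {a b:ℝ} (ha :0 ≤ a) (ha' : a ≤1) (hb :0 ≤ b) (hb' : b ≤1) : |lam a-lam b| ≤12 * |a-b| := by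
  rw [abs_sub_comm (lam a), abs_sub_comm a]
  refine (convex_Icc rl0 1).norm_image_sub_le_of_norm_hasDerivWithin_le (f := lam) (f' := fun u => -12*u*(1-u)^2) (fun u _ => ?_) (fun u hu => ?_) ⟨ha, ha'⟩ ⟨hb, hb'⟩
  · have := (((hhi u).const_sub 1).pow 3).mul (((hhi u).const_mul 3).const_add 1)
    refine (this.congr_deriv ?_).hasDerivWithinAt
    simp; ring
  · obtain ⟨h1, h2⟩ := hu
    have : (1-u)^2 ≤1 := by nlinarith
    rw [nea, mul_assoc, abs_mul, aon (a := u*_) pz]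
    norm_num
    nlinarith [sq_nonneg (1-u)]

lemma osc_f {H:ℝ → ℂ} {K V:ℝ} (hK :0 ≤ K) (hV :1 ≤ V) (h1 : ∀ u v, ‖H u-H v‖ ≤ K*V * |u-v|) (h2 : ∀ u, ‖H u‖ ≤ K) (h0 : H 0 =0) {u:ℝ} (hu :0<u) : ‖(lam (min u 1):ℂ)*(H u/u)‖ ≤ K*V ∧ ‖(lam (min u 1):ℂ)*(H u/u)‖ ≤ K/u ∧ ∀ p,0 ≤ p → ‖(lam (min u 1):ℂ)*(H u/u)-(lam (min (u+p) 1):ℂ)*(H (u+p)/(u+p:ℝ))‖ ≤14*(K*V)*(p/u) := by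
  have hl : ∀ v,0<v → ‖(lam (min v 1):ℂ)‖ ≤1 := fun v hv => by
    have := lam_bd (u := min v 1) pz (min_le_right _ _)
    rw [norm_real, non this.1]; exact this.2
  have hH : ∀ v,0<v → ‖H v‖ ≤ K*V*v := fun v hv => by have := h1 v 0; rwa [h0, sub_zero, sub_zero, aop hv] at this
  have hn : ‖(u:ℂ)‖ = u := by rw [norm_real, non hu.le]
  refine ⟨?_, ?_, fun p hp => ?_⟩
  · rw [norm_mul, norm_div, hn]
    calc _ ≤1*(K*V*u/u) := by gcongr; exacts [hl u hu, hH u hu]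
      _=_ := by field_simp
  · rw [norm_mul, norm_div, hn]
    calc _ ≤1*(K/u) := by gcongr; exacts [hl u hu, h2 u]
      _=_ := one_mul _
  · have hup :0<u+p := lz
    have e : (lam (min u 1):ℂ)*(H u/u)-(lam (min (u+p) 1):ℂ)*(H (u+p)/(u+p:ℝ))=((lam (min u 1)-lam (min (u+p) 1):ℝ):ℂ)*(H u/u)+(lam (min (u+p) 1):ℂ)*((H u-H (u+p))/u) + (lam (min (u+p) 1):ℂ)*(H (u+p)*((p/(u*(u+p)):ℝ):ℂ)) := by
      have : (u:ℂ) ≠0 := by exact_mod_cast hu.ne'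
      have : (u:ℂ)+p ≠0 := by exact_mod_cast hup.ne'
      push_cast; field_simp; ring
    have a1 : |lam (min u 1)-lam (min (u+p) 1)| * (K*V) ≤12*(K*V)*(p/u) := by
      rcases le_total u 1 with h | h
      · have := lam_lip (a := min u 1) (b := min (u+p) 1) pz (min_le_right _ _) pz (min_le_right _ _)
        have h3 : |min u 1 - min (u+p) 1| ≤ p := (abs_min_sub_min_le_max _ _ _ _).trans (by simp [aon hp, hp])
        have h4 : p ≤ p/u := (le_div_iff₀ hu).2 nlz
        calc _ ≤ (12*(p/u))*(K*V) := by gcongr; linarith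
          _=_ := by ring
      · rw [min_eq_right h, min_eq_right lz, sub_self, abs_zero, zero_mul]; positivity
    have a2 : ‖(H u-H (u+p))/u‖ ≤ K*V*(p/u) := by
      rw [norm_div, hn, mul_div_assoc']; gcongr
      have := h1 u (u+p); rwa [sub_add_cancel_left, abs_neg, aon hp] at this
    have a3 : ‖H (u+p)*((p/(u*(u+p)):ℝ):ℂ)‖ ≤ K*V*(p/u) := by
      rw [norm_mul, norm_real, non pz]
      calc _ ≤ K*V*(u+p)*(p/(u*(u+p))) := by gcongr; exact hH _ hup
        _=_ := by field_simp
    have a4 : ‖H u/u‖ ≤ K*V := by rw [norm_div, hn, dli hu]; exact hH u hu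
    rw [e]
    refine (norm_add₃_le).trans ?_
    rw [norm_mul, norm_mul, norm_mul, norm_real, nea]
    have b1 := (mlm a4 (abs_nonneg (lam (min u 1)-lam (min (u+p) 1)))).trans a1
    have b2 := mmm (hl (u+p) hup) a2 nnz zlo
    have b3 := mmm (hl (u+p) hup) a3 nnz zlo
    linarith only [b1, b2, b3]

lemma osc : ∃ C >0, ∀ (H:ℝ → ℂ) (K V s:ℝ),0 ≤ K → 1 ≤ V → (∀ u v, ‖H u-H v‖ ≤ K*V * |u-v|) → (∀ u, ‖H u‖ ≤ K) → H 0 =0 → ‖∫ u in 0..1, (lam u:ℂ)*(H u/u)*cex (Ci*(s*V:ℝ)*u)‖ ≤ C*(K*V^q18*(1 + |s|)^m78) := by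
  refine ⟨1000, nz, fun H K V s hK hV h1 h2 h0 => ?_⟩
  have hV0 :0<V := lz
  set f:ℝ → ℂ := fun u => (lam (min u 1):ℂ)*(H u/u) with hf
  set F:ℝ → ℂ := fun u => f u*cex (Ci*(s*V:ℝ)*u) with hF
  have e1 : (∫ u in 0..1, (lam u:ℂ)*(H u/u)*cex (Ci*(s*V:ℝ)*u))=∫ u in 0..1, F u := by
    refine integral_congr fun u hu => ?_
    rw [uIcc_of_le zlo] at hu
    simp only [hF, hf, min_eq_left hu.2]
  have hfo := fun u (hu :0<u) => osc_f hK hV h1 h2 h0 hu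
  have hex : ∀ u:ℝ, ‖cex (Ci*(s*V:ℝ)*u)‖ =1 := fun u => by rw [norm_exp]; simp
  have hn : ∀ u, ‖F u‖ = ‖f u‖ := fun u => by rw [hF, norm_mul, hex, mul_one]
  have hHc : Continuous H := by
    refine LipschitzWith.continuous (K := (K*V).toNNReal) (LipschitzWith.of_dist_le_mul fun u v => ?_)
    rw [den, Real.dist_eq, coe_toNNReal _ pz]; exact h1 u v
  have hfm : Measurable f := by
    have := lam_cont.measurable; have := hHc.measurable
    fun_prop
  have hFm : Measurable F := by fun_prop
  have hVe : V*V^m78=V^q18 := by rw [← rpow_one_add' hV0.le nz]; norm_num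
  rw [e1]
  have hP :0 ≤ K*V^q18 := pz
  have hsp :0 <1 + |s| := pz
  rcases le_total |s| 1 with hs | hs
  · have := int78 (F := F) (M := K*V^q18) fun u hu _ => by
      rw [hn]
      have := mp78 (X := ‖f u‖) (M := K*V) (r :=1/(V*u)) pz pz (hfo u hu).1 ((hfo u hu).2.1.trans (loe (by field_simp)))
      rwa [one_div, inv_rpow pz, ← rpow_neg pz, mul_rpow hV0.le hu.le, ← mul_assoc, mul_assoc K, hVe] at this
    have h3 : rl2^(-rl1) ≤ (1 + |s|)^m78 := by
      rw [rpow_neg nz, rpow_neg hsp.le]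
      gcongr
      exact (rlr (by linarith [abs_nonneg s]) (show q78 ≤1 by norm_num)).trans (rpow_le_rpow hsp.le lz zlo)
    rw [rpow_neg_one] at h3
    have := mlm h3 hP
    linarith
  · have hs0 :0 < |s| := lz
    set p := π/(|s| * V) with hp
    have hp0 :0<p := by have := pi_pos; positivity
    have hFi : ∀ a b,0 ≤ a → a ≤ b → IntervalIntegrable F volume a b := by
      intro a b ha hab
      rw [iii hab]
      refine Measure.integrableOn_of_bounded (M := K*V) sz hFm.aestronglyMeasurable ?_
      exact (ae_restrict_iff' mii).2 (Eventually.of_forall fun u hu => by rw [hn]; exact (hfo u (ha.trans_lt hu.1)).1)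
    have hsh : ∀ u:ℝ, f (u+p)*cex (Ci*(s*V:ℝ)*u) =-F (u+p) := by
      intro u
      have : cex (Ci*(s*V:ℝ)*(u+p:ℝ)) =-cex (Ci*(s*V:ℝ)*u) := by
        rw [ofReal_add, mul_add, cea, show Ci*(s*V:ℝ)*p=((s*V*p:ℝ):ℂ)*Ci by push_cast; ring, hp]
        rcases abs_cases s with ⟨h, _⟩ | ⟨h, _⟩
        · rw [show s*V*(π/(|s| * V))=π by rw [h] at hs0 ⊢; field_simp, exp_pi_mul_I]; ring
        · rw [show s*V*(π/(|s| * V)) = -π by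
            rw [h] at hs0 ⊢; have : s ≠0 := by rintro rfl; simp at hs0
            field_simp]
          rw [ofReal_neg, neg_mul, Complex.exp_neg, exp_pi_mul_I]; norm_num
      rw [hF]; simp only; rw [this]; ring
    have hid : (∫ u in 0..1, (f u-f (u+p))*cex (Ci*(s*V:ℝ)*u))+∫ u in 0..p, F u =2*∫ u in 0..1, F u := by
      have e2 : ∀ u:ℝ, (f u-f (u+p))*cex (Ci*(s*V:ℝ)*u)=F u+F (u+p) := fun u => by rw [sub_mul, hsh]; ring
      have i1 := hFi p (1+p) hp0.le lz
      have e3 : (∫ u in 0..1, F (u+p))=∫ u in p..(1+p), F u := by rw [integral_comp_add_right (fun u => F u), zero_add]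
      have e4 : (∫ u in rl1..(1+p), F u) =0 := by
        rw [integral_congr (g := fun _ =>0), intervalIntegral.integral_zero]
        intro u hu
        rw [uIcc_of_le lz] at hu
        simp [hF, hf, min_eq_right hu.1, lam]
      have e5 := integral_add_adjacent_intervals (hFi 0 p le_rfl hp0.le) i1
      have e6 := integral_add_adjacent_intervals (hFi 0 1 le_rfl zlo) (hFi 1 (1+p) zlo lz)
      have i2 : IntervalIntegrable (fun u => F (u+p)) volume 0 1 := by have := i1.comp_add_right p; simpa using this
      simp_rw [e2]
      rw [iia (hFi 0 1 le_rfl zlo) i2, e3]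
      rw [e4, ← e5] at e6
      linear_combination -e6
    have b1 := int78 (F := fun u => (f u-f (u+p))*cex (Ci*(s*V:ℝ)*u)) (M :=14*(K*V)*p^q78) fun u hu _ => by
      rw [norm_mul, hex, mul_one]
      have hb := mp78 (X := ‖f u-f (u+p)‖) (M :=14*(K*V)) (r := p/u) pz pz ((nsl _ _).trans (by have := (hfo u hu).1; have := (hfo (u+p) lz).1; have :0 ≤ K*V := pz; linarith)) ((hfo u hu).2.2 p hp0.le)
      rwa [div_rpow hp0.le hu.le, dem, ← rpow_neg hu.le, ← mul_assoc] at hb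
    have b2 : ‖∫ u in 0..p, F u‖ ≤ K*V*p := by
      have := ini (a :=0) (b := p) (f := F) (C := K*V) fun u hu => by rw [uIoc_of_le hp0.le] at hu; rw [hn]; exact (hfo u hu.1).1
      rwa [sub_zero, aop hp0] at this
    have hq : V*p=π * |s|⁻¹ := by rw [hp]; field_simp
    have hq1 : |s|⁻¹ ≤ |s| ^ m78 := by rw [← rpow_neg_one]; exact rlr hs nz
    have hpi : π^q78 ≤4 := by
      refine (rlr (by linarith [pi_gt_three]) (show q78 ≤1 by norm_num)).trans ?_
      rw [rpow_one]; exact pi_le_four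
    have hq2 : V*p^q78 ≤4*(V^q18 * |s| ^ m78) := by
      rw [hp, div_rpow pi_pos.le pz, mul_rpow hs0.le hV0.le, ← hVe, rpow_neg hs0.le, rpow_neg hV0.le]
      calc _=π^q78*(V*(V^q78)⁻¹*(|s| ^ q78)⁻¹) := by field_simp
        _ ≤ _ := by gcongr
    have hq3 : |s| ^ m78 ≤2*(1 + |s|)^m78 := by
      have : (2 * |s|)^m78 ≤ (1 + |s|)^m78 := rlo hsp lz nz
      rw [mul_rpow nz hs0.le] at this
      have h3 : rl2^(-1:ℝ) ≤2^m78 := rlr nz nz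
      rw [rpow_neg_one] at h3
      have := mlo h3 (rpow_nonneg hs0.le m78)
      linarith
    have hV1 :1 ≤ V^q18 := olr hV nz
    have hS := rpow_nonneg hs0.le m78
    have c1 : K*V*p ≤4*(K*V^q18 * |s| ^ m78) := by
      rw [mul_assoc, hq]
      calc _ ≤ K*(4 * |s| ^ m78) := by gcongr; exact pi_le_four
        _ =4*(K*1 * |s| ^ m78) := by ring
        _ ≤ _ := by gcongr
    have c2 := mlm hq2 hK
    have c3 := mlm hq3 hP
    have c4 : ‖2*∫ u in 0..1, F u‖ ≤8*(14*(K*V)*p^q78)+K*V*p := by rw [← hid]; exact (nal _ _).trans (ala b1 b2)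
    rw [norm_mul, cno] at c4
    have c5 :0 ≤ K*V^q18*(1 + |s|)^m78 := pz
    linarith only [c1, c2, c3, c4, c5]

lemma tt_shift (y t T v:ℝ) (ρ:ℂ) : tt y t ρ*cex (v*rt ρ T)=tt (y+v) t ρ*cex (-(v/2)+Ci*(t-T)*v) := by
  unfold tt
  have : cex ((ρ-ww t)*y)*cex (v*rt ρ T)=cex ((ρ-ww t)*(y+v:ℝ))*cex (-(v/2)+Ci*(t-T)*v) := by rw [← cea, ← cea]; congr 1; unfold ww; push_cast; ring
  linear_combination (mn ρ:ℂ)*kp (ρ-ww t)*this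

lemma tt_sum {y t T v:ℝ} (h :0 ≤ y+v) : HasSum (fun ρ => tt y t ρ*cex (v*rt ρ T)) (eh y*(bb (y+v) t*cex (Ci*(t-T)*v))) := by
  simp only [tt_shift]
  have := (SS_eq h t).1.hasSum.mul_right (cex (-(v/2)+Ci*(t-T)*v))
  refine (Eq.subst (motive := HasSum _) ?_ this)
  unfold bb SS
  have e : ((eh y:ℝ):ℂ)*(ex (-(y+v)/2):ℝ)=cex (-(v/2)) := by rw [← ofReal_mul, ← rea, ofReal_exp]; congr 1; push_cast; ring
  rw [cea]
  linear_combination -(∑' ρ, tt (y+v) t ρ)*cex (Ci*(t-T)*v)*e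

lemma sinh_bd {V T u:ℝ} (hV :0<V) (hu :0<u) (hu1 : u ≤1) {ρ:ℂ} (h0 :0<ρ.re) (h1 : ρ.re <1) :
    ‖(lam u:ℂ)*(csh (V*rt ρ T*u)/u)‖ ≤ ex V*(2*(V*(1 + |T|)*(1 + |ρ.im|)))^q18*u^m78 := by
  set z := V*rt ρ T with hz
  set Q := V*(1 + |T|)*(1 + |ρ.im|) with hQ
  have hQ0 :0<Q := pz
  have hzn : ‖z‖ ≤ Q := by
    rw [hz, norm_mul, norm_real, non hV.le, hQ, mul_assoc]
    gcongr
    refine (nla _).trans ?_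
    have : |ρ.re-1| ≤1 := abs_le.2 ⟨lz, lz⟩
    have h3 := abs_sub ρ.im T
    simp
    nlinarith [abs_nonneg T, abs_nonneg ρ.im]
  have hre : |z.re| ≤ V := by
    have : z.re=V*(ρ.re-1) := by rw [hz, re_ofReal_mul]; simp
    rw [this, abs_mul, aop hV]
    have : |ρ.re-1| ≤1 := abs_le.2 ⟨lz, lz⟩
    nlinarith
  have hn : ‖(u:ℂ)‖ = u := by rw [norm_real, non hu.le]
  have he : ex |(z*u).re| ≤ ex V := by rw [re_mul_ofReal, abs_mul, aop hu]; exact ele.2 (by nlinarith [abs_nonneg z.re])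
  obtain ⟨-, c2, c3⟩ := ch_le (z*u)
  rw [norm_mul, hn] at c3
  have hs := mpt (X := ‖csh (z*u)‖) (M := ex V) (r :=2*Q*u) (θ :=1/8) nz nz pz pz (c2.trans he) (c3.trans (by rw [mul_comm (ex V)]; gcongr ?_*?_; nlinarith))
  have hl := lam_bd hu.le hu1
  rw [norm_mul, norm_div, hn, norm_real, non hl.1]
  have hp : u^q18/u=u^m78 := by rw [← rpow_sub_one hu.ne']; norm_num
  calc _ ≤1*(ex V*(2*Q*u)^q18/u) := by gcongr; exact hl.2
    _=_ := by rw [mul_rpow pz hu.le, ← hp]; ring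

lemma P_eq {y V:ℝ} (hV :0<V) (hVy : V ≤ y) (T t:ℝ) :
    HasSum (fun ρ => tt y t ρ*Ph (V*rt ρ T)) (eh y/2*∫ u in 0..1, (lam u:ℂ)*((bb (y+V*u) t*cex (Ci*((t-T)*V:ℝ)*u)-bb (y-V*u) t*cex (Ci*(-(t-T)*V:ℝ)*u))/u)) := by
  have hy :0 ≤ y := lz
  have hint : ∀ ρ, Integrable (fun u:ℝ => tt y t ρ*((lam u:ℂ)*(csh (V*rt ρ T*u)/u))) (volume.restrict (Ioc 0 1)) :=
    fun ρ => ((iii zlo).1 (Ph_int _)).const_mul _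
  have hi78 : IntegrableOn (fun u:ℝ => u^m78) (Ioc 0 1) := (iii zlo).1 (intervalIntegrable_rpow' (a :=0) (b :=1) (show (-1:ℝ) < -(7/8) by norm_num))
  have h := hasSum_int (μ := volume.restrict (Ioc 0 1)) hint (mn_summable.mul_left (eh y*(32*(1+t^2))*(ex V*(2*(V*(1 + |T|)))^q18*8))) (fun ρ => ?_) (fun ρ h u => ?_)
  · convert h using 1
    · funext ρ; rw [icm, Ph, integral_of_le zlo]
    · rw [← iic, integral_of_le zlo]
      refine setIntegral_congr_fun mii fun u hu => ?_
      have hu' : V*u ≤ y := by nlinarith [hu.1, hu.2]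
      have h1 := tt_sum (y := y) (t := t) (T := T) (v := V*u) (by nlinarith [hu.1])
      have h2 := tt_sum (y := y) (t := t) (T := T) (v := -(V*u)) lz
      have h3 := (h1.sub h2).mul_left ((lam u:ℂ)/(2*u))
      beta_reduce
      refine (Eq.trans ?_ h3.tsum_eq.symm).trans (tsum_congr fun ρ => ?_)
      · rw [sub_eq_add_neg y]
        rw [show Ci*((t-T)*V:ℝ)*u=Ci*(t-T)*(V*u:ℝ) by push_cast; ring, show Ci*(-(t-T)*V:ℝ)*u=Ci*(t-T)*(-(V*u):ℝ) by push_cast; ring]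
        ring
      · rw [Complex.sinh, show V*rt ρ T*u=(V*u:ℝ)*rt ρ T by push_cast; ring, show -(((V*u:ℝ):ℂ)*rt ρ T)=(-(V*u):ℝ)*rt ρ T by push_cast; ring]
        ring
  · by_cases hm : mn ρ =0
    · simp [tt, hm]
    obtain ⟨s0, s1⟩ := mn_strip hm
    have hg :0 <1 + |ρ.im| := pz
    set Q := (2*(V*(1 + |T|)*(1 + |ρ.im|)))^q18 with hQ
    have hb : ∫ u in Ioc rl0 1, ‖tt y t ρ*((lam u:ℂ)*(csh (V*rt ρ T*u)/u))‖ ≤ ∫ u in Ioc rl0 1, ‖tt y t ρ‖ * (ex V*Q)*u^m78 := by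
      refine setIntegral_mono_on (hint ρ).norm (hi78.const_mul _) mii fun u hu => ?_
      rw [norm_mul, mul_assoc ‖_‖]
      exact mlm (sinh_bd hV hu.1 hu.2 s0 s1) nnz
    rw [icm, show ∫ u in Ioc rl0 1, u^m78 =8 by rw [← integral_of_le zlo, integral_rpow (Or.inl nz)]; norm_num] at hb
    have hd :1/(1+(ρ.im-t)^2) ≤4*(1+t^2)*(1 + |ρ.im|)^(-2:ℝ) := by
      rw [rpow_neg hg.le, rpow_two, ← dem, dld pz pz]
      have e : (1 + |ρ.im|)^2 ≤2*(1+ρ.im^2) := by rw [← sq_abs ρ.im]; nlinarith [sq_nonneg (|ρ.im| -1)]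
      nlinarith [sq_nonneg (ρ.im-2*t), mul_nonneg (sq_nonneg t) (sq_nonneg (ρ.im-t)), sq_nonneg t]
    have hQ2 : Q=(2*(V*(1 + |T|)))^q18*(1 + |ρ.im|)^q18 := by rw [hQ, ← mul_rpow pz hg.le]; congr 1; ring
    have he : (1 + |ρ.im|)^(-2:ℝ)*(1 + |ρ.im|)^q18 ≤ (1 + |ρ.im|)^m74 := by rw [← rpow_add hg]; exact rlr (by linarith [abs_nonneg ρ.im]) nz
    have hm0 := mn_nonneg ρ
    have ht : ‖tt y t ρ‖ ≤ mn ρ*(eh y*(8*(4*(1+t^2)*(1 + |ρ.im|)^(-2:ℝ)))) := by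
      refine (tt_norm' hy t ρ).trans ?_
      rw [show 8/(1+(ρ.im-t)^2) =8*(1/(1+(ρ.im-t)^2)) by ring]
      gcongr
    set W := (2*(V*(1 + |T|)))^q18
    have hW :0 ≤ W := pz
    calc _ ≤ _ := hb
      _ ≤ mn ρ*(eh y*(8*(4*(1+t^2)*(1 + |ρ.im|)^(-2:ℝ))))*(ex V*(W*(1 + |ρ.im|)^q18))*8 := by rw [hQ2]; gcongr
      _=(eh y*(32*(1+t^2))*(ex V*W*8))*(mn ρ*((1 + |ρ.im|)^(-2:ℝ)*(1 + |ρ.im|)^q18)) := by ring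
      _ ≤ _ := by gcongr
  · have : mn ρ =0 := le_antisymm ((mn_le_mz ρ).trans h.le) (mn_nonneg ρ)
    simp [tt, this]

lemma zs_alg {V δ a b:ℝ} (hV :0<V) (hδ :0 ≤ δ) : ex (-(6*(V*δ)))/((1+b^2)*(1+(V*a)^2)) ≤1/(1+(a-b)^2)*(2*(1/V)*((1/V+δ)/((1/V+δ)^2+a^2))+2*(1/V)^2*(1^2+b^2)⁻¹) := by
  have h0 :0 ≤ V*δ := pz
  have e0 : ex (-(6*(V*δ))) ≤1 := exp_le_one_iff.2 lz
  have e1 : ex (-(6*(V*δ))) ≤1/(1+V*δ) := by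
    rw [Real.exp_neg, ← one_div]
    exact odl pz (by linarith [aol (6*(V*δ))])
  have k1 :1/(1+V*δ)/(1+(V*a)^2) ≤1/V*((1/V+δ)/((1/V+δ)^2+a^2)) := by
    have :1/V*((1/V+δ)/((1/V+δ)^2+a^2))=(1+V*δ)/((1+V*δ)^2+(V*a)^2) := by field_simp
    rw [this, div_div, dld pz pz]
    nlinarith [mul_nonneg (mul_nonneg h0 (lz :0 ≤2+V*δ)) (sq_nonneg (V*a))]
  have k2 :1/((1+b^2)*(1+(V*a)^2)) ≤1/(1+(a-b)^2)*(2/(1+(V*a)^2)+2*(1/V)^2*(1^2+b^2)⁻¹) := by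
    have :2/(1+(V*a)^2)+2*(1/V)^2*(1^2+b^2)⁻¹=(2*(1+b^2)+2*(1/V^2+a^2))/((1+b^2)*(1+(V*a)^2)) := by field_simp
    rw [this, div_mul_div_comm, one_mul, dld pz pz, one_mul, mul_comm (1+(a-b)^2) _, mul_comm _ ((1+b^2)*_)]
    have :0 ≤1/V^2 := pz
    exact mlm (by nlinarith [sq_nonneg (a+b)]) pz
  calc _=ex (-(6*(V*δ)))*(1/((1+b^2)*(1+(V*a)^2))) := by ring
    _ ≤ ex (-(6*(V*δ)))*(1/(1+(a-b)^2)*(2/(1+(V*a)^2)+2*(1/V)^2*(1^2+b^2)⁻¹)) := by gcongr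
    _ =1/(1+(a-b)^2)*(2*(ex (-(6*(V*δ)))/(1+(V*a)^2))+ex (-(6*(V*δ)))*(2*(1/V)^2*(1^2+b^2)⁻¹)) := by ring
    _ ≤1/(1+(a-b)^2)*(2*(1/(1+V*δ)/(1+(V*a)^2))+1*(2*(1/V)^2*(1^2+b^2)⁻¹)) := by gcongr
    _ ≤ _ := by rw [one_mul, mul_assoc 2 (1/V)]; gcongr

lemma zero_side {L:ℂ} {C:ℝ} (hC :0<C) (hP : ∀ z:ℂ, (0 ≤ z.im → ‖Ph z-L‖ ≤ C*(ex (2 * |z.re|)/(1+z.im^2))) ∧ (z.im ≤0 → ‖Ph z+L‖ ≤ C*(ex (2 * |z.re|)/(1+z.im^2)))) :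
    ∃ D >0, ∀ y T t:ℝ,16 ≤ lg T → lg T/2 ≤ y → 3 ≤ T → |t-T| ≤ T → ‖∑' ρ, tt y t ρ*(Ph ((y/8:ℝ)*rt ρ T)-L*(if ρ.im ≤ T then-1 else 1))‖ ≤ D*(eh y*(1/(1+(t-T)^2))) := by
  obtain ⟨C2, hC2, h2⟩ := zero_sum_bound
  obtain ⟨C3, hC3, h3⟩ := zs_H
  refine ⟨8*C*(66*C2+64*C3), pz, fun y T t hl hy hT ht => ?_⟩
  set V := y/8 with hV
  set l := lg T with hl'
  have hV1 : l/16 ≤ V := by rw [hV]; linarith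
  have hV0 :0<V := lz
  have hh :1/V ≤16/l := by rw [dld hV0 lz]; linarith
  have hh1 :1/V ≤1 := by rw [div_le_one hV0]; linarith
  obtain ⟨a1, a2⟩ := h2 (1/V) pz T
  obtain ⟨b1, b2⟩ := h3 1 le_rfl t
  have hs := ((a1.mul_left (2*(1/V))).add (b1.mul_left (2*(1/V)^2))).mul_left (8*C*eh y*(1/(1+(t-T)^2)))
  refine (ton hs.hasSum fun ρ => ?_).trans ?_
  · by_cases hm : mn ρ =0
    · simp [tt, hm]
    obtain ⟨s0, s1⟩ := mn_strip hm
    have hm0 := mn_nonneg ρ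
    have hk : ‖Ph (V*rt ρ T)-L*(if ρ.im ≤ T then-1 else 1)‖ ≤ C*(ex (2*(V*(1-ρ.re)))/(1+(V*(ρ.im-T))^2)) := by
      have hz := hP (V*rt ρ T)
      have zr : ((V:ℂ)*rt ρ T).re=V*(ρ.re-1) := by rw [re_ofReal_mul]; simp
      have zi : ((V:ℂ)*rt ρ T).im=V*(ρ.im-T) := by rw [im_ofReal_mul]; simp
      rw [zr, zi, abs_mul, aop hV0, abs_of_neg lz, neg_sub] at hz
      split_ifs with h
      · rw [mul_neg_one, sub_neg_eq_add]; exact hz.2 (mul_nonpos_of_nonneg_of_nonpos hV0.le lz)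
      · rw [mul_one]; exact hz.1 (mul_nonneg hV0.le lz)
    have ha := zs_alg (V := V) (δ :=1-ρ.re) (a := ρ.im-T) (b := ρ.im-t) hV0 lz
    rw [show ρ.im-T-(ρ.im-t)=t-T by ring] at ha
    rw [norm_mul]
    have he : ex ((ρ.re-1/2)*y)*ex (2*(V*(1-ρ.re)))=eh y*ex (-(6*(V*(1-ρ.re)))) := by rw [← rea, ← rea]; congr 1; rw [hV]; ring
    calc _ ≤ (mn ρ*(ex ((ρ.re-1/2)*y)*(8/(1+(ρ.im-t)^2))))*(C*(ex (2*(V*(1-ρ.re)))/(1+(V*(ρ.im-T))^2))) :=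
          mmm (tt_norm y t ρ) hk nnz pz
      _ =8*C * mn ρ*(ex ((ρ.re-1/2)*y)*ex (2*(V*(1-ρ.re))))/((1+(ρ.im-t)^2)*(1+(V*(ρ.im-T))^2)) := by field_simp
      _ =8*C * mn ρ*eh y*(ex (-(6*(V*(1-ρ.re))))/((1+(ρ.im-t)^2)*(1+(V*(ρ.im-T))^2))) := by rw [he]; ring
      _ ≤ _ := mlm ha pz
      _=_ := by unfold pk; ring
  · rw [tml, (a1.mul_left _).tsum_add (b1.mul_left _), tml, tml]
    have hT0 :0<T := lz
    have hll : lg (T^2) =2*l := by rw [log_pow]; simp [hl']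
    have c1 : lg (|T| +1/V+2) ≤2*l := by rw [← hll, aop hT0]; exact lll pz nlz
    have c2 : lg (|t| +1+2) ≤2*l := by
      rw [← hll]; refine lll pz ?_
      have := abs_sub_abs_le_abs_sub t T
      rw [aop hT0] at this
      nlinarith
    have c3 :1/V*(2*l) ≤32 := by
      calc _ ≤16/l*(2*l) := by gcongr
        _ =32 := by field_simp; norm_num
    have d1 :2*(1/V)*∑' ρ, mn ρ*pk (1/V) T ρ ≤66*C2 := by
      calc _ ≤2*(1/V)*(C2*(1/(1/V)+lg (|T| +1/V+2))) := by gcongr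
        _ ≤2*(1/V)*(C2*(1/(1/V)+2*l)) := by gcongr
        _ =2*C2*(1+1/V*(2*l)) := by field_simp
        _ ≤2*C2*(1+32) := by gcongr
        _=_ := by ring
    have d2 :2*(1/V)^2*∑' ρ, mn ρ*(1^2+(ρ.im-t)^2)⁻¹ ≤64*C3 := by
      calc _ ≤2*(1/V)^2*(C3*lg (|t| +1+2)/1) := by gcongr
        _ ≤2*(1/V)^2*(C3*(2*l)/1) := by gcongr
        _ =2*C3*(1/V)*(1/V*(2*l)) := by ring
        _ ≤2*C3*1*32 := by gcongr
        _=_ := by ring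
    calc _ ≤8*C*eh y*(1/(1+(t-T)^2))*(66*C2+64*C3) := by gcongr
      _=_ := by ring

lemma osc_int {H:ℝ → ℂ} {K V:ℝ} (hK :0 ≤ K) (hV :1 ≤ V) (h1 : ∀ u v, ‖H u-H v‖ ≤ K*V * |u-v|) (h2 : ∀ u, ‖H u‖ ≤ K) (h0 : H 0 =0) (s:ℝ) : IntervalIntegrable (fun u:ℝ => (lam u:ℂ)*(H u/u)*cex (Ci*(s*V:ℝ)*u)) volume 0 1 := by
  rw [iii zlo]
  have hHc : Continuous H := by
    refine LipschitzWith.continuous (K := (K*V).toNNReal) (LipschitzWith.of_dist_le_mul fun u v => ?_)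
    rw [den, Real.dist_eq, coe_toNNReal _ pz]; exact h1 u v
  refine Measure.integrableOn_of_bounded (M := K*V) sz ?_ ?_
  · have := lam_cont.measurable; have := hHc.measurable
    exact Measurable.aestronglyMeasurable fz
  · refine (ae_restrict_iff' mii).2 (Eventually.of_forall fun u hu => ?_)
    have := (osc_f hK hV h1 h2 h0 hu.1).1
    rw [min_eq_left hu.2] at this
    rw [norm_mul, show ‖cex (Ci*(s*V:ℝ)*u)‖ =1 by rw [norm_exp]; simp, mul_one]
    exact this

lemma osc_alg (a b c d S:ℂ) : a/2*(b-c+2*d*S)-a*d*S=a/2*(b-c) := by ring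

lemma osc_side : ∃ D >0, ∀ y T t:ℝ,16 ≤ lg T → lg T/2 ≤ y → y ≤ lg T → 3 ≤ T → |t-T| ≤ T → ‖(∑' ρ, tt y t ρ*Ph ((y/8:ℝ)*rt ρ T))-SS y t*Ph (Ci*((t-T)*(y/8):ℝ))‖ ≤ D*(eh y*lg T^q18*abd t T^m78) ∧ ‖SS y t‖ ≤ D*eh y := by
  obtain ⟨C, hC, hb⟩ := bb_lip
  obtain ⟨B, hB, ho⟩ := osc
  refine ⟨2*B*C+C, pz, fun y T t hl hy hy' hT ht => ?_⟩
  set V := y/8 with hV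
  have hV1 :1 ≤ V := lz
  have hT0 :0<T := lz
  have hlog : ∀ Y, y-V ≤ Y → lt2 t ≤ ex Y := by
    intro Y hY
    have h1 :7*lg T/16 ≤ Y := lz
    have := quadratic_le_exp_of_nonneg (x := Y) lz
    have h3 : lt2 t ≤ lg T+2 := by
      have e : lg T+2=lg (T*ex 2) := by rw [rlm hT0.ne' (exp_pos _).ne', Real.log_exp]
      rw [e]; refine lll pz ?_
      have h4 := abs_sub_abs_le_abs_sub t T
      rw [aop hT0] at h4
      nlinarith [aol rl2]
    nlinarith
  have hb' : ∀ Y Y', y-V ≤ Y → y-V ≤ Y' → ‖bb Y t‖ ≤ C ∧ ‖bb Y t-bb Y' t‖ ≤ C * |Y-Y'| := fun Y Y' h h' =>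
    hb Y Y' t lz lz (hlog _ h) (hlog _ h')
  have hSb : SS y t=eh y*bb y t := by unfold bb; rw [← mul_assoc, ← ofReal_mul, ← rea, show y/2 + -y/2 =0 by ring]; simp
  have hE : ‖((eh y:ℝ):ℂ)‖ = eh y := by rw [norm_real, non (exp_pos _).le]
  refine ⟨?_, ?_⟩
  · set cl:ℝ → ℝ := fun u => max 0 (min u 1) with hcl
    have hcl0 : ∀ u,0 ≤ cl u ∧ cl u ≤1 := fun u => ⟨le_max_left _ _, max_le zlo (min_le_right _ _)⟩
    have hcll : ∀ u v, |cl u-cl v| ≤ |u-v| := fun u v => by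
      refine (abs_max_sub_max_le_max _ _ _ _).trans (max_le sz ?_)
      exact (abs_min_sub_min_le_max _ _ _ _).trans sz
    have hH : ∀ ε:ℝ, |ε| =1 → (∀ u v, ‖(bb (y+ε*(V*cl u)) t-bb y t)-(bb (y+ε*(V*cl v)) t-bb y t)‖ ≤2*C*V * |u-v|) ∧ (∀ u, ‖bb (y+ε*(V*cl u)) t-bb y t‖ ≤2*C) ∧ bb (y+ε*(V*cl 0)) t-bb y t =0 := by
      intro ε hε
      have hY : ∀ u, y-V ≤ y+ε*(V*cl u) := fun u => by
        have h1 : |ε*(V*cl u)| ≤ V := by rw [abs_mul, hε, one_mul, aon (by have := (hcl0 u).1; positivity)]; nlinarith [hcl0 u]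
        linarith [neg_le_of_abs_le h1]
      refine ⟨fun u v => ?_, fun u => ?_, by simp [hcl]⟩
      · rw [sub_sub_sub_cancel_right]
        refine (hb' _ _ (hY u) (hY v)).2.trans ?_
        rw [show y+ε*(V*cl u)-(y+ε*(V*cl v))=ε*(V*(cl u-cl v)) by ring, abs_mul, hε, abs_mul, aop (lz :0<V)]
        have := hcll u v
        have h2 : C*(1*(V * |cl u-cl v|)) ≤ C*(1*(V * |u-v|)) := by gcongr
        have :0 ≤ C*(V * |u-v|) := pz
        linarith
      · have := (hb' _ y (hY u) lz).1
        have := (hb' y y lz lz).1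
        linarith [nsl (bb (y+ε*(V*cl u)) t) (bb y t)]
    obtain ⟨p1, p2, p3⟩ := hH 1 sz
    obtain ⟨m1, m2, m3⟩ := hH (-1) sz
    have o1 := ho _ (2*C) V (t-T) pz hV1 p1 p2 p3
    have o2 := ho _ (2*C) V (-(t-T)) pz hV1 m1 m2 m3
    have i1 := osc_int pz hV1 p1 p2 p3 (t-T)
    have i2 := osc_int pz hV1 m1 m2 m3 (-(t-T))
    have i3 := (Ph_int (Ci*((t-T)*V:ℝ))).const_mul (2*bb y t)
    rw [abs_neg] at o2
    have hP := (P_eq (y := y) (V := V) lz lz T t).tsum_eq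
    rw [hP, hSb, Ph]
    have e : (∫ u in 0..1, (lam u:ℂ)*((bb (y+V*u) t*cex (Ci*((t-T)*V:ℝ)*u)-bb (y-V*u) t*cex (Ci*(-(t-T)*V:ℝ)*u))/u))=(∫ u in 0..1, (lam u:ℂ)*((bb (y+1*(V*cl u)) t-bb y t)/u)*cex (Ci*((t-T)*V:ℝ)*u))-(∫ u in 0..1, (lam u:ℂ)*((bb (y + -1*(V*cl u)) t-bb y t)/u)*cex (Ci*(-(t-T)*V:ℝ)*u))+2*bb y t*∫ u in 0..1, (lam u:ℂ)*(csh (Ci*((t-T)*V:ℝ)*u)/u) := by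
      rw [← iic, ← intervalIntegral.integral_sub i1 i2, ← iia (i1.sub i2) i3]
      refine integral_congr fun u hu => ?_
      rw [uIcc_of_le zlo] at hu
      have hc : cl u=u := by simp [hcl, hu.1, hu.2]
      simp only [hc]
      rw [Complex.sinh, show Ci*(-(t-T)*V:ℝ)*u = -(Ci*((t-T)*V:ℝ)*u) by push_cast; ring, one_mul, neg_one_mul, ← sub_eq_add_neg]
      ring
    rw [e, osc_alg, norm_mul, norm_div, hE, cno]
    have hVl : V^q18 ≤ lg T^q18 := rpow_le_rpow lz lz nz
    calc _ ≤ eh y/2*(B*(2*C*V^q18*abd t T^m78)+B*(2*C*V^q18*abd t T^m78)) := by gcongr; exact (nsl _ _).trans (ala o1 o2)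
      _ ≤ eh y/2*(B*(2*C*lg T^q18*abd t T^m78)+B*(2*C*lg T^q18*abd t T^m78)) := by gcongr
      _ =2*B*C*(eh y*lg T^q18*abd t T^m78) := by ring
      _ ≤ _ := by gcongr; linarith
  · rw [hSb, norm_mul, hE, mul_comm]
    have := (hb' y y lz lz).1
    have h0 :0 ≤ B*C := pz
    gcongr; linarith

lemma edge_smooth : ∃ C >0, ∀ y T t:ℝ,16 ≤ lg T → lg T/2 ≤ y → y ≤ lg T → 3 ≤ T → |t-T| ≤ T → ‖EE y T t‖ ≤ C*(eh y*lg T^q18*abd t T^m78) := by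
  obtain ⟨L, hL, C, hC, hP⟩ := Ph_main
  obtain ⟨D, hD, hz⟩ := zero_side hC hP
  obtain ⟨B, hB, ho⟩ := osc_side
  have hL0 :0 < ‖L‖ := npi.2 hL
  refine ⟨(2*D+B+2*B*C) / ‖L‖, pz, fun y T t hl hy hy' hT ht => ?_⟩
  have z := hz y T t hl hy hT ht
  obtain ⟨o, oS⟩ := ho y T t hl hy hy' hT ht
  have hy0 :0 ≤ y := lz
  set s := t-T with hs
  have hV :1 ≤ y/8 := lz
  have hsg : ‖Ph (Ci*(s*(y/8):ℝ))-L*(if t ≤ T then-1 else 1)‖ ≤ C*(1/(1+s^2)) := by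
    have h := hP (Ci*(s*(y/8):ℝ))
    have e1 : (Ci*(s*(y/8):ℝ)).re =0 := by simp
    have e2 : (Ci*(s*(y/8):ℝ)).im=s*(y/8) := by simp
    rw [e1, e2, abs_zero, mul_zero, Real.exp_zero] at h
    have hb : C*(1/(1+(s*(y/8))^2)) ≤ C*(1/(1+s^2)) := by
      refine mlm ?_ hC.le
      refine odl pz ?_
      rw [mul_pow]; linarith [lmo (sq_nonneg s) (one_le_pow₀ hV (n :=2))]
    split_ifs with h1
    · rw [mul_neg_one, sub_neg_eq_add]; exact (h.2 (mul_nonpos_of_nonpos_of_nonneg lz lz)).trans hb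
    · rw [mul_one]; exact (h.1 (mul_nonneg lz lz)).trans hb
  have hid : L*(2*EE y T t)=(∑' ρ, tt y t ρ*(Ph ((y/8:ℝ)*rt ρ T)-L*(if ρ.im ≤ T then-1 else 1))) - ((∑' ρ, tt y t ρ*Ph ((y/8:ℝ)*rt ρ T))-SS y t*Ph (Ci*(s*(y/8):ℝ))) - SS y t*(Ph (Ci*(s*(y/8):ℝ))-L*(if t ≤ T then-1 else 1)) := by
    have s1 := (P_eq (y := y) (V := y/8) lz lz T t).summable
    have s2 : Summable fun ρ:ℂ => tt y t ρ*(L*(if ρ.im ≤ T then-1 else 1)) := by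
      refine sob ((SS_eq hy0 t).1.norm.mul_right ‖L‖) fun ρ => ?_
      split_ifs <;> simp
    have e : (∑' ρ:ℂ, tt y t ρ*(L*(if ρ.im ≤ T then-1 else 1)))=L*(SS y t-2*∑' ρ:ℂ, if ρ.im ≤ T then tt y t ρ else 0) := by
      unfold SS
      rw [← tml (a := (2:ℂ)), ← (SS_eq hy0 t).1.tsum_sub ((tt_ind hy0 t _).mul_left 2), ← tml]
      refine tsum_congr fun ρ => ?_
      split_ifs <;> ring
    simp only [mul_sub (tt y t _)]
    rw [s1.tsum_sub s2, e]; unfold EE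
    split_ifs <;> ring
  have h1 :1/(1+s^2) ≤2*(1 + |s|)^m78 := by
    have h0 :1 ≤1 + |s| := by linarith [abs_nonneg s]
    have : (1 + |s|)^q78 ≤ (1 + |s|)^rl2 := rlr h0 nz
    rw [rpow_two] at this
    have hp :0<(1 + |s|)^q78 := pz
    rw [rpow_neg lz, ← dem, dld pz hp]
    rw [← sq_abs s]; nlinarith [sq_nonneg (|s| -1)]
  have h2 : rl1 ≤ lg T^q18 := olr lz nz
  set Q := lg T^q18
  set R := (1 + |s|)^m78
  have hR :0 ≤ R := pz
  have hQR :1/(1+s^2) ≤2*(Q*R) := h1.trans nlz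
  have hn := congrArg norm hid
  rw [norm_mul, norm_mul, cno] at hn
  have h3 : ‖SS y t*(Ph (Ci*(s*(y/8):ℝ))-L*(if t ≤ T then-1 else 1))‖ ≤ B*eh y*(C*(2*(Q*R))) := by rw [norm_mul]; exact mmm oS (hsg.trans (by gcongr)) nnz pz
  have h4 : D*(eh y*(1/(1+s^2))) ≤ D*(eh y*(2*(Q*R))) := by gcongr
  have h5 := (nsl _ _).trans (ala ((nsl _ _).trans (ala (z.trans h4) o)) h3)
  rw [← hn] at h5
  rw [dme, le_div_iff₀ hL0]
  have h6 :0 ≤ ‖L‖ * ‖EE y T t‖ := pz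
  linarith only [h5, h6]

def ff (A t:ℝ):ℝ := abd t A^m78

lemma ff_pos (A t:ℝ) :0<ff A t := by unfold ff; positivity
lemma ff_le (A t:ℝ) : ff A t ≤1 := rpow_le_one_of_one_le_of_nonpos (by linarith [abs_nonneg (t-A)]) nz

lemma ff_int : ∃ C:ℝ,0<C ∧ ∀ A, Integrable (fun t => ff A t*sqr (ff A t)) ∧ ∫ t, ff A t*sqr (ff A t) ≤ C := by
  have e : ∀ A, (fun t => ff A t*sqr (ff A t))=fun t => (1 + ‖t-A‖)^(-(21/16):ℝ) := by
    intro A; funext t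
    have h0 :0 <1 + |t-A| := pz
    rw [sqrt_eq_rpow, ff, ← rpow_mul h0.le, ← rpow_add h0, nea]; norm_num
  have h : Integrable (fun t:ℝ => (1 + ‖t‖)^(-(21/16):ℝ)) :=
    integrable_one_add_norm nz
  refine ⟨(∫ t:ℝ, (1 + ‖t‖)^(-(21/16):ℝ))+1, ?_, fun A => ?_⟩
  · have :0 ≤ ∫ t:ℝ, (1 + ‖t‖)^(-(21/16):ℝ) := integral_nonneg fun t => pz
    linarith
  · rw [e A]
    refine ⟨h.comp_sub_right A, ?_⟩
    rw [integral_sub_right_eq_self (fun t:ℝ => (1 + ‖t‖)^(-(21/16):ℝ)) A]; linarith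

lemma log8 {u:ℝ} (hu :1 ≤ u) : lg u ≤8*u^q18 := by
  have := log_le_rpow_div (lz :0 ≤ u) (nz : rl0 <1/8)
  linarith

lemma ff_eq (A t:ℝ) : abd t A^q18/abd t A=ff A t := by
  have h0 :0 <1 + |t-A| := pz
  rw [ff, ← rpow_sub_one h0.ne']; norm_num

lemma EE_far : ∃ C:ℝ,0<C ∧ ∀ y A t,0 ≤ y → 0 ≤ A → A ≤ |t-A| → ‖EE y A t‖ ≤ C*(eh y*ff A t) := by
  obtain ⟨C, hC, h⟩ := EE_triv
  refine ⟨C*10, pz, fun y A t hy hA ht => (h y hy A t).trans ?_⟩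
  have h0 :1 ≤1 + |t-A| := by linarith [abs_nonneg (t-A)]
  have h1 : rl1 ≤ abd t A^q18 := olr h0 nz
  have h2 : |t| ≤ |t-A| + A := by have := abs_add_le (t-A) A; rwa [sub_add_cancel, aon hA] at this
  have h3 : lg (|t| + |t-A| +3) ≤10*abd t A^q18 := by
    calc _ ≤ lg (3*abd t A) := lll pz lz
      _=lg 3+lg abd t A := rlm nz lz
      _ ≤ _ := by linarith [log8 h0, lls (nz : rl0 <3)]
  rw [← ff_eq, mul_assoc]
  refine mlm ?_ hC.le
  calc _ ≤ eh y*(10*abd t A^q18/abd t A) := by gcongr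
    _=_ := by ring

lemma EE_near : ∃ C:ℝ,0<C ∧ ∀ y A T t,0 ≤ y → 0 ≤ A → A ≤ T → 3 ≤ T → ‖EE y A t‖ ≤ C*(eh y*lg T*ff A t) := by
  obtain ⟨C, hC, h⟩ := EE_triv
  refine ⟨C*10, pz, fun y A T t hy hA hAT hT => (h y hy A t).trans ?_⟩
  have h0 :1 ≤1 + |t-A| := by linarith [abs_nonneg (t-A)]
  have h1 : rl1 ≤ abd t A^q18 := olr h0 nz
  have hl :1 ≤ lg T := log_three.trans (lll nz hT)
  have h2 : |t| ≤ |t-A| + A := by have := abs_add_le (t-A) A; rwa [sub_add_cancel, aon hA] at this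
  have h3 : lg (|t| + |t-A| +3) ≤10*(lg T*abd t A^q18) := by
    calc _ ≤ lg (T*T*abd t A) := by
          refine lll pz ?_
          have :2 * |t-A| + T+3 ≤ T*T*abd t A := by nlinarith [abs_nonneg (t-A), mul_nonneg (abs_nonneg (t-A)) (by nlinarith :0 ≤ T*T-2)]
          linarith
      _=lg T+lg T+lg abd t A := by rw [rlm pz lz, rlm pz pz]
      _ ≤ _ := by nlinarith [log8 h0]
  rw [← ff_eq, mul_assoc]
  refine mlm ?_ hC.le
  calc _ ≤ eh y*(10*(lg T*abd t A^q18)/abd t A) := by gcongr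
    _=_ := by ring

lemma EE_big : ∃ C:ℝ,0<C ∧ ∀ y T t,0 ≤ y → lg T/2 ≤ y → y ≤ lg T → 3 ≤ T → ‖EE y T t‖ ≤ C*(eh y*lg T^q18*ff T t) ∧ ‖EE y 0 t‖ ≤ C*(eh y*lg T^q18*ff 0 t) := by
  obtain ⟨C₁, h1, H1⟩ := EE_far
  obtain ⟨C₂, h2, H2⟩ := EE_near
  obtain ⟨C₃, h3, H3⟩ := edge_smooth
  refine ⟨C₁+C₂*16+C₃, pz, fun y T t hy ha hb hT => ?_⟩
  have hl :1 ≤ lg T := log_three.trans (lll nz hT)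
  have hp : rl1 ≤ lg T^q18 := olr hl nz
  set p := lg T^q18
  have far : ∀ A,0 ≤ A → A ≤ |t-A| → ‖EE y A t‖ ≤ (C₁+C₂*16+C₃)*(eh y*p*ff A t) := by
    intro A hA ht
    have f := ff_pos A t
    have e := exp_pos (y/2)
    refine (H1 y A t hy hA ht).trans (mmm lz ?_ pz pz)
    gcongr; exact lmo e.le hp
  refine ⟨?_, far 0 le_rfl (abs_nonneg _)⟩
  rcases le_total T |t-T| with h | h
  · exact far T lz h
  have f := ff_pos T t
  have e := exp_pos (y/2)
  rcases le_total 16 (lg T) with h' | h'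
  · refine (H3 y T t h' ha hb hT h).trans ?_
    change C₃*(eh y*p*ff T t) ≤ _
    gcongr; linarith
  · refine (H2 y T T t hy lz le_rfl hT).trans ?_
    have : lg T ≤16*p := lz
    calc _ ≤ C₂*(eh y*(16*p)*ff T t) := by gcongr
      _=(C₂*16)*(eh y*p*ff T t) := by ring
      _ ≤ _ := by gcongr; linarith

lemma pt_ab {a b U e:ℝ} (ha :0 ≤ a) (haU : a ≤ U) (hb :0 ≤ b) (he :0<e) :
    a*b ≤ e*a^2+sqr (U*b^3/e) := by
  rcases le_total b (e*a) with h | h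
  · have := sqrt_nonneg (U*b^3/e)
    have := mlm h ha
    linarith [this, (by ring : a*(e*a)=e*a^2)]
  · have : a*b ≤ sqr (U*b^3/e) := by
      apply le_sqrt_of_sq_le
      rw [le_div_iff₀ he]
      calc (a*b)^2*e=a*(e*a)*b^2 := by ring
        _ ≤ U*b*b^2 := by have := ha.trans haU; gcongr
        _=_ := by ring
    have :0 ≤ e*a^2 := pz
    linarith

lemma pt_R {S E₀ E₁:ℂ} {U V e f₀ f₁:ℝ} (hS : ‖S‖ ≤ U) (hV :0 ≤ V) (he :0<e) (f0 :0<f₀) (f0' : f₀ ≤1) (f1 :0<f₁) (f1' : f₁ ≤1) (h0 : ‖E₀‖ ≤ V*f₀) (h1 : ‖E₁‖ ≤ V*f₁) :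
    |‖S+(E₁-E₀)‖ ^2 - ‖S‖ ^2| ≤4*e * ‖S‖ ^2+2*(sqr (U*V^3/e)+V^2)*(f₀*sqr f₀+f₁*sqr f₁) := by
  have hU :0 ≤ U := (norm_nonneg _).trans hS
  have key : ∀ f:ℝ,0<f → ‖S‖ * (V*f) ≤ e * ‖S‖ ^2+sqr (U*V^3/e)*(f*sqr f) := by
    intro f hf
    refine (pt_ab (norm_nonneg S) hS (pz :0 ≤ V*f) he).trans_eq ?_
    rw [show U*(V*f)^3/e=(U*V^3/e)*(f^2*f) by ring, sqrt_mul pz, sqrt_mul pz, sqrt_sq hf.le]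
  have sq : ∀ f:ℝ,0<f → f ≤1 → f^2 ≤ f*sqr f := by
    intro f hf hf'
    rw [sq]; gcongr; exact le_sqrt_of_sq_le nlz
  set R := E₁-E₀
  have hR : ‖R‖ ≤ V*f₀+V*f₁ := (nsl _ _).trans lz
  have a1 : |‖S+R‖ ^2 - ‖S‖ ^2| ≤2*(‖S‖ * ‖R‖) + ‖R‖ ^2 := by
    have t1 := nal S R
    have t2 : ‖S‖ ≤ ‖S+R‖ + ‖R‖ := by simpa using nsl (S+R) R
    have := norm_nonneg (S+R)
    have := norm_nonneg S
    have := norm_nonneg R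
    rw [abs_le]; constructor
    · rcases le_total ‖R‖ ‖S‖ with h | h
      · nlinarith [plp lz (lz : ‖S‖ - ‖R‖ ≤ ‖S+R‖) 2]
      · nlinarith
    · nlinarith [plp nnz t1 2]
  have a2 : ‖S‖ * ‖R‖ ≤ ‖S‖ * (V*f₀) + ‖S‖ * (V*f₁) := by rw [← mul_add]; exact mlm hR nnz
  have a3 : ‖R‖ ^2 ≤ V^2*(2*(f₀^2+f₁^2)) := by
    refine (plp nnz hR 2).trans ?_
    rw [← mul_add, mul_pow]
    exact mlm (by linarith [sq_nonneg (f₀-f₁)]) (sq_nonneg V)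
  have a4 : V^2*(2*(f₀^2+f₁^2)) ≤ V^2*(2*(f₀*sqr f₀+f₁*sqr f₁)) :=
    mlm (by linarith [sq f₀ f0 f0', sq f₁ f1 f1']) (sq_nonneg V)
  have k0 := key f₀ f0
  have k1 := key f₁ f1
  linarith

lemma S1_abs : ∃ c:ℝ,0<c ∧ ∀ x T U V e:ℝ,1 ≤ x → 0 ≤ T → 0 ≤ U → 0 ≤ V → 0<e → (∀ t,0<t → t ≤ T → ‖SS (lg x) t‖ ≤ U) → (∀ t, ‖EE (lg x) T t‖ ≤ V*ff T t ∧ ‖EE (lg x) 0 t‖ ≤ V*ff 0 t) → |(∫ t, ‖S1 (lg x) T t‖ ^2)-∫ t in 0..T, ‖SS (lg x) t‖ ^2| ≤4*e*(∫ t in 0..T, ‖SS (lg x) t‖ ^2)+c*(sqr (U*V^3/e)+V^2) := by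
  obtain ⟨C, hC, hf⟩ := ff_int
  refine ⟨4*C, pz, fun x T U V e hx hT hU hV he hS hE => ?_⟩
  have hy := log_nonneg hx
  set y := lg x
  have iS := (FF0_eq (T := T) hx).1
  set g:ℝ → ℝ := (Ioc 0 T).indicator (fun t => ‖SS y t‖ ^2) with hg
  have ig : Integrable g := by
    rw [hg, integrable_indicator_iff mii]
    exact (((SS_cont hy).norm.pow 2).intervalIntegrable 0 T).1
  have eg : ∫ t in 0..T, ‖SS y t‖ ^2=∫ t, g t := by rw [integral_of_le hT, integral_indicator mii]
  have iF : Integrable (fun t => ff 0 t*sqr (ff 0 t)+ff T t*sqr (ff T t)) := (hf 0).1.add (hf T).1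
  set M :=2*(sqr (U*V^3/e)+V^2) with hM
  have hM0 :0 ≤ M := pz
  have i2 : Integrable (fun t =>4*e*g t + M*(ff 0 t*sqr (ff 0 t)+ff T t*sqr (ff T t))) :=
    (ig.const_mul (4*e)).add (iF.const_mul M)
  have pt : ∀ t, |‖S1 y T t‖ ^2-g t| ≤4*e*g t + M*(ff 0 t*sqr (ff 0 t)+ff T t*sqr (ff T t)) := by
    intro t
    have e1 : g t = ‖(if 0<t ∧ t ≤ T then SS y t else 0)‖ ^2 := by
      by_cases h :0<t ∧ t ≤ T
      · rw [hg, indicator_of_mem (show t ∈ Ioc 0 T from h), if_pos h]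
      · rw [hg, indicator_of_notMem (show t ∉ Ioc 0 T from h), if_neg h]; simp
    rw [e1, S1_split hy hT t]
    refine pt_R ?_ hV he (ff_pos 0 t) (ff_le 0 t) (ff_pos T t) (ff_le T t) (hE t).2 (hE t).1
    split_ifs with h
    · exact hS t h.1 h.2
    · simpa using hU
  rw [eg, ← integral_sub iS ig]
  calc _ ≤ ∫ t, |‖S1 y T t‖ ^2-g t| := abs_integral_le_integral_abs
    _ ≤ ∫ t, (4*e*g t + M*(ff 0 t*sqr (ff 0 t)+ff T t*sqr (ff T t))) :=
        integral_mono (iS.sub ig).abs i2 pt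
    _ =4*e*(∫ t, g t) + M*((∫ t, ff 0 t*sqr (ff 0 t))+∫ t, ff T t*sqr (ff T t)) := by rw [integral_add (ig.const_mul _) (iF.const_mul _), icm, icm, integral_add (hf 0).1 (hf T).1]
    _ ≤4*e*(∫ t, g t) + M*(C+C) := by gcongr; exacts [(hf 0).2, (hf T).2]
    _=_ := by rw [hM]; ring

lemma SS_U : ∃ C:ℝ,0<C ∧ ∀ y T t:ℝ,0 ≤ y → 3 ≤ T → 0<t → t ≤ T → ‖SS y t‖ ≤ C*(eh y*lg T) ∧ (lg T/2 ≤ y → ‖SS y t‖ ≤ C*eh y) := by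
  obtain ⟨C, hC, h⟩ := SS_bound
  refine ⟨C*5, pz, fun y T t hy hT h0 ht => ?_⟩
  have hl :1 ≤ lg T := log_three.trans (lll nz hT)
  have e1 :1 ≤ eh y := one_le_exp lz
  have e2 : ex (-y) ≤1 := exp_le_one_iff.2 lz
  have hlog : lt2 t ≤2*lg T := by
    rw [aop h0, two_mul, ← rlm lz lz]
    exact lll lz nlz
  have hb : ‖SS y t‖ ≤ C*(eh y+ex (-y)*(2*lg T)) :=
    (h y hy t).trans (by gcongr)
  refine ⟨hb.trans ?_, fun hy2 => hb.trans ?_⟩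
  · rw [mul_assoc]; gcongr
    have : ex (-y)*(2*lg T) ≤2*lg T := mul_le_of_le_one_left lz e2
    nlinarith
  · rw [mul_assoc]; gcongr
    have : ex (-y)*lg T ≤2 := by
      have h1 : lg T/2 ≤ ex y := hy2.trans ((lz : y ≤ y+1).trans (aol y))
      rw [Real.exp_neg, ← div_eq_inv_mul, dli epz]; linarith
    linarith

lemma S1_SS : ∃ C:ℝ,0<C ∧ ∀ x T:ℝ,3 ≤ T → 1 ≤ x → x ≤ T → |(∫ t, ‖S1 (lg x) T t‖ ^2)-∫ t in 0..T, ‖SS (lg x) t‖ ^2| ≤ C*((∫ t in 0..T, ‖SS (lg x) t‖ ^2)/sqr (lg T)+T*sqr (lg T)) := by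
  obtain ⟨c, hc, H⟩ := S1_abs
  obtain ⟨C₁, h1, H1⟩ := SS_U
  obtain ⟨C₂, h2, H2⟩ := EE_near
  obtain ⟨C₃, h3, H3⟩ := EE_big
  obtain ⟨P, hP, HP⟩ := poly_exp 2
  set K := C₁+C₂+C₃ with hK
  have hK0 :0<K := pz
  refine ⟨4+c*(2*K^2*(1+4*P)), pz, fun x T hT hx hxT => ?_⟩
  have hl :1 ≤ lg T := log_three.trans (lll nz hT)
  have hy := log_nonneg hx
  have hyl := lll lz hxT
  have hp : rl1 ≤ lg T^q18 := olr hl nz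
  have hz : ex (lg x/2)^2=x := by rw [← ren]; push_cast; rw [mul_div_cancel₀ _ nz, rel lz]
  have hzp := exp_pos (lg x/2)
  set y := lg x
  set z := eh y
  set p := lg T^q18 with hpd
  have hp8 : lg T=p^8 := by rw [hpd, ← rrn, ← rpow_mul lz]; norm_num
  have hp4 : sqr (lg T)=p^4 := by rw [hp8, show p^8=(p^4)^2 by ring, sqrt_sq pz]
  set I := ∫ t in 0..T, ‖SS y t‖ ^2 with hI
  have hI0 :0 ≤ I := intervalIntegral.integral_nonneg lz fun t _ => pz
  rw [hp4]
  have fin : ∀ U V:ℝ,0 ≤ U → 0 ≤ V → (∀ t,0<t → t ≤ T → ‖SS y t‖ ≤ U) → (∀ t, ‖EE y T t‖ ≤ V*ff T t ∧ ‖EE y 0 t‖ ≤ V*ff 0 t) → sqr (U*V^3/(1/p^4)) ≤ K^2*(1+4*P)*(T*p^4) → V^2 ≤ K^2*(1+4*P)*(T*p^4) → |(∫ t, ‖S1 y T t‖ ^2)-I| ≤ (4+c*(2*K^2*(1+4*P)))*(I/p^4+T*p^4) := by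
    intro U V hU hV hS hE q1 q2
    refine (H x T U V (1/p^4) hx lz hU hV pz hS hE).trans ?_
    have := mlm (ala q1 q2) hc.le
    have a1 :0 ≤ c*(2*K^2*(1+4*P))*(I/p^4) := pz
    have a2 :0 ≤ T*p^4 := pz
    rw [show 4*(1/p^4)*I =4*(I/p^4) by ring]
    linarith
  rcases le_total (lg T/2) y with h | h
  · refine fin (K*z) (K*(z*p)) pz pz (fun t a b => ?_) (fun t => ?_) ?_ ?_
    · refine ((H1 y T t hy hT a b).2 h).trans ?_
      gcongr; linarith
    · have := H3 y T t hy h hyl hT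
      have f1 := ff_pos T t
      have f2 := ff_pos 0 t
      refine ⟨this.1.trans ?_, this.2.trans ?_⟩ <;> rw [← mul_assoc] <;> gcongr <;> linarith
    · have : sqr (K*z*(K*(z*p))^3/(1/p^4)) ≤ K^2*(z^2*p^4) := by
        apply sqrt_le_iff.2 ⟨pz, ?_⟩
        calc _=K^4*z^4*p^7 := by field_simp
          _ ≤ K^4*z^4*p^8 := by exact mlm (pow_le_pow_right₀ hp nz) pz
          _=_ := by ring
      refine this.trans ?_
      rw [hz, mul_assoc]
      refine mlm ?_ (sq_nonneg K)
      refine (mlo hxT pz).trans (lml pz (lz :1 ≤1+4*P))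
    · rw [mul_pow, mul_pow, hz, mul_assoc]
      refine mlm ?_ (sq_nonneg K)
      refine (mmm hxT (pow_le_pow_right₀ hp (nz :2 ≤4)) pz lz).trans (lml pz (lz :1 ≤1+4*P))
  · have hxl : x*p^16 ≤4*P*T := by
      have q := HP (lg T/2) lz
      have : x ≤ ex (lg T/2) := by rw [← rel (lz :0<x)]; exact ele.2 h
      calc x*p^16 =4*(x*(lg T/2)^2) := by rw [hp8]; ring
        _ ≤4*(ex (lg T/2)*(P*ex (lg T/2))) := by gcongr
        _ =4*P*(ex (lg T/2)*ex (lg T/2)) := by ring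
        _=_ := by rw [← rea, add_halves, rel lz]
    have hx2 : ∀ k, k ≤16 → x*p^k*p^4 ≤ (1+4*P)*(T*p^4) := by
      intro k hk
      have : x*p^k ≤ x*p^16 := by gcongr
      rw [← mul_assoc]; exact mlo lz pz
    refine fin (K*(z*lg T)) (K*(z*lg T)) pz pz (fun t a b => ?_) (fun t => ?_) ?_ ?_
    · refine ((H1 y T t hy hT a b).1).trans ?_
      gcongr; linarith
    · have q1 := H2 y T T t hy lz le_rfl hT
      have q2 := H2 y 0 T t hy le_rfl lz hT
      have f1 := ff_pos T t
      have f2 := ff_pos 0 t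
      refine ⟨q1.trans ?_, q2.trans ?_⟩ <;> rw [← mul_assoc] <;> gcongr <;> linarith
    · rw [hp8]
      have : sqr (K*(z*p^8)*(K*(z*p^8))^3/(1/p^4))=K^2*(z^2*p^14*p^4) := by
        rw [show K*(z*p^8)*(K*(z*p^8))^3/(1/p^4)=(K^2*(z^2*p^14*p^4))^2 by field_simp]
        exact sqrt_sq pz
      rw [this, hz, mul_assoc (K^2)]
      exact mlm (hx2 14 nz) (sq_nonneg K)
    · rw [mul_pow, mul_pow, hz, mul_assoc, hp8, show x*(p^8)^2=x*p^12*p^4 by ring]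
      exact mlm (hx2 12 nz) (sq_nonneg K)

lemma osc_L {a T:ℝ} (ha :0<a) (hT :0 ≤ T) :
    ‖∫ t in 0..T, (ltp t:ℂ)*cex (-Ci*t*a)‖ ≤2*ltp T/a := by
  have hac : (a:ℂ) ≠0 := by exact_mod_cast ha.ne'
  have pos : ∀ t ∈ uIcc 0 T,0<t+2 := fun t ht => by rw [uIcc_of_le hT] at ht; linarith [ht.1]
  have hv : ∀ t ∈ uIcc 0 T, HasDerivAt (fun t:ℝ => cex (-Ci*t*a)*(Ci/a)) (cex (-Ci*t*a)) t := by
    intro t _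
    have h := ((((hhi t).ofReal_comp.const_mul (-Ci)).mul_const (a:ℂ)).cexp).mul_const (Ci/a)
    refine h.congr_deriv ?_
    simp only [id, ofReal_one, mul_one]
    field_simp
    linear_combination -I_sq
  have hu : ∀ t ∈ uIcc 0 T, HasDerivAt (fun t:ℝ => (ltp t:ℂ)) (((t+2)⁻¹:ℝ):ℂ) t := by
    intro t ht
    have := (((hhi t).add_const 2).log (pos t ht).ne').ofReal_comp
    simpa using this
  have hci : ContinuousOn (fun t:ℝ => (t+2)⁻¹) (uIcc 0 T) :=
    ContinuousOn.inv₀ fz fun t ht => (pos t ht).ne'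
  have hn : ∀ t:ℝ, ‖cex (-Ci*t*a)*(Ci/a)‖ =1/a := by
    intro t
    rw [norm_mul, norm_div, norm_I, norm_real, non ha.le, show -Ci*t*a=((-(t*a):ℝ):ℂ)*Ci by push_cast; ring, norm_exp_ofReal_mul_I, one_mul]
  rw [intervalIntegral.integral_mul_deriv_eq_deriv_mul hu hv (continuous_ofReal.comp_continuousOn hci).intervalIntegrable (Continuous.intervalIntegrable fz _ _)]
  have hL : ∀ t,0 ≤ t → 0 ≤ ltp t := fun t ht => log_nonneg lz
  have h3 : ‖∫ t in 0..T, (((t+2)⁻¹:ℝ):ℂ)*(cex (-Ci*t*a)*(Ci/a))‖ ≤ (ltp T-lg (0+2))*(1/a) := by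
    rw [← ies (f := fun t => ltp t) (f' := fun t => (t+2)⁻¹) (fun t ht => by simpa using ((hhi t).add_const 2).log (pos t ht).ne') hci.intervalIntegrable, ← intervalIntegral.integral_mul_const]
    refine intervalIntegral.norm_integral_le_of_norm_le hT (Eventually.of_forall fun t ht => ?_) (hci.intervalIntegrable.mul_const _)
    rw [norm_mul, hn, norm_real, non (inv_nonneg.2 (by linarith [ht.1]))]
  refine (nsl _ _).trans ((ala (nsl _ _) h3).trans ?_)
  rw [norm_mul, hn, norm_mul, hn, norm_real, norm_real, non (hL T hT), non (hL 0 le_rfl)]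
  apply loe; ring

lemma AA_L : ∃ C:ℝ,0<C ∧ ∀ y T:ℝ,0 ≤ y → 0 ≤ T → ‖∫ t in 0..T, (ltp t:ℂ)*AA y t‖ ≤ C*(eh y*ltp T) := by
  obtain ⟨C, hC, h⟩ := G1
  refine ⟨4*C, pz, fun y T hy hT => ?_⟩
  have hL :0 ≤ ltp T := log_nonneg lz
  have hs := intervalIntegral.hasSum_integral_of_dominated_convergence (μ := volume) (a :=0) (b := T) (F := fun (n:ℕ) t => (ltp t:ℂ)*((aa y n:ℂ)*cex (-Ci*t*lg n))) (f := fun t => (ltp t:ℂ)*AA y t) (fun n _ => ltp T*aa y n) (fun n => (Measurable.aestronglyMeasurable fz)) (fun n => Eventually.of_forall fun t ht => ?_) (Eventually.of_forall fun t _ => (h y hy).1.mul_left _)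
    intervalIntegrable_const (Eventually.of_forall fun t _ => (AA_sum hy t).hasSum.mul_left _)
  · rw [← hs.tsum_eq]
    refine (ton (((h y hy).1.mul_left (4*ltp T)).hasSum) fun n => ?_).trans ?_
    · simp_rw [mul_left_comm _ (aa y n:ℂ)]
      rw [iic, norm_mul, norm_real, non (aa_nn y n), mul_comm (4*_)]
      rcases lt_or_ge n 2 with hn | hn
      · have : aa y n =0 := by interval_cases n <;> simp [aa, vM]
        rw [this]; simp
      · refine mlm ?_ (aa_nn y n)
        have hn' : rl2 ≤ n := by exact_mod_cast hn
        have := log_two_le hn'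
        refine (osc_L lz hT).trans ?_
        rw [dli lz]; nlinarith
    · rw [tml]
      calc _ ≤4*ltp T*(C*eh y) := by gcongr; exact (h y hy).2
        _=_ := by ring
  · rw [norm_mul, AA_term, norm_real]
    rw [uIoc_of_le hT] at ht
    rw [non (log_nonneg (by linarith [ht.1]))]
    exact mlo (lll (by linarith [ht.1]) (by linarith [ht.2])) (aa_nn y n)

lemma int_L : ∃ C:ℝ,0<C ∧ ∀ T:ℝ,3 ≤ T → |(∫ t in 0..T, ltp t^2)-T*lg T^2| ≤ C*(T*lg T) := by
  refine ⟨30, nz, fun T hT => ?_⟩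
  have hl :1 ≤ lg T := log_three.trans (lll nz hT)
  set l := lg T
  have e1 : ∀ t ∈ uIcc 0 T, HasDerivAt (fun t => (t+2)*ltp t^2-2*((t+2)*ltp t)+2*(t+2)) (ltp t^2) t := by
    intro t ht
    rw [uIcc_of_le lz] at ht
    have hp : t+2 ≠0 := by linarith [ht.1]
    have h0 := (hhi t).add_const 2
    have h1 := h0.log hp
    refine (((h0.mul (h1.pow 2)).sub ((h0.mul h1).const_mul 2)).add (h0.const_mul 2)).congr_deriv ?_
    simp only [id, Pi.pow_apply]; field_simp; push_cast; ring
  rw [ies e1 (ContinuousOn.intervalIntegrable fun t ht => by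
    rw [uIcc_of_le lz] at ht
    exact (((continuous_id.add ccc).continuousAt.log (by simp; linarith [ht.1])).pow 2).continuousWithinAt)]
  have h1 : l ≤ ltp T := lll lz lz
  have h2 : ltp T ≤ l+2/T := by
    rw [show T+2=T*(1+2/T) by field_simp, rlm lz pz]
    have := lls (show 0 <1+2/T by positivity)
    linarith
  have h3 :2/T ≤1 := by rw [div_le_one lz]; linarith
  have hT2 : T*(2/T) =2 := by field_simp
  have c1 :0<lg 2 := log_pos nz
  have c2 : lg 2 ≤1 := by linarith [lls (show rl0 <2 by norm_num)]
  set M := ltp T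
  rw [zero_add]
  have hlT : l ≤ T-1 := lls lz
  have b1 : T*(M-l) ≤2 := by rw [← hT2]; exact mlm lz lz
  have b2 : T*(M^2-l^2) ≤6*l := by
    calc _=T*(M-l)*(M+l) := by ring
      _ ≤2*(3*l) := mmm b1 lz lz nz
      _=_ := by ring
  have b3 :0 ≤ T*(M^2-l^2) := mul_nonneg lz nlz
  have b4 : M^2 ≤2*l*T := by rw [sq]; exact mmm lz lz lz lz
  have b5 : T ≤ T*l := lmo lz hl
  have b6 : T * M ≤ T*(2*l) := mlm lz lz
  have b7 :0 ≤ T * M := mul_nonneg lz lz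
  have b8 :0 ≤ M^2 := sq_nonneg M
  have b9 : lg 2^2 ≤1 := pow_le_one₀ c1.le c2
  have b10 := sq_nonneg (lg 2)
  rw [abs_le]; constructor <;> linarith

lemma D_main : ∃ C:ℝ,0<C ∧ ∀ x T:ℝ,3 ≤ T → 1 ≤ x → x ≤ T → |(∫ t in 0..T, ‖((x⁻¹*ltp t:ℝ):ℂ)-AA (lg x) t‖ ^2)-(T*lg T^2/x^2+T*lg x)| ≤ C*(T*(lg T*sqr (lg T))/x^2+T*sqr (lg T)) := by
  obtain ⟨C₁, h1, H1⟩ := int_L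
  obtain ⟨C₂, h2, H2⟩ := mean_AA
  obtain ⟨C₃, h3, H3⟩ := AA_L
  refine ⟨C₁+C₂+4*C₃, pz, fun x T hT hx hxT => ?_⟩
  have hl :1 ≤ lg T := log_three.trans (lll nz hT)
  have hlT : lg T ≤ T-1 := lls lz
  have hy := log_nonneg hx
  have hT0 :0 ≤ T := lz
  have a1 := H1 T hT
  have a2 := H2 x T hT hx hxT
  have a3 := H3 (lg x) T hy hT0
  have hM : ltp T ≤2*lg T := by
    rw [two_mul, ← rlm lz lz]
    exact lll lz nlz
  have hz : x⁻¹*ex (lg x/2) ≤1 := by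
    rw [← div_eq_inv_mul, div_le_one lz]
    calc _ ≤ ex (lg x) := ele.2 lz
      _=x := rel lz
  have hs :1 ≤ sqr (lg T) := one_le_sqrt.2 hl
  have cL : ContinuousOn (fun t:ℝ => ltp t) (uIcc 0 T) := fun t ht => by
    rw [uIcc_of_le hT0] at ht
    exact ((continuous_id.add ccc).continuousAt.log (by simp; linarith [ht.1])).continuousWithinAt
  have cA := AA_cont hy
  set y := lg x
  set l := lg T
  set s := sqr l
  have cLA : ContinuousOn (fun t:ℝ => (ltp t:ℂ)*AA y t) (uIcc 0 T) :=
    (continuous_ofReal.comp_continuousOn cL).mul cA.continuousOn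
  have i3 : IntervalIntegrable (fun t:ℝ => ((ltp t:ℂ)*AA y t).re) volume 0 T :=
    (continuous_re.comp_continuousOn cLA).intervalIntegrable
  have i1 : IntervalIntegrable (fun t:ℝ => ltp t^2) volume 0 T := (cL.pow 2).intervalIntegrable
  have i2 : IntervalIntegrable (fun t:ℝ => ‖AA y t‖ ^2) volume 0 T := (cA.norm.pow 2).intervalIntegrable _ _
  have e : ∫ t in 0..T, ‖((x⁻¹*ltp t:ℝ):ℂ)-AA y t‖ ^2=(x⁻¹^2*(∫ t in 0..T, ltp t^2)+∫ t in 0..T, ‖AA y t‖ ^2)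
        -2*x⁻¹*∫ t in 0..T, ((ltp t:ℂ)*AA y t).re := by
    rw [← iic, ← iic, ← iia (i1.const_mul _) i2, ← intervalIntegral.integral_sub ((i1.const_mul _).add i2) (i3.const_mul _)]
    refine integral_congr fun t _ => ?_
    simp only [← normSq_eq_norm_sq, normSq_apply, sub_re, sub_im, ofReal_re, ofReal_im, mul_re]
    ring
  have a4 : |∫ t in 0..T, ((ltp t:ℂ)*AA y t).re| ≤ C₃*(eh y*ltp T) := by
    have : ∫ t in 0..T, ((ltp t:ℂ)*AA y t).re=(∫ t in 0..T, (ltp t:ℂ)*AA y t).re :=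
      reCLM.intervalIntegral_comp_comm cLA.intervalIntegrable
    rw [this]; exact (arl _).trans a3
  rw [e]
  have hx0 :0<x := lz
  have b1 : |x⁻¹^2*((∫ t in 0..T, ltp t^2)-T*l^2)| ≤ C₁*(T*(l*s)/x^2) := by
    rw [abs_mul, aon pz]
    calc _ ≤ x⁻¹^2*(C₁*(T*(l*s))) := by
          refine mlm (a1.trans ?_) pz
          gcongr; exact lmo lz hs
      _=_ := by field_simp
  have b2 : |2*x⁻¹*∫ t in 0..T, ((ltp t:ℂ)*AA y t).re| ≤4*C₃*(T*s) := by
    rw [abs_mul, aon (a :=2*x⁻¹) pz]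
    calc _ ≤2*x⁻¹*(C₃*(eh y*(2*l))) := by
          refine mlm (a4.trans ?_) pz
          gcongr
      _ =4*C₃*((x⁻¹*eh y)*l) := by ring
      _ ≤4*C₃*(T*s) := by
          refine mlm ?_ pz
          calc _ ≤1*l := by gcongr
            _ ≤ T*1 := lz
            _ ≤ _ := by gcongr
  have q1 :0 ≤ T*(l*s)/x^2 := pz
  have q2 :0 ≤ T*s := pz
  have e2 : T*l^2/x^2=x⁻¹^2*(T*l^2) := by field_simp
  rw [e2]
  have n1 := mul_nonneg h1.le q2
  have n2 := mul_nonneg (add_nonneg h2.le (pz :0 ≤4*C₃)) q1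
  rw [abs_le] at *
  constructor <;> linarith only [b1.1, b1.2, b2.1, b2.2, a2.1, a2.2, n1, n2]

lemma SS_main2 : ∃ C:ℝ,0<C ∧ ∀ x T:ℝ,3 ≤ T → 1 ≤ x → x ≤ T → |(∫ t in 0..T, ‖SS (lg x) t‖ ^2)-∫ t in 0..T, ‖((x⁻¹*ltp t:ℝ):ℂ)-AA (lg x) t‖ ^2| ≤ (∫ t in 0..T, ‖((x⁻¹*ltp t:ℝ):ℂ)-AA (lg x) t‖ ^2)/sqr (lg T)+C*(T*sqr (lg T)) := by
  obtain ⟨C, hC, H⟩ := SS_main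
  refine ⟨12*C^2, pz, fun x T hT hx hxT => ?_⟩
  have hl :1 ≤ lg T := log_three.trans (lll nz hT)
  have hy := log_nonneg hx
  have hT0 :0 ≤ T := lz
  have hx0 :0<x := lz
  have hs :1 ≤ sqr (lg T) := one_le_sqrt.2 hl
  have cA := AA_cont hy
  have cS := SS_cont hy
  have hz : ex (lg x/2)^2=x := by rw [← ren]; push_cast; rw [mul_div_cancel₀ _ nz, rel hx0]
  have hxi : ex (-lg x)=x⁻¹ := by rw [Real.exp_neg, rel hx0]
  have HH := H (lg x) hy
  rw [hxi] at HH
  set y := lg x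
  set s := sqr (lg T)
  set D:ℝ → ℂ := fun t => ((x⁻¹*ltp t:ℝ):ℂ)-AA y t with hD
  have cD : ContinuousOn D (uIcc 0 T) := by
    refine (continuous_ofReal.comp_continuousOn (ContinuousOn.mul continuousOn_const fun t ht => ?_)).sub cA.continuousOn
    rw [uIcc_of_le hT0] at ht
    exact ((continuous_id.add ccc).continuousAt.log (by simp; linarith [ht.1])).continuousWithinAt
  have iS : IntervalIntegrable (fun t => ‖SS y t‖ ^2) volume 0 T := (cS.norm.pow 2).intervalIntegrable _ _
  have iD : IntervalIntegrable (fun t => ‖D t‖ ^2) volume 0 T := (cD.norm.pow 2).intervalIntegrable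
  have iQ : IntervalIntegrable (fun t:ℝ => (1+t^2)⁻¹) volume 0 T := intervalIntegrable_inv_one_add_sq
  have iR : IntervalIntegrable (fun t:ℝ =>1/s * ‖D t‖ ^2+4*s*C^2*(1+x*(1+t^2)⁻¹)) volume 0 T :=
    (iD.const_mul _).add ((intervalIntegrable_const.add (iQ.const_mul _)).const_mul _)
  have pt : ∀ t ∈ Icc 0 T, |‖SS y t‖ ^2 - ‖D t‖ ^2| ≤1/s * ‖D t‖ ^2+4*s*C^2*(1+x*(1+t^2)⁻¹) := by
    intro t ht
    have h0 := HH t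
    rw [aon ht.1, sub_add] at h0
    change ‖SS y t-D t‖ ≤ _ at h0
    have h1 : ‖SS y t-D t‖ ^2 ≤2*C^2*(1+x*(1+t^2)⁻¹) := by
      refine (plp nnz h0 2).trans ?_
      have u1 : x⁻¹^2 ≤1 := pow_le_one₀ pz (inv_le_one_of_one_le₀ hx)
      have u2 : (eh y/(1+t^2))^2 ≤ x*(1+t^2)⁻¹ := by
        rw [div_pow, hz, dem]
        refine mlm (inv_anti₀ pz ?_) hx0.le
        exact le_self_pow₀ (by linarith [sq_nonneg t]) two_ne_zero
      rw [mul_pow]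
      calc _ ≤ C^2*(2*(x⁻¹^2+(eh y/(1+t^2))^2)) :=
            mlm (by linarith [sq_nonneg (x⁻¹-eh y/(1+t^2))]) pz
        _ ≤ C^2*(2*(1+x*(1+t^2)⁻¹)) := by gcongr
        _=_ := by ring
    set d := ‖D t‖
    set E := ‖SS y t-D t‖
    have d0 :0 ≤ d := norm_nonneg _
    have E0 :0 ≤ E := norm_nonneg _
    have t1 : ‖SS y t‖ ≤ d+E := by have := nal (D t) (SS y t-D t); rwa [add_sub_cancel] at this
    have t2 : d ≤ ‖SS y t‖ + E := by have := nsl (SS y t) (SS y t-D t); rwa [sub_sub_cancel] at this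
    have t3 : |‖SS y t‖ ^2-d^2| ≤2*(d*E)+E^2 := by
      have n := norm_nonneg (SS y t)
      rw [abs_le]; constructor
      · rcases le_total d E with h | h
        · nlinarith only [h, d0, E0, n]
        · nlinarith only [plp (sub_nonneg.2 h) (lz : d-E ≤ ‖SS y t‖) 2, E0]
      · nlinarith only [plp n t1 2]
    have t4 :2*(d*E) ≤1/s*d^2+s*E^2 := by
      have :0 ≤1/s*(d-s*E)^2 := pz
      have e :1/s*(d-s*E)^2 =1/s*d^2-2*(d*E)+s*E^2 := by
        have : s ≠0 := lz
        field_simp; ring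
      linarith
    have t5 : E^2 ≤ s*E^2 := lml (sq_nonneg E) hs
    have t6 := mlm h1 (lz :0 ≤2*s)
    linarith only [t3, t4, t5, t6]
  rw [← intervalIntegral.integral_sub iS iD]
  calc _ ≤ ∫ t in 0..T, |‖SS y t‖ ^2 - ‖D t‖ ^2| := intervalIntegral.abs_integral_le_integral_abs hT0
    _ ≤ ∫ t in 0..T, (1/s * ‖D t‖ ^2+4*s*C^2*(1+x*(1+t^2)⁻¹)) :=
        integral_mono_on hT0 (iS.sub iD).abs iR pt
    _=(∫ t in 0..T, ‖D t‖ ^2)/s+4*s*C^2*(T+x*(Real.arctan T)) := by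
        rw [iia (iD.const_mul _) ((intervalIntegrable_const.add (iQ.const_mul _)).const_mul _), iic, iic, iia intervalIntegrable_const (iQ.const_mul _), iic, integral_inv_one_add_sq, intervalIntegral.integral_const, arctan_zero]
        simp only [sub_zero, smul_eq_mul, mul_one]; ring
    _ ≤ _ := by
        have h4 : Real.arctan T ≤2 := by linarith [arctan_lt_pi_div_two T, pi_le_four]
        have : x*Real.arctan T ≤ T*2 := mmm hxT h4 (arctan_nonneg.2 hT0) hT0
        have := mlm (lz : T+x*Real.arctan T ≤3*T) (pz :0 ≤4*s*C^2)
        linarith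

lemma J_main : ∃ C:ℝ,0<C ∧ ∀ x T:ℝ,3 ≤ T → 1 ≤ x → x ≤ T → |(∫ t, ‖S1 (lg x) T t‖ ^2)-(T*lg T^2/x^2+T*lg x)| ≤ C*(T*(lg T*sqr (lg T))/x^2+T*sqr (lg T)) := by
  obtain ⟨C₁, h1, H1⟩ := D_main
  obtain ⟨C₂, h2, H2⟩ := SS_main2
  obtain ⟨C₃, h3, H3⟩ := S1_SS
  refine ⟨C₃*(2+2*C₁+C₂)+(1+2*C₁+C₂)+C₃, pz, fun x T hT hx hxT => ?_⟩
  have a1 := H1 x T hT hx hxT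
  have a2 := H2 x T hT hx hxT
  have a3 := H3 x T hT hx hxT
  have hl :1 ≤ lg T := log_three.trans (lll nz hT)
  have hyl := lll lz hxT
  have hy := log_nonneg hx
  have hs :1 ≤ sqr (lg T) := one_le_sqrt.2 hl
  have hs2 := sq_sqrt (lz :0 ≤ lg T)
  set D := ∫ t in 0..T, ‖((x⁻¹*ltp t:ℝ):ℂ)-AA (lg x) t‖ ^2
  set I := ∫ t in 0..T, ‖SS (lg x) t‖ ^2
  set J := ∫ t, ‖S1 (lg x) T t‖ ^2
  set y := lg x
  set l := lg T
  set s := sqr l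
  have q1 :0 ≤ T*(l*s)/x^2 := pz
  have q2 :0 ≤ T*s := pz
  set Q := T*(l*s)/x^2+T*s with hQ
  set M := T*l^2/x^2+T*y
  have hM : M ≤ Q*s := by
    have e : Q*s=T*(l*s^2)/x^2+T*s^2 := by rw [hQ]; ring
    rw [e, hs2, ← sq]
    exact ala le_rfl (mlm hyl lz)
  have hQ0 :0 ≤ Q := add_nonneg q1 q2
  have hQs : Q ≤ Q*s := lmo hQ0 hs
  have hDs : D/s ≤ (1+C₁)*Q := by
    rw [dli lz]
    have := mlm hQs h1.le
    linarith [(abs_le.1 a1).2]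
  have hTs : T*s ≤ Q := lz
  have b2 : |I-D| ≤ (1+C₁+C₂)*Q := by
    have := mlm hTs h2.le
    linarith
  have hIs : I/s ≤ (2+2*C₁+C₂)*Q := by
    have : I/s ≤ D/s + |I-D| := by
      rw [dli lz, add_mul, div_mul_cancel₀ _ lz]
      linarith [las (I-D), lmo (abs_nonneg (I-D)) hs]
    linarith
  have b3 : |J-I| ≤ C₃*((2+2*C₁+C₂)*Q+Q) := a3.trans (by gcongr)
  calc |J - M| = |(J-I)+(I-D)+(D - M)| := by ring_nf
    _ ≤ |J-I| + |I-D| + |D - M| := abs_add_three _ _ _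
    _ ≤ _ := lz

/-- Unconditionally, uniformly for `1 ≤ x ≤ T` and `T ≥ 3`,
`𝓕_{(0,T]}(x) = (T/(2πx²)) log²T (1 + O(1/√log T)) + (T/2π) log x + O(T √log T)`. -/
theorem FF0_asymptotic :
    ∃ C > 0, ∀ x T : ℝ, 3 ≤ T → 1 ≤ x → x ≤ T →
      ∃ E₁ E₂ : ℝ, |E₁| ≤ C / Real.sqrt (Real.log T) ∧
        |E₂| ≤ C * T * Real.sqrt (Real.log T) ∧
        FF0 x T = ((T / (2 * Real.pi * x ^ 2) * Real.log T ^ 2 * (1 + E₁) +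
          T / (2 * Real.pi) * Real.log x + E₂ : ℝ) : ℂ) := by
  obtain ⟨C, hC, H⟩ := J_main
  refine ⟨C, hC, fun x T hT hx hxT => ?_⟩
  have h := H x T hT hx hxT
  have hl :1 ≤ lg T := log_three.trans (lll nz hT)
  have hs :1 ≤ sqr (lg T) := one_le_sqrt.2 hl
  have hs2 := sq_sqrt (lz :0 ≤ lg T)
  have hT0 :0<T := lz
  have hx0 :0<x := lz
  rw [(FF0_eq (T := T) hx).2]
  set J := ∫ t, ‖S1 (lg x) T t‖ ^2
  set s := sqr (lg T)
  rw [← hs2] at *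
  have hs0 :0<s := lz
  set q := s/x^2*s^2+s with hq
  have hq0 :0<q := pz
  set e := J-(T*(s^2)^2/x^2+T*lg x) with he
  have h' : |e/(T*q)| ≤ C := by
    rw [abs_div, aop (pz :0<T*q), dli pz]
    refine h.trans_eq ?_
    rw [hq]; ring
  set d := e/(T*q) with hd
  have hed : e=d*(T*q) := by rw [hd]; field_simp
  refine ⟨d/s, d*(T*s)/(2*π), ?_, ?_, ?_⟩
  · rw [abs_div, aop hs0]; gcongr
  · rw [abs_div, abs_mul, aop (pz :0<T*s), aop two_pi_pos, mul_assoc]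
    refine (div_le_self pz (by linarith [pi_gt_three])).trans ?_
    gcongr
  · have : J=T*(s^2)^2/x^2+T*lg x+d*(T*q) := by rw [← hed, he]; ring
    rw [this, hq]
    congr 1
    have := pi_pos
    field_simp
    ring
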